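/- Let U be an open neighborhood of the origin in ℝⁿ and let f : U → ℝ be C^∞ with f(0)=0, ∇f(0)=0 and Γ₊(f) ≠ ∅, satisfying condition (C). Suppose at least one of the following holds: (a) d(f) > 1; (b) f is nonnegative or nonpositive on U; (c) 1/d(f) is not an odd integer and the τ_*-part f_{τ_*} does not vanish on U ∩ (ℝ∖{0})ⁿ. Then the oscillation index and its multiplicity satisfy β(f) = −1/d(f) and η(f) = m(f). -/

import Mathlib

open scoped BigOperators Topology
open Filter MeasureTheory Set

namespace KN

variable {n : ℕ}

/-- The standard inner product on `ℝⁿ`. -/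
def dot (a x : Fin n → ℝ) : ℝ := ∑ i, a i * x i

/-- The hyperplane `H(a,l) = {x | ⟨a,x⟩ = l}`. -/
def Hplane (a : Fin n → ℝ) (l : ℝ) : Set (Fin n → ℝ) := {x | dot a x = l}

/-- The closed half-space `H⁺(a,l) = {x | ⟨a,x⟩ ≥ l}`. -/
def Hhalf (a : Fin n → ℝ) (l : ℝ) : Set (Fin n → ℝ) := {x | l ≤ dot a x}

/-- View an integer vector as a real vector. -/
def intPt (a : Fin n → ℤ) : Fin n → ℝ := fun i => (a i : ℝ)

/-- View a vector of naturals as a real vector. -/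
def natPt (a : Fin n → ℕ) : Fin n → ℝ := fun i => (a i : ℝ)

/-- The nonnegative octant `ℝ₊ⁿ`. -/
def octant (n : ℕ) : Set (Fin n → ℝ) := {x | ∀ i, 0 ≤ x i}

/-- A (convex rational) polyhedron: a finite intersection of closed half-spaces with
integral data. -/
def IsPolyhedron (P : Set (Fin n → ℝ)) : Prop :=
  ∃ (N : ℕ) (a : Fin N → Fin n → ℤ) (l : Fin N → ℤ),
    P = ⋂ j, Hhalf (intPt (a j)) ((l j : ℝ))

/-- `(a,l) ∈ ℤⁿ × ℤ` is valid for `P` if `P ⊆ H⁺(a,l)`. -/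
def ValidPair (P : Set (Fin n → ℝ)) (a : Fin n → ℤ) (l : ℤ) : Prop :=
  P ⊆ Hhalf (intPt a) (l : ℝ)

/-- A face of a polyhedron `P`: a set of the form `P ∩ H(a,l)` with `(a,l)` valid for `P`. -/
def IsFaceOf (P F : Set (Fin n → ℝ)) : Prop :=
  ∃ (a : Fin n → ℤ) (l : ℤ), ValidPair P a l ∧ F = P ∩ Hplane (intPt a) (l : ℝ)

/-- Dimension of a subset of `ℝⁿ`: the dimension of its affine hull. -/
noncomputable def setDim (s : Set (Fin n → ℝ)) : ℕ :=
  Module.finrank ℝ (affineSpan ℝ s).direction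

/-- First-order partial derivative in the `i`-th coordinate direction. -/
noncomputable def pderiv1 (i : Fin n) (f : (Fin n → ℝ) → ℝ) : (Fin n → ℝ) → ℝ :=
  fun x => fderiv ℝ f x (Pi.single i 1)

/-- Iterated partial derivative `∂^α` for a multi-index `α ∈ ℤ₊ⁿ`. -/
noncomputable def mderiv (α : Fin n → ℕ) (f : (Fin n → ℝ) → ℝ) : (Fin n → ℝ) → ℝ :=
  (List.finRange n).foldr (fun i g => (pderiv1 i)^[α i] g) f

/-- Taylor coefficient `c_α = ∂^α f(0)/α!`. -/
noncomputable def taylorCoeff (f : (Fin n → ℝ) → ℝ) (α : Fin n → ℕ) : ℝ :=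
  mderiv α f 0 / ((∏ i, Nat.factorial (α i) : ℕ) : ℝ)

/-- The Newton polyhedron `Γ₊(f)`: the convex hull of `⋃ {α + ℝ₊ⁿ : c_α ≠ 0}`. -/
def NewtonPolyhedron (f : (Fin n → ℝ) → ℝ) : Set (Fin n → ℝ) :=
  convexHull ℝ {x | ∃ α : Fin n → ℕ, taylorCoeff f α ≠ 0 ∧ ∀ i, (α i : ℝ) ≤ x i}

/-- The pair `(a,l) ∈ ℤ₊ⁿ × ℤ₊` is valid for `P` and defines the face `γ = P ∩ H(a,l)`. -/
def DefinesFace (P : Set (Fin n → ℝ)) (a : Fin n → ℕ) (l : ℕ) (γ : Set (Fin n → ℝ)) : Prop :=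
  P ⊆ Hhalf (natPt a) (l : ℝ) ∧ γ = P ∩ Hplane (natPt a) (l : ℝ)

/-- The anisotropic dilation `x ↦ (t^{a₁}x₁, …, t^{aₙ}xₙ)`. -/
def scaleAction (a : Fin n → ℕ) (t : ℝ) (x : Fin n → ℝ) : Fin n → ℝ :=
  fun i => t ^ (a i) * x i

/-- `f` admits the `γ`-part on `U` (w.r.t. the polyhedron `P`): for every `x ∈ U` the limit
`lim_{t→0⁺} f(t^{a₁}x₁,…,t^{aₙ}xₙ)/t^l` exists for all valid pairs `(a,l) ∈ ℤ₊ⁿ×ℤ₊`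
defining `γ`. -/
def AdmitsGammaPartOn (f : (Fin n → ℝ) → ℝ) (U P γ : Set (Fin n → ℝ)) : Prop :=
  ∀ x ∈ U, ∀ (a : Fin n → ℕ) (l : ℕ), DefinesFace P a l γ →
    ∃ c : ℝ, Filter.Tendsto (fun t : ℝ => f (scaleAction a t x) / t ^ l) (𝓝[>] (0:ℝ)) (𝓝 c)

/-- Membership in the class `Ê[P](U)`. -/
def MemEhatP (P U : Set (Fin n → ℝ)) (f : (Fin n → ℝ) → ℝ) : Prop :=
  ContDiffOn ℝ (⊤ : ℕ∞) f U ∧ NewtonPolyhedron f ⊆ P ∧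
    ∀ γ, IsFaceOf P γ → AdmitsGammaPartOn f U P γ

/-- Membership in the class `Ê(U) = {f : f ∈ Ê[Γ₊(f)](U)}`, where `Ê[∅](U) = {0}`. -/
def MemEhat (U : Set (Fin n → ℝ)) (f : (Fin n → ℝ) → ℝ) : Prop :=
  (NewtonPolyhedron f = ∅ ∧ ∀ x ∈ U, f x = 0) ∨
  (NewtonPolyhedron f ≠ ∅ ∧ MemEhatP (NewtonPolyhedron f) U f)

/-- The polynomial `γ`-part `Σ_{α ∈ γ ∩ ℤ₊ⁿ} c_α x^α`. -/
noncomputable def gammaPartPoly (f : (Fin n → ℝ) → ℝ) (γ : Set (Fin n → ℝ))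
    (x : Fin n → ℝ) : ℝ :=
  ∑' α : {α : Fin n → ℕ // natPt α ∈ γ}, taylorCoeff f α.1 * ∏ i, x i ^ (α.1 i)

/-- `V(γ) = {k : γ + ℝ₊ e_k ⊆ γ}`. -/
def Vset (γ : Set (Fin n → ℝ)) : Set (Fin n) :=
  {k | ∀ x ∈ γ, ∀ r : ℝ, 0 ≤ r → x + r • (Pi.single k (1:ℝ) : Fin n → ℝ) ∈ γ}

/-- `W(γ) = {1,…,n} \ V(γ)`. -/
def Wset (γ : Set (Fin n → ℝ)) : Set (Fin n) := (Vset γ)ᶜ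

open Classical in
/-- `T_I` replaces the coordinates indexed by `I` with `0`. -/
noncomputable def TI (I : Set (Fin n)) (x : Fin n → ℝ) : Fin n → ℝ :=
  fun i => if i ∈ I then 0 else x i

open Classical in
/-- `T_I^r` replaces the coordinates indexed by `I` with `r`. -/
noncomputable def TIr (I : Set (Fin n)) (r : ℝ) (x : Fin n → ℝ) : Fin n → ℝ :=
  fun i => if i ∈ I then r else x i

/-- The canonical `γ`-part function
`f_γ(x) = Σ_{α ∈ γ_V} (1/α!) (∂^α f)(T_{W(γ)}(x)) x^α`, with `γ_V = T_{V(γ)}(γ) ∩ ℤ₊ⁿ`. -/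
noncomputable def gammaFn (f : (Fin n → ℝ) → ℝ) (γ : Set (Fin n → ℝ)) (x : Fin n → ℝ) : ℝ :=
  ∑' α : {α : Fin n → ℕ // natPt α ∈ TI (Vset γ) '' γ},
    mderiv α.1 f (TI (Wset γ) x) * (∏ i, x i ^ (α.1 i)) /
      ((∏ i, Nat.factorial (α.1 i) : ℕ) : ℝ)

/-- `f` is nondegenerate over `ℝ` w.r.t. its Newton polyhedron: for every nonempty compact
face `γ` of `Γ₊(f)` the gradient of the polynomial `f_γ` does not vanish on
`U ∩ (ℝ \ {0})ⁿ`. -/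
def Nondegenerate (f : (Fin n → ℝ) → ℝ) (U : Set (Fin n → ℝ)) : Prop :=
  ∀ γ, IsFaceOf (NewtonPolyhedron f) γ → γ.Nonempty → IsCompact γ →
    ∀ x ∈ U, (∀ i, x i ≠ 0) → fderiv ℝ (gammaPartPoly f γ) x ≠ 0

/-- Condition (C): `f ∈ Ê(U)` and `f` is nondegenerate over `ℝ` w.r.t. `Γ₊(f)`. -/
def ConditionC (U : Set (Fin n → ℝ)) (f : (Fin n → ℝ) → ℝ) : Prop :=
  MemEhat U f ∧ Nondegenerate f U

/-- The Newton distance `d(f)`: the coordinate of the point where the diagonal meets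
the boundary of `Γ₊(f)`. -/
noncomputable def newtonDist (f : (Fin n → ℝ) → ℝ) : ℝ :=
  sInf {t : ℝ | (fun _ : Fin n => t) ∈ NewtonPolyhedron f}

/-- `τ` is the principal face of `Γ₊(f)`: its relative interior contains
`q_* = (d(f),…,d(f))`. -/
def IsPrincipalFace (f : (Fin n → ℝ) → ℝ) (τ : Set (Fin n → ℝ)) : Prop :=
  IsFaceOf (NewtonPolyhedron f) τ ∧
    (fun _ : Fin n => newtonDist f) ∈ intrinsicInterior ℝ τ

/-- The oscillatory integral `I(t;φ) = ∫ e^{itf(x)} φ(x) dx`. -/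
noncomputable def oscInt (f : (Fin n → ℝ) → ℝ) (φ : (Fin n → ℝ) → ℂ) (t : ℝ) : ℂ :=
  ∫ x : Fin n → ℝ, Complex.exp (Complex.I * t * f x) * φ x

/-- `Z₊(s;φ) = ∫ f(x)₊^s φ(x) dx`. -/
noncomputable def zetaPlus (f : (Fin n → ℝ) → ℝ) (φ : (Fin n → ℝ) → ℂ) (s : ℂ) : ℂ :=
  ∫ x : Fin n → ℝ, ((max (f x) 0 : ℝ) : ℂ) ^ s * φ x

/-- `Z₋(s;φ) = ∫ f(x)₋^s φ(x) dx`. -/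
noncomputable def zetaMinus (f : (Fin n → ℝ) → ℝ) (φ : (Fin n → ℝ) → ℂ) (s : ℂ) : ℂ :=
  ∫ x : Fin n → ℝ, ((max (-f x) 0 : ℝ) : ℂ) ^ s * φ x

/-- The local zeta function `Z(s;φ) = ∫ |f(x)|^s φ(x) dx`. -/
noncomputable def zetaAbs (f : (Fin n → ℝ) → ℝ) (φ : (Fin n → ℝ) → ℂ) (s : ℂ) : ℂ :=
  ∫ x : Fin n → ℝ, ((|f x| : ℝ) : ℂ) ^ s * φ x

/-- An amplitude: a `C^∞` function with compact support contained in `U ∩ V`. -/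
def IsAmplitude (U V : Set (Fin n → ℝ)) (φ : (Fin n → ℝ) → ℂ) : Prop :=
  ContDiff ℝ (⊤ : ℕ∞) φ ∧ HasCompactSupport φ ∧ tsupport φ ⊆ U ∩ V

/-- Partial sum `Σ_{α ∈ E, α ≥ -M} Σ_{k=1}^n C_{αk} t^α (log t)^{k-1}`. -/
noncomputable def partialSum (n : ℕ) (E : Set ℝ) (C : ℝ → ℕ → ℂ) (M t : ℝ) : ℂ :=
  ∑ᶠ α ∈ {β ∈ E | -M ≤ β}, ∑ k ∈ Finset.Icc 1 n,
    C α k * ((t ^ α : ℝ) : ℂ) * (((Real.log t) ^ (k - 1) : ℝ) : ℂ)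

/-- `g(t)` admits the asymptotic expansion `Σ_{α ∈ E} Σ_{k=1}^n C_{αk} t^α (log t)^{k-1}`
as `t → +∞`. -/
def HasAsympExpansion (n : ℕ) (g : ℝ → ℂ) (E : Set ℝ) (C : ℝ → ℕ → ℂ) : Prop :=
  (∀ α k, C α k ≠ 0 → α ∈ E ∧ 1 ≤ k ∧ k ≤ n) ∧
  ∀ M : ℝ, ∃ K : ℝ, ∀ t : ℝ, 2 ≤ t →
    ‖g t - partialSum n E C M t‖ ≤ K * t ^ (-M)

/-- A set of exponents consisting of negative numbers, finite above any `-M`. -/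
def LocallyFiniteBelow (E : Set ℝ) : Prop :=
  E ⊆ Set.Iio 0 ∧ ∀ M : ℝ, {β ∈ E | -M ≤ β}.Finite

/-- The set `S(f)` of pairs `(α,k)` appearing with a nonzero coefficient in the asymptotic
expansion of `I(t;φ)` for amplitudes `φ` supported arbitrarily close to the origin. -/
def OscSet (U : Set (Fin n → ℝ)) (f : (Fin n → ℝ) → ℝ) : Set (ℝ × ℕ) :=
  {p | ∀ V ∈ 𝓝 (0 : Fin n → ℝ), ∃ φ : (Fin n → ℝ) → ℂ, IsAmplitude U V φ ∧
      ∃ E C, LocallyFiniteBelow E ∧ HasAsympExpansion n (oscInt f φ) E C ∧ C p.1 p.2 ≠ 0}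

/-- The cone spanned by the vectors `g j`, `j ∈ s`. -/
def coneSpanSub (g : Fin n → (Fin n → ℝ)) (s : Finset (Fin n)) : Set (Fin n → ℝ) :=
  {x | ∃ c : Fin n → ℝ, (∀ j, 0 ≤ c j) ∧ (∀ j ∉ s, c j = 0) ∧ x = ∑ j, c j • g j}

/-- The cone spanned by all the vectors `g j`. -/
def coneSpan (g : Fin n → (Fin n → ℝ)) : Set (Fin n → ℝ) := coneSpanSub g Finset.univ

/-- `l(a) = min {⟨a,α⟩ : α ∈ Γ}`. -/
noncomputable def lval (Γ : Set (Fin n → ℝ)) (a : Fin n → ℝ) : ℝ := sInf (dot a '' Γ)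

/-- Real matrix of skeleton vectors. -/
def genR (a : Fin n → (Fin n → ℕ)) : Fin n → (Fin n → ℝ) := fun j => natPt (a j)

/-- A simplicial subdivision `Σ` of the fan `Σ₀` associated with `Γ`, presented via the
skeletons of its `n`-dimensional cones: each maximal cone is unimodular (its skeleton can be
completed to a basis of the lattice `ℤⁿ`), the cones cover `ℝ₊ⁿ`, each cone lies in a cone
`closure(γ*)` of the fan `Σ₀`, and two cones intersect in a common face. -/
structure SimplicialSubdivision (n : ℕ) (Γ : Set (Fin n → ℝ)) where
  ι : Type
  fin : Fintype ι
  gen : ι → Fin n → (Fin n → ℕ)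
  unimodular : ∀ σ, (Matrix.det (Matrix.of fun j k => (gen σ j k : ℤ))).natAbs = 1
  covers : ∀ x ∈ octant n, ∃ σ, x ∈ coneSpan (genR (gen σ))
  subordinate : ∀ σ, ∃ γ, IsFaceOf Γ γ ∧ γ.Nonempty ∧
      ∀ j, ∀ y ∈ γ, dot (natPt (gen σ j)) y = lval Γ (natPt (gen σ j))
  compatible : ∀ σ τ, ∃ s : Finset (Fin n),
      (∀ j ∈ s, gen σ j ∈ Set.range (gen τ)) ∧
      coneSpan (genR (gen σ)) ∩ coneSpan (genR (gen τ)) = coneSpanSub (genR (gen σ)) s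

/-- The set `Σ^{(1)}` of primitive generators of the one-dimensional cones of `Σ`. -/
def sigma1 {n : ℕ} {Γ : Set (Fin n → ℝ)} (S : SimplicialSubdivision n Γ) :
    Set (Fin n → ℕ) :=
  {a | ∃ σ j, S.gen σ j = a}

/-- The set `{-(⟨a⟩+ν)/l(a) : ν ∈ ℤ₊, a ∈ Σ̃^{(1)}}`. -/
noncomputable def expSetMain {n : ℕ} (Γ : Set (Fin n → ℝ))
    (S : SimplicialSubdivision n Γ) : Set ℝ :=
  {r | ∃ a ∈ sigma1 S, 0 < lval Γ (natPt a) ∧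
        ∃ ν : ℕ, r = -((∑ i, (a i : ℝ)) + (ν : ℝ)) / lval Γ (natPt a)}

/-- The full candidate set `{-(⟨a⟩+ν)/l(a)} ∪ (-ℕ)`. -/
noncomputable def expSet {n : ℕ} (Γ : Set (Fin n → ℝ))
    (S : SimplicialSubdivision n Γ) : Set ℝ :=
  expSetMain Γ S ∪ {r | ∃ m : ℕ, r = -((m : ℝ) + 1)}

/-- `G` has at `s₀` a pole of order at most `m` (in particular `G` may be analytic there). -/
def PoleOrderAtMost (G : ℂ → ℂ) (s₀ : ℂ) (m : ℕ) : Prop :=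
  ∃ h : ℂ → ℂ, AnalyticAt ℂ h s₀ ∧ ∀ᶠ s in 𝓝[≠] s₀, (s - s₀) ^ m * G s = h s


open Classical in
/-- `A_V(N) = {α ∈ T_V(ℤ₊ⁿ) : ⟨α⟩ < N}`. -/
noncomputable def ASetF (n : ℕ) (V : Finset (Fin n)) (N : ℕ) : Finset (Fin n → ℕ) :=
  (Fintype.piFinset fun _ : Fin n => Finset.range (N + 1)).filter
    (fun α => (∀ j ∈ V, α j = 0) ∧ ∑ i, α i < N)

open Classical in
/-- `B_V(N) = {α ∈ T_V(ℤ₊ⁿ) : ⟨α⟩ = N}`. -/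
noncomputable def BSetF (n : ℕ) (V : Finset (Fin n)) (N : ℕ) : Finset (Fin n → ℕ) :=
  (Fintype.piFinset fun _ : Fin n => Finset.range (N + 1)).filter
    (fun α => (∀ j ∈ V, α j = 0) ∧ ∑ i, α i = N)

/-- `v` is a vertex (0-dimensional face) of `P`. -/
def IsVertex (P : Set (Fin n → ℝ)) (v : Fin n → ℝ) : Prop := IsFaceOf P {v}

/-- Membership in the class `Ě[P](U)`: an element of `Ê[P](U)` expressible as
`Σ_{p∈S} x^p ψ_p(x)` with `S ⊆ P ∩ ℤ₊ⁿ` finite containing all vertices of `P`, and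
`ψ_p(0) ≠ 0` for each vertex `p`. -/
def MemEcheck (P U : Set (Fin n → ℝ)) (f : (Fin n → ℝ) → ℝ) : Prop :=
  MemEhatP P U f ∧
  ∃ S : Finset (Fin n → ℕ), (∀ p ∈ S, natPt p ∈ P) ∧
    (∀ v, IsVertex P v → ∃ p ∈ S, natPt p = v) ∧
    ∃ ψ : (Fin n → ℕ) → (Fin n → ℝ) → ℝ,
      (∀ p ∈ S, ContDiffOn ℝ (⊤ : ℕ∞) (ψ p) U) ∧
      (∀ p ∈ S, IsVertex P (natPt p) → ψ p 0 ≠ 0) ∧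
      ∀ x ∈ U, f x = ∑ p ∈ S, (∏ i, x i ^ p i) * ψ p x

/-- Membership in the class `Ẽ(U)`: functions of the form `Σ_{p∈S} x^p ψ_p(x)` with
`ψ_p(0) ≠ 0` for all `p ∈ S`. -/
def MemEtilde (U : Set (Fin n → ℝ)) (f : (Fin n → ℝ) → ℝ) : Prop :=
  ∃ S : Finset (Fin n → ℕ), ∃ ψ : (Fin n → ℕ) → (Fin n → ℝ) → ℝ,
    (∀ p ∈ S, ContDiffOn ℝ (⊤ : ℕ∞) (ψ p) U) ∧ (∀ p ∈ S, ψ p 0 ≠ 0) ∧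
    ∀ x ∈ U, f x = ∑ p ∈ S, (∏ i, x i ^ p i) * ψ p x

/-- Membership in the Denjoy–Carleman class `ℰ_M(U)`. -/
def MemDC (M : ℕ → ℝ) (U : Set (Fin n → ℝ)) (f : (Fin n → ℝ) → ℝ) : Prop :=
  ContDiffOn ℝ (⊤ : ℕ∞) f U ∧
  ∀ K : Set (Fin n → ℝ), K ⊆ U → IsCompact K →
    ∃ A B : ℝ, 0 < A ∧ 0 < B ∧ ∀ x ∈ K, ∀ α : Fin n → ℕ,
      |mderiv α f x| ≤ A * B ^ (∑ i, α i) * ((∏ i, Nat.factorial (α i) : ℕ) : ℝ) *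
        M (∑ i, α i)

open Classical in
/-- The multi-index `α - 1` from the proof of Proposition 9.5:
`(α-1)_j = l_jλ - m_j` for `j ∈ B_λ`, `(α-1)_n = λ - 1`, and `0` otherwise. -/
noncomputable def alphaIdx (n lam : ℕ) (l m : Fin n → ℕ) (Bl : Finset (Fin n)) :
    Fin (n+1) → ℕ :=
  fun i => if h : i = Fin.last n then lam - 1
    else if i.castPred h ∈ Bl then l (i.castPred h) * lam - m (i.castPred h) else 0

open Classical in
/-- The constant `C_λ` of Proposition 9.5. -/
noncomputable def Cval (n lam : ℕ) (l m : Fin n → ℕ) (Bl : Finset (Fin n))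
    (η : (Fin (n+1) → ℝ) → ℝ) : ℝ :=
  (1 / (Nat.factorial (lam - 1) : ℝ)) *
  (∏ j ∈ Bl, ((l j : ℝ) *
      ∏ ν ∈ Finset.Icc 1 (l j * lam - m j),
        (((l j * lam : ℕ) : ℝ) - (m j : ℝ) + 1 - (ν : ℝ)))⁻¹) *
  (if Bl = Finset.univ then mderiv (alphaIdx n lam l m Bl) η 0
   else ∫ z : {j : Fin n // j ∉ Bl} → ℝ in {z | ∀ j, 0 ≤ z j},
     mderiv (alphaIdx n lam l m Bl) η
       (fun i => if h : i = Fin.last n then 0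
         else if hj : i.castPred h ∈ Bl then 0 else z ⟨i.castPred h, hj⟩))

section

open scoped ContDiff
open Real (exp log exp_pos exp_add exp_le_exp norm_of_nonneg log_pos log_nonneg exp_sum exp_log
  log_exp Gamma rpow_natCast rpow_add rpow_pos_of_pos rpow_neg rpow_def_of_pos log_mul
  log_le_log)
open Complex (I norm_real I_ne_zero ofReal_mul ofReal_re ofReal_one ofReal_zero conj_ofReal)
open Finset (sum_congr mul_sum sum_mul sum_nonneg single_le_sum sum_sub_distrib prod_congr
  sum_le_sum sum_add_distrib sum_neg_distrib sum_div sum_eq_zero mul_prod_erase sum_comm prod_const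
  mem_image_of_mem ne_of_mem_erase mem_filter induction_on mem_product sum_insert
  mem_insert_self mem_insert_of_mem)
open Function (update update_of_ne update_eq_self update_self update_comm iterate_succ_apply')
open Module (finrank)
open Pi (single)
open Submodule (span smul_mem subset_span)
open Prod.Lex (toLex_lt_toLex)

local notation "ℝ^[" n "]" => Fin n → ℝ
local notation "ℕ^[" n "]" => Fin n → ℕ
local notation "Γ₊" => NewtonPolyhedron

variable {f h g : ℝ^[n] → ℝ} {σ z v : ℝ^[n]} {φ u : ℝ^[n] → ℂ} {τ U Ω : Set ℝ^[n]} {b : ℕ^[n]}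
  {R : ℝ} {k : ℕ} {θ : ℕ^[n] → ℝ^[n] → ℝ}

/-- **Weyl's theorem**: a cone generated by finitely many integer vectors is cut out by
finitely many integer inequalities. -/
lemma exists_dual_generators {ι : Type*} [Fintype ι] [DecidableEq ι] (X : Finset (ι → ℤ)) :
    ∃ Y : Finset (ι → ℤ), (∀ y ∈ Y, ∀ x ∈ X, 0 ≤ ∑ i, y i * x i) ∧
      ∀ v : ι → ℝ, (∀ y ∈ Y, 0 ≤ ∑ i, (y i : ℝ) * v i) →
        ∃ c : (ι → ℤ) → ℝ, (∀ x, 0 ≤ c x) ∧ ∀ i, v i = ∑ x ∈ X, c x * (x i : ℝ) := by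
  classical
  induction X using induction_on with
  | empty =>
    refine ⟨(Finset.univ.image fun i => single i (1 : ℤ)) ∪
      (Finset.univ.image fun i => single i (-1 : ℤ)), by simp, fun v hv => ?_⟩
    refine ⟨0, by simp, fun i => ?_⟩
    have h1 := hv (single i 1) (by simp)
    have h2 := hv (single i (-1)) (by simp)
    simp only [Pi.single_apply, Int.cast_ite, Int.cast_one, Int.cast_zero, Int.cast_neg, ite_mul,
      zero_mul, Finset.sum_ite_eq', Finset.mem_univ, if_true] at h1 h2
    simp
    linarith
  | insert x X hx ih =>
    obtain ⟨Y, hYX, hY⟩ := ih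
    let pr : (ι → ℤ) → ℤ := fun y => ∑ i, y i * x i
    let cmb : (ι → ℤ) × (ι → ℤ) → (ι → ℤ) := fun q i => pr q.1 * q.2 i - pr q.2 * q.1 i
    refine ⟨Y.filter (fun y => 0 ≤ pr y) ∪
      (((Y.filter fun y => 0 < pr y) ×ˢ (Y.filter fun y => pr y < 0)).image cmb), ?_, ?_⟩
    · have key : ∀ q : (ι → ℤ) × (ι → ℤ), ∀ z : ι → ℤ, ∑ i, cmb q i * z i
          = pr q.1 * ∑ i, q.2 i * z i - pr q.2 * ∑ i, q.1 i * z i := by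
        intro q z
        simp only [cmb, mul_sum, ← sum_sub_distrib]
        grind
      intro y hy z hz
      rw [Finset.mem_union, mem_filter, Finset.mem_image] at hy
      rw [Finset.mem_insert] at hz
      rcases hy with ⟨hy, hp⟩ | ⟨⟨y1, y2⟩, hq, rfl⟩
      · grind
      · simp only [mem_product, mem_filter] at hq
        obtain ⟨⟨h1, p1⟩, h2, p2⟩ := hq
        rw [key]
        rcases hz with rfl | hz
        · linarith
        · have a1 := hYX _ h1 _ hz
          have a2 := hYX _ h2 _ hz
          dsimp only
          nlinarith
    · intro v hv
      let pv : (ι → ℤ) → ℝ := fun y => ∑ i, (y i : ℝ) * v i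
      let L : Finset ℝ := insert 0 ((Y.filter fun y => pr y < 0).image fun y => pv y / pr y)
      have hL : L.Nonempty := ⟨0, by simp [L]⟩
      have key : ∀ q : (ι → ℤ) × (ι → ℤ), ∑ i, ((cmb q i : ℤ) : ℝ) * v i
          = pr q.1 * pv q.2 - pr q.2 * pv q.1 := by
        intro q
        simp only [cmb, pv, mul_sum, ← sum_sub_distrib]
        grind
      have hμ0 : 0 ≤ L.max' hL := Finset.le_max' _ _ (by simp [L])
      have hμ : ∀ y ∈ Y, 0 ≤ pv y - L.max' hL * pr y := by
        intro y hy
        rcases lt_trichotomy (pr y) 0 with h | h | h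
        · have : pv y / pr y ≤ L.max' hL := Finset.le_max' _ _ (by
            simp only [L, Finset.mem_insert, Finset.mem_image, mem_filter]
            exact Or.inr ⟨y, ⟨hy, h⟩, rfl⟩)
          have h' : (pr y : ℝ) < 0 := by exact_mod_cast h
          rw [div_le_iff_of_neg h'] at this
          linarith
        · have := hv y (by simp [hy, h])
          rw [h]; simpa [pv] using this
        · have h' : (0 : ℝ) < pr y := by exact_mod_cast h
          have hmem := L.max'_mem hL
          have : L.max' hL ≤ pv y / pr y := by
            simp only [L, Finset.mem_insert, Finset.mem_image, mem_filter] at hmem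
            rcases hmem with h0 | ⟨y2, ⟨hy2, hp2⟩, h0⟩
            · rw [h0]
              exact div_nonneg (hv y (by simp [hy, h.le])) h'.le
            · rw [← h0]
              have hp2' : (pr y2 : ℝ) < 0 := by exact_mod_cast hp2
              have := hv (cmb (y, y2)) (Finset.mem_union_right _ (mem_image_of_mem _ (by
                simp [hy, h, hy2, hp2])))
              rw [key] at this
              rw [div_le_iff_of_neg hp2', div_mul_eq_mul_div, div_le_iff₀ h']
              linarith
          rw [le_div_iff₀ h'] at this
          linarith
      obtain ⟨c, hc0, hc⟩ := hY (fun i => v i - L.max' hL * x i) (by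
        intro y hy
        have := hμ y hy
        have e : ∑ i, (y i : ℝ) * (v i - L.max' hL * x i) = pv y - L.max' hL * pr y := by
          simp only [pv, pr, Int.cast_sum, Int.cast_mul, mul_sum, ← sum_sub_distrib]
          grind
        rw [e]; exact this)
      refine ⟨update c x (L.max' hL), fun z => ?_, fun i => ?_⟩
      · grind
      · rw [sum_insert hx, update_self]
        rw [sum_congr rfl (fun z hz => by rw [update_of_ne (ne_of_mem_of_not_mem hz hx)]), ← hc i]
        ring

/-- **Dickson's lemma**. -/
lemma exists_finset_minimal (T : Set ℕ^[n]) :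
    ∃ S : Finset ℕ^[n], (∀ s ∈ S, s ∈ T) ∧ ∀ α ∈ T, ∃ s ∈ S, s ≤ α := by
  have hfin : {s | Minimal (· ∈ T) s}.Finite :=
    WellQuasiOrderedLE.finite_of_isAntichain (setOfPred_minimal_antichain _)
  refine ⟨hfin.toFinset, fun s hs => ?_, fun α hα => ?_⟩
  · exact ((hfin.mem_toFinset).1 hs).prop
  · obtain ⟨b, hb, hm⟩ := exists_minimal_le_of_wellFoundedLT (· ∈ T) α hα
    exact ⟨b, hfin.mem_toFinset.2 hm, hb⟩

lemma dot_add_right (a x y : ℝ^[n]) : dot a (x + y) = dot a x + dot a y := by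
  simp [dot, mul_add, sum_add_distrib]

lemma dot_smul_right (a x : ℝ^[n]) (c : ℝ) : dot a (c • x) = c * dot a x := by
  simp only [dot, mul_sum, Pi.smul_apply, smul_eq_mul]
  grind

lemma dot_comm (a x : ℝ^[n]) : dot a x = dot x a := by simp [dot, mul_comm]

lemma dot_mono_right {a x y : ℝ^[n]} (ha : ∀ i, 0 ≤ a i) (h : ∀ i, x i ≤ y i) : dot a x ≤ dot a y :=
  sum_le_sum fun i _ => mul_le_mul_of_nonneg_left (h i) (ha i)

lemma convex_Hhalf (a : ℝ^[n]) (l : ℝ) : Convex ℝ (Hhalf a l) := by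
  intro x hx y hy c d hc hd hcd
  have hx' : l ≤ dot a x := hx
  have hy' : l ≤ dot a y := hy
  change l ≤ dot a (c • x + d • y)
  rw [dot_add_right, dot_smul_right, dot_smul_right]
  calc l = c * l + d * l := by rw [← add_mul, hcd, one_mul]
    _ ≤ _ := by gcongr

/-- The data describing the Newton polyhedron: its minimal exponents `S` and a finite family
`A` of covectors cutting it out. -/
structure PolyData (f : ℝ^[n] → ℝ) where
  S : Finset ℕ^[n]
  A : Finset ℕ^[n]
  nonempty : S.Nonempty
  coeff_ne : ∀ s ∈ S, taylorCoeff f s ≠ 0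
  dominates : ∀ α, taylorCoeff f α ≠ 0 → ∃ s ∈ S, s ≤ α
  mem_of_forall : ∀ v : ℝ^[n],
    (∀ a ∈ A, ∃ s ∈ S, dot (natPt a) (natPt s) ≤ dot (natPt a) v) → v ∈ Γ₊ f

variable (D : PolyData f)

lemma natPt_mem_NewtonPolyhedron {α : ℕ^[n]} (h : taylorCoeff f α ≠ 0) : natPt α ∈ Γ₊ f :=
  subset_convexHull ℝ _ ⟨α, h, fun _ => le_rfl⟩

lemma convex_NewtonPolyhedron (f : ℝ^[n] → ℝ) : Convex ℝ (Γ₊ f) := convex_convexHull ℝ _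

lemma NewtonPolyhedron_upward {v w : ℝ^[n]}
    (hv : v ∈ Γ₊ f) (h : ∀ i, v i ≤ w i) : w ∈ Γ₊ f := by
  have : Γ₊ f ⊆ (fun x => x + (w - v)) ⁻¹' Γ₊ f := by
    refine convexHull_min ?_ ((convex_NewtonPolyhedron f).translate_preimage_left (w - v))
    rintro x ⟨α, hα, hx⟩
    refine subset_convexHull ℝ _ ⟨α, hα, fun i => ?_⟩
    simp only [Pi.add_apply, Pi.sub_apply]
    linarith [hx i, h i]
  simpa using this hv

lemma exists_polyData (hΓ : (Γ₊ f).Nonempty) :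
    Nonempty (PolyData f) := by
  classical
  obtain ⟨S, hS, hdom⟩ := exists_finset_minimal {α | taylorCoeff f α ≠ 0}
  have hne : S.Nonempty := by
    have : {x : ℝ^[n] | ∃ α : ℕ^[n], taylorCoeff f α ≠ 0 ∧ ∀ i, (α i : ℝ) ≤ x i}.Nonempty :=
      convexHull_nonempty_iff.1 hΓ
    obtain ⟨x, α, hα, -⟩ := this
    obtain ⟨s, hs, -⟩ := hdom α hα
    exact ⟨s, hs⟩
  let g : ℕ^[n] → (Option (Fin n) → ℤ) := fun s o => o.elim 1 fun i => (s i : ℤ)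
  let e : Fin n → (Option (Fin n) → ℤ) := fun i o => o.elim 0 fun j => if j = i then 1 else 0
  have hg : Function.Injective g := by
    intro s s' h
    funext i
    have := congrFun h (some i)
    simpa [g] using this
  obtain ⟨Y, hYX, hY⟩ := exists_dual_generators (S.image g ∪ Finset.univ.image e)
  refine ⟨⟨S, Y.image fun y i => (y (some i)).toNat, hne, hS, hdom, fun v hv => ?_⟩⟩
  obtain ⟨c, hc0, hc⟩ := hY (fun o => o.elim 1 v) (by
    intro y hy
    have hynn : ∀ i, 0 ≤ y (some i) := by
      intro i
      have := hYX y hy (e i) (Finset.mem_union_right _ (mem_image_of_mem _ (by simp)))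
      simpa [Fintype.sum_option, e] using this
    obtain ⟨s, hs, hsv⟩ := hv _ (mem_image_of_mem _ hy)
    have h1 := hYX y hy (g s) (Finset.mem_union_left _ (mem_image_of_mem _ hs))
    have h1' : (0 : ℝ) ≤ (y none : ℝ) + ∑ i, (y (some i) : ℝ) * s i := by
      simp only [Fintype.sum_option, g, Option.elim] at h1
      have : ((0 : ℤ) : ℝ) ≤ ((y none * 1 + ∑ i, y (some i) * (s i : ℤ) : ℤ) : ℝ) := by
        exact_mod_cast h1
      simpa using this
    have e1 : ∀ i, (natPt (fun i => (y (some i)).toNat) : ℝ^[n]) i = y (some i) := by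
      intro i
      simp only [natPt]
      have := Int.toNat_of_nonneg (hynn i)
      exact_mod_cast this
    simp only [dot, e1] at hsv
    simp only [Fintype.sum_option, Option.elim, natPt] at *
    linarith)
  have hsum1 : ∑ s ∈ S, c (g s) ≤ 1 ∧ 1 ≤ ∑ s ∈ S, c (g s) := by
    have h := hc none
    have h2 : ∑ x ∈ S.image g ∪ Finset.univ.image e, c x * (x none : ℝ)
        = ∑ x ∈ S.image g, c x * (x none : ℝ) := by
      refine (Finset.sum_subset Finset.subset_union_left fun x hx hx' => ?_).symm
      rcases Finset.mem_union.1 hx with h | h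
      · exact absurd h hx'
      · obtain ⟨i, -, rfl⟩ := Finset.mem_image.1 h
        simp [e]
    rw [h2, Finset.sum_image hg.injOn] at h
    simp [g] at h
    constructor <;> linarith
  have hle : ∀ i, ∑ s ∈ S, c (g s) * (s i : ℝ) ≤ v i := by
    intro i
    have h := hc (some i)
    simp only [Option.elim] at h
    rw [h]
    have h3 : ∑ s ∈ S, c (g s) * (s i : ℝ) = ∑ x ∈ S.image g, c x * (x (some i) : ℝ) := by
      rw [Finset.sum_image hg.injOn]
      simp [g]
    rw [h3]
    refine Finset.sum_le_sum_of_subset_of_nonneg Finset.subset_union_left fun x hx _ => ?_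
    refine mul_nonneg (hc0 x) ?_
    rcases Finset.mem_union.1 hx with h | h
    · grind
    · obtain ⟨j, -, rfl⟩ := Finset.mem_image.1 h
      simp only [e, Option.elim]
      split_ifs <;> simp
  have hmem : ∑ s ∈ S, c (g s) • (natPt s : ℝ^[n]) ∈ Γ₊ f :=
    (convex_NewtonPolyhedron f).sum_mem (fun s _ => hc0 _) (le_antisymm hsum1.1 hsum1.2)
      fun s hs => natPt_mem_NewtonPolyhedron (hS s hs)
  refine NewtonPolyhedron_upward hmem fun i => ?_
  simpa [natPt] using hle i

/-- The minimal value of `⟨z, ·⟩` on the Newton polyhedron is attained on `S`. -/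
lemma PolyData.exists_dot_le {v z : ℝ^[n]}
    (hv : v ∈ Γ₊ f) (hz : ∀ i, 0 ≤ z i) :
    ∃ s ∈ D.S, dot z (natPt s) ≤ dot z v := by
  obtain ⟨s, hs, hmin⟩ := D.S.exists_min_image (fun s => dot z (natPt s)) D.nonempty
  refine ⟨s, hs, ?_⟩
  have : Γ₊ f ⊆ Hhalf z (dot z (natPt s)) := by
    refine convexHull_min ?_ (convex_Hhalf _ _)
    rintro x ⟨α, hα, hx⟩
    obtain ⟨s', hs', hle⟩ := D.dominates α hα
    refine (hmin s' hs').trans (dot_mono_right hz fun i => le_trans ?_ (hx i))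
    simpa [natPt] using hle i
  exact this hv

lemma PolyData.mem {s : ℕ^[n]} (hs : s ∈ D.S) :
    natPt s ∈ Γ₊ f := natPt_mem_NewtonPolyhedron (D.coeff_ne s hs)

lemma contDiff_intervalIntegral_param {E : Type*} [NormedAddCommGroup E] [NormedSpace ℝ E]
    {G : E → ℝ → ℝ} (hG : ContDiff ℝ ∞ (fun p : E × ℝ => G p.1 p.2)) :
    ContDiff ℝ ∞ fun x => ∫ s in (0 : ℝ)..1, G x s := by
  let χ : ContDiffBump (0 : ℝ) := ⟨1, 2, by norm_num, by norm_num⟩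
  have h1 : ContDiffOn ℝ ∞ (fun q : E × ℝ =>
      (convolution ((Ioc (0 : ℝ) 1).indicator 1) (fun y => χ y * G q.1 (-y))
        (ContinuousLinearMap.mul ℝ ℝ) volume) q.2) (univ ×ˢ univ) := by
    refine contDiffOn_convolution_right_with_param (ContinuousLinearMap.mul ℝ ℝ)
      (g := fun p y => χ y * G p (-y)) (k := Metric.closedBall 0 2) isOpen_univ
      (isCompact_closedBall _ _) ?_ ?_ ?_
    · intro p x _ hx
      have : χ x = 0 := χ.zero_of_le_dist (by rw [Metric.mem_closedBall, not_le] at hx; exact hx.le)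
      simp [this]
    · exact ((integrable_indicator_iff measurableSet_Ioc).2
        (integrableOn_const (by simp))).locallyIntegrable
    · refine ContDiff.contDiffOn ?_
      refine ContDiff.mul (χ.contDiff.comp contDiff_snd) ?_
      exact hG.comp (contDiff_fst.prodMk contDiff_snd.neg)
  rw [univ_prod_univ, contDiffOn_univ] at h1
  have h2 := h1.comp ((contDiff_id (𝕜 := ℝ) (E := E)).prodMk (contDiff_const (c := (0 : ℝ))))
  convert h2 using 1
  refine funext fun x => ?_
  simp only [Function.comp, convolution, intervalIntegral.integral_of_le zero_le_one, id]
  rw [← integral_indicator measurableSet_Ioc]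
  refine integral_congr_ae (.of_forall fun s => ?_)
  by_cases hs : s ∈ Ioc (0 : ℝ) 1
  · have : χ (0 - s) = 1 := χ.one_of_mem_closedBall (by
      simp only [Metric.mem_closedBall, dist_zero_right, zero_sub, norm_neg]
      rw [norm_of_nonneg hs.1.le]; exact hs.2)
    simp [hs]
    simp at this
    rw [this]; simp
  · simp [hs]

lemma contDiff_pderiv1 {i : Fin n} (hg : ContDiff ℝ ∞ g) : ContDiff ℝ ∞ (pderiv1 i g) :=
  (hg.fderiv_right (m := ∞) le_rfl).clm_apply contDiff_const

lemma contDiff_update_mul (i : Fin n) :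
    ContDiff ℝ ∞ (fun p : ℝ^[n] × ℝ => update p.1 i (p.2 * p.1 i)) := by
  rw [contDiff_pi]
  intro j
  by_cases h : j = i
  · subst h
    simp only [update_self]
    exact contDiff_snd.mul ((contDiff_apply ℝ ℝ j).comp contDiff_fst)
  · simp only [update_of_ne h]
    exact (contDiff_apply ℝ ℝ j).comp contDiff_fst

/-- The algebra of smooth functions, as a type. -/
abbrev Smooth (n : ℕ) := {g : ℝ^[n] → ℝ // ContDiff ℝ ∞ g}

/-- Restriction to the coordinate hyperplane `x i = 0`. -/
def restr (i : Fin n) : Function.End (Smooth n) := fun g =>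
  ⟨fun x => g.1 (update x i 0), by
    have := g.2.comp ((contDiff_update_mul i).comp
      ((contDiff_id (𝕜 := ℝ)).prodMk (contDiff_const (c := (0 : ℝ)))))
    simpa [Function.comp_def] using this⟩

/-- The Hadamard quotient `(g - g|_{x i = 0}) / x i`. -/
noncomputable def hquot (i : Fin n) : Function.End (Smooth n) := fun g =>
  ⟨fun x => ∫ s in (0 : ℝ)..1, pderiv1 i g.1 (update x i (s * x i)),
    contDiff_intervalIntegral_param ((contDiff_pderiv1 g.2).comp (contDiff_update_mul i))⟩

lemma hasDerivAt_update (hg : ContDiff ℝ ∞ g) (i : Fin n)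
    (x : ℝ^[n]) (c : ℝ) :
    HasDerivAt (fun s => g (update x i s)) (pderiv1 i g (update x i c)) c := by
  have h1 : HasDerivAt (fun s => update x i s) (single i (1 : ℝ)) c := by
    rw [hasDerivAt_pi]
    intro j
    by_cases h : j = i
    · subst h; simpa using hasDerivAt_id' c
    · simpa [h] using hasDerivAt_const c (x j)
  exact ((hg.differentiable (by simp)) _).hasFDerivAt.comp_hasDerivAt c h1

lemma restr_add_mul_hquot (i : Fin n) (g : Smooth n) (x : ℝ^[n]) :
    g.1 x = (restr i g).1 x + x i * (hquot i g).1 x := by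
  have h := intervalIntegral.integral_eq_sub_of_hasDerivAt (a := 0) (b := 1)
    (f := fun s : ℝ => g.1 (update x i (s * x i)))
    (f' := fun s => pderiv1 i g.1 (update x i (s * x i)) * x i) (fun s _ => by
      have := (hasDerivAt_update g.2 i x (s * x i)).comp s
        ((hasDerivAt_id s).mul_const (x i))
      simpa [Function.comp_def] using this) (by
      refine Continuous.intervalIntegrable ?_ _ _
      refine Continuous.mul ?_ continuous_const
      exact (((contDiff_pderiv1 g.2).comp (contDiff_update_mul i)).continuous).comp
        (continuous_const.prodMk continuous_id))
  rw [intervalIntegral.integral_mul_const] at h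
  simp only [one_mul, zero_mul, update_eq_self] at h
  simp only [restr, hquot]
  linarith

lemma pderiv1_restr {i j : Fin n} (hij : i ≠ j) (g : Smooth n) (x : ℝ^[n]) :
    pderiv1 i (restr j g).1 x = pderiv1 i g.1 (update x j 0) := by
  have h1 := hasDerivAt_update (restr j g).2 i x (x i)
  rw [update_eq_self] at h1
  have h2 := hasDerivAt_update g.2 i (update x j 0) (x i)
  have e : update (update x j 0) i (x i) = update x j 0 := by
    rw [update_comm hij.symm, update_eq_self]
  rw [e] at h2
  refine h1.unique (h2.congr_of_eventuallyEq (.of_forall fun s => ?_))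
  simp only [restr]
  rw [update_comm hij]

lemma restr_comm (i j : Fin n) : Commute (restr i) (restr j) := by
  refine funext fun g => Subtype.ext (funext fun x => ?_)
  rcases eq_or_ne i j with rfl | h
  · rfl
  · change g.1 _ = g.1 _
    rw [update_comm h]

lemma hquot_restr_comm {i j : Fin n} (hij : i ≠ j) : Commute (hquot i) (restr j) := by
  refine funext fun g => Subtype.ext (funext fun x => ?_)
  change ∫ s in (0 : ℝ)..1, pderiv1 i (restr j g).1 (update x i (s * x i)) =
    ∫ s in (0 : ℝ)..1, pderiv1 i g.1
      (update (update x j 0) i (s * (update x j 0) i))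
  refine intervalIntegral.integral_congr fun s _ => ?_
  rw [pderiv1_restr hij, update_of_ne hij, update_comm hij]

lemma dense_coord_ne_zero (i j : Fin n) : Dense {x : ℝ^[n] | x i ≠ 0 ∧ x j ≠ 0} := by
  have h : ∀ k : Fin n, Dense {x : ℝ^[n] | x k ≠ 0} ∧ IsOpen {x : ℝ^[n] | x k ≠ 0} := by
    intro k
    refine ⟨?_, isOpen_ne_fun (continuous_apply k) continuous_const⟩
    exact (dense_compl_singleton (0 : ℝ)).preimage (isOpenMap_eval k)
  exact (h i).1.inter_of_isOpen_left (h j).1 (h i).2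

lemma restr_sub_apply (i : Fin n) (g : Smooth n) (x : ℝ^[n]) :
    (restr i g).1 x = g.1 (update x i 0) := rfl

lemma hquot_comm (i j : Fin n) : Commute (hquot i) (hquot j) := by
  rcases eq_or_ne i j with rfl | hij
  · exact Commute.refl _
  refine funext fun g => Subtype.ext ?_
  change (hquot i (hquot j g)).1 = (hquot j (hquot i g)).1
  refine Continuous.ext_on (dense_coord_ne_zero i j) (hquot i (hquot j g)).2.continuous
    (hquot j (hquot i g)).2.continuous fun x hx => ?_
  have a1 := restr_add_mul_hquot i (hquot j g) x
  have a2 := restr_add_mul_hquot j g x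
  have a3 := restr_add_mul_hquot j g (update x i 0)
  have b1 := restr_add_mul_hquot j (hquot i g) x
  have b2 := restr_add_mul_hquot i g x
  have b3 := restr_add_mul_hquot i g (update x j 0)
  simp only [restr_sub_apply] at *
  rw [update_of_ne hij.symm] at a3
  rw [update_of_ne hij] at b3
  rw [update_comm hij] at a3
  have : x i * x j * (hquot i (hquot j g)).1 x = x i * x j * (hquot j (hquot i g)).1 x := by
    linear_combination (-x j) * a1 - a2 + a3 + x i * b1 + b2 - b3
  exact mul_left_cancel₀ (mul_ne_zero hx.1 hx.2) this

/-- The monomial `x ^ p`. -/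
def xpow (p : ℕ^[n]) (x : ℝ^[n]) : ℝ := ∏ i, x i ^ p i

/-- The pairing of natural vectors. -/
def ndot (b s : ℕ^[n]) : ℕ := ∑ i, b i * s i

lemma dot_natPt (b s : ℕ^[n]) : dot (natPt b) (natPt s) = (ndot b s : ℝ) := by
  simp [dot, natPt, ndot]

lemma dot_natPt_le {b s q : ℕ^[n]} :
    dot (natPt b) (natPt s) ≤ dot (natPt b) (natPt q) ↔ ndot b s ≤ ndot b q := by
  rw [dot_natPt, dot_natPt, Nat.cast_le]

lemma PolyData.exists_separation (D : PolyData f) :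
    ∃ K₀ : ℕ, ∀ K ≥ K₀, ∀ p : ℕ^[n], natPt p ∉ Γ₊ f → (∀ i, p i ≤ K) →
      ∃ b : ℕ^[n], ∃ l : ℕ, Γ₊ f ⊆ Hhalf (natPt b) (l : ℝ) ∧ ndot b p < l ∧
        ∀ i, (p i < K → 1 ≤ b i) ∧ (p i = K → b i = 0) := by
  classical
  refine ⟨(∑ a ∈ D.A, ∑ s ∈ D.S, ndot a s) + 1, fun K hK p hp hpK => ?_⟩
  obtain ⟨a, haA, ha⟩ : ∃ a ∈ D.A, ∀ s ∈ D.S, ndot a p < ndot a s := by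
    by_contra! h
    refine hp (D.mem_of_forall _ fun a ha => ?_)
    obtain ⟨s, hs, hle⟩ := h a ha
    exact ⟨s, hs, dot_natPt_le.2 hle⟩
  obtain ⟨s₁, hs₁⟩ := D.nonempty
  have haK : ∀ i, p i = K → a i = 0 := by
    intro i hi
    by_contra h0
    have h1 : ndot a s₁ ≤ ∑ a ∈ D.A, ∑ s ∈ D.S, ndot a s :=
      (single_le_sum (f := fun s => ndot a s) (fun _ _ => Nat.zero_le _) hs₁).trans
        (single_le_sum (f := fun a => ∑ s ∈ D.S, ndot a s)
          (fun _ _ => Nat.zero_le _) haA)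
    have h2 : a i * p i ≤ ndot a p :=
      single_le_sum (f := fun i => a i * p i) (fun _ _ => Nat.zero_le _) (Finset.mem_univ i)
    have h3 := ha s₁ hs₁
    have h4 : p i ≤ a i * p i := Nat.le_mul_of_pos_left _ (Nat.pos_of_ne_zero h0)
    omega
  let M := ∑ i, p i + 1
  let b : ℕ^[n] := fun i => M * a i + if p i < K then 1 else 0
  obtain ⟨s, hs, hmin⟩ := D.S.exists_min_image (fun s => ndot b s) D.nonempty
  refine ⟨b, ndot b s, fun v hv => ?_, ?_, fun i => ⟨fun h => ?_, fun h => ?_⟩⟩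
  · obtain ⟨s', hs', hle⟩ := D.exists_dot_le (z := natPt b) hv fun i => Nat.cast_nonneg _
    refine le_trans ?_ hle
    rw [dot_natPt]
    exact_mod_cast hmin s' hs'
  · have e1 : ndot b p = M * ndot a p + ∑ i, (if p i < K then p i else 0) := by
      simp only [ndot, b, mul_sum, ← sum_add_distrib]
      refine sum_congr rfl fun i _ => ?_
      split_ifs <;> ring
    have e2 : ∑ i, (if p i < K then p i else 0) ≤ ∑ i, p i :=
      sum_le_sum fun i _ => by split_ifs <;> simp
    have e3 : M * ndot a s ≤ ndot b s := by
      simp only [ndot, b, mul_sum]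
      refine sum_le_sum fun i _ => ?_
      rw [← mul_assoc]
      exact Nat.mul_le_mul_right _ (Nat.le_add_right _ _)
    have e4 : M * (ndot a p + 1) ≤ M * ndot a s := Nat.mul_le_mul_left _ (ha s hs)
    rw [mul_add, mul_one] at e4
    simp only [M] at *
    omega
  · simp [b, h]
  · simp [b, h, haK i h]

/-- The Taylor coefficient operators of order `K` in the variable `x i`. -/
noncomputable def cop (K : ℕ) (i : Fin n) (k : ℕ) : Function.End (Smooth n) :=
  if k < K then restr i * hquot i ^ k else hquot i ^ K

lemma cop_comm (K : ℕ) (i j : Fin n) (hij : i ≠ j) (k l : ℕ) :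
    Commute (cop K i k) (cop K j l) := by
  have h1 := hquot_comm i j
  have h2 := hquot_restr_comm hij
  have h3 := (hquot_restr_comm hij.symm).symm
  have h4 := restr_comm i j
  unfold cop
  split_ifs
  · exact (h4.mul_right (h3.pow_right _)).mul_left ((h2.mul_right (h1.pow_right _)).pow_left _)
  · exact (h3.pow_right _).mul_left (h1.pow_pow _ _)
  · exact (h2.mul_right (h1.pow_right _)).pow_left _
  · exact h1.pow_pow _ _

lemma taylor_cop (K : ℕ) (i : Fin n) (g : Smooth n) (x : ℝ^[n]) :
    g.1 x = ∑ k ∈ Finset.range (K + 1), x i ^ k * (cop K i k g).1 x := by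
  have h : ∀ L, g.1 x = (∑ k ∈ Finset.range L, x i ^ k * ((restr i * hquot i ^ k) g).1 x)
      + x i ^ L * ((hquot i ^ L) g).1 x := by
    intro L
    induction L with
    | zero => simp; rfl
    | succ L ih =>
      rw [Finset.sum_range_succ, ih, restr_add_mul_hquot i ((hquot i ^ L) g) x, pow_succ' (hquot i)]
      change _ + x i ^ L * ((restr i ((hquot i ^ L) g)).1 x +
        x i * (hquot i ((hquot i ^ L) g)).1 x) = _ +
        x i ^ L * (restr i ((hquot i ^ L) g)).1 x + x i ^ (L + 1) *
        (hquot i ((hquot i ^ L) g)).1 x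
      ring
  rw [h K, Finset.sum_range_succ]
  congr 1
  · refine sum_congr rfl fun k hk => ?_
    rw [cop, if_pos (Finset.mem_range.1 hk)]
  · rw [cop, if_neg (lt_irrefl K)]

/-- Iterated Taylor coefficient operators. -/
noncomputable def coef (K : ℕ) (J : Finset (Fin n)) (p : ℕ^[n]) : Function.End (Smooth n) :=
  J.noncommProd (fun j => cop K j (p j)) fun i _ j _ hij => cop_comm K i j hij _ _

lemma coef_insert {K : ℕ} {J : Finset (Fin n)} {i : Fin n} (hi : i ∉ J) (p : ℕ^[n]) :
    coef K (insert i J) p = coef K J p * cop K i (p i) :=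
  Finset.noncommProd_insert_of_notMem' _ _ _ _ hi

lemma coef_congr {K K' : ℕ} {J : Finset (Fin n)} {p q : ℕ^[n]}
    (h : ∀ j ∈ J, cop K j (p j) = cop K' j (q j)) : coef K J p = coef K' J q :=
  Finset.noncommProd_congr rfl h _

lemma expand_coef (K : ℕ) (J : Finset (Fin n)) :
    ∃ F : Finset ℕ^[n], (∀ p, p ∈ F ↔ ∀ j, (j ∈ J → p j ≤ K) ∧ (j ∉ J → p j = 0)) ∧
      ∀ (g : Smooth n) (x : ℝ^[n]), g.1 x = ∑ p ∈ F, xpow p x * (coef K J p g).1 x := by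
  classical
  induction J using induction_on with
  | empty =>
    refine ⟨{0}, by simp [funext_iff], fun g x => ?_⟩
    simp [xpow, coef]
    rfl
  | insert i J hi ih =>
    obtain ⟨F, hF', hE⟩ := ih
    have hF := fun p => (hF' p).1
    have hinj : Set.InjOn (fun q : ℕ^[n] × ℕ => update q.1 i q.2)
        ↑(F ×ˢ Finset.range (K + 1)) := by
      rintro ⟨p, k⟩ hp ⟨q, l⟩ hq h
      simp only [Finset.coe_product, mem_prod, Finset.mem_coe] at hp hq
      have h1 : k = l := by simpa using congrFun h i
      refine Prod.ext (funext fun j => ?_) h1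
      by_cases hj : j = i
      · subst hj
        exact (((hF p hp.1) j).2 hi).trans (((hF q hq.1) j).2 hi).symm
      · simpa [hj] using congrFun h j
    refine ⟨(F ×ˢ Finset.range (K + 1)).image fun q => update q.1 i q.2, ?_, ?_⟩
    · refine fun p => ⟨fun hp j => ?_, fun hp => ?_⟩
      swap
      · simp only [Finset.mem_image, mem_product, Finset.mem_range, Prod.exists]
        refine ⟨update p i 0, p i, ⟨(hF' _).2 fun j => ?_, ?_⟩, by simp⟩
        · by_cases hj : j = i
          · subst hj; simp
          · simpa [hj] using hp j
        · have := (hp i).1 (mem_insert_self _ _)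
          omega
      simp only [Finset.mem_image, mem_product, Finset.mem_range, Prod.exists] at hp
      obtain ⟨q, k, ⟨hq, hk⟩, rfl⟩ := hp
      by_cases hj : j = i
      · subst hj
        simp only [Finset.mem_insert, true_or, update_self, not_true_eq_false]
        exact ⟨fun _ => by omega, fun h => h.elim⟩
      · simp only [Finset.mem_insert, hj, false_or, update_of_ne, ne_eq, not_false_eq_true]
        exact hF q hq j
    · intro g x
      rw [Finset.sum_image hinj, Finset.sum_product_right, taylor_cop K i g x]
      refine sum_congr rfl fun k _ => ?_
      rw [hE (cop K i k g) x, mul_sum]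
      refine sum_congr rfl fun p hp => ?_
      have e1 : coef K (insert i J) (update p i k) g = coef K J p (cop K i k g) := by
        rw [coef_insert hi, update_self]
        change coef K J _ (cop K i k g) = _
        refine congrFun (coef_congr fun j hj => ?_) _
        rw [update_of_ne (ne_of_mem_of_not_mem hj hi)]
      have e2 : xpow (update p i k) x = x i ^ k * xpow p x := by
        simp only [xpow]
        rw [← mul_prod_erase _ _ (Finset.mem_univ i),
          ← mul_prod_erase _ (fun j => x j ^ p j) (Finset.mem_univ i),
          update_self, ((hF p hp) i).2 hi, pow_zero, one_mul]
        congr 1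
        refine prod_congr rfl fun j hj => ?_
        rw [update_of_ne (ne_of_mem_erase hj)]
      rw [e1, e2]
      ring

lemma eq_of_update_invariant {J : Finset (Fin n)}
    (hJ : ∀ j ∈ J, ∀ x c, h (update x j c) = h x) {x y : ℝ^[n]}
    (hxy : ∀ i ∉ J, x i = y i) : h x = h y := by
  classical
  have key : ∀ T ⊆ J, h (T.piecewise y x) = h x := by
    intro T
    induction T using induction_on with
    | empty => simp
    | insert i T hi ih =>
      intro hT
      rw [Finset.piecewise_insert, hJ i (hT (mem_insert_self _ _))]
      exact ih fun j hj => hT (mem_insert_of_mem hj)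
  rw [← key J subset_rfl]
  congr 1
  funext i
  by_cases hi : i ∈ J <;> simp [hi, hxy]

lemma coef_invariant {K : ℕ} {J : Finset (Fin n)} {p : ℕ^[n]} (hp : ∀ j ∈ J, p j < K)
    (g : Smooth n) {x y : ℝ^[n]} (hxy : ∀ i ∉ J, x i = y i) :
    (coef K J p g).1 x = (coef K J p g).1 y := by
  classical
  refine eq_of_update_invariant (J := J) (fun j hj x c => ?_) hxy
  have h := Finset.mul_noncommProd_erase J hj (fun j => cop K j (p j))
    fun i _ j _ hij => cop_comm K i j hij _ _
  rw [coef, ← h, cop, if_pos (hp j hj)]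
  change (restr j _).1 _ = (restr j _).1 _
  rw [restr_sub_apply, restr_sub_apply, Function.update_idem]

/-- `g` vanishes on the cube of radius `r`. -/
def VanOn (r : ℝ) (g : Smooth n) : Prop := ∀ x, (∀ i, |x i| < r) → g.1 x = 0

lemma VanOn.restr {r : ℝ} (hr : 0 < r) {g : Smooth n} (h : VanOn r g) (i : Fin n) :
    VanOn r (restr i g) := by
  intro x hx
  refine h _ fun j => ?_
  by_cases hj : j = i
  · subst hj; simpa using hr
  · simpa [hj] using hx j

lemma VanOn.hquot {r : ℝ} {g : Smooth n} (h : VanOn r g) (i : Fin n) :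
    VanOn r (hquot i g) := by
  intro x hx
  have h0 : ∀ y : ℝ^[n], (∀ i, |y i| < r) → pderiv1 i g.1 y = 0 := by
    intro y hy
    have hopen : IsOpen {y : ℝ^[n] | ∀ i, |y i| < r} := by
      have : {y : ℝ^[n] | ∀ i, |y i| < r} = ⋂ i, {y | |y i| < r} := by ext; simp
      rw [this]
      exact isOpen_iInter_of_finite fun i => isOpen_lt (by fun_prop) continuous_const
    have : g.1 =ᶠ[𝓝 y] fun _ => 0 := by filter_upwards [hopen.mem_nhds hy] with z hz using h z hz
    rw [pderiv1, this.fderiv_eq]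
    simp
  change ∫ s in (0 : ℝ)..1, pderiv1 i g.1 (update x i (s * x i)) = 0
  rw [intervalIntegral.integral_congr (g := fun _ => 0), intervalIntegral.integral_zero]
  intro s hs
  rw [uIcc_of_le zero_le_one] at hs
  refine h0 _ fun j => ?_
  by_cases hj : j = i
  · subst hj
    rw [update_self, abs_mul, abs_of_nonneg hs.1]
    exact (mul_le_of_le_one_left (abs_nonneg _) hs.2).trans_lt (hx j)
  · simpa [hj] using hx j

lemma VanOn.coef {r : ℝ} (hr : 0 < r) {g : Smooth n} (h : VanOn r g) (K : ℕ)
    (J : Finset (Fin n)) (p : ℕ^[n]) : VanOn r (coef K J p g) := by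
  classical
  have hpow : ∀ (i : Fin n) (k : ℕ) (g : Smooth n), VanOn r g → VanOn r ((KN.hquot i ^ k) g) := by
    intro i k
    induction k with
    | zero => intro g hg; exact hg
    | succ k ih => intro g hg; rw [pow_succ]; exact ih _ (hg.hquot i)
  induction J using induction_on generalizing g with
  | empty => exact h
  | insert i J hi ih =>
    rw [coef_insert hi]
    refine ih (g := cop K i (p i) g) ?_
    unfold cop
    split_ifs
    · exact (hpow i _ g h).restr hr i
    · exact hpow i _ g h

lemma isBigO_pow_pow {k l : ℕ} (h : l ≤ k) :
    (fun t : ℝ => t ^ k) =O[𝓝[>] (0 : ℝ)] fun t => t ^ l := by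
  refine Asymptotics.IsBigO.of_bound 1 ?_
  filter_upwards [Ioo_mem_nhdsGT one_pos] with t ht
  rw [one_mul, norm_of_nonneg (pow_nonneg ht.1.le _), norm_of_nonneg (pow_nonneg ht.1.le _)]
  exact pow_le_pow_of_le_one ht.1.le ht.2.le h

lemma coeff_eq_zero_of_isBigO {l : ℕ} {c : ℕ → ℝ}
    (h : (fun t : ℝ => ∑ e ∈ Finset.range l, c e * t ^ e) =O[𝓝[>] (0 : ℝ)] fun t => t ^ l) :
    ∀ e < l, c e = 0 := by
  intro e
  induction e using Nat.strong_induction_on with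
  | _ e ih =>
    intro he
    have h1 : (fun t : ℝ => c e * t ^ e) =O[𝓝[>] (0 : ℝ)] fun t => t ^ (e + 1) := by
      have h2 : ∀ t : ℝ, c e * t ^ e = ∑ k ∈ Finset.range l, c k * t ^ k
          - ∑ k ∈ Finset.Ico (e + 1) l, c k * t ^ k := by
        intro t
        rw [← Finset.sum_range_add_sum_Ico _ (Nat.succ_le_of_lt he), Finset.sum_range_succ,
          sum_eq_zero (s := Finset.range e)]
        · simp
        · intro k hk
          rw [Finset.mem_range] at hk
          rw [ih k hk (hk.trans he), zero_mul]
      simp only [h2]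
      refine (h.trans (isBigO_pow_pow he)).sub (Asymptotics.IsBigO.fun_sum fun k hk => ?_)
      exact (isBigO_pow_pow (Finset.mem_Ico.1 hk).1).const_mul_left _
    have h3 : (fun _ : ℝ => c e) =O[𝓝[>] (0 : ℝ)] fun t => t := by
      have := h1.mul (Asymptotics.isBigO_refl (fun t : ℝ => (t ^ e)⁻¹) (𝓝[>] (0 : ℝ)))
      refine this.congr' ?_ ?_ <;>
      · filter_upwards [self_mem_nhdsWithin] with t (ht : 0 < t)
        field_simp
        try ring
    have h4 := h3.trans_tendsto (tendsto_id.mono_left nhdsWithin_le_nhds)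
    exact tendsto_nhds_unique tendsto_const_nhds h4

lemma xpow_scaleAction (b q : ℕ^[n]) (t : ℝ) (x : ℝ^[n]) :
    xpow q (scaleAction b t x) = t ^ ndot b q * xpow q x := by
  simp only [xpow, scaleAction, ndot, mul_pow, Finset.prod_mul_distrib, ← pow_mul,
    Finset.prod_pow_eq_pow_sum]

lemma coef_eq_zero {g : Smooth n} {r : ℝ} (hr : 0 < r) {K : ℕ} {p b : ℕ^[n]} {l : ℕ}
    (J : Finset (Fin n)) (hJ : ∀ i, i ∈ J ↔ p i < K)
    (hlim : ∀ x : ℝ^[n], (∀ i, |x i| < r) → ∃ c : ℝ,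
      Tendsto (fun t => g.1 (scaleAction b t x) / t ^ l) (𝓝[>] (0 : ℝ)) (𝓝 c))
    (hl : ndot b p < l) (hbJ : ∀ i ∈ J, 1 ≤ b i) (hbI : ∀ i ∉ J, b i = 0) :
    VanOn r (coef K J p g) := by
  classical
  set K' := max K l with hK'
  obtain ⟨F, hF, hE⟩ := expand_coef K' J
  let h : ℕ^[n] → ℝ^[n] → ℝ := fun q => (coef K' J q g).1
  have hinv : ∀ q, ndot b q < l → ∀ x y : ℝ^[n], (∀ i ∉ J, x i = y i) → h q x = h q y := by
    intro q hq x y hxy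
    refine coef_invariant (fun j hj => ?_) g hxy
    have h1 : b j * q j ≤ ndot b q :=
      single_le_sum (f := fun i => b i * q i) (fun _ _ => Nat.zero_le _) (Finset.mem_univ j)
    have h2 : q j ≤ b j * q j := Nat.le_mul_of_pos_left _ (hbJ j hj)
    have h3 : l ≤ K' := le_max_right _ _
    omega
  have hc : ∀ x : ℝ^[n], (∀ i, |x i| < r) → ∀ e < l,
      ∑ q ∈ F with ndot b q = e, xpow q x * h q x = 0 := by
    intro x hx
    refine coeff_eq_zero_of_isBigO ?_
    have e1 : ∀ t : ℝ, ∑ e ∈ Finset.range l, (∑ q ∈ F with ndot b q = e, xpow q x * h q x) * t ^ e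
        = g.1 (scaleAction b t x) - ∑ q ∈ F with ¬ ndot b q < l,
          t ^ ndot b q * (xpow q x * h q (scaleAction b t x)) := by
      intro t
      rw [hE g (scaleAction b t x), ← Finset.sum_filter_add_sum_filter_not F (fun q => ndot b q < l)]
      simp only [xpow_scaleAction]
      have e2 : ∑ q ∈ F with ¬ ndot b q < l, t ^ ndot b q * xpow q x *
          (coef K' J q g).1 (scaleAction b t x) = ∑ q ∈ F with ¬ ndot b q < l,
          t ^ ndot b q * (xpow q x * h q (scaleAction b t x)) :=
        sum_congr rfl fun q _ => by simp only [h]; ring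
      rw [e2, add_sub_cancel_right, ← Finset.sum_fiberwise_of_maps_to (s := F.filter _)
        (t := Finset.range l) (g := fun q => ndot b q) (fun q hq => by
          simpa using (mem_filter.1 hq).2)]
      refine sum_congr rfl fun e he => ?_
      rw [sum_mul, Finset.filter_filter]
      have he' := Finset.mem_range.1 he
      refine sum_congr (Finset.filter_congr fun q _ => ⟨fun h => ⟨by omega, h⟩,
        fun h => h.2⟩) fun q hq => ?_
      have hq2 := (mem_filter.1 hq).2
      have : h q (scaleAction b t x) = h q x := hinv q hq2.1 _ _ fun i hi => by
        simp [scaleAction, hbI i hi]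
      simp only [h] at this ⊢
      rw [this, hq2.2]
      ring
    simp only [e1]
    refine Asymptotics.IsBigO.sub ?_ (Asymptotics.IsBigO.fun_sum fun q hq => ?_)
    · obtain ⟨c, hcl⟩ := hlim x hx
      have h1 := hcl.isBigO_one ℝ
      have h2 := h1.mul (Asymptotics.isBigO_refl (fun t : ℝ => t ^ l) (𝓝[>] (0 : ℝ)))
      refine h2.congr' ?_ ?_
      · filter_upwards [self_mem_nhdsWithin] with t (ht : 0 < t)
        field_simp
      · exact .of_forall fun t => one_mul _
    · have hq2 : l ≤ ndot b q := not_lt.1 (mem_filter.1 hq).2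
      have hcont : Continuous fun t : ℝ => xpow q x * h q (scaleAction b t x) := by
        refine continuous_const.mul ((coef K' J q g).2.continuous.comp ?_)
        refine continuous_pi fun i => ?_
        exact (continuous_pow (b i)).mul continuous_const
      have h2 := (hcont.tendsto 0).mono_left (nhdsWithin_le_nhds (s := Ioi 0))
      simpa using (isBigO_pow_pow hq2).mul (h2.isBigO_one ℝ)
  intro x hx
  let pJ : ℕ^[n] := fun i => if i ∈ J then p i else 0
  have hb0 : ∀ q : ℕ^[n], (∀ i ∈ J, q i = p i) → ndot b q = ndot b p := by
    intro q hq
    refine sum_congr rfl fun i _ => ?_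
    by_cases hi : i ∈ J
    · rw [hq i hi]
    · rw [hbI i hi, zero_mul, zero_mul]
  have hpJ : ndot b pJ = ndot b p := hb0 _ fun i hi => by simp [pJ, hi]
  have hmem : pJ ∈ F := (hF pJ).2 fun j => ⟨fun hj => by
      simp only [pJ, hj, if_true]
      exact ((hJ j).1 hj).le.trans (le_max_left _ _), fun hj => by simp [pJ, hj]⟩
  have e3 : coef K J p = coef K' J pJ := coef_congr fun j hj => by
    have := (hJ j).1 hj
    simp only [pJ, hj, if_true, cop, this, this.trans_le (le_max_left K l), K']
  rw [e3]
  let ex : ℕ^[n] → (Fin n →₀ ℕ) := Finsupp.equivFunOnFinite.symm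
  let Q : MvPolynomial (Fin n) ℝ := ∑ q ∈ F with ndot b q = ndot b p,
    MvPolynomial.monomial (ex q) (h q x)
  have hQ : Q = 0 := by
    refine MvPolynomial.funext_set (fun _ => Ioo (-r) r) (fun _ => Ioo_infinite (by linarith)) ?_
    intro y hy
    have hy' : ∀ i, |J.piecewise y x i| < r := by
      intro i
      by_cases hi : i ∈ J
      · simp only [hi, Finset.piecewise_eq_of_mem]
        exact abs_lt.2 (hy i (mem_univ i))
      · simpa [hi] using hx i
    have := hc _ hy' _ hl
    simp only [Q, map_sum, MvPolynomial.eval_monomial, map_zero]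
    rw [← this]
    refine sum_congr rfl fun q hq => ?_
    have hq' := mem_filter.1 hq
    have e4 : h q (J.piecewise y x) = h q x := hinv q (hq'.2.trans_lt hl) _ _ fun i hi => by
      simp [hi]
    have e5 : (ex q).prod (fun i k => y i ^ k) = xpow q (J.piecewise y x) := by
      rw [Finsupp.prod_fintype _ _ (by simp)]
      refine prod_congr rfl fun i _ => ?_
      by_cases hi : i ∈ J
      · simp [ex, hi]
      · simp [ex, ((hF q).1 hq'.1 i).2 hi]
    rw [e4, e5, mul_comm]
  have h6 := congrArg (MvPolynomial.coeff (ex pJ)) hQ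
  simp only [Q, MvPolynomial.coeff_sum, MvPolynomial.coeff_monomial, MvPolynomial.coeff_zero] at h6
  rw [Finset.sum_eq_single pJ] at h6
  · simpa using h6
  · intro q _ hq
    rw [if_neg fun h => hq (Finsupp.equivFunOnFinite.symm.injective h)]
  · intro h
    exact absurd (mem_filter.2 ⟨hmem, hpJ⟩) h

/-- A smooth function satisfying the limit conditions defining `Ê[P]` near the origin is a
finite combination of monomials with exponents in `P` with smooth coefficients. -/
lemma exists_rep (D : PolyData f) {g : Smooth n} {r : ℝ} (hr : 0 < r)
    (hlim : ∀ x : ℝ^[n], (∀ i, |x i| < r) → ∀ (b : ℕ^[n]) (l : ℕ),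
      Γ₊ f ⊆ Hhalf (natPt b) l → ∃ c : ℝ,
      Tendsto (fun t => g.1 (scaleAction b t x) / t ^ l) (𝓝[>] (0 : ℝ)) (𝓝 c)) :
    ∃ (F : Finset ℕ^[n]) (ψ : ℕ^[n] → ℝ^[n] → ℝ),
      (∀ p, ContDiff ℝ ∞ (ψ p)) ∧ (∀ p ∈ F, natPt p ∈ Γ₊ f) ∧
      ∀ x : ℝ^[n], (∀ i, |x i| < r) → g.1 x = ∑ p ∈ F, xpow p x * ψ p x := by
  classical
  obtain ⟨K, hK⟩ := D.exists_separation
  obtain ⟨F, hF, hE⟩ := expand_coef K (Finset.univ : Finset (Fin n))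
  refine ⟨F.filter fun p => natPt p ∈ Γ₊ f, fun p => (coef K Finset.univ p g).1,
    fun p => (coef K Finset.univ p g).2, fun p hp => (mem_filter.1 hp).2, fun x hx => ?_⟩
  rw [hE g x]
  refine (Finset.sum_subset (Finset.filter_subset _ _) fun p hp hp' => ?_).symm
  have hpP : natPt p ∉ Γ₊ f := fun h => hp' (mem_filter.2 ⟨hp, h⟩)
  have hpK : ∀ i, p i ≤ K := fun i => ((hF p).1 hp i).1 (Finset.mem_univ i)
  obtain ⟨b, l, hP, hl, hb⟩ := hK K le_rfl p hpP hpK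
  let J : Finset (Fin n) := Finset.univ.filter fun i => p i < K
  have hJ : ∀ i, i ∈ J ↔ p i < K := fun i => by simp [J]
  have hv : VanOn r (coef K J p g) := coef_eq_zero hr J hJ (fun x hx => hlim x hx b l hP) hl
    (fun i hi => (hb i).1 ((hJ i).1 hi)) fun i hi => (hb i).2 (by
      have := hpK i
      rw [hJ] at hi
      omega)
  have hu : coef K Finset.univ p = coef K Jᶜ p * coef K J p := by
    have := Finset.noncommProd_union_of_disjoint (s := Jᶜ) (t := J) disjoint_compl_left
      (fun j => cop K j (p j)) fun i _ j _ hij => cop_comm K i j hij _ _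
    rw [coef, coef, coef, ← this]
    exact Finset.noncommProd_congr (by rw [Finset.union_comm, Finset.union_compl]) (fun _ _ => rfl) _
  rw [hu]
  change _ * (coef K Jᶜ p (coef K J p g)).1 x = 0
  rw [hv.coef hr K Jᶜ p x hx, mul_zero]

lemma exists_smooth_extension (hUopen : IsOpen U)
    (hU0 : (0 : ℝ^[n]) ∈ U) (hf : ContDiffOn ℝ ∞ f U) :
    ∃ (g : Smooth n) (r : ℝ), 0 < r ∧ r < 1 ∧ (∀ x : ℝ^[n], (∀ i, |x i| ≤ r) → x ∈ U) ∧
      ∀ x : ℝ^[n], (∀ i, |x i| < r) → g.1 x = f x := by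
  obtain ⟨ρ, hρ, hball⟩ := Metric.isOpen_iff.1 hUopen 0 hU0
  let χ : ContDiffBump (0 : ℝ^[n]) := ⟨ρ / 3, ρ / 2, by positivity, by linarith⟩
  have hsm : ContDiff ℝ ∞ fun x => χ x * f x := by
    rw [contDiff_iff_contDiffAt]
    intro x
    by_cases hx : x ∈ U
    · exact χ.contDiffAt.mul (hf.contDiffAt (hUopen.mem_nhds hx))
    · have hx' : x ∉ tsupport χ := by
        rw [χ.tsupport_eq]
        intro h
        exact hx (hball (lt_of_le_of_lt (Metric.mem_closedBall.1 h) (by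
          change ρ / 2 < ρ; linarith)))
      have : (fun x => χ x * f x) =ᶠ[𝓝 x] fun _ => 0 := by
        filter_upwards [notMem_tsupport_iff_eventuallyEq.1 hx'] with y hy
        simp [hy]
      exact contDiffAt_const.congr_of_eventuallyEq this
  have hmem : ∀ x : ℝ^[n], ∀ r : ℝ, 0 ≤ r → (∀ i, |x i| ≤ r) → dist x 0 ≤ r := by
    intro x r hr h
    rw [dist_zero_right, pi_norm_le_iff_of_nonneg hr]
    exact h
  have h0 : 0 < min (ρ / 3) (1 / 2) := by positivity
  refine ⟨⟨_, hsm⟩, min (ρ / 3) (1 / 2), h0, lt_of_le_of_lt (min_le_right _ _) (by norm_num),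
    fun x hx => hball ?_, fun x hx => ?_⟩
  · exact lt_of_le_of_lt (hmem x _ h0.le hx) (lt_of_le_of_lt (min_le_left _ _) (by linarith))
  · have := χ.one_of_mem_closedBall (x := x) (Metric.mem_closedBall.2
      ((hmem x _ h0.le fun i => (hx i).le).trans (min_le_left _ _)))
    simp [this]

lemma abs_scaleAction_le {t : ℝ} (ht : 0 ≤ t) (ht1 : t ≤ 1) (x : ℝ^[n])
    (i : Fin n) : |scaleAction b t x i| ≤ |x i| := by
  rw [scaleAction, abs_mul, abs_of_nonneg (pow_nonneg ht _)]
  exact mul_le_of_le_one_left (abs_nonneg _) (pow_le_one₀ ht ht1)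

/-- Near the origin, a function in `Ê(U)` is a finite combination of monomials with exponents
in its Newton polyhedron, with smooth coefficients. -/
lemma isFaceOf_of_valid {P : Set ℝ^[n]} {l : ℕ}
    (hP : P ⊆ Hhalf (natPt b) l) : IsFaceOf P (P ∩ Hplane (natPt b) l) := by
  have e : intPt (fun i => (b i : ℤ)) = natPt b := by funext i; simp [intPt, natPt]
  refine ⟨fun i => (b i : ℤ), (l : ℤ), ?_, ?_⟩
  · rw [ValidPair, e]
    simpa using hP
  · rw [e]
    simp

lemma exists_local_rep (hUopen : IsOpen U)
    (hU0 : (0 : ℝ^[n]) ∈ U) (hf : ContDiffOn ℝ ∞ f U)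
    (hΓ : (Γ₊ f).Nonempty) (hE : MemEhat U f) :
    ∃ r : ℝ, 0 < r ∧ r < 1 ∧ (∀ x : ℝ^[n], (∀ i, |x i| ≤ r) → x ∈ U) ∧
      ∃ (F : Finset ℕ^[n]) (ψ : ℕ^[n] → ℝ^[n] → ℝ),
      (∀ p, ContDiff ℝ ∞ (ψ p)) ∧ (∀ p ∈ F, natPt p ∈ Γ₊ f) ∧
      ∀ x : ℝ^[n], (∀ i, |x i| < r) → f x = ∑ p ∈ F, xpow p x * ψ p x := by
  obtain ⟨D⟩ := exists_polyData hΓ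
  obtain ⟨g, r, hr, hr1, hrU, hg⟩ := exists_smooth_extension hUopen hU0 hf
  have hE' : MemEhatP (Γ₊ f) U f := by
    rcases hE with h | h
    · exact absurd h.1 hΓ.ne_empty
    · exact h.2
  obtain ⟨F, ψ, h1, h2, h3⟩ := exists_rep D (g := g) hr fun x hx b l hP => by
    obtain ⟨c, hc⟩ := hE'.2.2 _ (isFaceOf_of_valid hP) x (hrU x fun i => (hx i).le) b l ⟨hP, rfl⟩
    refine ⟨c, hc.congr' ?_⟩
    filter_upwards [Ioo_mem_nhdsGT (zero_lt_one' ℝ)] with t ht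
    rw [hg _ fun i => (abs_scaleAction_le ht.1.le ht.2.le x i).trans_lt (hx i)]
  exact ⟨r, hr, hr1, hrU, F, ψ, h1, h2, fun x hx => (hg x hx).symm.trans (h3 x hx)⟩

lemma contDiff_iterate_pderiv1 (i : Fin n) (k : ℕ)
    (hg : ContDiff ℝ ∞ g) : ContDiff ℝ ∞ ((pderiv1 i)^[k] g) := by
  induction k with
  | zero => simpa using hg
  | succ k ih => rw [iterate_succ_apply']; exact contDiff_pderiv1 ih

lemma pderiv1_add (i : Fin n) {g h : ℝ^[n] → ℝ} (hg : ContDiff ℝ ∞ g)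
    (hh : ContDiff ℝ ∞ h) :
    pderiv1 i (fun x => g x + h x) = fun x => pderiv1 i g x + pderiv1 i h x := by
  funext x
  rw [pderiv1, fderiv_fun_add (hg.differentiable (by simp) x) (hh.differentiable (by simp) x)]
  rfl

lemma pderiv1_mul (i : Fin n) {g h : ℝ^[n] → ℝ} (hg : ContDiff ℝ ∞ g)
    (hh : ContDiff ℝ ∞ h) :
    pderiv1 i (fun x => g x * h x) = fun x => pderiv1 i g x * h x + g x * pderiv1 i h x := by
  funext x
  rw [pderiv1, fderiv_fun_mul (hg.differentiable (by simp) x) (hh.differentiable (by simp) x)]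
  simp [pderiv1]
  ring

lemma pderiv1_const_mul (i : Fin n) (c : ℝ)
    (hh : ContDiff ℝ ∞ h) :
    pderiv1 i (fun x => c * h x) = fun x => c * pderiv1 i h x := by
  funext x
  rw [pderiv1, fderiv_const_mul (hh.differentiable (by simp) x)]
  rfl

lemma contDiff_coord (i : Fin n) : ContDiff ℝ ∞ fun x : ℝ^[n] => x i := contDiff_apply ℝ ℝ i

lemma pderiv1_coord_pow (i j : Fin n) (m : ℕ) :
    pderiv1 i (fun x => x j ^ (m + 1)) =
      fun x => if i = j then ((m : ℝ) + 1) * x j ^ m else 0 := by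
  funext x
  have : HasFDerivAt (fun x : ℝ^[n] => x j ^ (m + 1))
      (((m + 1 : ℕ) * x j ^ m) • ContinuousLinearMap.proj (R := ℝ) (φ := fun _ => ℝ) j) x := by
    simpa using ((ContinuousLinearMap.proj (R := ℝ) (φ := fun _ : Fin n => ℝ) j).hasFDerivAt
      (x := x)).pow (m + 1)
  rw [pderiv1, this.fderiv]
  by_cases h : i = j
  · subst h; simp
  · simp [h, Ne.symm h]

/-- The composition of iterated partial derivatives along a list of coordinates. -/
noncomputable def lderiv (α : ℕ^[n]) (L : List (Fin n)) (f : ℝ^[n] → ℝ) : ℝ^[n] → ℝ :=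
  L.foldr (fun i g => (pderiv1 i)^[α i] g) f

lemma contDiff_lderiv (α : ℕ^[n]) (L : List (Fin n))
    (hg : ContDiff ℝ ∞ g) : ContDiff ℝ ∞ (lderiv α L g) := by
  induction L with
  | nil => exact hg
  | cons i L ih => exact contDiff_iterate_pderiv1 i _ ih

lemma iterate_pderiv1_add (i : Fin n) (k : ℕ) {g h : ℝ^[n] → ℝ}
    (hg : ContDiff ℝ ∞ g) (hh : ContDiff ℝ ∞ h) :
    (pderiv1 i)^[k] (fun x => g x + h x) =
      fun x => (pderiv1 i)^[k] g x + (pderiv1 i)^[k] h x := by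
  induction k with
  | zero => rfl
  | succ k ih =>
    rw [iterate_succ_apply', ih, pderiv1_add i (contDiff_iterate_pderiv1 i k hg)
      (contDiff_iterate_pderiv1 i k hh), iterate_succ_apply',
      iterate_succ_apply']

lemma iterate_pderiv1_const_mul (i : Fin n) (k : ℕ) (c : ℝ)
    (hh : ContDiff ℝ ∞ h) :
    (pderiv1 i)^[k] (fun x => c * h x) = fun x => c * (pderiv1 i)^[k] h x := by
  induction k with
  | zero => rfl
  | succ k ih =>
    rw [iterate_succ_apply', ih, pderiv1_const_mul i c (contDiff_iterate_pderiv1 i k hh),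
      iterate_succ_apply']

lemma lderiv_add (α : ℕ^[n]) (L : List (Fin n)) {g h : ℝ^[n] → ℝ}
    (hg : ContDiff ℝ ∞ g) (hh : ContDiff ℝ ∞ h) :
    lderiv α L (fun x => g x + h x) = fun x => lderiv α L g x + lderiv α L h x := by
  induction L with
  | nil => rfl
  | cons i L ih =>
    change (pderiv1 i)^[α i] (lderiv α L _) = _
    rw [ih, iterate_pderiv1_add i _ (contDiff_lderiv α L hg) (contDiff_lderiv α L hh)]
    rfl

lemma lderiv_const_mul (α : ℕ^[n]) (L : List (Fin n)) (c : ℝ)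
    (hh : ContDiff ℝ ∞ h) :
    lderiv α L (fun x => c * h x) = fun x => c * lderiv α L h x := by
  induction L with
  | nil => rfl
  | cons i L ih =>
    change (pderiv1 i)^[α i] (lderiv α L _) = _
    rw [ih, iterate_pderiv1_const_mul i _ c (contDiff_lderiv α L hh)]
    rfl

lemma mderiv_sum (α : ℕ^[n]) {ι : Type*} (F : Finset ι) (g : ι → ℝ^[n] → ℝ)
    (hg : ∀ p ∈ F, ContDiff ℝ ∞ (g p)) (y : ℝ^[n]) :
    mderiv α (fun x => ∑ p ∈ F, g p x) y = ∑ p ∈ F, mderiv α (g p) y := by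
  classical
  induction F using induction_on with
  | empty =>
    have := congrFun (lderiv_const_mul α (List.finRange n) 0 (h := fun _ => 0) contDiff_const) y
    simpa [lderiv, mderiv] using this
  | insert a F ha ih =>
    simp only [sum_insert ha]
    have h1 := hg a (mem_insert_self _ _)
    have h2 : ContDiff ℝ ∞ fun x => ∑ p ∈ F, g p x :=
      ContDiff.sum fun p hp => hg p (mem_insert_of_mem hp)
    rw [← ih fun p hp => hg p (mem_insert_of_mem hp)]
    exact congrFun (lderiv_add α (List.finRange n) h1 h2) y

lemma mderiv_congr (α : ℕ^[n]) {f g : ℝ^[n] → ℝ} {y : ℝ^[n]}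
    (h : f =ᶠ[𝓝 y] g) : mderiv α f y = mderiv α g y := by
  have h1 : ∀ (i : Fin n) (k : ℕ) {f g : ℝ^[n] → ℝ}, f =ᶠ[𝓝 y] g →
      (pderiv1 i)^[k] f =ᶠ[𝓝 y] (pderiv1 i)^[k] g := by
    intro i k f g h
    induction k with
    | zero => exact h
    | succ k ih =>
      rw [iterate_succ_apply', iterate_succ_apply']
      filter_upwards [ih.fderiv (𝕜 := ℝ)] with x hx
      rw [pderiv1, pderiv1, hx]
  have h2 : ∀ L : List (Fin n), lderiv α L f =ᶠ[𝓝 y] lderiv α L g := by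
    intro L
    induction L with
    | nil => exact h
    | cons i L ih => exact h1 i _ ih
  exact (h2 (List.finRange n)).self_of_nhds

lemma iterate_pderiv1_coord_pow_mul (i : Fin n) (k m : ℕ)
    (hh : ContDiff ℝ ∞ h) :
    ∃ h', ContDiff ℝ ∞ h' ∧ (pderiv1 i)^[k] (fun x => x i ^ (m + k) * h x) =
      fun x => x i ^ m * ((m + k).descFactorial k * h x + x i * h' x) := by
  induction k generalizing h m with
  | zero => exact ⟨fun _ => 0, contDiff_const, by simp⟩
  | succ k ih =>
    obtain ⟨h', hs, he⟩ := ih (m + 1) hh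
    have e : (fun x : ℝ^[n] => x i ^ (m + (k + 1)) * h x) =
        fun x => x i ^ (m + 1 + k) * h x := by
      funext x; congr 2; ring
    have hG : ContDiff ℝ ∞
        fun x => ((m + 1 + k).descFactorial k : ℝ) * h x + x i * h' x :=
      (contDiff_const.mul hh).add ((contDiff_coord i).mul hs)
    refine ⟨fun x => (m + 1) * h' x + pderiv1 i (fun x =>
      ((m + 1 + k).descFactorial k : ℝ) * h x + x i * h' x) x,
      (contDiff_const.mul hs).add (contDiff_pderiv1 hG), ?_⟩
    rw [e, iterate_succ_apply', he, pderiv1_mul i ((contDiff_coord i).pow _) hG,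
      pderiv1_coord_pow]
    funext x
    have : (m + (k + 1)).descFactorial (k + 1) = (m + 1) * (m + 1 + k).descFactorial k := by
      rw [show m + (k + 1) = m + 1 + k by ring, Nat.descFactorial_succ]
      congr 1
      omega
    rw [this]
    push_cast
    simp
    ring

lemma lderiv_coord_pow_mul (α : ℕ^[n]) (L : List (Fin n)) (j : Fin n) (m : ℕ)
    (hh : ContDiff ℝ ∞ h) :
    ∃ h', ContDiff ℝ ∞ h' ∧ lderiv α L (fun x => x j ^ (m + L.count j * α j) * h x) =
      fun x => x j ^ m * h' x := by
  induction L generalizing m with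
  | nil => exact ⟨h, hh, by simp [lderiv]⟩
  | cons i L ih =>
    change ∃ h', _ ∧ (pderiv1 i)^[α i] (lderiv α L _) = _
    by_cases hij : i = j
    · subst hij
      obtain ⟨h', hs, he⟩ := ih (m + α i)
      have e : m + (i :: L).count i * α i = m + α i + L.count i * α i := by grind
      rw [e, he]
      obtain ⟨h'', hs', he'⟩ := iterate_pderiv1_coord_pow_mul i (α i) m hs
      exact ⟨_, (contDiff_const.mul hs).add ((contDiff_coord i).mul hs'), he'⟩
    · obtain ⟨h', hs, he⟩ := ih m
      rw [List.count_cons_of_ne hij, he]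
      refine ⟨(pderiv1 i)^[α i] h', contDiff_iterate_pderiv1 i _ hs, ?_⟩
      induction α i with
      | zero => rfl
      | succ k ihk =>
        rw [iterate_succ_apply', ihk, pderiv1_mul i ((contDiff_coord j).pow _)
          (contDiff_iterate_pderiv1 i _ hs), iterate_succ_apply']
        rcases m with _ | m
        · funext x
          simp [pderiv1]
        · rw [pderiv1_coord_pow]
          simp [hij]

lemma mderiv_eq_zero (α : ℕ^[n]) (j : Fin n)
    (hh : ContDiff ℝ ∞ h) {y : ℝ^[n]} (hy : y j = 0) :
    mderiv α (fun x => x j ^ (α j + 1) * h x) y = 0 := by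
  obtain ⟨h', -, he⟩ := lderiv_coord_pow_mul α (List.finRange n) j 1 hh
  rw [List.count_eq_one_of_mem (List.nodup_finRange n) (List.mem_finRange j), one_mul,
    add_comm] at he
  change lderiv α (List.finRange n) _ y = 0
  rw [he]
  simp [hy]

lemma lderiv_prod_mul (α : ℕ^[n]) (L : List (Fin n)) (hL : L.Nodup) {y : ℝ^[n]}
    (hy : ∀ i, α i ≠ 0 → y i = 0) (hh : ContDiff ℝ ∞ h) :
    lderiv α L (fun x => (L.map fun i => x i ^ α i).prod * h x) y =
      ((L.map fun i => (α i).factorial).prod : ℕ) * h y := by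
  induction L using List.reverseRecOn generalizing h with
  | nil => simp [lderiv]
  | append_singleton L i ih =>
    have hLs : ContDiff ℝ ∞ fun x : ℝ^[n] => (L.map fun i => x i ^ α i).prod := by
      clear ih hL
      induction L with
      | nil => simpa using contDiff_const
      | cons j L ihL => simpa using ((contDiff_coord j).pow (α j)).mul ihL
    have hnd := List.nodup_append.1 hL
    have hiL : i ∉ L := by grind
    have e0 : lderiv α (L ++ [i]) (fun x => ((L ++ [i]).map fun i => x i ^ α i).prod * h x) =
        lderiv α L ((pderiv1 i)^[α i] fun x => x i ^ (0 + α i) *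
          ((L.map fun i => x i ^ α i).prod * h x)) := by
      rw [lderiv, List.foldr_append]
      simp only [List.map_append, List.prod_append, List.map_cons, List.map_nil, List.prod_cons,
        List.prod_nil, mul_one, zero_add, List.foldr_cons, List.foldr_nil]
      rw [lderiv]
      grind
    rw [e0]
    by_cases hα : α i = 0
    · simp only [hα, Function.iterate_zero, id, add_zero, pow_zero, one_mul]
      rw [ih hnd.1 hh]
      simp [hα]
    obtain ⟨h', hs, he⟩ := iterate_pderiv1_coord_pow_mul i (α i) 0 (hLs.mul hh)
    rw [he]
    simp only [pow_zero, one_mul, zero_add, Nat.descFactorial_self]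
    rw [lderiv_add α L (contDiff_const.mul (hLs.mul hh)) ((contDiff_coord i).mul hs)]
    have h2 : lderiv α L (fun x => ((α i).factorial : ℝ) *
        ((L.map fun i => x i ^ α i).prod * h x)) y =
        (α i).factorial * (((L.map fun i => (α i).factorial).prod : ℕ) * h y) := by
      rw [lderiv_const_mul α L _ (hLs.mul hh)]
      grind
    change lderiv α L _ y + lderiv α L _ y = _
    rw [h2]
    obtain ⟨h'', -, he''⟩ := lderiv_coord_pow_mul α L i 1 hs
    rw [List.count_eq_zero_of_not_mem hiL] at he''
    simp only [zero_mul, add_zero, pow_one] at he''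
    rw [he'']
    simp [hy i hα]
    ring

lemma mderiv_xpow_mul (α : ℕ^[n]) {y : ℝ^[n]} (hy : ∀ i, α i ≠ 0 → y i = 0)
    (hh : ContDiff ℝ ∞ h) :
    mderiv α (fun x => xpow α x * h x) y = (∏ i, (α i).factorial : ℕ) * h y := by
  have := lderiv_prod_mul α (List.finRange n) (List.nodup_finRange n) hy hh
  have e : ∀ {M : Type} [CommMonoid M] (g : Fin n → M), ((List.finRange n).map g).prod =
      ∏ i, g i := fun g => by
    rw [← List.ofFn_eq_map, List.prod_ofFn]
  simp only [e] at this
  exact this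

lemma contDiff_xpow (p : ℕ^[n]) : ContDiff ℝ ∞ (xpow p) :=
  contDiff_prod fun i _ => (contDiff_coord i).pow _

/-- Derivatives of a monomial times a smooth function at a zero of a coordinate to which the
monomial vanishes to higher order. -/
lemma mderiv_xpow_mul_eq_zero (α p : ℕ^[n]) (j : Fin n) (hj : α j < p j)
    (hh : ContDiff ℝ ∞ h) {y : ℝ^[n]} (hy : y j = 0) :
    mderiv α (fun x => xpow p x * h x) y = 0 := by
  have : (fun x => xpow p x * h x) = fun x => x j ^ (α j + 1) *
      (x j ^ (p j - (α j + 1)) * (∏ i ∈ Finset.univ.erase j, x i ^ p i) * h x) := by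
    funext x
    rw [xpow, ← mul_prod_erase Finset.univ _ (Finset.mem_univ j), ← mul_assoc,
      ← mul_assoc, ← pow_add]
    congr 4
    omega
  rw [this]
  exact mderiv_eq_zero α j ((((contDiff_coord j).pow _).mul
    (contDiff_prod fun i _ => (contDiff_coord i).pow _)).mul hh) hy

lemma mderiv_sum_xpow {F : Finset ℕ^[n]}
    {ψ : ℕ^[n] → ℝ^[n] → ℝ} (hψ : ∀ p, ContDiff ℝ ∞ (ψ p)) {y : ℝ^[n]}
    (hf : f =ᶠ[𝓝 y] fun x => ∑ p ∈ F, xpow p x * ψ p x) (α : ℕ^[n]) :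
    mderiv α f y = ∑ p ∈ F, mderiv α (fun x => xpow p x * ψ p x) y := by
  rw [mderiv_congr α hf, mderiv_sum α F _ fun p _ => (contDiff_xpow p).mul (hψ p)]

lemma abs_dot_le {a x : ℝ^[n]} {ε : ℝ} (hx : ∀ i, |x i| ≤ ε) :
    |dot a x| ≤ (∑ i, |a i|) * ε := by
  rw [dot, sum_mul]
  refine (Finset.abs_sum_le_sum_abs _ _).trans (sum_le_sum fun i _ => ?_)
  rw [abs_mul]
  exact mul_le_mul_of_nonneg_left (hx i) (abs_nonneg _)

/-- A real solution of finitely many integral linear equations and strict inequalities can be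
replaced by an integral one. -/
lemma exists_int_dir {κ : Type*} [Finite κ] (a : κ → Fin n → ℤ) (Z : κ → Prop) (v : ℝ^[n])
    (h0 : ∀ k, Z k → dot (intPt (a k)) v = 0) (h1 : ∀ k, ¬ Z k → 0 < dot (intPt (a k)) v) :
    ∃ b : Fin n → ℤ, (∀ k, Z k → dot (intPt (a k)) (intPt b) = 0) ∧
      ∀ k, ¬ Z k → 0 < dot (intPt (a k)) (intPt b) := by
  obtain ⟨ε, hε', hε⟩ : ∃ ε, (∀ k, (∑ i, |intPt (a k) i|) * ε < 1 ∧ (¬ Z k →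
      (∑ i, |intPt (a k) i|) * ε < dot (intPt (a k)) v)) ∧ 0 < ε := by
    have h : ∀ c d : ℝ, 0 < d → ∀ᶠ ε in 𝓝[>] (0 : ℝ), c * ε < d := fun c d hd =>
      ((continuous_const_mul c).tendsto' 0 0 (mul_zero c)).mono_left nhdsWithin_le_nhds
        |>.eventually (gt_mem_nhds hd)
    refine ((eventually_all.2 fun k => (h _ 1 one_pos).and ?_).and
      eventually_mem_nhdsWithin).exists
    by_cases hk : Z k
    · simp [hk]
    · exact (h _ _ (h1 k hk)).mono fun _ h _ => h
  let x : ℕ → ℝ^[n] := fun q i => Int.fract ((q : ℝ) * v i)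
  obtain ⟨y, -, φ, hφ, hlim⟩ := (isCompact_Icc (a := (0 : ℝ^[n])) (b := 1)).tendsto_subseq
    (x := x) fun q => ⟨fun i => Int.fract_nonneg _, fun i => (Int.fract_lt_one _).le⟩
  obtain ⟨k, hk⟩ := Metric.cauchySeq_iff'.1 hlim.cauchySeq ε hε
  have hk1 := hk (k + 1) (Nat.le_succ k)
  have hq : φ k + 1 ≤ φ (k + 1) := hφ (Nat.lt_succ_self k)
  obtain ⟨q, hq'⟩ := Nat.exists_eq_add_of_le hq
  let b : Fin n → ℤ := fun i => ⌊(φ (k + 1) : ℝ) * v i⌋ - ⌊(φ k : ℝ) * v i⌋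
  have hb : ∀ i, |intPt b i - (q + 1) * v i| ≤ ε := by
    intro i
    have h2 := (dist_le_pi_dist (x (φ (k + 1))) (x (φ k)) i).trans hk1.le
    rw [Real.dist_eq] at h2
    have h3 : intPt b i - (q + 1) * v i = -(x (φ (k + 1)) i - x (φ k) i) := by
      simp only [intPt, b, x, Int.fract]
      rw [hq']
      push_cast
      ring
    rwa [h3, abs_neg]
  have hd : ∀ a : ℝ^[n], |dot a (intPt b) - (q + 1) * dot a v| ≤ (∑ i, |a i|) * ε := by
    intro a
    have : dot a (intPt b) - (q + 1) * dot a v = dot a (fun i => intPt b i - (q + 1) * v i) := by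
      simp only [dot, mul_sum, ← sum_sub_distrib]
      exact sum_congr rfl fun i _ => by ring
    rw [this]
    exact abs_dot_le hb
  refine ⟨b, fun k hk => ?_, fun k hk => ?_⟩
  · have h3 := (hd (intPt (a k))).trans_lt (hε' k).1
    have h4 : dot (intPt (a k)) (intPt b) = ((∑ i, a k i * b i : ℤ) : ℝ) := by simp [dot, intPt]
    rw [h0 k hk, mul_zero, sub_zero, h4] at h3
    have h5 : |∑ i, a k i * b i| < 1 := by exact_mod_cast h3
    rw [h4, Int.abs_lt_one_iff.1 h5, Int.cast_zero]
  · have h2 := (abs_le.1 (hd (intPt (a k)))).1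
    have h3 := (hε' k).2 hk
    nlinarith [h1 k hk, (by positivity : (0 : ℝ) ≤ q)]

/-- The sum of the monomials with exponents in `S` in exponential coordinates. -/
noncomputable def expSum (S : Finset ℕ^[n]) (z : ℝ^[n]) : ℝ := ∑ s ∈ S, exp (-dot (natPt s) z)

lemma expSum_pos {S : Finset ℕ^[n]} (hS : S.Nonempty) (z : ℝ^[n]) : 0 < expSum S z :=
  Finset.sum_pos (fun _ _ => exp_pos _) hS

lemma exp_le_expSum {S : Finset ℕ^[n]} {s : ℕ^[n]} (hs : s ∈ S) (z : ℝ^[n]) :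
    exp (-dot (natPt s) z) ≤ expSum S z :=
  single_le_sum (f := fun s => exp (-dot (natPt s) z))
    (fun _ _ => (exp_pos _).le) hs

lemma dot_sub_left (a b x : ℝ^[n]) : dot (a - b) x = dot a x - dot b x := by
  simp [dot, sub_mul, sum_sub_distrib]

lemma dot_sub_right (a x y : ℝ^[n]) : dot a (x - y) = dot a x - dot a y := by
  simp [dot, mul_sub, sum_sub_distrib]

lemma dot_single_left (i : Fin n) (x : ℝ^[n]) : dot (single i 1) x = x i := by
  simp [dot, Pi.single_apply]

lemma continuous_dot (a : ℝ^[n]) : Continuous (dot a) := by unfold dot; fun_prop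

/-- A sequence on which finitely many linear functionals converge is a convergent sequence plus
a sequence in the common kernel. -/
lemma exists_tendsto_sub_mem_ker {ι : Type*} [Finite ι] (a : ι → ℝ^[n])
    (z : ℕ → ℝ^[n]) (L : ι → ℝ) (h : ∀ s, Tendsto (fun k => dot (a s) (z k)) atTop (𝓝 (L s))) :
    ∃ (w : ℕ → ℝ^[n]) (w' : ℝ^[n]), Tendsto w atTop (𝓝 w') ∧
      ∀ k s, dot (a s) (z k - w k) = 0 := by
  have := Fintype.ofFinite ι
  let Λ : ℝ^[n] →ₗ[ℝ] (ι → ℝ) :=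
    { toFun := fun z s => dot (a s) z
      map_add' := fun x y => funext fun s => dot_add_right _ _ _
      map_smul' := fun c x => funext fun s => dot_smul_right _ _ _ }
  obtain ⟨g, hg⟩ := Λ.rangeRestrict.exists_rightInverse_of_surjective Λ.range_rangeRestrict
  have hL : Tendsto (fun k => Λ (z k)) atTop (𝓝 L) := tendsto_pi_nhds.2 h
  have hLr : L ∈ LinearMap.range Λ :=
    (Submodule.closed_of_finiteDimensional (LinearMap.range Λ)).mem_of_tendsto hL
      (.of_forall fun k => ⟨z k, rfl⟩)
  have hgr : ∀ y : LinearMap.range Λ, Λ (g y) = y := fun y =>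
    congrArg Subtype.val (LinearMap.congr_fun hg y)
  refine ⟨fun k => g (Λ.rangeRestrict (z k)), g ⟨L, hLr⟩, ?_, fun k s => ?_⟩
  · refine (LinearMap.continuous_of_finiteDimensional g).continuousAt.tendsto.comp ?_
    exact tendsto_subtype_rng.2 hL
  · rw [dot_sub_right, sub_eq_zero]
    exact (congrFun (hgr (Λ.rangeRestrict (z k))) s).symm

lemma intPt_single (i : Fin n) : intPt (single i 1) = single i 1 := by
  funext j
  by_cases h : j = i
  · subst h; simp [intPt]
  · simp [intPt, h]

/-- The edges of the Newton polyhedron at the vertex `s₀`, redundantly: the differences with the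
other generators and the coordinate directions. -/
def PolyData.edge (s₀ : ℕ^[n]) : D.S ⊕ Fin n → Fin n → ℤ :=
  Sum.elim (fun s i => (s.1 i : ℤ) - s₀ i) fun i => single i 1

lemma PolyData.intPt_edge_inl (s₀ : ℕ^[n])
    (s : D.S) : intPt (D.edge s₀ (.inl s)) = natPt s.1 - natPt s₀ := by
  funext i; simp [intPt, natPt, edge]

lemma PolyData.dot_edge_inr (s₀ : ℕ^[n])
    (i : Fin n) (v : ℝ^[n]) : dot (intPt (D.edge s₀ (.inr i))) v = v i := by
  rw [edge, Sum.elim_inr, intPt_single, dot_single_left]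

lemma PolyData.exists_combo (s₀ : ℕ^[n])
    {p : ℝ^[n]} (hp : p ∈ Γ₊ f) : ∃ c : D.S ⊕ Fin n → ℝ, (∀ k, 0 ≤ c k) ∧
      ∀ v, dot (p - natPt s₀) v = ∑ k, c k * dot (intPt (D.edge s₀ k)) v := by
  classical
  refine convexHull_min (t := {p | ∃ c : D.S ⊕ Fin n → ℝ, (∀ k, 0 ≤ c k) ∧
    ∀ v, dot (p - natPt s₀) v = ∑ k, c k * dot (intPt (D.edge s₀ k)) v}) ?_ ?_ hp
  · rintro x ⟨α, hα, hx⟩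
    obtain ⟨s, hs, hle⟩ := D.dominates α hα
    refine ⟨Sum.elim (single ⟨s, hs⟩ 1) (x - natPt s), ?_, fun v => ?_⟩
    · rintro (t | i)
      · simp only [Sum.elim_inl, Pi.single_apply]; split_ifs <;> simp
      · exact sub_nonneg.2 (le_trans (Nat.cast_le.2 (hle i)) (hx i))
    · simp only [Fintype.sum_sum_type, Sum.elim_inl, Sum.elim_inr, dot_edge_inr, Pi.single_apply,
        ite_mul, one_mul, zero_mul, Finset.sum_ite_eq', Finset.mem_univ, if_true, intPt_edge_inl]
      rw [← dot, dot_sub_left, dot_sub_left, dot_sub_left]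
      ring
  · rintro x ⟨c, hc, hx⟩ y ⟨d, hd, hy⟩ a b ha hb hab
    refine ⟨a • c + b • d, fun k => add_nonneg (mul_nonneg ha (hc k)) (mul_nonneg hb (hd k)),
      fun v => ?_⟩
    have h1 := hx v
    have h2 := hy v
    rw [dot_sub_left] at h1 h2 ⊢
    simp only [Pi.add_apply, Pi.smul_apply, smul_eq_mul, add_mul, mul_assoc, sum_add_distrib,
      ← mul_sum, ← h1, ← h2]
    rw [dot_comm, dot_add_right, dot_smul_right, dot_smul_right, dot_comm v, dot_comm v]
    linear_combination dot (natPt s₀) v * hab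

set_option maxHeartbeats 1000000 in
/-- Along a sequence going to infinity in all coordinates, the monomials with exponents in the
Newton polyhedron, relative to `expSum`, subconverge to the monomials of a compact face. -/
lemma exists_face_limit (z : ℕ → ℝ^[n])
    (hz : ∀ (k : ℕ) i, k ≤ z k i) :
    ∃ (φ : ℕ → ℕ) (b : ℕ^[n]) (l : ℕ) (w : ℝ^[n]) (C : ℝ), StrictMono φ ∧
      (∀ i, Tendsto (fun k => z (φ k) i) atTop atTop) ∧
      (∀ i, 0 < b i) ∧ 0 < C ∧ Γ₊ f ⊆ Hhalf (natPt b) l ∧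
      (∃ s ∈ D.S, ndot b s = l) ∧ ∀ p ∈ Γ₊ f,
        (dot (natPt b) p = l → Tendsto (fun k => exp (-dot p (z (φ k))) /
          expSum D.S (z (φ k))) atTop (𝓝 (C * exp (-dot p w)))) ∧
        ((l : ℝ) < dot (natPt b) p → Tendsto (fun k => exp (-dot p (z (φ k))) /
          expSum D.S (z (φ k))) atTop (𝓝 0)) := by
  classical
  let ρ : ℕ → D.S → ℝ := fun k s => exp (-dot (natPt s.1) (z k)) / expSum D.S (z k)
  have hN : ∀ z, 0 < expSum D.S z := expSum_pos D.nonempty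
  obtain ⟨c, hc, φ, hφ, hlim⟩ := (isCompact_Icc (a := (0 : D.S → ℝ)) (b := 1)).tendsto_subseq
    (x := ρ) fun q => ⟨fun s => (div_pos (exp_pos _) (hN _)).le,
      fun s => (div_le_one (hN _)).2 (exp_le_expSum s.2 _)⟩
  have hz' : ∀ i, Tendsto (fun k => z (φ k) i) atTop atTop := fun i => tendsto_atTop_mono
    (fun k => hz (φ k) i) (tendsto_natCast_atTop_atTop.comp hφ.tendsto_atTop)
  have hlim' : ∀ s : D.S, Tendsto (fun k => ρ (φ k) s) atTop (𝓝 (c s)) :=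
    fun s => (tendsto_pi_nhds.1 hlim) s
  have hρ : ∀ k s, 0 < ρ k s := fun k s => div_pos (exp_pos _) (hN _)
  have hsum : ∑ s, c s = 1 := by
    refine tendsto_nhds_unique (tendsto_finsetSum _ fun s _ => hlim' s)
      (tendsto_const_nhds.congr fun k => ?_)
    simp only [ρ]
    rw [← sum_div, Finset.sum_coe_sort D.S fun s => exp (-dot (natPt s) (z (φ k)))]
    exact (div_self (hN _).ne').symm
  obtain ⟨s₀, -, hs₀⟩ : ∃ s ∈ Finset.univ, 0 < c s :=
    Finset.exists_lt_of_sum_lt (f := fun _ : D.S => (0 : ℝ)) (by rw [hsum]; simp)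
  have hquot : ∀ (p : ℝ^[n]) k, exp (-dot p (z k)) / expSum D.S (z k) =
      exp (-dot (p - natPt s₀.1) (z k)) * ρ k s₀ := by
    intro p k
    rw [← mul_div_assoc, ← exp_add, dot_sub_left]
    congr 2
    ring
  have hdot : ∀ (s : D.S) k, dot (natPt s.1 - natPt s₀.1) (z k) =
      log (ρ k s₀) - log (ρ k s) := by
    intro s k
    rw [Real.log_div (exp_pos _).ne' (hN _).ne', Real.log_div (exp_pos _).ne' (hN _).ne',
      log_exp, log_exp, dot_sub_left]
    ring
  have hl0 : Tendsto (fun k => log (ρ (φ k) s₀)) atTop (𝓝 (log (c s₀))) := (hlim' s₀).log hs₀.ne'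
  obtain ⟨w, w', hw, hker⟩ := exists_tendsto_sub_mem_ker
    (ι := {s : D.S // 0 < c s}) (fun s => natPt s.1.1 - natPt s₀.1) (fun k => z (φ k))
    (fun s => log (c s₀) - log (c s.1)) fun s => by
      simp only [hdot]
      exact hl0.sub ((hlim' s.1).log s.2.ne')
  have hwd : ∀ a : ℝ^[n], Tendsto (fun k => dot a (w k)) atTop (𝓝 (dot a w')) :=
    fun a => (continuous_dot a).continuousAt.tendsto.comp hw
  let a := D.edge s₀.1
  let Z : D.S ⊕ Fin n → Prop := Sum.elim (fun s => 0 < c s) fun _ => False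
  have hZ0 : ∀ j, Z j → ∀ k, dot (intPt (a j)) (z (φ k) - w k) = 0 := by
    rintro (s | i) hj k
    · rw [D.intPt_edge_inl]
      exact hker k ⟨s, hj⟩
    · exact hj.elim
  have hinf : ∀ j, ¬ Z j →
      Tendsto (fun k => dot (intPt (a j)) (z (φ k) - w k)) atTop atTop := by
    rintro (s | i) hj
    · have h1 : Tendsto (fun k => -log (ρ (φ k) s)) atTop atTop :=
        tendsto_neg_atBot_atTop.comp (Real.tendsto_log_nhdsGT_zero.comp
          (tendsto_nhdsWithin_iff.2 ⟨le_antisymm (not_lt.1 hj) (hc.1 s) ▸ hlim' s,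
            .of_forall fun k => hρ _ _⟩))
      simp only [a, D.intPt_edge_inl, dot_sub_right (natPt s.1 - natPt s₀.1), hdot]
      exact (hl0.add_atTop h1).atTop_add (hwd (natPt s.1 - natPt s₀.1)).neg
    · simp only [a, D.dot_edge_inr]
      exact (hz' i).atTop_add ((tendsto_pi_nhds.1 hw i).neg)
  have hev : ∀ᶠ k in atTop, ∀ j, ¬ Z j → 0 < dot (intPt (a j)) (z (φ k) - w k) :=
    eventually_all.2 fun j => by
      by_cases hj : Z j
      · simp [hj]
      · exact ((hinf j hj).eventually_gt_atTop 0).mono fun k h _ => h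
  obtain ⟨k₀, hk₀⟩ := hev.exists
  obtain ⟨b', hb0, hb1⟩ := exists_int_dir a Z _ (fun j hj => hZ0 j hj k₀) hk₀
  have hbpos : ∀ i, 0 < b' i := fun i => by
    have := hb1 (.inr i) id
    rw [D.dot_edge_inr] at this
    exact Int.cast_pos.1 this
  let b : ℕ^[n] := fun i => (b' i).toNat
  have hb : natPt b = intPt b' := funext fun i => by
    simp only [natPt, intPt, b]
    exact_mod_cast Int.toNat_of_nonneg (hbpos i).le
  have hb2 : ∀ j, 0 ≤ dot (intPt (a j)) (intPt b') := fun j => by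
    by_cases hj : Z j
    exacts [(hb0 j hj).ge, (hb1 j hj).le]
  have hdp : ∀ p, dot (natPt b) p - ndot b s₀.1 = dot (p - natPt s₀.1) (intPt b') := fun p => by
    rw [← dot_natPt, dot_sub_left, dot_comm p, dot_comm (natPt s₀.1), hb]
  refine ⟨φ, b, ndot b s₀.1, w', c s₀ * exp (dot (natPt s₀.1) w'), hφ, hz',
    fun i => by simpa [b] using hbpos i, by positivity, fun p hp => ?_, ⟨s₀.1, s₀.2, rfl⟩,
    fun p hp => ?_⟩
  · obtain ⟨e, he, h⟩ := D.exists_combo s₀ hp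
    rw [Hhalf, mem_ofPred_eq, ← sub_nonneg, hdp, h]
    exact sum_nonneg fun j _ => mul_nonneg (he j) (hb2 j)
  obtain ⟨e, he, h⟩ := D.exists_combo s₀ hp
  simp only [hquot]
  constructor <;> intro hpl
  · have h1 : ∀ j, e j * dot (intPt (a j)) (intPt b') = 0 := fun j =>
      (Finset.sum_eq_zero_iff_of_nonneg fun j _ => mul_nonneg (he j) (hb2 j)).1
        (by rw [← h, ← hdp, hpl, sub_self]) j (Finset.mem_univ j)
    have hv : ∀ k, dot (p - natPt s₀.1) (z (φ k)) = dot (p - natPt s₀.1) (w k) := fun k => by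
      rw [← sub_eq_zero, ← dot_sub_right, h]
      refine sum_eq_zero fun j _ => ?_
      by_cases hj : Z j
      · rw [hZ0 j hj, mul_zero]
      · rw [(mul_eq_zero.1 (h1 j)).resolve_right (hb1 j hj).ne', zero_mul]
    simp only [hv]
    convert (hwd (p - natPt s₀.1)).neg.rexp.mul (hlim' s₀) using 2
    rw [mul_assoc, ← exp_add, dot_sub_left, mul_comm]
    congr 2
    ring
  · rw [← sub_pos, hdp, h] at hpl
    obtain ⟨j, -, hj⟩ := Finset.exists_ne_zero_of_sum_ne_zero hpl.ne'
    have hjZ : ¬ Z j := fun h => hj (by rw [hb0 j h, mul_zero])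
    have hv : Tendsto (fun k => dot (p - natPt s₀.1) (z (φ k) - w k)) atTop atTop := by
      refine tendsto_atTop_mono' _ ?_ ((hinf j hjZ).const_mul_atTop
        ((he j).lt_of_ne' (left_ne_zero_of_mul hj)))
      filter_upwards [hev] with k hk
      rw [h]
      refine single_le_sum (f := fun j => e j * dot (intPt (a j)) (z (φ k) - w k))
        (fun i _ => mul_nonneg (he i) ?_) (Finset.mem_univ j)
      by_cases hi : Z i
      exacts [(hZ0 i hi k).ge, (hk i hi).le]
    have hv' : Tendsto (fun k => dot (p - natPt s₀.1) (z (φ k))) atTop atTop := by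
      refine (hv.atTop_add (hwd (p - natPt s₀.1))).congr fun k => ?_
      rw [dot_sub_right, sub_add_cancel]
    simpa using (Real.tendsto_exp_neg_atTop_nhds_zero.comp hv').mul (hlim' s₀)

lemma pderiv1_xpow_mul (i : Fin n) (p : ℕ^[n]) (x : ℝ^[n]) :
    x i * pderiv1 i (xpow p) x = p i * xpow p x := by
  have h1 := hasDerivAt_update (contDiff_xpow p) i x (x i)
  rw [update_eq_self] at h1
  have e : (fun s => xpow p (update x i s)) =
      fun s => s ^ p i * ∏ j ∈ Finset.univ.erase i, x j ^ p j := by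
    funext s
    rw [xpow, ← mul_prod_erase Finset.univ _ (Finset.mem_univ i)]
    congr 1
    · simp
    · exact prod_congr rfl fun j hj => by rw [update_of_ne (ne_of_mem_erase hj)]
  rw [e] at h1
  have h2 := (hasDerivAt_pow (p i) (x i)).mul_const (∏ j ∈ Finset.univ.erase i, x j ^ p j)
  rw [h1.unique h2, xpow, ← mul_prod_erase Finset.univ (fun j => x j ^ p j)
    (Finset.mem_univ i)]
  rcases p i with _ | m
  · simp
  · rw [Nat.add_sub_cancel]
    push_cast
    ring

/-- A local representation of `f` adapted to its Newton polyhedron. -/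
structure LocalModel (f : ℝ^[n] → ℝ) extends PolyData f where
  F : Finset ℕ^[n]
  ψ : ℕ^[n] → ℝ^[n] → ℝ
  smooth : ∀ p, ContDiff ℝ ∞ (ψ p)
  mem_poly : ∀ p ∈ F, natPt p ∈ Γ₊ f
  germ : f =ᶠ[𝓝 0] fun x => ∑ p ∈ F, xpow p x * ψ p x

/-- Exponential coordinates on an orthant. -/
noncomputable def expc (σ z : ℝ^[n]) : ℝ^[n] := fun i => σ i * exp (-z i)

variable (M : LocalModel f)

lemma contDiff_expc (σ : ℝ^[n]) : ContDiff ℝ ∞ (expc σ) :=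
  contDiff_pi.2 fun i => contDiff_const.mul ((contDiff_coord i).neg.exp)

lemma xpow_expc (p : ℕ^[n]) (σ z : ℝ^[n]) :
    xpow p (expc σ z) = xpow p σ * exp (-dot (natPt p) z) := by
  simp only [xpow, expc, mul_pow, Finset.prod_mul_distrib, dot, ← sum_neg_distrib,
    exp_sum, natPt, ← Real.exp_nat_mul]
  congr 1
  exact prod_congr rfl fun i _ => by congr 1; ring

lemma fderiv_comp_expc (hg : ContDiff ℝ ∞ g) (σ : ℝ^[n])
    (i : Fin n) (z : ℝ^[n]) :
    pderiv1 i (fun z => g (expc σ z)) z = -(expc σ z i * pderiv1 i g (expc σ z)) := by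
  have h1 := hasDerivAt_update (hg.comp (contDiff_expc σ)) i z (z i)
  rw [update_eq_self] at h1
  have h2 := hasDerivAt_update hg i (expc σ z) (expc σ z i)
  rw [update_eq_self] at h2
  have h3 : HasDerivAt (fun s => σ i * exp (-s)) (-(expc σ z i)) (z i) := by
    have := ((hasDerivAt_neg (z i)).exp).const_mul (σ i)
    refine this.congr_deriv ?_
    simp [expc]
  have h4 := h2.comp_of_eq (z i) h3 rfl
  have e : ∀ s, expc σ (update z i s) =
      update (expc σ z) i (σ i * exp (-s)) := by
    intro s
    funext j
    by_cases h : j = i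
    · subst h; simp [expc]
    · simp [expc, h]
  have e2 : (g ∘ expc σ) ∘ update z i = (fun s => g (update (expc σ z) i s)) ∘
      fun s => σ i * exp (-s) := by
    funext s
    simp only [Function.comp]
    rw [e]
  have h1' : HasDerivAt ((g ∘ expc σ) ∘ update z i) _ (z i) := h1
  rw [e2] at h1'
  have := h1'.unique h4
  change pderiv1 i (g ∘ expc σ) z = _
  rw [this]
  ring

namespace LocalModel

/-- The sum of the monomials of the model with coefficients `θ`. -/
noncomputable def wsum (θ : ℕ^[n] → ℝ^[n] → ℝ) (x : ℝ^[n]) : ℝ := ∑ p ∈ M.F, xpow p x * θ p x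

lemma contDiff_wsum (hθ : ∀ p, ContDiff ℝ ∞ (θ p)) : ContDiff ℝ ∞ (M.wsum θ) :=
  ContDiff.sum fun p _ => (contDiff_xpow p).mul (hθ p)

/-- The coefficients of the logarithmic derivative `x_i ∂_i` of `wsum θ`. -/
noncomputable def logDer (i : Fin n) (θ : ℕ^[n] → ℝ^[n] → ℝ) (p : ℕ^[n]) (x : ℝ^[n]) : ℝ :=
  p i * θ p x + x i * pderiv1 i (θ p) x

lemma contDiff_logDer (i : Fin n) (hθ : ∀ p, ContDiff ℝ ∞ (θ p)) (p : ℕ^[n]) : ContDiff ℝ ∞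
    (logDer i θ p) :=
  (contDiff_const.mul (hθ p)).add ((contDiff_coord i).mul (contDiff_pderiv1 (hθ p)))

lemma mul_pderiv1_wsum (i : Fin n)
    (hθ : ∀ p, ContDiff ℝ ∞ (θ p)) (x : ℝ^[n]) :
    x i * pderiv1 i (M.wsum θ) x = M.wsum (logDer i θ) x := by
  have h : pderiv1 i (M.wsum θ) x = ∑ p ∈ M.F, pderiv1 i (fun x => xpow p x * θ p x) x := by
    unfold wsum
    rw [pderiv1, fderiv_fun_sum fun p _ =>
      ((contDiff_xpow p).mul (hθ p)).differentiable (by simp) x]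
    simp [pderiv1]
  rw [h, mul_sum, wsum]
  refine sum_congr rfl fun p _ => ?_
  rw [pderiv1_mul i (contDiff_xpow p) (hθ p), mul_add, ← mul_assoc, pderiv1_xpow_mul, logDer]
  ring

lemma pderiv1_wsum_expc (i : Fin n)
    (hθ : ∀ p, ContDiff ℝ ∞ (θ p)) (σ z : ℝ^[n]) :
    pderiv1 i (fun z => M.wsum θ (expc σ z)) z = -M.wsum (logDer i θ) (expc σ z) := by
  rw [fderiv_comp_expc (M.contDiff_wsum hθ), M.mul_pderiv1_wsum i hθ]

/-- The weight function: sum of the vertex monomials in exponential coordinates. -/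
noncomputable def N (z : ℝ^[n]) : ℝ := expSum M.S z

lemma N_pos (z : ℝ^[n]) : 0 < M.N z := expSum_pos M.nonempty z

lemma exp_le_N {p : ℝ^[n]} (hp : p ∈ Γ₊ f)
    (hz : ∀ i, 0 ≤ z i) : exp (-dot p z) ≤ M.N z := by
  obtain ⟨s, hs, hle⟩ := M.exists_dot_le hp hz
  refine le_trans (exp_le_exp.2 ?_) (exp_le_expSum hs z)
  rw [dot_comm p, dot_comm (natPt s)]
  linarith

lemma tendsto_expc {z : ℕ → ℝ^[n]}
    (hz : ∀ i, Tendsto (fun k => z k i) atTop atTop) :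
    Tendsto (fun k => expc σ (z k)) atTop (𝓝 0) := by
  refine tendsto_pi_nhds.2 fun i => ?_
  simpa [expc] using (Real.tendsto_exp_neg_atTop_nhds_zero.comp (hz i)).const_mul (σ i)

/-- Subsequential limits of `wsum θ / N`. -/
lemma tendsto_wsum_div (σ : ℝ^[n]) {z : ℕ → ℝ^[n]}
    (hz : ∀ i, Tendsto (fun k => z k i) atTop atTop) {l : ℕ} {w : ℝ^[n]}
    {C : ℝ} (hP : Γ₊ f ⊆ Hhalf (natPt b) l)
    (h : ∀ p ∈ Γ₊ f,
        (dot (natPt b) p = l → Tendsto (fun k => exp (-dot p (z k)) /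
          expSum M.S (z k)) atTop (𝓝 (C * exp (-dot p w)))) ∧
        ((l : ℝ) < dot (natPt b) p → Tendsto (fun k => exp (-dot p (z k)) /
          expSum M.S (z k)) atTop (𝓝 0)))
    (hθ : ∀ p, Continuous (θ p)) :
    Tendsto (fun k => M.wsum θ (expc σ (z k)) / M.N (z k)) atTop
      (𝓝 (C * ∑ p ∈ M.F with ndot b p = l, xpow p (expc σ w) * θ p 0)) := by
  classical
  rw [mul_sum, Finset.sum_filter]
  simp only [wsum, sum_div]
  refine tendsto_finsetSum _ fun p hp => ?_
  have hp' := M.mem_poly p hp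
  have hθ' : Tendsto (fun k => θ p (expc σ (z k))) atTop (𝓝 (θ p 0)) :=
    (hθ p).continuousAt.tendsto.comp (tendsto_expc hz)
  have e : ∀ k, xpow p (expc σ (z k)) * θ p (expc σ (z k)) / M.N (z k) =
      xpow p σ * (exp (-dot (natPt p) (z k)) / expSum M.S (z k)) *
        θ p (expc σ (z k)) := fun k => by
    rw [xpow_expc, N]; ring
  simp only [e]
  split_ifs with hpl
  · have := (((h _ hp').1 (by rw [dot_natPt, hpl])).const_mul (xpow p σ)).mul hθ'
    convert this using 2
    rw [xpow_expc]
    ring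
  · have hlt : (l : ℝ) < dot (natPt b) (natPt p) := by
      refine lt_of_le_of_ne (hP hp') fun h => hpl ?_
      rw [dot_natPt] at h
      exact_mod_cast h.symm
    have := (((h _ hp').2 hlt).const_mul (xpow p σ)).mul hθ'
    simpa using this

end LocalModel

lemma isClosed_NewtonPolyhedron (D : PolyData f) :
    IsClosed (Γ₊ f) := by
  have e : Γ₊ f = ⋂ a ∈ D.A, ⋃ s ∈ D.S,
      {v | dot (natPt a) (natPt s) ≤ dot (natPt a) v} := by
    ext v
    simp only [mem_iInter, mem_iUnion, exists_prop]
    refine ⟨fun hv a _ => D.exists_dot_le hv fun i => Nat.cast_nonneg _, fun h =>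
      D.mem_of_forall v h⟩
  rw [e]
  refine isClosed_biInter fun a _ => Set.Finite.isClosed_biUnion D.S.finite_toSet fun s _ => ?_
  exact isClosed_le continuous_const (continuous_dot _)

lemma PolyData.nonneg (D : PolyData f)
    (hv : v ∈ Γ₊ f) (i : Fin n) : 0 ≤ v i := by
  obtain ⟨s, -, hs⟩ := D.exists_dot_le hv (z := single i 1) fun j => by
    by_cases h : j = i
    · subst h; simp
    · simp [h]
  rw [dot_single_left, dot_single_left] at hs
  exact le_trans (Nat.cast_nonneg _) hs

lemma isCompact_face (D : PolyData f) {l : ℕ}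
    (hb : ∀ i, 0 < b i) : IsCompact (Γ₊ f ∩ Hplane (natPt b) l) := by
  refine (isCompact_Icc (a := (0 : ℝ^[n])) (b := fun _ => (l : ℝ))).of_isClosed_subset
    ((isClosed_NewtonPolyhedron D).inter (isClosed_eq (continuous_dot _) continuous_const)) ?_
  rintro v ⟨hv, hl⟩
  refine ⟨D.nonneg hv, fun i => ?_⟩
  have hl : dot (natPt b) v = l := hl
  rw [← hl]
  have h1 : natPt b i * v i ≤ dot (natPt b) v :=
    single_le_sum (f := fun i => natPt b i * v i)
      (fun j _ => mul_nonneg (Nat.cast_nonneg _) (D.nonneg hv j)) (Finset.mem_univ i)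
  have h2 : (1 : ℝ) ≤ natPt b i := by
    have := hb i
    simp only [natPt]
    exact_mod_cast this
  nlinarith [D.nonneg hv i]

namespace LocalModel

/-- Taylor coefficients on a compact face. -/
lemma taylorCoeff_face {l : ℕ} (hb : ∀ i, 0 < b i)
    (hP : Γ₊ f ⊆ Hhalf (natPt b) l) {α : ℕ^[n]} (hα : ndot b α = l) :
    taylorCoeff f α = if α ∈ M.F then M.ψ α 0 else 0 := by
  classical
  have hne : ∀ p ∈ M.F, p ≠ α → mderiv α (fun x => xpow p x * M.ψ p x) 0 = 0 := by
    intro p hp hpα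
    obtain ⟨i, hi⟩ : ∃ i, α i < p i := by
      by_contra! h
      have h1 : (l : ℝ) ≤ dot (natPt b) (natPt p) := hP (M.mem_poly p hp)
      rw [dot_natPt, Nat.cast_le, ← hα] at h1
      obtain ⟨j, hj⟩ := Function.ne_iff.1 hpα
      refine absurd h1 (not_le.2 (Finset.sum_lt_sum (fun i _ => Nat.mul_le_mul_left _ (h i))
        ⟨j, Finset.mem_univ j, ?_⟩))
      exact Nat.mul_lt_mul_of_pos_left (lt_of_le_of_ne (h j) hj) (hb j)
    exact mderiv_xpow_mul_eq_zero α p i hi (M.smooth p) rfl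
  rw [taylorCoeff, mderiv_sum_xpow M.smooth M.germ α]
  split_ifs with h
  · rw [Finset.sum_eq_single_of_mem α h hne, mderiv_xpow_mul (y := 0) α (fun _ _ => rfl) (M.smooth α)]
    have : ((∏ i, (α i).factorial : ℕ) : ℝ) ≠ 0 := by
      exact_mod_cast (Finset.prod_pos fun i _ => Nat.factorial_pos _).ne'
    field_simp
  · rw [sum_eq_zero fun p hp => hne p hp fun e => h (e ▸ hp), zero_div]

lemma gammaPartPoly_eq {l : ℕ} (hb : ∀ i, 0 < b i)
    (hP : Γ₊ f ⊆ Hhalf (natPt b) l) :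
    gammaPartPoly f (Γ₊ f ∩ Hplane (natPt b) l) =
      fun x => ∑ p ∈ M.F with ndot b p = l, xpow p x * M.ψ p 0 := by
  classical
  funext x
  have hmem : ∀ α : ℕ^[n], natPt α ∈ Γ₊ f ∩ Hplane (natPt b) l →
      ndot b α = l := fun α h => by
    have h2 : dot (natPt b) (natPt α) = l := h.2
    rw [dot_natPt] at h2
    exact_mod_cast h2
  rw [gammaPartPoly, tsum_eq_sum (s := (M.F.filter fun p => ndot b p = l).subtype
    fun α => natPt α ∈ Γ₊ f ∩ Hplane (natPt b) l)]
  · rw [← Finset.sum_subtype_of_mem (fun p => xpow p x * M.ψ p 0) (p := fun α =>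
      natPt α ∈ Γ₊ f ∩ Hplane (natPt b) l)]
    · refine sum_congr rfl fun α hα => ?_
      have h1 := (mem_filter.1 (Finset.mem_subtype.1 hα))
      rw [M.taylorCoeff_face hb hP h1.2, if_pos h1.1, mul_comm]
      rfl
    · intro p hp
      have h1 := mem_filter.1 hp
      refine ⟨M.mem_poly p h1.1, ?_⟩
      change dot (natPt b) (natPt p) = l
      rw [dot_natPt, h1.2]
  · intro α hα
    rw [M.taylorCoeff_face hb hP (hmem α.1 α.2), if_neg, zero_mul]
    intro h
    exact hα (Finset.mem_subtype.2 (mem_filter.2 ⟨h, hmem α.1 α.2⟩))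

lemma pderiv1_face_sum {l : ℕ} (c : ℕ^[n] → ℝ) (i : Fin n)
    (x : ℝ^[n]) :
    x i * pderiv1 i (fun x => ∑ p ∈ M.F with ndot b p = l, xpow p x * c p) x =
      ∑ p ∈ M.F with ndot b p = l, xpow p x * (p i * c p) := by
  rw [pderiv1, fderiv_fun_sum fun p _ =>
    ((contDiff_xpow p).mul contDiff_const).differentiable (by simp) x]
  simp only [sum_apply]
  rw [mul_sum]
  refine sum_congr rfl fun p _ => ?_
  have := pderiv1_xpow_mul i p x
  rw [fderiv_mul_const ((contDiff_xpow p).differentiable (by simp) x)]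
  rw [pderiv1] at this
  simp only [smul_apply, smul_eq_mul]
  linear_combination c p * this

lemma xpow_expc_add (p b : ℕ^[n]) (σ w : ℝ^[n]) (ξ : ℝ) :
    xpow p (expc σ (w + ξ • natPt b)) = exp (-(ξ * ndot b p)) * xpow p (expc σ w) := by
  rw [xpow_expc, xpow_expc, dot_add_right, dot_smul_right, dot_comm (natPt p) (natPt b),
    dot_natPt, neg_add, exp_add]
  ring

lemma tendsto_add_smul_natPt (hb : ∀ i, 0 < b i) (w : ℝ^[n]) (i : Fin n) :
    Tendsto (fun k : ℕ => (w + (k : ℝ) • natPt b) i) atTop atTop :=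
  tendsto_atTop_add_const_left _ _ (tendsto_natCast_atTop_atTop.atTop_mul_const
    (Nat.cast_pos.2 (hb i)))

lemma exists_expc_mem (hU : U ∈ 𝓝 (0 : ℝ^[n]))
    (hb : ∀ i, 0 < b i) (σ w : ℝ^[n]) : ∃ ξ : ℝ, expc σ (w + ξ • natPt b) ∈ U := by
  obtain ⟨k, hk⟩ := ((tendsto_expc (tendsto_add_smul_natPt hb w)).eventually hU).exists
  exact ⟨k, hk⟩

lemma expc_ne_zero (hσ : ∀ i, |σ i| = 1) (z : ℝ^[n]) (i : Fin n) :
    expc σ z i ≠ 0 := by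
  refine mul_ne_zero (fun h => ?_) (exp_pos _).ne'
  have := hσ i
  rw [h] at this
  simp at this

/-- Nondegeneracy, in terms of the logarithmic derivatives of the face polynomial. -/
lemma exists_face_sum_ne_zero (hU : U ∈ 𝓝 (0 : ℝ^[n]))
    (hnd : Nondegenerate f U) (hσ : ∀ i, |σ i| = 1) {l : ℕ}
    (hb : ∀ i, 0 < b i) (hP : Γ₊ f ⊆ Hhalf (natPt b) l) {s : ℕ^[n]}
    (hs : s ∈ M.S) (hsl : ndot b s = l) (w : ℝ^[n]) :
    ∃ i, ∑ p ∈ M.F with ndot b p = l, xpow p (expc σ w) * (p i * M.ψ p 0) ≠ 0 := by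
  by_contra! hzero
  obtain ⟨ξ, hξ⟩ := exists_expc_mem hU hb σ w
  have hface := isFaceOf_of_valid hP
  refine hnd _ hface ⟨natPt s, M.mem hs, ?_⟩ (isCompact_face M.toPolyData hb) _ hξ
    (expc_ne_zero hσ _) ?_
  · change dot (natPt b) (natPt s) = l
    rw [dot_natPt, hsl]
  · rw [M.gammaPartPoly_eq hb hP]
    refine ContinuousLinearMap.ext fun v => ?_
    have hpi : ∀ i, fderiv ℝ (fun x => ∑ p ∈ M.F with ndot b p = l, xpow p x * M.ψ p 0)
        (expc σ (w + ξ • natPt b)) (single i 1) = 0 := by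
      intro i
      have := M.pderiv1_face_sum (b := b) (l := l) (fun p => M.ψ p 0) i
        (expc σ (w + ξ • natPt b))
      refine (mul_eq_zero.1 (this.trans ?_)).resolve_left (expc_ne_zero hσ _ i)
      rw [← mul_zero (exp (-(ξ * l))), ← hzero i, mul_sum]
      refine sum_congr rfl fun p hp => ?_
      rw [xpow_expc_add, (mem_filter.1 hp).2]
      ring
    have hv : v = ∑ i, v i • (single i 1 : ℝ^[n]) := by
      funext j
      simp [Finset.sum_apply, Pi.single_apply]
    rw [hv, map_sum]
    simp [hpi]

/-- Nondegeneracy gives a lower bound for the gradient in exponential coordinates. -/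
lemma exists_gradient_bound (hU : U ∈ 𝓝 (0 : ℝ^[n]))
    (hnd : Nondegenerate f U) (hσ : ∀ i, |σ i| = 1) :
    ∃ R c : ℝ, 0 ≤ R ∧ 0 < c ∧ ∀ z : ℝ^[n], (∀ i, R ≤ z i) →
      c * M.N z ^ 2 ≤ ∑ i, M.wsum (logDer i M.ψ) (expc σ z) ^ 2 := by
  by_contra! hcon
  choose z hz hlt using fun k : ℕ => hcon k (1 / ((k : ℝ) + 1)) (Nat.cast_nonneg _)
    (by positivity)
  obtain ⟨φ, b, l, w, C, hφ, hz', hb, hC, hP, ⟨s, hs, hsl⟩, hlim⟩ :=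
    exists_face_limit M.toPolyData z hz
  have hT := fun i => M.tendsto_wsum_div σ hz' hP hlim
    fun p => (contDiff_logDer i M.smooth p).continuous
  have hzero : ∀ i, ∑ p ∈ M.F with ndot b p = l, xpow p (expc σ w) * (p i * M.ψ p 0) = 0 := by
    intro i
    have h1 : Tendsto (fun k => (M.wsum (logDer i M.ψ) (expc σ (z (φ k))) / M.N (z (φ k))) ^ 2)
        atTop (𝓝 0) := by
      refine squeeze_zero (g := fun k => 1 / ((φ k : ℝ) + 1)) (fun k => sq_nonneg _) (fun k => ?_)
        (tendsto_one_div_add_atTop_nhds_zero_nat.comp hφ.tendsto_atTop)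
      rw [div_pow, div_le_iff₀ (pow_pos (M.N_pos _) 2)]
      exact (single_le_sum (f := fun i => M.wsum (logDer i M.ψ) (expc σ (z (φ k))) ^ 2)
        (fun _ _ => sq_nonneg _) (Finset.mem_univ i)).trans (hlt (φ k)).le
    have h2 := tendsto_nhds_unique h1 ((hT i).pow 2)
    have h3 := (mul_eq_zero.1 (pow_eq_zero_iff (two_ne_zero)|>.1 h2.symm)).resolve_left hC.ne'
    simpa [logDer] using h3
  obtain ⟨i, hi⟩ := M.exists_face_sum_ne_zero hU hnd hσ hb hP hs hsl w
  exact hi (hzero i)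

end LocalModel

section

/-- First-order partial derivative of a complex-valued function. -/
noncomputable def cderiv (i : Fin n) (u : ℝ^[n] → ℂ) : ℝ^[n] → ℂ :=
  fun z => fderiv ℝ u z (single i 1)

lemma contDiff_cderiv (i : Fin n) (hu : ContDiff ℝ ∞ u) : ContDiff ℝ ∞ (cderiv i u) :=
  (hu.fderiv_right (by simp)).clm_apply contDiff_const

lemma cderiv_add (i : Fin n) {u v : ℝ^[n] → ℂ} (hu : ContDiff ℝ ∞ u)
    (hv : ContDiff ℝ ∞ v) :
    cderiv i (fun z => u z + v z) = fun z => cderiv i u z + cderiv i v z := by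
  funext z
  rw [cderiv, fderiv_fun_add (hu.differentiable (by simp) z) (hv.differentiable (by simp) z)]
  rfl

lemma cderiv_mul (i : Fin n) {u v : ℝ^[n] → ℂ} (hu : ContDiff ℝ ∞ u)
    (hv : ContDiff ℝ ∞ v) :
    cderiv i (fun z => u z * v z) = fun z => cderiv i u z * v z + u z * cderiv i v z := by
  funext z
  rw [cderiv, fderiv_fun_mul (hu.differentiable (by simp) z) (hv.differentiable (by simp) z)]
  simp only [add_apply, smul_apply, smul_eq_mul, cderiv]
  ring

lemma cderiv_inv (i : Fin n) (hu : ContDiff ℝ ∞ u)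
    (h0 : ∀ z, u z ≠ 0) :
    cderiv i (fun z => (u z)⁻¹) = fun z => -cderiv i u z * ((u z)⁻¹ * (u z)⁻¹) := by
  funext z
  have h1 := (hu.differentiable (by simp) z).hasFDerivAt
  have h2 := (hasDerivAt_inv (h0 z)).comp_hasFDerivAt_of_eq z (f := u) (f' := fderiv ℝ u z) h1 rfl
  have h3 : HasFDerivAt (fun z => (u z)⁻¹) _ z := h2
  rw [cderiv, h3.fderiv]
  simp only [smul_apply, smul_eq_mul, cderiv]
  field_simp [h0 z]

lemma cderiv_ofReal (i : Fin n) {g : ℝ^[n] → ℝ} (hg : ContDiff ℝ ∞ g) :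
    cderiv i (fun z => (g z : ℂ)) = fun z => (pderiv1 i g z : ℂ) := by
  funext z
  have h := (Complex.ofRealCLM.hasFDerivAt).comp z (hg.differentiable (by simp) z).hasFDerivAt
  have h' : HasFDerivAt (fun z => (g z : ℂ)) _ z := h
  rw [cderiv, h'.fderiv]
  rfl

lemma contDiff_ofReal {g : ℝ^[n] → ℝ} (hg : ContDiff ℝ ∞ g) : ContDiff ℝ ∞ fun z => (g z : ℂ) :=
  Complex.ofRealCLM.contDiff.comp hg

variable {ι : Type*}

/-- Symbol estimates of order `k` with weight `m` on `Ω`, uniformly in a parameter. -/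
def SymK (Ω : Set ℝ^[n]) : ℕ → (ι → ℝ^[n] → ℝ) → (ι → ℝ^[n] → ℂ) → Prop
  | 0, m, u => ∃ C, ∀ t, ∀ z ∈ Ω, ‖u t z‖ ≤ C * m t z
  | k + 1, m, u => (∃ C, ∀ t, ∀ z ∈ Ω, ‖u t z‖ ≤ C * m t z) ∧
      ∀ i, SymK Ω k m fun t => cderiv i (u t)

/-- Smooth families all of whose derivatives are bounded by the weight `m` on `Ω`. -/
structure Symb (Ω : Set ℝ^[n]) (m : ι → ℝ^[n] → ℝ) (u : ι → ℝ^[n] → ℂ) :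
    Prop where
  smooth : ∀ t, ContDiff ℝ ∞ (u t)
  est : ∀ k, SymK Ω k m u

variable {m m' : ι → ℝ^[n] → ℝ} {u v : ι → ℝ^[n] → ℂ}

lemma SymK.zero (h : SymK Ω k m u) : ∃ C, ∀ t, ∀ z ∈ Ω, ‖u t z‖ ≤ C * m t z := by
  cases k with
  | zero => exact h
  | succ k => exact h.1

lemma SymK.of_succ : ∀ {u : ι → ℝ^[n] → ℂ}, SymK Ω (k + 1) m u →
    SymK Ω k m u := by
  induction k with
  | zero => exact fun h => h.1
  | succ k ih => exact fun h => ⟨h.1, fun i => ih (h.2 i)⟩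

lemma SymK.mono {c : ℝ} (h0 : ∀ t, ∀ z ∈ Ω, 0 ≤ m t z)
    (hm : ∀ t, ∀ z ∈ Ω, m t z ≤ c * m' t z) :
    ∀ {u : ι → ℝ^[n] → ℂ}, SymK Ω k m u → SymK Ω k m' u := by
  have key : ∀ {u : ι → ℝ^[n] → ℂ}, (∃ C, ∀ t, ∀ z ∈ Ω, ‖u t z‖ ≤ C * m t z) →
      ∃ C, ∀ t, ∀ z ∈ Ω, ‖u t z‖ ≤ C * m' t z := by
    rintro u ⟨C, hC⟩
    refine ⟨|C| * c, fun t z hz => (hC t z hz).trans ?_⟩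
    calc C * m t z ≤ |C| * m t z := mul_le_mul_of_nonneg_right (le_abs_self C) (h0 t z hz)
      _ ≤ |C| * (c * m' t z) := mul_le_mul_of_nonneg_left (hm t z hz) (abs_nonneg C)
      _ = |C| * c * m' t z := by ring
  induction k with
  | zero => exact fun h => key h
  | succ k ih => exact fun h => ⟨key h.1, fun i => ih (h.2 i)⟩

lemma SymK.add : ∀ {u v : ι → ℝ^[n] → ℂ},
    (∀ t, ContDiff ℝ ∞ (u t)) → (∀ t, ContDiff ℝ ∞ (v t)) →
    SymK Ω k m u → SymK Ω k m v → SymK Ω k m fun t z => u t z + v t z := by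
  have key : ∀ {u v : ι → ℝ^[n] → ℂ}, (∃ C, ∀ t, ∀ z ∈ Ω, ‖u t z‖ ≤ C * m t z) →
      (∃ C, ∀ t, ∀ z ∈ Ω, ‖v t z‖ ≤ C * m t z) →
      ∃ C, ∀ t, ∀ z ∈ Ω, ‖u t z + v t z‖ ≤ C * m t z := by
    rintro u v ⟨C, hC⟩ ⟨C', hC'⟩
    refine ⟨C + C', fun t z hz => (norm_add_le _ _).trans ?_⟩
    rw [add_mul]
    exact add_le_add (hC t z hz) (hC' t z hz)
  induction k with
  | zero => exact fun _ _ h h' => key h h'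
  | succ k ih =>
    refine @fun u v hu hv h h' => ⟨key h.1 h'.1, fun i => ?_⟩
    simp only [cderiv_add i (hu _) (hv _)]
    exact ih (fun t => contDiff_cderiv i (hu t)) (fun t => contDiff_cderiv i (hv t)) (h.2 i)
      (h'.2 i)

lemma SymK.mul : ∀ {u v : ι → ℝ^[n] → ℂ},
    (∀ t, ContDiff ℝ ∞ (u t)) → (∀ t, ContDiff ℝ ∞ (v t)) →
    SymK Ω k m u → SymK Ω k m' v →
    SymK Ω k (fun t z => m t z * m' t z) fun t z => u t z * v t z := by
  have key : ∀ {u v : ι → ℝ^[n] → ℂ}, (∃ C, ∀ t, ∀ z ∈ Ω, ‖u t z‖ ≤ C * m t z) →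
      (∃ C, ∀ t, ∀ z ∈ Ω, ‖v t z‖ ≤ C * m' t z) →
      ∃ C, ∀ t, ∀ z ∈ Ω, ‖u t z * v t z‖ ≤ C * (m t z * m' t z) := by
    rintro u v ⟨C, hC⟩ ⟨C', hC'⟩
    refine ⟨C * C', fun t z hz => ?_⟩
    rw [norm_mul]
    calc ‖u t z‖ * ‖v t z‖ ≤ (C * m t z) * (C' * m' t z) :=
          mul_le_mul (hC t z hz) (hC' t z hz) (norm_nonneg _) ((norm_nonneg _).trans (hC t z hz))
      _ = _ := by ring
  induction k with
  | zero => exact fun _ _ h h' => key h h'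
  | succ k ih =>
    refine @fun u v hu hv h h' => ⟨key h.1 h'.1, fun i => ?_⟩
    simp only [cderiv_mul i (hu _) (hv _)]
    exact SymK.add (fun t => (contDiff_cderiv i (hu t)).mul (hv t))
      (fun t => (hu t).mul (contDiff_cderiv i (hv t)))
      (ih (fun t => contDiff_cderiv i (hu t)) hv (h.2 i) h'.of_succ)
      (ih hu (fun t => contDiff_cderiv i (hv t)) h.of_succ (h'.2 i))

lemma Symb.mono {c : ℝ} (h : Symb Ω m u) (h0 : ∀ t, ∀ z ∈ Ω, 0 ≤ m t z)
    (hm : ∀ t, ∀ z ∈ Ω, m t z ≤ c * m' t z) : Symb Ω m' u :=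
  ⟨h.smooth, fun k => (h.est k).mono h0 hm⟩

lemma Symb.congr (h : Symb Ω m u) (h0 : ∀ t, ∀ z ∈ Ω, 0 ≤ m t z)
    (hm : ∀ t, ∀ z ∈ Ω, m t z = m' t z) : Symb Ω m' u :=
  h.mono (c := 1) h0 fun t z hz => by rw [hm t z hz, one_mul]

lemma Symb.add (hu : Symb Ω m u) (hv : Symb Ω m v) : Symb Ω m fun t z => u t z + v t z :=
  ⟨fun t => (hu.smooth t).add (hv.smooth t), fun k => (hu.est k).add hu.smooth hv.smooth (hv.est k)⟩

lemma Symb.mul (hu : Symb Ω m u) (hv : Symb Ω m' v) :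
    Symb Ω (fun t z => m t z * m' t z) fun t z => u t z * v t z :=
  ⟨fun t => (hu.smooth t).mul (hv.smooth t), fun k => (hu.est k).mul hu.smooth hv.smooth (hv.est k)⟩

lemma Symb.cderiv (hu : Symb Ω m u) (i : Fin n) : Symb Ω m fun t => cderiv i (u t) :=
  ⟨fun t => contDiff_cderiv i (hu.smooth t), fun k => (hu.est (k + 1)).2 i⟩

lemma SymK.zero_fun : SymK Ω k m fun _ _ => 0 := by
  have key : ∃ C, ∀ t, ∀ z ∈ Ω, ‖(0 : ℂ)‖ ≤ C * m t z := ⟨0, fun _ _ _ => by simp⟩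
  induction k with
  | zero => exact key
  | succ k ih =>
    refine ⟨key, fun i => ?_⟩
    have : (fun _ : ι => KN.cderiv i fun _ : ℝ^[n] => (0 : ℂ)) = fun _ _ => 0 := by
      funext t z; simp [KN.cderiv]
    rw [this]
    exact ih

lemma Symb.of_const (a : ι → ℂ) (hm : ∀ t z, z ∈ Ω → ‖a t‖ ≤ m t z) :
    Symb Ω m fun t _ => a t := by
  refine ⟨fun t => contDiff_const, fun k => ?_⟩
  cases k with
  | zero => exact ⟨1, fun t z hz => by rw [one_mul]; exact hm t z hz⟩
  | succ k =>
    refine ⟨⟨1, fun t z hz => by rw [one_mul]; exact hm t z hz⟩, fun i => ?_⟩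
    have : (fun t : ι => KN.cderiv i fun _ : ℝ^[n] => a t) = fun _ _ => 0 := by
      funext t z; simp [KN.cderiv]
    rw [this]
    exact SymK.zero_fun

lemma Symb.const_mul (hu : Symb Ω m u) (a : ℂ) : Symb Ω m fun t z => a * u t z := by
  refine ⟨fun t => contDiff_const.mul (hu.smooth t), fun k => ?_⟩
  have key : ∀ {k : ℕ} {u : ι → ℝ^[n] → ℂ}, (∀ t, ContDiff ℝ ∞ (u t)) →
      SymK Ω k m u → SymK Ω k m fun t z => a * u t z := by
    intro k
    have k0 : ∀ {u : ι → ℝ^[n] → ℂ}, (∃ C, ∀ t, ∀ z ∈ Ω, ‖u t z‖ ≤ C * m t z) →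
        ∃ C, ∀ t, ∀ z ∈ Ω, ‖a * u t z‖ ≤ C * m t z := by
      rintro u ⟨C, hC⟩
      refine ⟨‖a‖ * C, fun t z hz => ?_⟩
      rw [norm_mul, mul_assoc]
      exact mul_le_mul_of_nonneg_left (hC t z hz) (norm_nonneg _)
    induction k with
    | zero => exact fun _ h => k0 h
    | succ k ih =>
      refine @fun u hu h => ⟨k0 h.1, fun i => ?_⟩
      have : ∀ t, KN.cderiv i (fun z => a * u t z) = fun z => a * KN.cderiv i (u t) z := fun t => by
        have := cderiv_mul i (u := fun _ => a) contDiff_const (hu t)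
        rw [this]
        funext z
        simp [KN.cderiv]
      simp only [this]
      exact ih (fun t => contDiff_cderiv i (hu t)) (h.2 i)
  exact key hu.smooth (hu.est k)

lemma Symb.sum {κ : Type*} (s : Finset κ) {w : κ → ι → ℝ^[n] → ℂ}
    (h : ∀ j ∈ s, Symb Ω m (w j)) : Symb Ω m fun t z => ∑ j ∈ s, w j t z := by
  classical
  induction s using induction_on with
  | empty => exact ⟨fun t => by simpa using contDiff_const, fun k => by simpa using SymK.zero_fun⟩
  | insert a s ha ih =>
    simp only [sum_insert ha]
    exact (h a (mem_insert_self a s)).add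
      (ih fun j hj => h j (mem_insert_of_mem hj))

lemma Symb.inv {c : ℝ} (hu : Symb Ω m u) (hm : ∀ t, ∀ z ∈ Ω, 0 < m t z) (h0 : ∀ t z, u t z ≠ 0)
    (hc : 0 < c) (hlow : ∀ t, ∀ z ∈ Ω, c * m t z ≤ ‖u t z‖) :
    Symb Ω (fun t z => (m t z)⁻¹) fun t z => (u t z)⁻¹ := by
  have hsm : ∀ t, ContDiff ℝ ∞ fun z => (u t z)⁻¹ := fun t => (hu.smooth t).inv (h0 t)
  have base : ∃ C, ∀ t, ∀ z ∈ Ω, ‖(u t z)⁻¹‖ ≤ C * (m t z)⁻¹ := by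
    refine ⟨c⁻¹, fun t z hz => ?_⟩
    rw [norm_inv, ← mul_inv]
    exact inv_anti₀ (mul_pos hc (hm t z hz)) (hlow t z hz)
  refine ⟨hsm, fun k => ?_⟩
  induction k with
  | zero => exact base
  | succ k ih =>
    refine ⟨base, fun i => ?_⟩
    simp only [cderiv_inv i (hu.smooth _) (h0 _)]
    have h1 : SymK Ω k m fun t z => -KN.cderiv i (u t) z := by
      simpa using ((hu.cderiv i).const_mul (-1)).est k
    have h2 := h1.mul (fun t => (contDiff_cderiv i (hu.smooth t)).neg)
      (fun t => (hsm t).mul (hsm t)) (ih.mul hsm hsm ih)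
    refine h2.mono (c := 1) (fun t z hz => ?_) fun t z hz => ?_
    · have := (hm t z hz).le
      positivity
    · have := (hm t z hz).ne'
      rw [one_mul]
      apply le_of_eq
      field_simp

end

section

variable {ι : Type*} {m : ι → ℝ^[n] → ℝ} {u : ι → ℝ^[n] → ℂ}

lemma cderiv_eq_zero_of_notMem (hΩ : IsClosed Ω) {u : ℝ^[n] → ℂ}
    (h : ∀ z, z ∉ Ω → u z = 0) (i : Fin n) (hz : z ∉ Ω) : cderiv i u z = 0 := by
  have : u =ᶠ[𝓝 z] fun _ => 0 := by
    filter_upwards [hΩ.isOpen_compl.mem_nhds hz] with y hy using h y hy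
  rw [cderiv, this.fderiv_eq]
  simp

lemma integrable_of_bound (hΩ : IsClosed Ω) {u : ℝ^[n] → ℂ} {m : ℝ^[n] → ℝ}
    (hu : Continuous u) (h : ∀ z, z ∉ Ω → u z = 0) {C : ℝ} (hC : ∀ z ∈ Ω, ‖u z‖ ≤ C * m z)
    (hm : IntegrableOn m Ω) : Integrable u := by
  refine ((integrable_indicator_iff hΩ.measurableSet).2 (hm.const_mul C)).mono'
    hu.aestronglyMeasurable (.of_forall fun z => ?_)
  by_cases hz : z ∈ Ω
  · rw [indicator_of_mem hz]
    exact hC z hz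
  · rw [indicator_of_notMem hz, h z hz, norm_zero]

lemma norm_integral_le_of_bound (hΩ : IsClosed Ω) {u : ℝ^[n] → ℂ} {m : ℝ^[n] → ℝ}
    (h : ∀ z, z ∉ Ω → u z = 0) {C : ℝ} (hC : ∀ z ∈ Ω, ‖u z‖ ≤ C * m z)
    (hm : IntegrableOn m Ω) : ‖∫ z, u z‖ ≤ C * ∫ z in Ω, m z := by
  rw [← integral_const_mul, ← integral_indicator hΩ.measurableSet]
  refine norm_integral_le_of_norm_le
    ((integrable_indicator_iff hΩ.measurableSet).2 (hm.const_mul C))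
    (.of_forall fun z => ?_)
  by_cases hz : z ∈ Ω
  · rw [indicator_of_mem hz]
    exact hC z hz
  · rw [indicator_of_notMem hz, h z hz, norm_zero]

/-- The oscillating factor `e^{isF}`. -/
noncomputable def osc (F : ℝ^[n] → ℝ) (s : ℝ) (z : ℝ^[n]) : ℂ := Complex.exp (I * s * F z)

lemma norm_osc (F : ℝ^[n] → ℝ) (s : ℝ) (z : ℝ^[n]) : ‖osc F s z‖ = 1 := by
  have : I * s * F z = ((s * F z : ℝ) : ℂ) * I := by push_cast; ring
  rw [osc, this, Complex.norm_exp_ofReal_mul_I]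

lemma contDiff_osc {F : ℝ^[n] → ℝ} (hF : ContDiff ℝ ∞ F) (s : ℝ) : ContDiff ℝ ∞ (osc F s) :=
  (contDiff_const.mul (contDiff_ofReal hF)).cexp

lemma cderiv_osc {F : ℝ^[n] → ℝ} (hF : ContDiff ℝ ∞ F) (s : ℝ) (i : Fin n)
    (z : ℝ^[n]) : cderiv i (osc F s) z = I * s * pderiv1 i F z * osc F s z := by
  have h1 : HasFDerivAt (fun z => I * s * (F z : ℂ)) _ z :=
    ((contDiff_ofReal hF).differentiable (by simp) z).hasFDerivAt.const_mul (I * s)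
  have h2 : HasFDerivAt (osc F s) _ z := h1.cexp
  rw [cderiv, h2.fderiv]
  have := congrFun (cderiv_ofReal i hF) z
  simp only [cderiv] at this
  simp only [smul_apply, smul_eq_mul, this, osc]
  ring

/-- Phases with gradient comparable to a weight. -/
structure PhaseBound (Ω : Set ℝ^[n]) (N F : ℝ^[n] → ℝ) : Prop where
  closed : IsClosed Ω
  smooth : ContDiff ℝ ∞ F
  cont : Continuous N
  pos : ∀ z, 0 < N z
  symb : ∀ i, Symb Ω (fun (_ : Unit) z => N z) fun _ z => (pderiv1 i F z : ℂ)
  lower : ∃ c : ℝ, 0 < c ∧ ∀ z ∈ Ω, c * N z ^ 2 ≤ ∑ i, pderiv1 i F z ^ 2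

lemma SymK.comp {κ : Type*} (g : κ → ι) : ∀ {u : ι → ℝ^[n] → ℂ},
    SymK Ω k m u → SymK Ω k (fun t => m (g t)) fun t => u (g t) := by
  induction k with
  | zero => rintro u ⟨C, hC⟩; exact ⟨C, fun t => hC (g t)⟩
  | succ k ih =>
    rintro u ⟨⟨C, hC⟩, h⟩
    exact ⟨⟨C, fun t => hC (g t)⟩, fun i => ih (h i)⟩

lemma Symb.comp {κ : Type*} (h : Symb Ω m u) (g : κ → ι) :
    Symb Ω (fun t => m (g t)) fun t => u (g t) :=
  ⟨fun t => h.smooth (g t), fun k => (h.est k).comp g⟩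

namespace PhaseBound
variable {N F : ℝ^[n] → ℝ} (s : ι → ℝ)

lemma symb' (H : PhaseBound Ω N F) (i : Fin n) :
    Symb Ω (fun (_ : ι) z => N z) fun _ z => (pderiv1 i F z : ℂ) :=
  (H.symb i).comp fun _ => ()

/-- The damping factor `1 / (1 + s²|∇F|²)`. -/
noncomputable def damp (F : ℝ^[n] → ℝ) (s : ι → ℝ) (t : ι) (z : ℝ^[n]) : ℂ :=
  (1 + (s t : ℂ) ^ 2 * ∑ i, (pderiv1 i F z : ℂ) ^ 2)⁻¹

lemma damp_den (F : ℝ^[n] → ℝ) (s : ι → ℝ) (t : ι) (z : ℝ^[n]) :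
    (1 + (s t : ℂ) ^ 2 * ∑ i, (pderiv1 i F z : ℂ) ^ 2) =
      ((1 + s t ^ 2 * ∑ i, pderiv1 i F z ^ 2 : ℝ) : ℂ) := by
  push_cast; rfl

lemma damp_den_pos (F : ℝ^[n] → ℝ) (s : ι → ℝ) (t : ι) (z : ℝ^[n]) :
    0 < 1 + s t ^ 2 * ∑ i, pderiv1 i F z ^ 2 := by
  have := mul_nonneg (sq_nonneg (s t)) (sum_nonneg fun i (_ : i ∈ Finset.univ) =>
    sq_nonneg (pderiv1 i F z))
  linarith

lemma symb_damp (H : PhaseBound Ω N F) :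
    Symb Ω (fun t z => (1 + s t ^ 2 * N z ^ 2)⁻¹) (damp F s) := by
  obtain ⟨c, hc, hlow⟩ := H.lower
  have h1 : Symb Ω (fun t z => 1 + s t ^ 2 * N z ^ 2) fun t z =>
      (1 + (s t : ℂ) ^ 2 * ∑ i, (pderiv1 i F z : ℂ) ^ 2) := by
    refine (Symb.of_const (fun _ => 1) fun t z _ => ?_).add ?_
    · rw [norm_one]
      have := mul_nonneg (sq_nonneg (s t)) (sq_nonneg (N z))
      linarith
    · have h2 : Symb Ω (fun (_ : ι) z => N z * N z) fun _ z => ∑ i, (pderiv1 i F z : ℂ) ^ 2 := by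
        refine Symb.sum _ fun i _ => ?_
        simpa only [sq] using (H.symb' i).mul (H.symb' i)
      have h3 : Symb Ω (fun t _ => s t ^ 2) fun t (_ : ℝ^[n]) => (s t : ℂ) ^ 2 :=
        Symb.of_const (fun t => (s t : ℂ) ^ 2) fun t z _ => by simp
      refine (h3.mul h2).mono (c := 1) (fun t z _ => ?_) fun t z _ => ?_
      · exact mul_nonneg (sq_nonneg _) (mul_self_nonneg _)
      · nlinarith
  refine h1.inv (c := min c 1) (fun t z _ => ?_) (fun t z => ?_) (lt_min hc one_pos)
    fun t z hz => ?_
  · positivity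
  · rw [damp_den]
    exact_mod_cast (damp_den_pos F s t z).ne'
  · rw [damp_den, norm_real, norm_of_nonneg (damp_den_pos F s t z).le]
    have h4 := mul_le_mul_of_nonneg_left (hlow z hz) (sq_nonneg (s t))
    have h5 : min c 1 * (s t ^ 2 * N z ^ 2) ≤ c * (s t ^ 2 * N z ^ 2) :=
      mul_le_mul_of_nonneg_right (min_le_left _ _) (by positivity)
    have h6 := min_le_right c 1
    nlinarith

/-- One step of integration by parts. -/
noncomputable def step (F : ℝ^[n] → ℝ) (s : ι → ℝ) (u : ι → ℝ^[n] → ℂ) (t : ι) (z : ℝ^[n]) : ℂ :=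
  damp F s t z * u t z + ∑ i, I * (s t * cderiv i
    (fun z => (pderiv1 i F z : ℂ) * damp F s t z * u t z) z)

lemma symb_step (H : PhaseBound Ω N F) (hs : ∀ t, 0 ≤ s t) (hm : ∀ t, ∀ z ∈ Ω, 0 ≤ m t z)
    (hu : Symb Ω m u) :
    Symb Ω (fun t z => m t z * (1 + s t * N z)⁻¹) (step F s u) := by
  have hN := H.pos
  have hx : ∀ t z, 0 ≤ s t * N z := fun t z => mul_nonneg (hs t) (hN z).le
  refine Symb.add ?_ (Symb.sum _ fun i _ => Symb.const_mul ?_ _)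
  · refine ((H.symb_damp s).mul hu).mono (c := 2) (fun t z hz => ?_) fun t z hz => ?_
    · have := hm t z hz
      positivity
    · have h1 : (1 + s t ^ 2 * N z ^ 2)⁻¹ ≤ 2 * (1 + s t * N z)⁻¹ := by
        rw [← mul_pow, inv_eq_one_div, ← div_eq_mul_inv, div_le_div_iff₀ (by positivity)
          (by linarith [hx t z])]
        nlinarith [hx t z, sq_nonneg (s t * N z - 1)]
      linarith [mul_le_mul_of_nonneg_right h1 (hm t z hz)]
  · have h3 : Symb Ω (fun t _ => s t) fun t (_ : ℝ^[n]) => (s t : ℂ) :=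
      Symb.of_const (fun t => (s t : ℂ)) fun t z _ => by rw [norm_real, norm_of_nonneg (hs t)]
    refine (h3.mul ((((H.symb' i).mul (H.symb_damp s)).mul hu).cderiv i)).mono (c := 2)
      (fun t z hz => ?_) fun t z hz => ?_
    · have := hm t z hz
      have := hs t
      have := (hN z).le
      positivity
    · have h1 : s t * N z * (1 + s t ^ 2 * N z ^ 2)⁻¹ ≤ 2 * (1 + s t * N z)⁻¹ := by
        rw [← mul_pow, ← div_eq_mul_inv, ← div_eq_mul_inv, div_le_div_iff₀ (by positivity)
          (by linarith [hx t z])]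
        nlinarith [hx t z, sq_nonneg (s t * N z - 1)]
      linarith [mul_le_mul_of_nonneg_right h1 (hm t z hz)]

lemma step_eq_zero (hΩ : IsClosed Ω) {u : ι → ℝ^[n] → ℂ}
    (h : ∀ t z, z ∉ Ω → u t z = 0) (t : ι) (z : ℝ^[n]) (hz : z ∉ Ω) : step F s u t z = 0 := by
  rw [step, h t z hz, mul_zero, zero_add]
  refine sum_eq_zero fun i _ => ?_
  rw [cderiv_eq_zero_of_notMem hΩ (fun z hz => by rw [h t z hz, mul_zero]) i hz]
  simp

lemma integral_step (H : PhaseBound Ω N F) (hs : ∀ t, 0 ≤ s t) (hm : ∀ t, ∀ z ∈ Ω, 0 ≤ m t z)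
    (hmi : ∀ t, IntegrableOn (m t) Ω) (hu : Symb Ω m u) (h0 : ∀ t z, z ∉ Ω → u t z = 0) (t : ι) :
    ∫ z, osc F (s t) z * u t z = ∫ z, osc F (s t) z * step F s u t z := by
  have hbd : ∀ v : ι → ℝ^[n] → ℂ, Symb Ω m v → (∀ z, z ∉ Ω → v t z = 0) →
      Integrable fun z => osc F (s t) z * v t z := by
    intro v hv hv0
    obtain ⟨C, hC⟩ := (hv.est 0).zero
    refine integrable_of_bound H.closed ((contDiff_osc H.smooth _).continuous.mul
      (hv.smooth t).continuous) (fun z hz => by rw [hv0 z hz, mul_zero]) (C := C) (m := m t)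
      (fun z hz => ?_) (hmi t)
    rw [norm_mul, norm_osc, one_mul]
    exact hC t z hz
  have hN := H.pos
  have hx : ∀ t z, 0 ≤ s t * N z := fun t z => mul_nonneg (hs t) (hN z).le
  have h3 : Symb Ω (fun t _ => s t) fun t (_ : ℝ^[n]) => (s t : ℂ) :=
    Symb.of_const (fun t => (s t : ℂ)) fun t z _ => by rw [norm_real, norm_of_nonneg (hs t)]
  have hden : ∀ t z, 0 < 1 + s t ^ 2 * N z ^ 2 := fun t z => by positivity
  -- the field along which we integrate by parts
  have hV : ∀ i, Symb Ω m fun t z => (s t : ℂ) * ((pderiv1 i F z : ℂ) * damp F s t z * u t z) := by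
    intro i
    refine (h3.mul (((H.symb' i).mul (H.symb_damp s)).mul hu)).mono (c := 1)
      (fun t z hz => ?_) fun t z hz => ?_
    · have := hm t z hz
      have := hs t
      have := (hN z).le
      positivity
    · have h1 : s t * N z * (1 + s t ^ 2 * N z ^ 2)⁻¹ ≤ 1 := by
        rw [← mul_pow, ← div_eq_mul_inv, div_le_one (by positivity)]
        nlinarith [hx t z, sq_nonneg (s t * N z - 1)]
      linarith [mul_le_mul_of_nonneg_right h1 (hm t z hz)]
  have hV2 : ∀ i, Symb Ω m fun t z => (s t : ℂ) * (pderiv1 i F z : ℂ) *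
      ((s t : ℂ) * ((pderiv1 i F z : ℂ) * damp F s t z * u t z)) := by
    intro i
    refine ((h3.mul (H.symb' i)).mul (h3.mul (((H.symb' i).mul (H.symb_damp s)).mul hu))).mono
      (c := 1) (fun t z hz => ?_) fun t z hz => ?_
    · have := hm t z hz
      have := hs t
      have := (hN z).le
      positivity
    · have h1 : (s t * N z) * (s t * N z) * (1 + s t ^ 2 * N z ^ 2)⁻¹ ≤ 1 := by
        rw [← mul_pow, ← div_eq_mul_inv, div_le_one (by positivity)]
        nlinarith [hx t z]
      linarith [mul_le_mul_of_nonneg_right h1 (hm t z hz)]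
  have hibp : ∀ i, ∫ z, osc F (s t) z * cderiv i (fun z =>
      (s t : ℂ) * ((pderiv1 i F z : ℂ) * damp F s t z * u t z)) z =
      -∫ z, cderiv i (osc F (s t)) z *
        ((s t : ℂ) * ((pderiv1 i F z : ℂ) * damp F s t z * u t z)) := by
    intro i
    refine integral_mul_fderiv_eq_neg_fderiv_mul_of_integrable ?_ ?_ ?_
      (fun z _ => (contDiff_osc H.smooth _).differentiable (by simp) z)
      (fun z _ => ((hV i).smooth t).differentiable (by simp) z)
    · have h4 := (hbd _ (hV2 i) fun z hz => by simp [h0 t z hz]).const_mul I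
      refine h4.congr (.of_forall fun z => ?_)
      change _ = cderiv i (osc F (s t)) z * _
      rw [cderiv_osc H.smooth]
      ring
    · exact hbd _ ((hV i).cderiv i) fun z hz =>
        cderiv_eq_zero_of_notMem H.closed (fun z hz => by simp [h0 t z hz]) i hz
    · exact hbd _ (hV i) fun z hz => by simp [h0 t z hz]
  have hW : Integrable fun z => osc F (s t) z * (damp F s t z * u t z) := by
    have h5 : Symb Ω m fun t z => damp F s t z * u t z := by
      refine ((H.symb_damp s).mul hu).mono (c := 1) (fun t z hz => ?_) fun t z hz => ?_
      · have := hm t z hz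
        positivity
      · have h1 : (1 + s t ^ 2 * N z ^ 2)⁻¹ ≤ 1 := inv_le_one_of_one_le₀ (by
          have : 0 ≤ s t ^ 2 * N z ^ 2 := by positivity
          linarith)
        linarith [mul_le_mul_of_nonneg_right h1 (hm t z hz)]
    exact hbd _ h5 fun z hz => by simp [h0 t z hz]
  have e1 : ∀ z, osc F (s t) z * step F s u t z = osc F (s t) z * (damp F s t z * u t z) +
      ∑ i, I * (osc F (s t) z * cderiv i (fun z =>
      (s t : ℂ) * ((pderiv1 i F z : ℂ) * damp F s t z * u t z)) z) := by
    intro z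
    rw [step, mul_add, mul_sum]
    congr 1
    refine sum_congr rfl fun i _ => ?_
    have h6 := congrFun (cderiv_mul i (u := fun _ => (s t : ℂ)) (v := fun z =>
      (pderiv1 i F z : ℂ) * damp F s t z * u t z) contDiff_const
      ((((H.symb' i).mul (H.symb_damp s)).mul hu).smooth t)) z
    rw [h6]
    simp only [cderiv, fderiv_fun_const]
    simp
    ring
  have e2 : ∀ z, osc F (s t) z * u t z = osc F (s t) z * (damp F s t z * u t z) +
      ∑ i, I * (-(cderiv i (osc F (s t)) z *
        ((s t : ℂ) * ((pderiv1 i F z : ℂ) * damp F s t z * u t z)))) := by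
    intro z
    have h7 : (1 + (s t : ℂ) ^ 2 * ∑ i, (pderiv1 i F z : ℂ) ^ 2) * damp F s t z = 1 := by
      rw [damp, damp_den]
      exact mul_inv_cancel₀ (by exact_mod_cast (damp_den_pos F s t z).ne')
    have h8 : ∑ i, I * (-(cderiv i (osc F (s t)) z *
        ((s t : ℂ) * ((pderiv1 i F z : ℂ) * damp F s t z * u t z)))) =
        (s t : ℂ) ^ 2 * (∑ i, (pderiv1 i F z : ℂ) ^ 2) * damp F s t z *
          (osc F (s t) z * u t z) := by
      rw [mul_sum, sum_mul, sum_mul]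
      refine sum_congr rfl fun i _ => ?_
      rw [cderiv_osc H.smooth]
      linear_combination (-(s t : ℂ) ^ 2 * (pderiv1 i F z : ℂ) ^ 2 * damp F s t z *
          (osc F (s t) z * u t z)) * Complex.I_sq
    rw [h8]
    linear_combination (-(osc F (s t) z * u t z)) * h7
  have hi1 : ∀ i, Integrable fun z => I * (osc F (s t) z * cderiv i (fun z =>
      (s t : ℂ) * ((pderiv1 i F z : ℂ) * damp F s t z * u t z)) z) := fun i =>
    (hbd _ ((hV i).cderiv i) fun z hz =>
        cderiv_eq_zero_of_notMem H.closed (fun z hz => by simp [h0 t z hz]) i hz).const_mul _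
  have hi2 : ∀ i, Integrable fun z => I * (-(cderiv i (osc F (s t)) z *
        ((s t : ℂ) * ((pderiv1 i F z : ℂ) * damp F s t z * u t z)))) := fun i => by
    refine (hbd _ (hV2 i) fun z hz => by simp [h0 t z hz]).congr
      (.of_forall fun z => ?_)
    simp only [cderiv_osc H.smooth]
    linear_combination ((s t : ℂ) ^ 2 * (pderiv1 i F z : ℂ) ^ 2 * damp F s t z *
          (osc F (s t) z * u t z)) * Complex.I_sq
  simp only [e1, e2]
  rw [integral_add hW (integrable_finsetSum _ fun i _ => hi1 i),
    integral_add hW (integrable_finsetSum _ fun i _ => hi2 i),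
    integral_finsetSum _ fun i _ => hi1 i, integral_finsetSum _ fun i _ => hi2 i]
  congr 1
  refine sum_congr rfl fun i _ => ?_
  rw [integral_const_mul, integral_const_mul, hibp, integral_neg]

/-- Repeated integration by parts. -/
lemma norm_integral_le (H : PhaseBound Ω N F) (hs : ∀ t, 0 ≤ s t) (K : ℕ) :
    ∀ {m : ι → ℝ^[n] → ℝ}
    {u : ι → ℝ^[n] → ℂ}, (∀ t, ∀ z ∈ Ω, 0 ≤ m t z) →
    (∀ t, IntegrableOn (m t) Ω) → Symb Ω m u → (∀ t z, z ∉ Ω → u t z = 0) →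
    ∃ C, 0 ≤ C ∧ ∀ t, ‖∫ z, osc F (s t) z * u t z‖ ≤
      C * ∫ z in Ω, m t z * ((1 + s t * N z)⁻¹) ^ K := by
  have hx : ∀ t z, 0 ≤ s t * N z := fun t z => mul_nonneg (hs t) (H.pos z).le
  induction K with
  | zero =>
    intro m u hm hmi hu h0
    obtain ⟨C, hC⟩ := (hu.est 0).zero
    refine ⟨|C|, abs_nonneg C, fun t => ?_⟩
    simp only [pow_zero, mul_one]
    refine norm_integral_le_of_bound H.closed (fun z hz => by rw [h0 t z hz, mul_zero])
      (fun z hz => ?_) (hmi t)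
    rw [norm_mul, norm_osc, one_mul]
    exact (hC t z hz).trans (mul_le_mul_of_nonneg_right (le_abs_self C) (hm t z hz))
  | succ K ih =>
    intro m u hm hmi hu h0
    obtain ⟨C, hC0, hC⟩ := ih (m := fun t z => m t z * (1 + s t * N z)⁻¹) (u := step F s u)
      (fun t z hz => mul_nonneg (hm t z hz) (inv_nonneg.2 (by linarith [hx t z])))
      (fun t => by
        refine (hmi t).mono' ((hmi t).aestronglyMeasurable.mul (Continuous.inv₀ (by
          have := H.cont
          fun_prop) fun z => by have := hx t z; positivity).aestronglyMeasurable)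
          ((ae_restrict_iff' H.closed.measurableSet).2 (.of_forall fun z hz => ?_))
        rw [norm_of_nonneg (mul_nonneg (hm t z hz) (inv_nonneg.2 (by linarith [hx t z])))]
        exact mul_le_of_le_one_right (hm t z hz)
          (inv_le_one_of_one_le₀ (by linarith [hx t z])))
      (H.symb_step s hs hm hu) (fun t z hz => step_eq_zero s H.closed h0 t z hz)
    refine ⟨C, hC0, fun t => ?_⟩
    rw [H.integral_step s hs hm hmi hu h0]
    refine (hC t).trans_eq ?_
    congr 1
    refine integral_congr_ae (.of_forall fun z => ?_)
    simp only [pow_succ]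
    ring

end PhaseBound

end

section

variable {ι : Type*}

/-- The shifted octant `z_i ≥ R`. -/
def oct (n : ℕ) (R : ℝ) : Set ℝ^[n] := {z | ∀ i, R ≤ z i}

lemma isClosed_oct (R : ℝ) : IsClosed (oct n R) := by
  have : oct n R = ⋂ i, {z | R ≤ z i} := by ext z; simp [oct]
  rw [this]
  exact isClosed_iInter fun i => isClosed_le continuous_const (continuous_apply i)

lemma abs_expc_le (hσ : ∀ i, |σ i| = 1) (i : Fin n) :
    |expc σ z i| = exp (-z i) := by
  rw [expc, abs_mul, hσ, one_mul, abs_of_pos (exp_pos _)]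

lemma expc_mem_Icc (hσ : ∀ i, |σ i| = 1)
    (hz : ∀ i, 0 ≤ z i) : expc σ z ∈ Icc (fun _ => -1) (fun _ => 1 : ℝ^[n]) := by
  have h : ∀ i, |expc σ z i| ≤ 1 := fun i => by
    rw [abs_expc_le hσ, Real.exp_le_one_iff]
    linarith [hz i]
  exact ⟨fun i => (abs_le.1 (h i)).1, fun i => (abs_le.1 (h i)).2⟩

lemma cderiv_comp_expc {g : ℝ^[n] → ℂ} (hg : ContDiff ℝ ∞ g) (σ : ℝ^[n])
    (i : Fin n) (z : ℝ^[n]) :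
    cderiv i (fun z => g (expc σ z)) z = -(expc σ z i * cderiv i g (expc σ z)) := by
  have h := (hg.differentiable (by simp) (expc σ z)).hasFDerivAt.comp z (hasFDerivAt_pi.2
    fun j => (hasFDerivAt_apply j z).neg.exp.const_mul (σ j))
  have e : cderiv i (fun z => g (expc σ z)) z = _ := congrArg (fun L => L (single i 1)) h.fderiv
  rw [e, ContinuousLinearMap.comp_apply, cderiv, ← neg_mul, ← Complex.ofReal_neg,
    ← Complex.real_smul, ← map_smul]
  congr 1
  funext j
  by_cases hij : j = i
  · subst hij
    simp [expc]
  · simp [hij]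

lemma symb_comp_expc (hσ : ∀ i, |σ i| = 1) (hR : 0 ≤ R)
    {g : ℝ^[n] → ℂ} (hg : ContDiff ℝ ∞ g) :
    Symb (oct n R) (fun (_ : ι) _ => 1) fun _ z => g (expc σ z) := by
  have key : ∀ g : ℝ^[n] → ℂ, ContDiff ℝ ∞ g →
      ∃ C : ℝ, ∀ _ : ι, ∀ z ∈ oct n R, ‖g (expc σ z)‖ ≤ C * 1 := by
    intro g hg
    obtain ⟨C, hC⟩ := (isCompact_Icc (a := (fun _ => -1 : ℝ^[n]))
      (b := fun _ => 1)).exists_bound_of_continuousOn hg.continuous.continuousOn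
    refine ⟨C, fun _ z hz => ?_⟩
    rw [mul_one]
    exact hC _ (expc_mem_Icc hσ fun i => hR.trans (hz i))
  refine ⟨fun _ => hg.comp (contDiff_expc σ), fun k => ?_⟩
  induction k generalizing g with
  | zero => exact key g hg
  | succ k ih =>
    refine ⟨key g hg, fun i => ?_⟩
    have h1 : ContDiff ℝ ∞ fun x : ℝ^[n] => -((x i : ℂ) * cderiv i g x) :=
      ((contDiff_ofReal (contDiff_coord i)).mul (contDiff_cderiv i hg)).neg
    have h2 := ih h1
    have e : (fun _ : ι => cderiv i fun z => g (expc σ z)) =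
        fun _ z => -((expc σ z i : ℂ) * cderiv i g (expc σ z)) := by
      funext _ z
      rw [cderiv_comp_expc hg]
    rw [e]
    exact h2

lemma contDiff_dot (ρ : ℝ^[n]) : ContDiff ℝ ∞ (dot ρ) :=
  ContDiff.sum fun i _ => contDiff_const.mul (contDiff_coord i)

lemma contDiff_exp_dot (ρ : ℝ^[n]) : ContDiff ℝ ∞ fun z : ℝ^[n] => exp (-dot ρ z) :=
  (contDiff_dot ρ).neg.exp

lemma pderiv1_exp_dot (ρ : ℝ^[n]) (i : Fin n) (z : ℝ^[n]) :
    pderiv1 i (fun z => exp (-dot ρ z)) z = -ρ i * exp (-dot ρ z) := by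
  have h : HasFDerivAt (fun z => exp (-dot ρ z)) _ z := (HasFDerivAt.fun_sum fun j _ =>
    ((hasFDerivAt_apply j z).const_mul (ρ j))).neg.exp
  rw [pderiv1, h.fderiv]
  simp [Pi.single_apply, mul_comm, dot]

lemma symb_exp_dot (Ω : Set ℝ^[n]) (ρ : ℝ^[n]) :
    Symb Ω (fun (_ : ι) z => exp (-dot ρ z)) fun _ z => (exp (-dot ρ z) : ℂ) := by
  refine ⟨fun _ => ?_, fun k => ?_⟩
  · simpa only [Complex.ofReal_exp] using contDiff_ofReal (contDiff_exp_dot ρ)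
  have key : ∀ a : ℂ, SymK Ω k (fun (_ : ι) z => exp (-dot ρ z))
      fun _ z => a * ((exp (-dot ρ z) : ℝ) : ℂ) := by
    have base : ∀ a : ℂ, ∃ C : ℝ, ∀ _ : ι, ∀ z ∈ Ω, ‖a * ((exp (-dot ρ z) : ℝ) : ℂ)‖ ≤
        C * exp (-dot ρ z) := fun a => ⟨‖a‖, fun _ z _ => by
      rw [norm_mul, norm_real, norm_of_nonneg (exp_pos _).le]⟩
    induction k with
    | zero => exact base
    | succ k ih =>
      refine fun a => ⟨base a, fun i => ?_⟩
      have e : (fun _ : ι => cderiv i fun z => a * ((exp (-dot ρ z) : ℝ) : ℂ)) =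
          fun _ z => (a * (-ρ i)) * ((exp (-dot ρ z) : ℝ) : ℂ) := by
        funext _ z
        rw [cderiv_mul i contDiff_const (contDiff_ofReal (contDiff_exp_dot ρ)),
          cderiv_ofReal i (contDiff_exp_dot ρ)]
        simp only [pderiv1_exp_dot]
        simp [cderiv]
        ring
      rw [e]
      exact ih _
  simpa using key 1

namespace LocalModel

lemma contDiff_N : ContDiff ℝ ∞ M.N := ContDiff.sum fun _ _ => contDiff_exp_dot _

lemma symb_wsum (hσ : ∀ i, |σ i| = 1) (hR : 0 ≤ R)
    (hθ : ∀ p, ContDiff ℝ ∞ (θ p)) :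
    Symb (oct n R) (fun (_ : ι) z => M.N z) fun _ z => (M.wsum θ (expc σ z) : ℂ) := by
  have h : ∀ p ∈ M.F, Symb (oct n R) (fun (_ : ι) z => M.N z) fun _ z =>
      (xpow p σ : ℂ) * (((exp (-dot (natPt p) z) : ℝ) : ℂ) * (θ p (expc σ z) : ℂ)) :=
    fun p hp => Symb.const_mul (((symb_exp_dot _ _).mul (symb_comp_expc hσ hR
      (contDiff_ofReal (hθ p)))).mono (c := 1) (fun _ z _ => by positivity) fun _ z hz => by
        rw [mul_one, one_mul]
        exact M.exp_le_N (M.mem_poly p hp) fun i => hR.trans (hz i)) _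
  have e : (fun (_ : ι) z => (M.wsum θ (expc σ z) : ℂ)) = fun _ z => ∑ p ∈ M.F,
      (xpow p σ : ℂ) * (((exp (-dot (natPt p) z) : ℝ) : ℂ) * (θ p (expc σ z) : ℂ)) := by
    funext _ z
    rw [wsum]
    push_cast [xpow_expc]
    exact sum_congr rfl fun p _ => by ring
  rw [e]
  exact Symb.sum _ h

/-- The phase in exponential coordinates. -/
noncomputable def phase (σ z : ℝ^[n]) : ℝ := M.wsum M.ψ (expc σ z)

lemma contDiff_phase (σ : ℝ^[n]) : ContDiff ℝ ∞ (M.phase σ) :=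
  (M.contDiff_wsum M.smooth).comp (contDiff_expc σ)

lemma pderiv1_phase (σ : ℝ^[n]) (i : Fin n) (z : ℝ^[n]) :
    pderiv1 i (M.phase σ) z = -M.wsum (logDer i M.ψ) (expc σ z) :=
  M.pderiv1_wsum_expc i M.smooth σ z

lemma phaseBound (hσ : ∀ i, |σ i| = 1) {R c : ℝ} (hR : 0 ≤ R) (hc : 0 < c)
    (h : ∀ z : ℝ^[n], (∀ i, R ≤ z i) →
      c * M.N z ^ 2 ≤ ∑ i, M.wsum (logDer i M.ψ) (expc σ z) ^ 2) :
    PhaseBound (oct n R) M.N (M.phase σ) where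
  closed := isClosed_oct R
  smooth := M.contDiff_phase σ
  cont := M.contDiff_N.continuous
  pos := M.N_pos
  symb i := by
    have := (M.symb_wsum (ι := Unit) hσ hR (contDiff_logDer i M.smooth)).const_mul (-1)
    refine this.congr (fun _ z _ => (M.N_pos z).le) (fun _ _ _ => rfl) |> fun h => ?_
    convert h using 3 with _ z
    rw [pderiv1_phase]
    push_cast
    ring
  lower := ⟨c, hc, fun z hz => by
    simp only [pderiv1_phase, neg_sq]
    exact h z hz⟩

end LocalModel

end

lemma integrable_exp_neg_mul_abs {a : ℝ} (ha : 0 < a) :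
    Integrable fun x : ℝ => exp (-(a * |x|)) := by
  rw [← integrableOn_univ, ← Iic_union_Ioi (a := (0 : ℝ))]
  refine IntegrableOn.union ?_ ?_
  · refine (integrableOn_exp_mul_Iic ha 0).congr_fun (fun x hx => ?_) measurableSet_Iic
    have hx : x ≤ 0 := hx
    simp [abs_of_nonpos hx]
  · refine (integrableOn_exp_mul_Ioi (neg_lt_zero.2 ha) 0).congr_fun (fun x hx => ?_)
      measurableSet_Ioi
    have hx : 0 < x := hx
    simp [abs_of_pos hx]

/-- Products of functions of independent linear functionals. -/
lemma exists_integral_prod_dot (s : Finset ℝ^[n])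
    (hs : LinearIndepOn ℝ id (s : Set ℝ^[n])) (hn : s.card = n) :
    ∃ c : ℝ, 0 < c ∧ ∀ h : ℝ^[n] → ℝ → ℝ, (∀ u ∈ s, Integrable (h u)) →
      Integrable (fun z => ∏ u ∈ s, h u (dot u z)) ∧
      ∫ z, ∏ u ∈ s, h u (dot u z) = c * ∏ u ∈ s, ∫ x, h u x := by
  classical
  have hcard : Fintype.card s = n := by rw [Fintype.card_coe, hn]
  let e : Fin n ≃ s := (Fintype.equivFinOfCardEq hcard).symm
  let Λ : Matrix (Fin n) (Fin n) ℝ := Matrix.of fun k => (e k : ℝ^[n])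
  have hΛ : Λ.det ≠ 0 := by
    rw [← isUnit_iff_ne_zero, ← Matrix.isUnit_iff_isUnit_det,
      ← Matrix.linearIndependent_rows_iff_isUnit]
    exact (LinearIndependent.comp hs e e.injective :)
  have happ : ∀ z k, Matrix.toLin' Λ z k = dot (e k) z := fun z k => rfl
  have hmap := Real.map_matrix_volume_pi_eq_smul_volume_pi hΛ
  have hmeas : Measurable (Matrix.toLin' Λ) :=
    (LinearMap.continuous_of_finiteDimensional _).measurable
  refine ⟨|Λ.det⁻¹|, abs_pos.2 (inv_ne_zero hΛ), fun h hh => ?_⟩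
  have hprod : ∀ z, ∏ u ∈ s, h u (dot u z) = ∏ k, h (e k) (Matrix.toLin' Λ z k) := by
    intro z
    rw [← Finset.prod_coe_sort s, ← e.prod_comp]
    rfl
  have hi : Integrable (fun y : ℝ^[n] => ∏ k, h (e k) (y k)) :=
    Integrable.fintype_prod fun k => hh _ (e k).2
  have hi' : Integrable (fun y : ℝ^[n] => ∏ k, h (e k) (y k))
      (Measure.map (Matrix.toLin' Λ) volume) := by
    rw [hmap]
    exact hi.smul_measure ENNReal.ofReal_ne_top
  simp only [hprod]
  refine ⟨(integrable_map_measure hi'.aestronglyMeasurable hmeas.aemeasurable).1 hi', ?_⟩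
  rw [← integral_map hmeas.aemeasurable hi'.aestronglyMeasurable (f := fun y : ℝ^[n] =>
    ∏ k, h (e k) (y k)), hmap, integral_smul_measure, integral_fintype_prod_volume_eq_prod,
    ENNReal.toReal_ofReal (abs_nonneg _), smul_eq_mul]
  congr 1
  rw [← Finset.prod_coe_sort s, ← e.prod_comp]

/-- Completion of a linearly independent set by coordinate functionals. -/
lemma exists_completion (s : Finset ℝ^[n])
    (hs : LinearIndepOn ℝ id (s : Set ℝ^[n])) :
    ∃ b : Finset ℝ^[n], s ⊆ b ∧ LinearIndepOn ℝ id (b : Set ℝ^[n]) ∧ b.card = n ∧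
      ∀ u ∈ b, u ∉ s → ∃ i, u = single i 1 := by
  classical
  obtain ⟨b, hb, hsb, hspan, hli⟩ := exists_linearIndepOn_id_extension hs
    (t := (s : Set ℝ^[n]) ∪ range fun i : Fin n => (single i 1 : ℝ^[n]))
    subset_union_left
  have hfin : b.Finite := (s.finite_toSet.union (finite_range _)).subset hb
  have htop : span ℝ b = ⊤ := by
    rw [eq_top_iff, ← (Pi.basisFun ℝ (Fin n)).span_eq, Submodule.span_le]
    rintro _ ⟨i, rfl⟩
    rw [Pi.basisFun_apply]
    exact hspan (Or.inr ⟨i, rfl⟩)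
  refine ⟨hfin.toFinset, ?_, ?_, ?_, ?_⟩
  · intro x hx
    exact hfin.mem_toFinset.2 (hsb hx)
  · rwa [hfin.coe_toFinset]
  · have := hfin.fintype
    have h1 := finrank_span_set_eq_card (R := ℝ) (s := b) hli
    rw [htop, finrank_top, Module.finrank_fin_fun] at h1
    refine Eq.trans ?_ h1.symm
    rw [Set.Finite.card_toFinset, ← Set.toFinset_card]
  · intro u hu hus
    rcases hb (hfin.mem_toFinset.1 hu) with h | ⟨i, hi⟩
    · exact absurd h hus
    · exact ⟨i, hi.symm⟩

/-- A nonnegative profile: equal to one on `[0,S]`, exponentially decaying beyond. -/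
noncomputable def profile (δ S x : ℝ) : ℝ :=
  indicator (Icc 0 S) (fun _ => 1) x + indicator (Ioi S) (fun x => exp (-δ * (x - S))) x

lemma integrable_profile_tail {δ : ℝ} (hδ : 0 < δ) (S : ℝ) :
    Integrable (indicator (Ioi S) fun x => exp (-δ * (x - S))) := by
  refine (integrable_indicator_iff measurableSet_Ioi).2 ?_
  refine IntegrableOn.congr_fun ((integrableOn_exp_mul_Ioi (neg_lt_zero.2 hδ) S).const_mul
    (exp (δ * S))) (fun x _ => ?_) measurableSet_Ioi
  rw [← exp_add]
  congr 1; ring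

lemma integrable_profile {δ : ℝ} (hδ : 0 < δ) (S : ℝ) : Integrable (profile δ S) :=
  Integrable.add ((integrable_indicator_iff measurableSet_Icc).2 (by simp))
    (integrable_profile_tail hδ S)

lemma integral_profile {δ : ℝ} (hδ : 0 < δ) {S : ℝ} (hS : 0 ≤ S) :
    ∫ x, profile δ S x = S + 1 / δ := by
  unfold profile
  rw [integral_add ((integrable_indicator_iff measurableSet_Icc).2 (by simp))
    (integrable_profile_tail hδ S), integral_indicator measurableSet_Icc,
    integral_indicator measurableSet_Ioi]
  congr 1
  · simp [hS]
  · have : ∀ x, exp (-δ * (x - S)) = exp (δ * S) * exp (-δ * x) := fun x => by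
      rw [← exp_add]; congr 1; ring
    simp only [this]
    rw [integral_const_mul, integral_exp_mul_Ioi (neg_lt_zero.2 hδ),
      neg_div_neg_eq, ← mul_div_assoc, ← exp_add]
    simp

lemma exp_le_profile {δ S x y : ℝ} (hδ : 0 < δ) (hx : 0 ≤ x) (hy : 0 ≤ y) (hxy : x ≤ S + y) :
    exp (-δ * y) ≤ profile δ S x := by
  rw [profile]
  rcases le_or_gt x S with h | h
  · rw [indicator_of_mem (show x ∈ Icc 0 S from ⟨hx, h⟩), indicator_of_notMem (by simpa using h)]
    rw [add_zero, Real.exp_le_one_iff]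
    nlinarith
  · rw [indicator_of_notMem (fun h' => absurd h'.2 (not_le.2 h)), indicator_of_mem (by simpa using h),
      zero_add, exp_le_exp]
    nlinarith

lemma profile_nonneg (δ S x : ℝ) : 0 ≤ profile δ S x :=
  add_nonneg (indicator_nonneg (fun _ _ => zero_le_one) _)
    (indicator_nonneg (fun _ _ => (exp_pos _).le) _)

lemma inv_one_add_pow_le {x κ : ℝ} {K : ℕ} (hx : 0 < x) (hκ : 0 ≤ κ) (hK : κ ≤ K) :
    ((1 + x)⁻¹) ^ K ≤ x ^ (-κ) := by
  have h1 : ((1 + x)⁻¹) ^ K = (1 + x) ^ (-(K : ℝ)) := by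
    rw [rpow_neg (by linarith), rpow_natCast, inv_pow]
  rw [h1]
  calc (1 + x) ^ (-(K : ℝ)) ≤ (1 + x) ^ (-κ) :=
        Real.rpow_le_rpow_of_exponent_le (by linarith) (by linarith)
    _ ≤ x ^ (-κ) := Real.rpow_le_rpow_of_nonpos hx (by linarith) (by linarith)

lemma dot_nonneg {ρ z : ℝ^[n]} (hρ : ∀ i, 0 ≤ ρ i) (hz : ∀ i, 0 ≤ z i) : 0 ≤ dot ρ z :=
  sum_nonneg fun i _ => mul_nonneg (hρ i) (hz i)

/-- Pointwise majorant of the damped density. -/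
lemma damped_le {ρ z : ℝ^[n]} {μ B t y Nz : ℝ} {K : ℕ} (hμ : 0 < μ) (hB : 0 < B)
    (hK : 2 * μ ≤ K) (ht : 0 < t) (hy : 0 ≤ y) (hN : exp (-dot ρ z / μ + y) ≤ B * Nz) :
    exp (-dot ρ z) * ((1 + t * Nz)⁻¹) ^ K ≤
      (B ^ (2 * μ) + B ^ (μ / 2)) * t ^ (-μ) *
        (exp (-(|dot ρ z - μ * log t| / 2)) * exp (-(μ / 2 * y))) := by
  set s := dot ρ z
  have hNz : 0 < Nz := by
    have := (exp_pos _).trans_le hN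
    exact pos_of_mul_pos_right this hB.le
  have hx : 0 < t * Nz := mul_pos ht hNz
  have key : ∀ κ : ℝ, 0 ≤ κ → κ ≤ K → exp (-s) * ((1 + t * Nz)⁻¹) ^ K ≤
      B ^ κ * t ^ (-μ) * (exp ((κ / μ - 1) * (s - μ * log t)) * exp (-(κ * y))) := by
    intro κ h0 h1
    have h2 : (t * Nz) ^ (-κ) ≤ B ^ κ * (t ^ (-κ) * exp (-κ * (-s / μ + y))) := by
      have h3 : t * exp (-s / μ + y) / B ≤ t * Nz := by
        rw [div_le_iff₀ hB]
        nlinarith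
      refine (Real.rpow_le_rpow_of_nonpos (by positivity) h3 (by linarith)).trans_eq ?_
      rw [Real.div_rpow (by positivity) hB.le, Real.mul_rpow ht.le (exp_pos _).le,
        rpow_neg hB.le, div_inv_eq_mul, ← Real.exp_mul]
      ring_nf
    refine (mul_le_mul_of_nonneg_left ((inv_one_add_pow_le hx h0 h1).trans h2)
      (exp_pos _).le).trans_eq ?_
    rw [rpow_def_of_pos ht, rpow_def_of_pos ht]
    have h4 : exp (-s) * (B ^ κ * (exp (log t * -κ) *
        exp (-κ * (-s / μ + y)))) = B ^ κ * exp (-s + (log t * -κ +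
        -κ * (-s / μ + y))) := by
      rw [exp_add, exp_add]; ring
    rw [h4, mul_assoc, ← exp_add, ← exp_add]
    congr 2
    field_simp
    ring
  have hexp : ∀ a b : ℝ, 0 ≤ exp a * exp b := fun a b => by positivity
  have htμ : 0 ≤ t ^ (-μ) := (rpow_pos_of_pos ht _).le
  have hB1 : 0 ≤ B ^ (2 * μ) := (rpow_pos_of_pos hB _).le
  have hB2 : 0 ≤ B ^ (μ / 2) := (rpow_pos_of_pos hB _).le
  rcases le_total s (μ * log t) with h | h
  · refine (key (2 * μ) (by linarith) hK).trans ?_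
    rw [abs_of_nonpos (by linarith)]
    have e1 : exp ((2 * μ / μ - 1) * (s - μ * log t)) ≤
        exp (-(-(s - μ * log t) / 2)) := by
      rw [exp_le_exp, mul_div_cancel_right₀ _ hμ.ne']
      linarith
    have e2 : exp (-(2 * μ * y)) ≤ exp (-(μ / 2 * y)) := by
      rw [exp_le_exp]
      nlinarith [mul_nonneg hμ.le hy]
    have e3 := mul_le_mul e1 e2 (exp_pos _).le (exp_pos _).le
    refine mul_le_mul ?_ e3 (hexp _ _) (by positivity)
    exact mul_le_mul_of_nonneg_right (by linarith) htμ
  · refine (key (μ / 2) (by linarith) (by linarith)).trans ?_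
    rw [abs_of_nonneg (by linarith)]
    have e1 : (μ / 2 / μ - 1) * (s - μ * log t) = -((s - μ * log t) / 2) := by
      field_simp
      ring
    rw [e1]
    refine mul_le_mul_of_nonneg_right ?_ (hexp _ _)
    exact mul_le_mul_of_nonneg_right (by linarith) htμ

lemma integrableOn_exp_neg_dot {ρ : ℝ^[n]} (hρ : ∀ i, 0 < ρ i) (R : ℝ) :
    IntegrableOn (fun z => exp (-dot ρ z)) (oct n R) := by
  have h1 : Integrable fun z : ℝ^[n] => ∏ i, indicator (Ici R) (fun x => exp (-ρ i * x)) (z i) :=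
    Integrable.fintype_prod fun i => (integrable_indicator_iff measurableSet_Ici).2
      ((integrableOn_Ici_iff_integrableOn_Ioi).2 (integrableOn_exp_mul_Ioi (neg_lt_zero.2 (hρ i)) R))
  rw [← integrable_indicator_iff (isClosed_oct R).measurableSet]
  refine h1.congr (.of_forall fun z => ?_)
  by_cases hz : z ∈ oct n R
  · rw [indicator_of_mem hz]
    have : ∀ i, indicator (Ici R) (fun x => exp (-ρ i * x)) (z i) = exp (-ρ i * z i) :=
      fun i => indicator_of_mem (show z i ∈ Ici R from hz i) _
    simp only [this]
    rw [← exp_sum]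
    congr 1
    simp [dot]
  · rw [indicator_of_notMem hz]
    have : ∃ i, z i ∉ Ici R := by
      by_contra h
      push Not at h
      exact hz h
    obtain ⟨i, hi⟩ := this
    exact Finset.prod_eq_zero (Finset.mem_univ i) (indicator_of_notMem hi _)

/-- Upper bound for damped exponential volumes. -/
lemma exists_volume_le {ρ : ℝ^[n]} (hρ : ∀ i, 1 ≤ ρ i) {T : Finset ℝ^[n]}
    (hρT : ρ ∉ T) (hli : LinearIndepOn ℝ id (insert ρ (T : Set ℝ^[n]))) {μ ε B : ℝ}
    (hμ : 0 < μ) (hε : 0 < ε) (hB : 0 < B) {Nf : ℝ^[n] → ℝ}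
    (hΩm : MeasurableSet Ω) (hΩ : ∀ z ∈ Ω, ∀ i, 0 ≤ z i)
    (h : ∀ z ∈ Ω, exp (-dot ρ z / μ + ε * ∑ u ∈ T, |dot u z|) ≤ B * Nf z) {K : ℕ}
    (hK : 2 * μ ≤ K) :
    ∃ C, 0 ≤ C ∧ ∀ t : ℝ, 2 ≤ t →
      ∫ z in Ω, exp (-dot ρ z) * ((1 + t * Nf z)⁻¹) ^ K ≤
        C * (t ^ (-μ) * log t ^ (n - 1 - T.card)) := by
  classical
  rw [← Finset.coe_insert] at hli
  obtain ⟨b, hsb, hbli, hbn, hnew⟩ := exists_completion _ hli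
  obtain ⟨c, hc, hnt⟩ := exists_integral_prod_dot b hbli hbn
  set W := b \ insert ρ T with hW
  have hWcard : W.card = n - 1 - T.card := by
    rw [hW, Finset.card_sdiff_of_subset hsb, Finset.card_insert_of_notMem hρT, hbn]; omega
  have hWT : ∀ u ∈ W, u ≠ ρ ∧ u ∉ T := fun u hu => by
    have := (Finset.mem_sdiff.1 hu).2
    rw [Finset.mem_insert, not_or] at this
    exact this
  have hWs : ∀ u ∈ W, ∃ i, u = single i 1 := fun u hu =>
    hnew u (Finset.mem_sdiff.1 hu).1 (Finset.mem_sdiff.1 hu).2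
  obtain ⟨δ, hδ, hδW⟩ : ∃ δ : ℝ, 0 < δ ∧ W.card * δ ≤ 1 / 4 := by
    refine ⟨1 / (4 * (W.card + 1)), by positivity, ?_⟩
    rw [mul_one_div, div_le_iff₀ (by positivity)]
    linarith
  let H : ℝ → ℝ^[n] → ℝ → ℝ := fun s u x =>
    if u = ρ then exp (-(1 / 4 * |x - s|)) else
      if u ∈ T then exp (-(μ / 2 * ε * |x|)) else profile δ s x
  have hHρ : ∀ s x, H s ρ x = exp (-(1 / 4 * |x - s|)) := fun s x => if_pos rfl
  have hHT : ∀ s, ∀ u ∈ T, ∀ x, H s u x = exp (-(μ / 2 * ε * |x|)) := fun s u hu x => by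
    have : u ≠ ρ := fun h => hρT (h ▸ hu)
    simp [H, this, hu]
  have hHW : ∀ s, ∀ u ∈ W, ∀ x, H s u x = profile δ s x := fun s u hu x => by
    simp [H, (hWT u hu).1, (hWT u hu).2]
  have hprod : ∀ g : ℝ^[n] → ℝ, ∏ u ∈ b, g u = (∏ u ∈ W, g u) * (g ρ * ∏ u ∈ T, g u) := by
    intro g
    rw [← Finset.prod_sdiff hsb, Finset.prod_insert hρT]
  have hHint : ∀ s, ∀ u ∈ b, Integrable (H s u) := by
    intro s u hu
    by_cases h1 : u = ρ
    · subst h1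
      have := (integrable_exp_neg_mul_abs (a := 1 / 4) (by norm_num)).comp_sub_right s
      exact this.congr (.of_forall fun x => (hHρ s x).symm)
    by_cases h2 : u ∈ T
    · have := (integrable_exp_neg_mul_abs (a := μ / 2 * ε) (by positivity))
      exact this.congr (.of_forall fun x => (hHT s u h2 x).symm)
    · have h3 : u ∈ W := by
        rw [hW, Finset.mem_sdiff, Finset.mem_insert]
        exact ⟨hu, by tauto⟩
      exact (integrable_profile hδ s).congr (.of_forall fun x => (hHW s u h3 x).symm)
  set c1 := ∫ x : ℝ, exp (-(1 / 4 * |x|))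
  set c2 := ∫ x : ℝ, exp (-(μ / 2 * ε * |x|))
  have hc1 : 0 ≤ c1 := integral_nonneg fun _ => (exp_pos _).le
  have hc2 : 0 ≤ c2 := integral_nonneg fun _ => (exp_pos _).le
  have hl2 : 0 < log 2 := log_pos one_lt_two
  set D := (B ^ (2 * μ) + B ^ (μ / 2)) with hD
  have hD0 : 0 ≤ D := by positivity
  refine ⟨D * c * c1 * c2 ^ T.card * (μ + 1 / δ / log 2) ^ W.card, by positivity,
    fun t ht => ?_⟩
  have ht0 : 0 < t := by linarith
  have hlog : log 2 ≤ log t := log_le_log two_pos ht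
  set s := μ * log t with hs
  have hs0 : 0 ≤ s := mul_nonneg hμ.le (hl2.le.trans hlog)
  obtain ⟨hi, hval⟩ := hnt (H s) (hHint s)
  have htμ : 0 ≤ t ^ (-μ) := (rpow_pos_of_pos ht0 _).le
  have hpt : ∀ z ∈ Ω, exp (-dot ρ z) * ((1 + t * Nf z)⁻¹) ^ K ≤
      D * t ^ (-μ) * ∏ u ∈ b, H s u (dot u z) := by
    intro z hz
    refine (damped_le hμ hB hK ht0 (mul_nonneg hε.le (sum_nonneg fun _ _ => abs_nonneg _))
      (h z hz)).trans ?_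
    refine mul_le_mul_of_nonneg_left ?_ (mul_nonneg hD0 htμ)
    rw [hprod, hHρ, ← mul_assoc (∏ u ∈ W, H s u (dot u z))]
    have e1 : exp (-(μ / 2 * (ε * ∑ u ∈ T, |dot u z|))) = ∏ u ∈ T, H s u (dot u z) := by
      rw [prod_congr rfl fun u hu => hHT s u hu (dot u z), ← exp_sum,
        mul_sum, mul_sum, ← sum_neg_distrib]
      congr 1
      exact sum_congr rfl fun u _ => by ring
    rw [e1]
    refine mul_le_mul_of_nonneg_right ?_ (Finset.prod_nonneg fun u hu => by
      rw [hHT s u hu]; exact (exp_pos _).le)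
    set a := |dot ρ z - s|
    have ha : 0 ≤ a := abs_nonneg _
    have e2 : exp (-δ * a) ^ W.card ≤ ∏ u ∈ W, H s u (dot u z) := by
      rw [← prod_const]
      refine Finset.prod_le_prod (fun _ _ => (exp_pos _).le) fun u hu => ?_
      rw [hHW s u hu]
      obtain ⟨i, rfl⟩ := hWs u hu
      rw [dot_single_left]
      refine exp_le_profile hδ (hΩ z hz i) ha ?_
      have h1 : z i ≤ dot ρ z := by
        refine le_trans ?_ (single_le_sum (f := fun i => ρ i * z i)
          (fun j _ => mul_nonneg (zero_le_one.trans (hρ j)) (hΩ z hz j)) (Finset.mem_univ i))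
        exact le_mul_of_one_le_left (hΩ z hz i) (hρ i)
      have h2 : dot ρ z - s ≤ a := le_abs_self _
      linarith
    calc exp (-(a / 2)) ≤ exp (-δ * a) ^ W.card * exp (-(1 / 4 * a)) := by
          rw [← Real.exp_nat_mul, ← exp_add, exp_le_exp]
          nlinarith [mul_le_mul_of_nonneg_right hδW ha]
      _ ≤ _ := mul_le_mul_of_nonneg_right e2 (exp_pos _).le
  have hHnn : ∀ z ∈ Ω, 0 ≤ exp (-dot ρ z) * ((1 + t * Nf z)⁻¹) ^ K := by
    intro z hz
    have : 0 < Nf z := pos_of_mul_pos_right ((exp_pos _).trans_le (h z hz)) hB.le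
    positivity
  have hprodnn : ∀ z, 0 ≤ ∏ u ∈ b, H s u (dot u z) := fun z =>
    Finset.prod_nonneg fun u hu => by
      simp only [H]
      split_ifs
      · positivity
      · positivity
      · exact profile_nonneg _ _ _
  calc ∫ z in Ω, exp (-dot ρ z) * ((1 + t * Nf z)⁻¹) ^ K
      ≤ ∫ z in Ω, D * t ^ (-μ) * ∏ u ∈ b, H s u (dot u z) :=
        integral_mono_of_nonneg ((ae_restrict_iff' hΩm).2 (.of_forall hHnn))
          (hi.const_mul _).integrableOn ((ae_restrict_iff' hΩm).2 (.of_forall hpt))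
    _ ≤ ∫ z, D * t ^ (-μ) * ∏ u ∈ b, H s u (dot u z) :=
        setIntegral_le_integral (hi.const_mul _) (.of_forall fun z =>
          mul_nonneg (mul_nonneg hD0 htμ) (hprodnn z))
    _ = D * t ^ (-μ) * (c * ((s + 1 / δ) ^ W.card * (c1 * c2 ^ T.card))) := by
        rw [integral_const_mul, hval, hprod]
        congr 3
        · rw [prod_congr rfl fun u hu => by
            rw [integral_congr_ae (.of_forall (hHW s u hu)), integral_profile hδ hs0],
            prod_const]
        · congr 1
          · rw [integral_congr_ae (.of_forall (hHρ s))]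
            exact integral_sub_right_eq_self (fun x => exp (-(1 / 4 * |x|))) s
          · rw [prod_congr rfl fun u hu => by
              rw [integral_congr_ae (.of_forall (hHT s u hu))], prod_const]
    _ ≤ D * t ^ (-μ) * (c * (((μ + 1 / δ / log 2) * log t) ^ W.card *
          (c1 * c2 ^ T.card))) := by
        have : s + 1 / δ ≤ (μ + 1 / δ / log 2) * log t := by
          rw [add_mul, ← hs]
          have : 1 / δ ≤ 1 / δ / log 2 * log t := by
            rw [div_mul_eq_mul_div, le_div_iff₀ hl2]
            exact mul_le_mul_of_nonneg_left hlog (by positivity)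
          linarith
        gcongr
    _ = _ := by
        rw [mul_pow, hWcard]
        ring

lemma taylorCoeff_zero (f : ℝ^[n] → ℝ) : taylorCoeff f 0 = f 0 := by
  have : ∀ L : List (Fin n), L.foldr (fun i g => (pderiv1 i)^[(0 : ℕ^[n]) i] g) f = f := by
    intro L
    induction L with
    | nil => rfl
    | cons i L ih => rw [List.foldr_cons, ih]; rfl
  rw [taylorCoeff, mderiv, this]
  simp

lemma dot_one_left (x : ℝ^[n]) : dot (fun _ => 1) x = ∑ i, x i := by simp [dot]

namespace PolyData

open Classical in
/-- The facet normals active at a point of the polyhedron. -/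
noncomputable def active (v : ℝ^[n]) : Finset ℕ^[n] :=
  D.A.filter fun a => ∀ s ∈ D.S, dot (natPt a) v ≤ dot (natPt a) (natPt s)

lemma natPt_nonneg (a : ℕ^[n]) (i : Fin n) : 0 ≤ natPt a i := Nat.cast_nonneg _

lemma active_le {a : ℕ^[n]} {v p : ℝ^[n]} (ha : a ∈ D.active v)
    (hp : p ∈ Γ₊ f) : dot (natPt a) v ≤ dot (natPt a) p := by
  classical
  obtain ⟨s, hs, h⟩ := D.exists_dot_le hp (natPt_nonneg a)
  exact ((mem_filter.1 ha).2 s hs).trans h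

lemma eventually_mem {v u : ℝ^[n]} (hv : v ∈ Γ₊ f)
    (hu : ∀ a ∈ D.active v, 0 ≤ dot (natPt a) u) :
    ∀ᶠ ε : ℝ in 𝓝[>] 0, v + ε • u ∈ Γ₊ f := by
  classical
  have h : ∀ a ∈ D.A, ∀ᶠ ε : ℝ in 𝓝[>] 0,
      ∃ s ∈ D.S, dot (natPt a) (natPt s) ≤ dot (natPt a) (v + ε • u) := by
    intro a ha
    by_cases haa : a ∈ D.active v
    · obtain ⟨s, hs, h⟩ := D.exists_dot_le hv (natPt_nonneg a)
      filter_upwards [self_mem_nhdsWithin] with ε hε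
      have hε : 0 < ε := hε
      refine ⟨s, hs, ?_⟩
      rw [dot_add_right, dot_smul_right]
      have := mul_nonneg hε.le (hu a haa)
      linarith
    · rw [active, mem_filter, not_and] at haa
      have := haa ha
      push Not at this
      obtain ⟨s, hs, hlt⟩ := this
      have hc : Tendsto (fun ε : ℝ => dot (natPt a) (v + ε • u)) (𝓝[>] 0)
          (𝓝 (dot (natPt a) v)) := by
        have : Continuous fun ε : ℝ => dot (natPt a) (v + ε • u) :=
          (continuous_dot _).comp (by fun_prop)
        have h2 := (this.tendsto 0).mono_left (nhdsWithin_le_nhds (s := Ioi 0))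
        simpa using h2
      filter_upwards [hc.eventually (lt_mem_nhds hlt)] with ε hε
      exact ⟨s, hs, hε.le⟩
  filter_upwards [(Filter.eventually_all_finset D.A).2 h] with ε hε
  exact D.mem_of_forall _ hε

lemma exists_pos (D : PolyData f) (hf0 : f 0 = 0) (hv : v ∈ Γ₊ f) :
    ∃ i, 0 < v i := by
  by_contra hcon
  push Not at hcon
  obtain ⟨s, hs, h⟩ := D.exists_dot_le hv (z := fun _ => 1) fun _ => zero_le_one
  rw [dot_one_left, dot_one_left] at h
  have h0 : ∑ i, natPt s i ≤ 0 := h.trans (Finset.sum_nonpos fun i _ => hcon i)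
  have h1 := (Finset.sum_eq_zero_iff_of_nonneg fun i _ => natPt_nonneg s i).1
    (le_antisymm h0 (sum_nonneg fun i _ => natPt_nonneg s i))
  have h2 : s = 0 := funext fun i => by
    have := h1 i (Finset.mem_univ i)
    exact Nat.cast_eq_zero.1 this
  have := D.coeff_ne s hs
  rw [h2, taylorCoeff_zero] at this
  exact this hf0

lemma dim_pos (D : PolyData f) (hf0 : f 0 = 0) : 0 < n := by
  obtain ⟨s, hs⟩ := D.nonempty
  obtain ⟨i, -⟩ := D.exists_pos hf0 (D.mem hs)
  exact i.pos

lemma diag_mem (D : PolyData f) (hf0 : f 0 = 0) : (fun _ : Fin n => newtonDist f) ∈ Γ₊ f := by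
  have hn := D.dim_pos hf0
  have hcl : IsClosed {t : ℝ | (fun _ : Fin n => t) ∈ Γ₊ f} :=
    (isClosed_NewtonPolyhedron D).preimage (by fun_prop)
  refine hcl.csInf_mem ?_ ⟨0, fun t ht => ?_⟩
  · obtain ⟨s, hs⟩ := D.nonempty
    refine ⟨∑ i, natPt s i, NewtonPolyhedron_upward (D.mem hs) fun i => ?_⟩
    exact single_le_sum (f := natPt s) (fun i _ => natPt_nonneg s i) (Finset.mem_univ i)
  · exact D.nonneg (v := fun _ => t) ht ⟨0, hn⟩

lemma bddBelow (D : PolyData f) (hf0 : f 0 = 0) : BddBelow {t : ℝ | (fun _ : Fin n => t) ∈ Γ₊ f} :=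
  ⟨0, fun t ht => D.nonneg (v := fun _ => t) ht ⟨0, D.dim_pos hf0⟩⟩

lemma newtonDist_pos (D : PolyData f) (hf0 : f 0 = 0) : 0 < newtonDist f := by
  obtain ⟨i, hi⟩ := D.exists_pos hf0 (D.diag_mem hf0)
  exact hi

/-- Facet normals active at the diagonal point. -/
noncomputable def diagActive : Finset ℕ^[n] := D.active fun _ => newtonDist f

lemma dot_const_right (a : ℝ^[n]) (c : ℝ) : dot a (fun _ => c) = c * ∑ i, a i := by
  simp [dot, mul_sum, mul_comm]

lemma exists_diagActive (hf0 : f 0 = 0) : ∃ a ∈ D.diagActive, 0 < ∑ i, natPt a i := by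
  by_contra hcon
  push Not at hcon
  have h := D.eventually_mem (u := fun _ => -1) (D.diag_mem hf0) (fun a ha => by
    rw [dot_const_right]
    linarith [hcon a ha])
  obtain ⟨ε, hε, hpos⟩ := (h.and self_mem_nhdsWithin).exists
  have hpos : 0 < ε := hpos
  have h2 : (fun _ : Fin n => newtonDist f - ε) ∈ Γ₊ f := by
    convert hε using 1
    funext i
    simp [sub_eq_add_neg]
  have := csInf_le (D.bddBelow hf0) h2
  have h3 : newtonDist f ≤ newtonDist f - ε := this
  linarith

/-- The lineality space of the tangent cone at the diagonal point. -/
def lineal : Submodule ℝ ℝ^[n] where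
  carrier := {u | ∀ a ∈ D.diagActive, dot (natPt a) u = 0}
  add_mem' := fun hu hv a ha => by rw [dot_add_right, hu a ha, hv a ha, add_zero]
  zero_mem' := fun a _ => by simp [dot]
  smul_mem' := fun c u hu a ha => by rw [dot_smul_right, hu a ha, mul_zero]

lemma mem_lineal {u : ℝ^[n]} : u ∈ D.lineal ↔ ∀ a ∈ D.diagActive, dot (natPt a) u = 0 := Iff.rfl

lemma dot_intPt_nonneg_of_valid {b : Fin n → ℤ} {l : ℤ} {u v : ℝ^[n]}
    (hval : ValidPair (Γ₊ f) b l) (hv : dot (intPt b) v = l) {ε : ℝ} (hε : 0 < ε)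
    (h : v + ε • u ∈ Γ₊ f) : 0 ≤ dot (intPt b) u := by
  have h1 : (l : ℝ) ≤ dot (intPt b) (v + ε • u) := hval h
  rw [dot_add_right, dot_smul_right, hv] at h1
  exact nonneg_of_mul_nonneg_right (by linarith) hε

lemma face_sub_mem_lineal (hτ : IsPrincipalFace f τ) {p : ℝ^[n]}
    (hp : p ∈ τ) : p - (fun _ => newtonDist f) ∈ D.lineal := by
  obtain ⟨⟨b, l, hval, rfl⟩, hnt⟩ := hτ
  set q : ℝ^[n] := fun _ => newtonDist f with hq
  set τ := Γ₊ f ∩ Hplane (intPt b) (l : ℝ) with hτ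
  intro a ha
  rw [dot_sub_right]
  have h1 := D.active_le ha hp.1
  refine le_antisymm ?_ (by linarith)
  obtain ⟨y, hy, hyq⟩ := mem_intrinsicInterior.1 hnt
  have hpa : p ∈ affineSpan ℝ τ := subset_affineSpan ℝ _ hp
  have hqa : q ∈ affineSpan ℝ τ := hyq ▸ y.2
  let g : ℝ → affineSpan ℝ τ := fun ε => ⟨AffineMap.lineMap q p ε, AffineMap.lineMap_mem ε hqa hpa⟩
  have hg : Continuous g := by
    refine Continuous.subtype_mk ?_ _
    exact AffineMap.lineMap_continuous
  have hg0 : g 0 = y := Subtype.ext (by simp [g, hyq])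
  have hev : ∀ᶠ ε in 𝓝 (0 : ℝ), g ε ∈ ((↑) ⁻¹' τ : Set (affineSpan ℝ τ)) := by
    have := hg.tendsto 0
    rw [hg0] at this
    exact this.eventually (mem_interior_iff_mem_nhds.1 hy)
  have hev2 := hev.filter_mono (nhdsWithin_le_nhds (s := Iio 0))
  obtain ⟨ε, hε, hneg⟩ := (hev2.and self_mem_nhdsWithin).exists
  have hneg : ε < 0 := hneg
  have h3 : AffineMap.lineMap q p ε ∈ Γ₊ f := hε.1
  have h4 := D.active_le ha h3
  rw [AffineMap.lineMap_apply_module', dot_add_right, dot_smul_right, dot_sub_right] at h4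
  nlinarith

lemma mem_face_of_lineal (hf0 : f 0 = 0) (hτ : IsPrincipalFace f τ)
    {u : ℝ^[n]} (hu : u ∈ D.lineal) (h : (fun _ => newtonDist f) + u ∈ Γ₊ f) :
    (fun _ => newtonDist f) + u ∈ τ := by
  obtain ⟨⟨b, l, hval, rfl⟩, hnt⟩ := hτ
  set q : ℝ^[n] := fun _ => newtonDist f with hq
  have hqτ := intrinsicInterior_subset hnt
  have hql : dot (intPt b) q = l := hqτ.2
  obtain ⟨ε, hε, hpos⟩ := ((D.eventually_mem (u := -u) (D.diag_mem hf0) fun a ha => by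
    have := (D.lineal.neg_mem hu) a ha
    exact this.ge).and self_mem_nhdsWithin).exists
  have h1 := dot_intPt_nonneg_of_valid hval hql hpos hε
  have h2 := dot_intPt_nonneg_of_valid hval hql (u := u) one_pos (by rwa [one_smul])
  refine ⟨h, ?_⟩
  have h3 : dot (intPt b) (-u) = - dot (intPt b) u := by simp [dot]
  change dot (intPt b) (q + u) = l
  rw [dot_add_right, hql]
  linarith

lemma setDim_principal (hf0 : f 0 = 0) (hτ : IsPrincipalFace f τ) :
    setDim τ = finrank ℝ D.lineal := by
  have hqτ := intrinsicInterior_subset hτ.2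
  have : (affineSpan ℝ τ).direction = D.lineal := by
    rw [direction_affineSpan]
    apply le_antisymm
    · rw [vectorSpan_eq_span_vsub_set_right ℝ hqτ, Submodule.span_le]
      rintro _ ⟨p, hp, rfl⟩
      exact D.face_sub_mem_lineal hτ hp
    · intro u hu
      obtain ⟨ε, hε, hpos⟩ := ((D.eventually_mem (u := u) (D.diag_mem hf0) fun a ha =>
        (hu a ha).ge).and self_mem_nhdsWithin).exists
      have hpos : 0 < ε := hpos
      have h1 := D.mem_face_of_lineal hf0 hτ (D.lineal.smul_mem ε hu) hε
      have h2 := vsub_mem_vectorSpan ℝ h1 hqτ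
      rw [vsub_eq_sub, add_sub_cancel_left] at h2
      have := (vectorSpan ℝ τ).smul_mem ε⁻¹ h2
      rwa [inv_smul_smul₀ hpos.ne'] at this
  rw [setDim, this]

lemma one_notMem_lineal (hf0 : f 0 = 0) : (fun _ => (1 : ℝ)) ∉ D.lineal := by
  intro h
  obtain ⟨a, ha, hpos⟩ := D.exists_diagActive hf0
  have := h a ha
  rw [dot_const_right] at this
  linarith

end PolyData

lemma exists_large_image (b : Fin n → ℝ^[n]) (hb : LinearIndependent ℝ b)
    (J : Finset (Fin n)) {i₀ : Fin n} (hi₀ : i₀ ∈ J)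
    (hpos : ∀ k ∈ J, 0 < ∑ i, b k i) (hout : ∀ k ∉ J, ∑ i, b k i = 1) (R : ℝ) :
    ∃ c C : ℝ, 0 < c ∧ ∀ T : ℝ, 0 < T → ∃ G : Set ℝ^[n], IsCompact G ∧
      ENNReal.ofReal (c * T ^ (J.card - 1)) ≤ volume G ∧
      ∀ z ∈ G, ∑ i, z i ≤ T + C ∧ ∃ η : ℝ^[n], (∀ k, 0 ≤ η k) ∧
        (z = fun i => R + ∑ k, η k * b k i) ∧ T ≤ ∑ k ∈ J, η k * ∑ i, b k i := by
  classical
  have hn : 0 < n := i₀.pos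
  set β : ℝ^[n] := fun k => ∑ i, b k i with hβ
  have hβpos : ∀ k, 0 < β k := fun k => by
    by_cases hk : k ∈ J
    · exact hpos k hk
    · simp only [hβ]; rw [hout k hk]; exact one_pos
  let η : ℝ^[n] →ₗ[ℝ] ℝ^[n] :=
    { toFun := fun c k => (if k = i₀ then c i₀ - ∑ j ∈ J.erase i₀, c j else c k) / β k
      map_add' := fun c c' => by
        funext k
        simp only [Pi.add_apply, sum_add_distrib]
        split_ifs <;> ring
      map_smul' := fun r c => by
        funext k
        simp only [Pi.smul_apply, smul_eq_mul, ← mul_sum, RingHom.id_apply]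
        split_ifs <;> ring }
  let V : ℝ^[n] →ₗ[ℝ] ℝ^[n] := (Fintype.linearCombination ℝ b) ∘ₗ η
  have hη : ∀ c k, η c k = (if k = i₀ then c i₀ - ∑ j ∈ J.erase i₀, c j else c k) / β k :=
    fun _ _ => rfl
  have hV : ∀ c i, V c i = ∑ k, η c k * b k i := by
    intro c i
    simp [V, Fintype.linearCombination_apply]
  have hdet : LinearMap.det V ≠ 0 := by
    intro h0
    have h1 := LinearMap.bot_lt_ker_of_det_eq_zero h0
    obtain ⟨c, hc, hc0⟩ := Submodule.exists_mem_ne_zero_of_ne_bot h1.ne'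
    have h2 : ∑ k, η c k • b k = 0 := by
      have : V c = 0 := hc
      simpa [V, Fintype.linearCombination_apply] using this
    have h3 : ∀ k, η c k = 0 := Fintype.linearIndependent_iff.1 hb _ h2
    have h4 : ∀ k, k ≠ i₀ → c k = 0 := by
      intro k hk
      have := h3 k
      rw [hη, if_neg hk, div_eq_zero_iff] at this
      exact this.resolve_right (hβpos k).ne'
    have h5 := h3 i₀
    rw [hη, if_pos rfl, div_eq_zero_iff, sum_eq_zero fun j hj =>
      h4 j (ne_of_mem_erase hj), sub_zero] at h5
    apply hc0
    funext k
    by_cases hk : k = i₀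
    · rw [hk]; exact h5.resolve_right (hβpos i₀).ne'
    · exact h4 k hk
  refine ⟨|LinearMap.det V| * (1 / n) ^ (J.card - 1), n * R + 1 + n, by positivity,
    fun T hT => ?_⟩
  let lo : ℝ^[n] := fun k => if k = i₀ then T else 0
  let hi : ℝ^[n] := fun k => if k = i₀ then T + 1 else if k ∈ J then T / n else 1
  refine ⟨(fun x => (fun _ => R) + x) '' (V '' Icc lo hi), ?_, ?_, ?_⟩
  · exact (isCompact_Icc.image (LinearMap.continuous_of_finiteDimensional V)).image (by fun_prop)
  · rw [image_add_left, measure_preimage_add, Measure.addHaar_image_linearMap, Real.volume_Icc_pi,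
      mul_assoc, ENNReal.ofReal_mul (abs_nonneg _)]
    gcongr
    rw [← ENNReal.ofReal_prod_of_nonneg]
    · refine ENNReal.ofReal_le_ofReal ?_
      have : ∀ k, hi k - lo k = if k ∈ J.erase i₀ then T / n else 1 := by
        intro k
        simp only [hi, lo, Finset.mem_erase]
        by_cases h1 : k = i₀ <;> by_cases h2 : k ∈ J <;> simp [h1, h2]
      simp only [this]
      rw [Finset.prod_ite_mem, Finset.univ_inter, prod_const, Finset.card_erase_of_mem hi₀,
        ← mul_pow]
      refine le_of_eq ?_
      congr 1
      ring
    · intro k _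
      simp only [hi, lo]
      split_ifs <;> simp
      positivity
  · rintro _ ⟨_, ⟨c, ⟨hlo, hhi⟩, rfl⟩, rfl⟩
    have hc0 : T ≤ c i₀ ∧ c i₀ ≤ T + 1 := by
      have h1 := hlo i₀
      have h2 := hhi i₀
      simp only [lo, hi, if_true] at h1 h2
      exact ⟨h1, h2⟩
    have hc : ∀ k, k ≠ i₀ → 0 ≤ c k := fun k hk => by
      have h1 := hlo k
      simpa only [lo, if_neg hk] using h1
    have hJ : ∀ k ∈ J.erase i₀, c k ≤ T / n := fun k hk => by
      have h2 := hhi k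
      rw [Finset.mem_erase] at hk
      simpa only [hi, if_neg hk.1, if_pos hk.2] using h2
    have hJc : ∀ k, k ∉ J → c k ≤ 1 := fun k hk => by
      have h2 := hhi k
      have : k ≠ i₀ := fun h => hk (h ▸ hi₀)
      simpa only [hi, if_neg this, if_neg hk] using h2
    have hsum : ∑ j ∈ J.erase i₀, c j ≤ T := by
      refine (Finset.sum_le_card_nsmul _ _ _ hJ).trans ?_
      rw [nsmul_eq_mul, Finset.card_erase_of_mem hi₀]
      have h1 : ((J.card - 1 : ℕ) : ℝ) ≤ n := by
        have : J.card ≤ n := (Finset.card_le_univ J).trans_eq (Fintype.card_fin n)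
        exact_mod_cast (Nat.sub_le _ _).trans this
      rw [mul_div_assoc', div_le_iff₀ (by positivity)]
      nlinarith
    have hη0 : ∀ k, 0 ≤ η c k := fun k => by
      rw [hη]
      refine div_nonneg ?_ (hβpos k).le
      split_ifs with hk
      · linarith
      · exact hc k hk
    have hηβ : ∀ k, η c k * β k = if k = i₀ then c i₀ - ∑ j ∈ J.erase i₀, c j else c k :=
      fun k => by rw [hη, div_mul_cancel₀ _ (hβpos k).ne']
    have hJsum : ∑ k ∈ J, η c k * β k = c i₀ := by
      have h1 : ∑ k ∈ J.erase i₀, η c k * β k = ∑ k ∈ J.erase i₀, c k :=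
        sum_congr rfl fun k hk => by rw [hηβ k, if_neg (ne_of_mem_erase hk)]
      rw [← Finset.add_sum_erase J _ hi₀, hηβ, if_pos rfl, h1]
      ring
    refine ⟨?_, η c, hη0, ?_, ?_⟩
    · have h1 : ∑ i, ((fun _ => R) + V c : ℝ^[n]) i = n * R + ∑ k, η c k * β k := by
        simp only [Pi.add_apply, sum_add_distrib, hV]
        rw [sum_comm]
        simp [hβ, mul_sum]
      rw [← Finset.sum_add_sum_compl J (fun k => η c k * β k), hJsum] at h1
      refine h1.trans_le ?_
      have h2 : ∑ k ∈ Jᶜ, η c k * β k ≤ n := by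
        refine (Finset.sum_le_card_nsmul _ _ 1 fun k hk => ?_).trans ?_
        · rw [Finset.mem_compl] at hk
          rw [hηβ, if_neg (show k ≠ i₀ from fun h => hk (h ▸ hi₀))]
          exact hJc k hk
        · rw [nsmul_eq_mul, mul_one]
          exact_mod_cast (Finset.card_le_univ _).trans_eq (Fintype.card_fin n)
      linarith [hc0.2]
    · funext i
      change R + V c i = _
      rw [hV]
    · rw [hJsum]; exact hc0.1

namespace PolyData

lemma finrank_span_diagActive :
    finrank ℝ (span ℝ (natPt '' (D.diagActive : Set ℕ^[n]))) +
      finrank ℝ D.lineal = n := by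
  classical
  let M : Matrix D.diagActive (Fin n) ℝ := Matrix.of fun a => natPt a
  have h1 := M.mulVecLin.finrank_range_add_finrank_ker
  have h2 : LinearMap.ker M.mulVecLin = D.lineal := by
    ext u
    rw [LinearMap.mem_ker, mem_lineal]
    constructor
    · intro h a ha
      exact congrFun h ⟨a, ha⟩
    · intro h
      funext a
      exact h a a.2
  have h3 := M.rank_eq_finrank_span_row
  have h4 : Set.range M.row = natPt '' (D.diagActive : Set ℕ^[n]) := by
    ext u
    constructor
    · rintro ⟨a, rfl⟩
      exact ⟨a, a.2, rfl⟩
    · rintro ⟨a, ha, rfl⟩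
      exact ⟨⟨a, ha⟩, rfl⟩
  rw [h4] at h3
  rw [← h3, ← h2]
  rw [Module.finrank_fin_fun] at h1
  exact h1

lemma exists_active_basis (hf0 : f 0 = 0) :
    ∃ (b : Fin n → ℝ^[n]) (J : Finset (Fin n)) (i₀ : Fin n), LinearIndependent ℝ b ∧
      i₀ ∈ J ∧ J.card = n - finrank ℝ D.lineal ∧ (∀ k i, 0 ≤ b k i) ∧
      (∀ k ∈ J, 0 < ∑ i, b k i) ∧ (∀ k ∉ J, ∑ i, b k i = 1) ∧
      ∀ k ∈ J, ∃ a ∈ D.diagActive, b k = natPt a := by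
  classical
  obtain ⟨a, ha, hapos⟩ := D.exists_diagActive hf0
  have ha0 : natPt a ≠ 0 := fun h => by
    rw [h] at hapos
    simp at hapos
  obtain ⟨s, hst, has, hspan, hli⟩ := exists_linearIndepOn_id_extension
    (s := {natPt a}) (t := natPt '' (D.diagActive : Set ℕ^[n]))
    ((linearIndepOn_singleton_iff ℝ).2 ha0) (singleton_subset_iff.2 ⟨a, ha, rfl⟩)
  have hfin : s.Finite := (D.diagActive.finite_toSet.image _).subset hst
  obtain ⟨B, hsB, hBli, hBn, hnew⟩ := exists_completion hfin.toFinset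
    (by rwa [hfin.coe_toFinset])
  have hcard : Fintype.card B = n := by rw [Fintype.card_coe, hBn]
  let e : Fin n ≃ B := (Fintype.equivFinOfCardEq hcard).symm
  have haB : natPt a ∈ B := hsB (hfin.mem_toFinset.2 (has rfl))
  let J : Finset (Fin n) := Finset.univ.filter fun k => (e k : ℝ^[n]) ∈ s
  have hJ : ∀ k, k ∈ J ↔ (e k : ℝ^[n]) ∈ s := fun k => by simp [J]
  have hJcard : J.card = hfin.toFinset.card := by
    refine Finset.card_bij (fun k _ => (e k : ℝ^[n])) (fun k hk => ?_) (fun k _ k' _ h => ?_)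
      fun u hu => ?_
    · exact hfin.mem_toFinset.2 ((hJ k).1 hk)
    · exact e.injective (Subtype.ext h)
    · refine ⟨e.symm ⟨u, hsB hu⟩, ?_, by simp⟩
      rw [hJ]
      simpa using hfin.mem_toFinset.1 hu
  have hJa : ∀ k ∈ J, ∃ a ∈ D.diagActive, (e k : ℝ^[n]) = natPt a := fun k hk => by
    obtain ⟨a, ha, h⟩ := hst ((hJ k).1 hk)
    exact ⟨a, ha, h.symm⟩
  have hJn : ∀ k, k ∉ J → ∃ i, (e k : ℝ^[n]) = single i 1 := fun k hk =>
    hnew _ (e k).2 fun h => hk ((hJ k).2 (hfin.mem_toFinset.1 h))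
  have hnn : ∀ k i, 0 ≤ (e k : ℝ^[n]) i := fun k i => by
    by_cases hk : k ∈ J
    · obtain ⟨a, -, h⟩ := hJa k hk
      rw [h]; exact natPt_nonneg a i
    · obtain ⟨j, h⟩ := hJn k hk
      rw [h, Pi.single_apply]
      split_ifs <;> norm_num
  have hli' : LinearIndependent ℝ fun k => (e k : ℝ^[n]) :=
    (LinearIndependent.comp hBli e e.injective :)
  refine ⟨fun k => e k, J, e.symm ⟨natPt a, haB⟩, hli', ?_, ?_, hnn, ?_, ?_, hJa⟩
  · rw [hJ]; simpa using has rfl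
  · have h1 := D.finrank_span_diagActive
    have h2 : span ℝ (natPt '' (D.diagActive : Set ℕ^[n])) = span ℝ s :=
      le_antisymm (Submodule.span_le.2 hspan) (Submodule.span_mono hst)
    have := hfin.fintype
    rw [h2, finrank_span_set_eq_card (R := ℝ) (s := s) hli] at h1
    rw [hJcard, Set.Finite.card_toFinset, ← Set.toFinset_card]
    omega
  · intro k hk
    refine lt_of_le_of_ne (sum_nonneg fun i _ => hnn k i) fun h => ?_
    have h1 := (Finset.sum_eq_zero_iff_of_nonneg fun i _ => hnn k i).1 h.symm
    exact hli'.ne_zero k (funext fun i => h1 i (Finset.mem_univ i))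
  · intro k hk
    obtain ⟨j, h⟩ := hJn k hk
    simp [h]

/-- Lower bound for exponential volumes of sublevel sets. -/
lemma exists_volume_ge (hf0 : f 0 = 0) (hR : 0 ≤ R) :
    ∃ c t₀ : ℝ, 0 < c ∧ 2 ≤ t₀ ∧ ∀ t : ℝ, t₀ ≤ t → ∃ G : Set ℝ^[n], IsCompact G ∧
      G ⊆ oct n R ∧ (∀ z ∈ G, expSum D.S z ≤ 1 / t) ∧
      c * (t ^ (-(1 / newtonDist f)) * log t ^ (n - finrank ℝ D.lineal - 1)) ≤
        ∫ z in G, exp (-dot (fun _ => 1) z) := by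
  classical
  obtain ⟨b, J, i₀, hli, hi₀, hJ, hnn, hpos, hout, hact⟩ := D.exists_active_basis hf0
  obtain ⟨c, C, hc, H⟩ := exists_large_image b hli J hi₀ hpos hout R
  set d := newtonDist f with hd
  have hd0 : 0 < d := D.newtonDist_pos hf0
  have hS : (0 : ℝ) < D.S.card := by exact_mod_cast D.nonempty.card_pos
  have hS1 : (1 : ℝ) ≤ D.S.card := by exact_mod_cast D.nonempty.card_pos
  refine ⟨exp (-C) * (D.S.card : ℝ) ^ (-(1 / d)) * c * (1 / d) ^ (J.card - 1), 2,
    by positivity, le_rfl, fun t ht => ?_⟩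
  have ht0 : 0 < t := by linarith
  have hlt : 0 < log t := log_pos (by linarith)
  set T := (log t + log D.S.card) / d with hT
  have hTl : log t / d ≤ T := by rw [hT]; gcongr; linarith [log_nonneg hS1]
  have hT0 : 0 < T := lt_of_lt_of_le (by positivity) hTl
  obtain ⟨G, hG, hvol, hz⟩ := H T hT0
  refine ⟨G, hG, fun z hzG => ?_, fun z hzG => ?_, ?_⟩
  · obtain ⟨-, η, hη, rfl, -⟩ := hz z hzG
    intro i
    exact le_add_of_nonneg_right (sum_nonneg fun k _ => mul_nonneg (hη k) (hnn k i))
  · obtain ⟨-, η, hη, rfl, hTη⟩ := hz z hzG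
    have key : ∀ s ∈ D.S, d * T ≤ dot (natPt s) (fun i => R + ∑ k, η k * b k i) := by
      intro s hs
      have e1 : dot (natPt s) (fun i => R + ∑ k, η k * b k i) =
          R * ∑ i, natPt s i + ∑ k, η k * dot (natPt s) (b k) := by
        simp only [dot, mul_add, sum_add_distrib, mul_sum]
        congr 1
        · exact sum_congr rfl fun i _ => mul_comm _ _
        · rw [sum_comm]
          exact sum_congr rfl fun k _ => sum_congr rfl fun i _ => by ring
      rw [e1]
      have e2 : d * T ≤ ∑ k ∈ J, η k * dot (natPt s) (b k) := by
        refine (mul_le_mul_of_nonneg_left hTη hd0.le).trans ?_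
        rw [mul_sum]
        refine sum_le_sum fun k hk => ?_
        obtain ⟨a, ha, hba⟩ := hact k hk
        have h1 := D.active_le ha (D.mem hs)
        rw [dot_const_right, ← hba, ← hd] at h1
        rw [dot_comm (natPt s), mul_left_comm]
        exact mul_le_mul_of_nonneg_left h1 (hη k)
      have e3 : ∑ k ∈ J, η k * dot (natPt s) (b k) ≤ ∑ k, η k * dot (natPt s) (b k) :=
        Finset.sum_le_sum_of_subset_of_nonneg (Finset.subset_univ J) fun k _ _ =>
          mul_nonneg (hη k) (dot_nonneg (natPt_nonneg s) (hnn k))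
      have e4 : 0 ≤ R * ∑ i, natPt s i := mul_nonneg hR (sum_nonneg fun i _ => natPt_nonneg s i)
      linarith
    have h2 : expSum D.S (fun i => R + ∑ k, η k * b k i) ≤ D.S.card • exp (-(d * T)) :=
      Finset.sum_le_card_nsmul _ _ _ fun s hs => exp_le_exp.2 (neg_le_neg (key s hs))
    refine h2.trans (le_of_eq ?_)
    rw [hT, mul_div_cancel₀ _ hd0.ne', ← log_mul ht0.ne' hS.ne', Real.exp_neg,
      exp_log (by positivity), nsmul_eq_mul]
    field_simp
  · have h1 : c * T ^ (J.card - 1) ≤ (volume G).toReal := by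
      rw [← ENNReal.toReal_ofReal (show 0 ≤ c * T ^ (J.card - 1) by positivity)]
      exact ENNReal.toReal_mono hG.measure_lt_top.ne hvol
    have h2 : exp (-(T + C)) * (volume G).toReal ≤
        ∫ z in G, exp (-dot (fun _ => 1) z) := by
      have := setIntegral_mono_on (μ := volume) (s := G)
        (f := fun _ => exp (-(T + C))) (g := fun z => exp (-dot (fun _ => 1) z))
        (integrableOn_const hG.measure_lt_top.ne)
        ((contDiff_exp_dot (fun _ => 1)).continuous.continuousOn.integrableOn_compact hG)
        hG.measurableSet fun z hzG => by
          rw [exp_le_exp, dot_one_left]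
          linarith [(hz z hzG).1]
      rwa [setIntegral_const, smul_eq_mul, mul_comm] at this
    refine le_trans ?_ h2
    have h3 : exp (-(T + C)) = exp (-C) * (D.S.card : ℝ) ^ (-(1 / d)) * t ^ (-(1 / d)) := by
      rw [rpow_def_of_pos hS, rpow_def_of_pos ht0, ← exp_add, ← exp_add]
      congr 1
      rw [hT]
      field_simp
      ring
    have h4 : c * ((1 / d) ^ (J.card - 1) * log t ^ (J.card - 1)) ≤ (volume G).toReal := by
      refine le_trans ?_ h1
      rw [← mul_pow]
      gcongr
      rw [one_div_mul_eq_div]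
      exact hTl
    rw [h3, ← hJ]
    calc _ = exp (-C) * (D.S.card : ℝ) ^ (-(1 / d)) * t ^ (-(1 / d)) *
          (c * ((1 / d) ^ (J.card - 1) * log t ^ (J.card - 1))) := by ring
      _ ≤ _ := mul_le_mul_of_nonneg_left h4 (by positivity)

end PolyData

lemma SymK.mono_set {ι : Type*} {Ω Ω' : Set ℝ^[n]} {m : ι → ℝ^[n] → ℝ}
    (h : Ω' ⊆ Ω) : ∀ {u : ι → ℝ^[n] → ℂ}, SymK Ω k m u → SymK Ω' k m u := by
  induction k with
  | zero =>
    rintro u ⟨C, hC⟩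
    exact ⟨C, fun t z hz => hC t z (h hz)⟩
  | succ k ih =>
    rintro u ⟨⟨C, hC⟩, h2⟩
    exact ⟨⟨C, fun t z hz => hC t z (h hz)⟩, fun i => ih (h2 i)⟩

lemma Symb.mono_set {ι : Type*} {Ω Ω' : Set ℝ^[n]} {m : ι → ℝ^[n] → ℝ}
    {u : ι → ℝ^[n] → ℂ} (hu : Symb Ω m u) (h : Ω' ⊆ Ω) : Symb Ω' m u :=
  ⟨hu.smooth, fun k => (hu.est k).mono_set h⟩

lemma PhaseBound.mono {Ω Ω' : Set ℝ^[n]} {N F : ℝ^[n] → ℝ} (H : PhaseBound Ω N F)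
    (hΩ' : IsClosed Ω') (h : Ω' ⊆ Ω) : PhaseBound Ω' N F where
  closed := hΩ'
  smooth := H.smooth
  cont := H.cont
  pos := H.pos
  symb i := (H.symb i).mono_set h
  lower := by
    obtain ⟨c, hc, hl⟩ := H.lower
    exact ⟨c, hc, fun z hz => hl z (h hz)⟩

/-- Decay of an oscillatory integral whose phase dominates an exponential weight. -/
lemma PhaseBound.exists_decay {N F : ℝ^[n] → ℝ}
    (H : PhaseBound Ω N F) (hΩ : ∀ z ∈ Ω, ∀ i, 0 ≤ z i) {ρ : ℝ^[n]} (hρ : ∀ i, 1 ≤ ρ i)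
    {T : Finset ℝ^[n]} (hρT : ρ ∉ T)
    (hli : LinearIndepOn ℝ id (insert ρ (T : Set ℝ^[n]))) {μ ε B : ℝ}
    (hμ : 0 < μ) (hε : 0 < ε) (hB : 0 < B)
    (h : ∀ z ∈ Ω, exp (-dot ρ z / μ + ε * ∑ u ∈ T, |dot u z|) ≤ B * N z)
   
    (hu : Symb Ω (fun (_ : Unit) z => exp (-dot ρ z)) fun _ z => u z)
    (h0 : ∀ z, z ∉ Ω → u z = 0) :
    ∃ C, 0 ≤ C ∧ ∀ t : ℝ, 2 ≤ t → ‖∫ z, osc F t z * u z‖ ≤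
      C * (t ^ (-μ) * log t ^ (n - 1 - T.card)) := by
  obtain ⟨K, hK⟩ := exists_nat_ge (2 * μ)
  obtain ⟨C₁, hC₁, h₁⟩ := exists_volume_le hρ hρT hli hμ hε hB H.closed.measurableSet hΩ h hK
  have hu' : Symb Ω (fun (_ : Ici (2 : ℝ)) z => exp (-dot ρ z)) fun _ z => u z :=
    hu.comp fun _ => ()
  obtain ⟨C₂, hC₂, h₂⟩ := H.norm_integral_le (s := fun t : Ici (2 : ℝ) => (t : ℝ))
    (fun t => zero_le_two.trans t.2) K (fun _ _ _ => (exp_pos _).le)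
    (fun _ => (integrableOn_exp_neg_dot (fun i => zero_lt_one.trans_le (hρ i)) 0).mono_set
      fun z hz => hΩ z hz) hu' fun _ z hz => h0 z hz
  refine ⟨C₂ * C₁, mul_nonneg hC₂ hC₁, fun t ht => (h₂ ⟨t, ht⟩).trans ?_⟩
  rw [mul_assoc]
  exact mul_le_mul_of_nonneg_left (h₁ t ht) hC₂

/-- The amplitude in exponential coordinates. -/
noncomputable def amp (σ ρ : ℝ^[n]) (φ : ℝ^[n] → ℂ) (z : ℝ^[n]) : ℂ :=
  (exp (-dot ρ z) : ℂ) * φ (expc σ z)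

/-- Smooth amplitudes supported in the box `|x_i| ≤ e^{-R}`. -/
structure IsAmp (R : ℝ) (φ : ℝ^[n] → ℂ) : Prop where
  smooth : ContDiff ℝ ∞ φ
  eq_zero : ∀ x i, exp (-R) < |x i| → φ x = 0

lemma IsAmp.amp_eq_zero (hφ : IsAmp R φ)
    (hσ : ∀ i, |σ i| = 1) (ρ : ℝ^[n]) (hz : z ∉ oct n R) :
    amp σ ρ φ z = 0 := by
  obtain ⟨i, hi⟩ : ∃ i, z i < R := by simpa [oct] using hz
  rw [amp, hφ.eq_zero _ i, mul_zero]
  rw [abs_expc_le hσ]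
  exact Real.exp_lt_exp.2 (by linarith)

lemma IsAmp.symb (hR : 0 ≤ R) (hφ : IsAmp R φ) (hσ : ∀ i, |σ i| = 1) (ρ : ℝ^[n]) {ι : Type*} : Symb
    (oct n R) (fun (_ : ι) z => exp (-dot ρ z)) fun _ z => amp σ ρ φ z :=
  ((symb_exp_dot (oct n R) ρ).mul (symb_comp_expc hσ hR hφ.smooth)).mono (fun _ _ _ => by positivity) (c := 1)
    fun _ _ _ => by simp

namespace LocalModel
variable {φ : ℝ^[n] → ℂ}

lemma exists_decay_of_mem (hσ : ∀ i, |σ i| = 1) (hR : 0 ≤ R)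
    (H : PhaseBound (oct n R) M.N (M.phase σ)) (hφ : IsAmp R φ) (hn : 0 < n) {ρ : ℝ^[n]}
    (hρ : ∀ i, 1 ≤ ρ i) {μ : ℝ} (hμ : 0 < μ) (hmem : μ⁻¹ • ρ ∈ Γ₊ f) :
    ∃ C, 0 ≤ C ∧ ∀ t : ℝ, 2 ≤ t → ‖∫ z, osc (M.phase σ) t z * amp σ ρ φ z‖ ≤
      C * (t ^ (-μ) * log t ^ (n - 1)) := by
  have hρ0 : ρ ≠ 0 := fun h => by
    have := hρ ⟨0, hn⟩
    rw [h] at this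
    exact absurd this (by norm_num)
  have hz0 : ∀ z ∈ oct n R, ∀ i, 0 ≤ z i := fun z hz i => hR.trans (hz i)
  have := H.exists_decay hz0 hρ (T := ∅) (by simp)
    (by simpa using (linearIndepOn_singleton_iff (R := ℝ) (v := id) (i := ρ)).2 hρ0) hμ
    one_pos one_pos (fun z hz => ?_) (hφ.symb hR hσ ρ) fun z hz => hφ.amp_eq_zero hσ ρ hz
  · simpa using this
  · refine le_trans (le_of_eq ?_) ((M.exp_le_N hmem (hz0 z hz)).trans_eq (one_mul _).symm)
    rw [Finset.sum_empty, dot_comm (μ⁻¹ • ρ), dot_smul_right, dot_comm z]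
    congr 1
    field_simp
    ring

end LocalModel

namespace PolyData

lemma exists_lineal_basis :
    ∃ T : Finset ℝ^[n], (∀ u ∈ T, u ∈ D.lineal) ∧
      LinearIndepOn ℝ id (T : Set ℝ^[n]) ∧
      span ℝ (T : Set ℝ^[n]) = D.lineal ∧
      T.card = finrank ℝ D.lineal := by
  classical
  set b := Module.finBasis ℝ D.lineal
  have hli : LinearIndependent ℝ fun i => (b i : ℝ^[n]) :=
    b.linearIndependent.map' D.lineal.subtype (by simp)
  refine ⟨Finset.univ.image fun i => (b i : ℝ^[n]), by simp, ?_, ?_, ?_⟩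
  · rw [Finset.coe_image, Finset.coe_univ, image_univ]
    exact hli.linearIndepOn_id
  · have h := congr_arg (Submodule.map D.lineal.subtype) b.span_eq
    rw [Submodule.map_span, Submodule.map_top, Submodule.range_subtype, ← range_comp] at h
    rw [Finset.coe_image, Finset.coe_univ, image_univ]
    exact h
  · rw [Finset.card_image_of_injective _ hli.injective, Finset.card_univ, Fintype.card_fin]

lemma linearIndepOn_insert_one (hf0 : f 0 = 0) {T : Finset ℝ^[n]}
    (hT : LinearIndepOn ℝ id (T : Set ℝ^[n])) (hs : span ℝ (T : Set ℝ^[n]) = D.lineal) :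
    LinearIndepOn ℝ id (insert (fun _ => (1 : ℝ)) (T : Set ℝ^[n])) :=
  hT.id_insert (hs ▸ D.one_notMem_lineal hf0)

/-- Quantitative form of `q_* + lineal ⊆ P` near `q_*`. -/
lemma exists_lineal_le (hf0 : f 0 = 0) {T : Finset ℝ^[n]} (hT : ∀ u ∈ T, u ∈ D.lineal) :
    ∃ ε : ℝ, 0 < ε ∧ ∀ z : ℝ^[n], (∀ i, 0 ≤ z i) →
      ε * ∑ u ∈ T, |dot u z| ≤ log (expSum D.S z) + newtonDist f * ∑ i, z i := by
  have h1 : ∀ᶠ ε in 𝓝[>] (0 : ℝ), ∀ u ∈ T,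
      (fun _ => newtonDist f) + ε • u ∈ Γ₊ f ∧
      (fun _ => newtonDist f) + ε • -u ∈ Γ₊ f := by
    refine (Finset.eventually_all T).2 fun u hu => ?_
    have hu' := D.mem_lineal.1 (hT u hu)
    refine (D.eventually_mem (D.diag_mem hf0) fun a ha => (hu' a ha).ge).and
      (D.eventually_mem (D.diag_mem hf0) fun a ha => ?_)
    rw [← neg_one_smul ℝ u, dot_smul_right, hu' a ha, mul_zero]
  obtain ⟨ε, hε, hε0⟩ := (h1.and self_mem_nhdsWithin).exists
  have hε0 : 0 < ε := hε0
  refine ⟨ε / (T.card + 1), by positivity, fun z hz => ?_⟩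
  have hle : ∀ p ∈ Γ₊ f, -dot p z ≤ log (expSum D.S z) := fun p hp => by
    obtain ⟨s, hs, hle⟩ := D.exists_dot_le hp hz
    rw [Real.le_log_iff_exp_le (expSum_pos D.nonempty z)]
    refine (exp_le_exp.2 ?_).trans (exp_le_expSum hs z)
    rw [dot_comm p, dot_comm (natPt s)]
    linarith
  have hdiag : dot (fun _ => newtonDist f) z = newtonDist f * ∑ i, z i := by
    rw [dot_comm, dot_const_right]
  set L := log (expSum D.S z) + newtonDist f * ∑ i, z i with hL
  have h0 : 0 ≤ L := by
    have := hle _ (D.diag_mem hf0)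
    rw [hdiag] at this
    linarith
  have h2 : ∀ u ∈ T, |dot u z| ≤ L / ε := fun u hu => by
    have h3 := hle _ (hε u hu).1
    have h4 := hle _ (hε u hu).2
    rw [dot_comm, dot_add_right, dot_smul_right, dot_comm z, hdiag, dot_comm z] at h3 h4
    have h5 : dot (-u) z = -dot u z := by
      rw [dot_comm, ← neg_one_smul ℝ u, dot_smul_right, dot_comm, neg_one_mul]
    rw [h5] at h4
    rw [le_div_iff₀ hε0]
    nth_rw 1 [← abs_of_pos hε0]
    rw [← abs_mul, abs_le]
    constructor <;> linarith
  have h6 := Finset.sum_le_card_nsmul _ _ _ h2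
  rw [nsmul_eq_mul] at h6
  calc ε / (T.card + 1) * ∑ u ∈ T, |dot u z| ≤ ε / (T.card + 1) * (T.card * (L / ε)) := by gcongr
    _ = T.card / (T.card + 1) * L := by field_simp
    _ ≤ 1 * L := by
        gcongr
        rw [div_le_one (by positivity)]
        linarith
    _ = L := one_mul _

end PolyData

namespace LocalModel
variable {φ : ℝ^[n] → ℂ}

lemma exists_decay_diag (hR : 0 ≤ R) (H : PhaseBound (oct n R) M.N (M.phase σ)) (hf0 : f 0 = 0)
   
    (hu : Symb (oct n R) (fun (_ : Unit) z => exp (-dot (fun _ => 1) z)) fun _ z => u z)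
    (h0 : ∀ z, z ∉ oct n R → u z = 0) :
    ∃ C, 0 ≤ C ∧ ∀ t : ℝ, 2 ≤ t → ‖∫ z, osc (M.phase σ) t z * u z‖ ≤
      C * (t ^ (-(1 / newtonDist f)) *
        log t ^ (n - finrank ℝ M.lineal - 1)) := by
  obtain ⟨T, hTl, hli, hs, hcard⟩ := M.exists_lineal_basis
  obtain ⟨ε, hε, hle⟩ := M.exists_lineal_le hf0 hTl
  have hd := M.newtonDist_pos hf0
  have hz0 : ∀ z ∈ oct n R, ∀ i, 0 ≤ z i := fun z hz i => hR.trans (hz i)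
  have := H.exists_decay hz0 (fun _ => le_rfl)
    (fun h => M.one_notMem_lineal hf0 (hTl _ h)) (M.linearIndepOn_insert_one hf0 hli hs)
    (one_div_pos.2 hd) hε one_pos (fun z hz => ?_) hu h0
  · rwa [hcard, Nat.sub_right_comm] at this
  · rw [one_mul, ← Real.le_log_iff_exp_le (M.N_pos z), dot_one_left, one_div, div_inv_eq_mul]
    have := hle z (hz0 z hz)
    rw [N]
    linarith

end LocalModel

/-- The asymptotic scale `t^α (log t)^j`. -/
noncomputable def scale (p : ℝ × ℕ) (t : ℝ) : ℂ := ((t ^ p.1 * log t ^ p.2 : ℝ) : ℂ)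

/-- Finite combinations of the scale functions with indices in `A`. -/
noncomputable def polyhom (A : Set (ℝ × ℕ)) : Submodule ℂ (ℝ → ℂ) := span ℂ (scale '' A)

/-- `g` has a finite expansion in the scale, up to an error `O(t^{-l} (log t)^k)`. -/
def HasExp (k : ℕ) (l : ℝ) (g : ℝ → ℂ) : Prop :=
  ∃ h ∈ polyhom {p | -l < p.1}, ∃ K : ℝ, ∀ t : ℝ, 2 ≤ t →
    ‖g t - h t‖ ≤ K * (t ^ (-l) * log t ^ k)

section
variable {l : ℝ} {g h : ℝ → ℂ}

lemma HasExp.of_bound {K : ℝ} (hg : ∀ t : ℝ, 2 ≤ t → ‖g t‖ ≤ K * (t ^ (-l) * log t ^ k)) :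
    HasExp k l g :=
  ⟨0, zero_mem _, K, by simpa using hg⟩

lemma HasExp.add (hg : HasExp k l g) (hh : HasExp k l h) : HasExp k l fun t => g t + h t := by
  obtain ⟨p, hp, K, hK⟩ := hg
  obtain ⟨q, hq, L, hL⟩ := hh
  refine ⟨p + q, add_mem hp hq, K + L, fun t ht => ?_⟩
  rw [Pi.add_apply, add_mul, add_sub_add_comm]
  exact (norm_add_le _ _).trans (add_le_add (hK t ht) (hL t ht))

lemma HasExp.const_mul (hg : HasExp k l g) (a : ℂ) : HasExp k l fun t => a * g t := by
  obtain ⟨p, hp, K, hK⟩ := hg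
  refine ⟨a • p, smul_mem _ _ hp, ‖a‖ * K, fun t ht => ?_⟩
  rw [Pi.smul_apply, smul_eq_mul, ← mul_sub, norm_mul, mul_assoc]
  exact mul_le_mul_of_nonneg_left (hK t ht) (norm_nonneg _)

lemma HasExp.zero : HasExp k l fun _ => 0 := .of_bound (K := 0) (by simp)

lemma HasExp.sum {κ : Type*} (s : Finset κ) {w : κ → ℝ → ℂ} (hw : ∀ j ∈ s, HasExp k l (w j)) :
    HasExp k l fun t => ∑ j ∈ s, w j t := by
  classical
  induction s using induction_on with
  | empty => simpa using HasExp.zero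
  | insert a s ha ih =>
    simp only [sum_insert ha]
    exact (hw a (by simp)).add (ih fun j hj => hw j (by simp [hj]))

lemma hasDerivAt_real_scale (α : ℝ) (j : ℕ) {t : ℝ} (ht : 0 < t) :
    HasDerivAt (fun t : ℝ => t ^ α * log t ^ j)
      ((α * (t ^ α * log t ^ j) + j * (t ^ α * log t ^ (j - 1))) / t) t := by
  refine ((Real.hasDerivAt_rpow_const (p := α) (Or.inl ht.ne')).mul
    ((Real.hasDerivAt_log ht.ne').pow j)).congr_deriv ?_
  rw [Real.rpow_sub_one ht.ne']
  simp only [Pi.pow_apply]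
  field_simp

lemma hasDerivAt_scale (α : ℝ) (j : ℕ) {t : ℝ} (ht : 0 < t) :
    HasDerivAt (scale (α, j)) ((α * scale (α, j) t + j * scale (α, j - 1) t) / t) t := by
  refine ((hasDerivAt_real_scale α j ht).ofReal_comp).congr_deriv ?_
  simp only [scale]
  push_cast
  rfl

lemma exists_polyhom_solution {ρ : ℝ} (hρ : -l < ρ) {p : ℝ → ℂ}
    (hp : p ∈ polyhom {p | -l < p.1}) :
    ∃ P ∈ polyhom {p | -l < p.1}, ∀ t : ℝ, 0 < t → HasDerivAt P ((ρ * P t + p t) / t) t := by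
  have hmem : ∀ (α : ℝ) (j : ℕ), -l < α → scale (α, j) ∈ polyhom {p : ℝ × ℕ | -l < p.1} :=
    fun α j h => subset_span ⟨(α, j), h, rfl⟩
  induction hp using Submodule.span_induction with
  | mem x hx =>
    obtain ⟨⟨α, j⟩, hα, rfl⟩ := hx
    have hα : -l < α := hα
    by_cases h : α = ρ
    · subst h
      refine ⟨(1 / (j + 1 : ℂ)) • scale (α, j + 1), smul_mem _ _ (hmem _ _ hα),
        fun t ht => ?_⟩
      refine ((hasDerivAt_scale α (j + 1) ht).const_smul (1 / (j + 1 : ℂ))).congr_deriv ?_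
      have : (j + 1 : ℂ) ≠ 0 := by exact_mod_cast j.succ_ne_zero
      have ht' : (t : ℂ) ≠ 0 := by exact_mod_cast ht.ne'
      simp only [Pi.smul_apply, smul_eq_mul, Nat.add_sub_cancel]
      push_cast
      field_simp
    · have h' : (α : ℂ) - ρ ≠ 0 := by exact_mod_cast sub_ne_zero.2 h
      induction j with
      | zero =>
        refine ⟨(1 / (α - ρ : ℂ)) • scale (α, 0), smul_mem _ _ (hmem _ _ hα),
          fun t ht => ?_⟩
        refine ((hasDerivAt_scale α 0 ht).const_smul (1 / (α - ρ : ℂ))).congr_deriv ?_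
        have ht' : (t : ℂ) ≠ 0 := by exact_mod_cast ht.ne'
        simp only [Pi.smul_apply, smul_eq_mul]
        field_simp
        push_cast
        ring
      | succ j ih =>
        obtain ⟨Q, hQ, hQ'⟩ := ih hα
        refine ⟨(1 / (α - ρ : ℂ)) • (scale (α, j + 1) - (j + 1 : ℂ) • Q),
          smul_mem _ _ (sub_mem (hmem _ _ hα) (smul_mem _ _ hQ)),
          fun t ht => ?_⟩
        refine (((hasDerivAt_scale α (j + 1) ht).sub ((hQ' t ht).const_smul
          (j + 1 : ℂ))).const_smul (1 / (α - ρ : ℂ))).congr_deriv ?_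
        have ht' : (t : ℂ) ≠ 0 := by exact_mod_cast ht.ne'
        simp only [Pi.smul_apply, Pi.sub_apply, smul_eq_mul, Nat.add_sub_cancel]
        field_simp
        push_cast
        ring
  | zero => exact ⟨0, zero_mem _, fun t _ => (hasDerivAt_const t (0 : ℂ)).congr_deriv (by simp)⟩
  | add x y _ _ hx hy =>
    obtain ⟨P, hP, hP'⟩ := hx
    obtain ⟨Q, hQ, hQ'⟩ := hy
    refine ⟨P + Q, add_mem hP hQ, fun t ht => ((hP' t ht).add (hQ' t ht)).congr_deriv ?_⟩
    simp only [Pi.add_apply]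
    ring
  | smul a x _ hx =>
    obtain ⟨P, hP, hP'⟩ := hx
    refine ⟨a • P, smul_mem _ _ hP, fun t ht => ((hP' t ht).const_smul a).congr_deriv ?_⟩
    simp only [Pi.smul_apply, smul_eq_mul]
    ring

lemma tendsto_scale_zero {δ : ℝ} (hδ : 0 < δ) (k : ℕ) :
    Tendsto (fun t : ℝ => t ^ (-δ) * log t ^ k) atTop (𝓝 0) := by
  have h := (isLittleO_log_rpow_rpow_atTop (k : ℝ) hδ).tendsto_div_nhds_zero
  refine h.congr' ?_
  filter_upwards [eventually_gt_atTop 0] with t ht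
  rw [rpow_neg ht.le, rpow_natCast, div_eq_inv_mul]

lemma exists_antideriv {δ : ℝ} (hδ : 0 < δ) (k : ℕ) :
    ∃ B : ℝ → ℝ, (∀ t, 0 < t → HasDerivAt B (-(t ^ (-δ) * log t ^ k / t)) t) ∧
      Tendsto B atTop (𝓝 0) ∧ ∃ C, ∀ t : ℝ, 2 ≤ t → B t ≤ C * (t ^ (-δ) * log t ^ k) := by
  induction k with
  | zero =>
    refine ⟨fun t => δ⁻¹ * (t ^ (-δ) * log t ^ 0), fun t ht => ?_, ?_, δ⁻¹, fun t _ => le_rfl⟩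
    · refine ((hasDerivAt_real_scale (-δ) 0 ht).const_mul δ⁻¹).congr_deriv ?_
      field_simp
      push_cast
      ring
    · simpa using (tendsto_scale_zero hδ 0).const_mul δ⁻¹
  | succ k ih =>
    obtain ⟨B, hB, hB0, C, hC⟩ := ih
    refine ⟨fun t => δ⁻¹ * (t ^ (-δ) * log t ^ (k + 1)) + δ⁻¹ * (k + 1) * B t,
      fun t ht => ?_, ?_, δ⁻¹ + δ⁻¹ * (k + 1) * |C| / log 2, fun t ht => ?_⟩
    · refine (((hasDerivAt_real_scale (-δ) (k + 1) ht).const_mul δ⁻¹).add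
        ((hB t ht).const_mul (δ⁻¹ * (k + 1)))).congr_deriv ?_
      rw [Nat.add_sub_cancel]
      push_cast
      field_simp
      ring
    · simpa using ((tendsto_scale_zero hδ (k + 1)).const_mul δ⁻¹).add (hB0.const_mul (δ⁻¹ * (k + 1)))
    · have h2 : 0 < log 2 := log_pos (by norm_num)
      have h3 : log 2 ≤ log t := log_le_log (by norm_num) ht
      have h4 : 0 ≤ t ^ (-δ) * log t ^ k := by
        have : 0 ≤ log t := h2.le.trans h3
        positivity
      rw [add_mul]
      refine add_le_add le_rfl ?_
      calc δ⁻¹ * (k + 1) * B t ≤ δ⁻¹ * (k + 1) * (|C| * (t ^ (-δ) * log t ^ k)) := by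
            gcongr
            exact (hC t ht).trans (by gcongr; exact le_abs_self C)
        _ = δ⁻¹ * (k + 1) * |C| / log 2 * (t ^ (-δ) * log t ^ k * log 2) := by field_simp
        _ ≤ δ⁻¹ * (k + 1) * |C| / log 2 * (t ^ (-δ) * log t ^ k * log t) := by gcongr
        _ = _ := by ring

lemma HasExp.of_ode {ρ : ℝ} (hρ : -l < ρ) (hh : HasExp k l h)
    (hg : ∀ t : ℝ, 2 ≤ t → HasDerivAt g ((ρ * g t + h t) / t) t) : HasExp k l g := by
  obtain ⟨p, hp, K, hK⟩ := hh
  obtain ⟨P, hP, hP'⟩ := exists_polyhom_solution hρ hp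
  obtain ⟨B, hB, hB0, C, hC⟩ := exists_antideriv (show 0 < ρ + l by linarith) k
  set u : ℝ → ℂ := fun t => scale (-ρ, 0) t * (g t - P t) with hu
  have hu' : ∀ t : ℝ, 2 ≤ t → HasDerivAt u (scale (-ρ, 0) t * (h t - p t) / t) t := by
    intro t ht
    have ht0 : 0 < t := by linarith
    refine ((hasDerivAt_scale (-ρ) 0 ht0).mul ((hg t ht).sub (hP' t ht0))).congr_deriv ?_
    push_cast
    simp only [Pi.sub_apply]
    ring
  have hscale : ∀ t : ℝ, 0 < t → ‖scale (-ρ, 0) t‖ = t ^ (-ρ) := fun t ht => by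
    rw [scale, pow_zero, mul_one, norm_real, norm_of_nonneg (by positivity)]
  have hu'' : ∀ t : ℝ, 2 ≤ t → ‖scale (-ρ, 0) t * (h t - p t) / t‖ ≤
      |K| * (t ^ (-(ρ + l)) * log t ^ k / t) := by
    intro t ht
    have ht0 : 0 < t := by linarith
    have hl0 : 0 ≤ log t := log_nonneg (by linarith)
    rw [norm_div, norm_mul, hscale t ht0, norm_real, norm_of_nonneg ht0.le, neg_add,
      rpow_add ht0]
    calc t ^ (-ρ) * ‖h t - p t‖ / t ≤ t ^ (-ρ) * (|K| * (t ^ (-l) * log t ^ k)) / t := by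
          gcongr
          exact (hK t ht).trans (by gcongr; exact le_abs_self K)
      _ = _ := by ring
  have key : ∀ t s : ℝ, 2 ≤ t → t ≤ s → ‖u s - u t‖ ≤ |K| * (B t - B s) := by
    intro t s ht hts
    have hBd : ∀ x : ℝ, 2 ≤ x → HasDerivAt (fun s => |K| * (B t - B s))
        (|K| * (x ^ (-(ρ + l)) * log x ^ k / x)) x := fun x hx =>
      (((hB x (by linarith)).const_sub (B t)).const_mul |K|).congr_deriv (by ring)
    refine image_norm_le_of_norm_deriv_right_le_deriv_boundary' (a := t) (b := s)
      (f := fun s => u s - u t) (B := fun s => |K| * (B t - B s))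
      (f' := fun x => scale (-ρ, 0) x * (h x - p x) / x)
      (B' := fun x => |K| * (x ^ (-(ρ + l)) * log x ^ k / x))
      (fun x hx => ((hu' x (ht.trans hx.1)).sub_const _).continuousAt.continuousWithinAt)
      (fun x hx => ((hu' x (ht.trans hx.1)).sub_const _).hasDerivWithinAt) (by simp)
      (fun x hx => (hBd x (ht.trans hx.1)).continuousAt.continuousWithinAt)
      (fun x hx => (hBd x (ht.trans hx.1)).hasDerivWithinAt)
      (fun x hx => hu'' x (ht.trans hx.1)) (right_mem_Icc.2 hts)
  have hcauchy : CauchySeq u := by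
    refine Metric.cauchySeq_iff'.2 fun ε hε => ?_
    have h1 : Tendsto (fun s => |K| * B s) atTop (𝓝 0) := by simpa using hB0.const_mul |K|
    obtain ⟨N, hN⟩ := eventually_atTop.1 (h1.eventually (Metric.ball_mem_nhds 0 (half_pos hε)))
    have h2 : ∀ s, N ≤ s → |(|K| * B s)| < ε / 2 := fun s hs => by simpa using hN s hs
    refine ⟨max N 2, fun s hs => ?_⟩
    rw [dist_eq_norm]
    refine (key _ s (le_max_right _ _) hs).trans_lt ?_
    have h3 := abs_lt.1 (h2 _ (le_max_left N 2))
    have h4 := abs_lt.1 (h2 s ((le_max_left _ _).trans hs))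
    linarith [h3.2, h4.1]
  obtain ⟨L, hL⟩ := cauchySeq_tendsto_of_complete hcauchy
  have hlim : ∀ t : ℝ, 2 ≤ t → ‖L - u t‖ ≤ |K| * B t := by
    intro t ht
    have h1 : Tendsto (fun s => ‖u s - u t‖) atTop (𝓝 ‖L - u t‖) := (hL.sub_const _).norm
    have h2 : Tendsto (fun s => |K| * (B t - B s)) atTop (𝓝 (|K| * (B t - 0))) :=
      (hB0.const_sub _).const_mul _
    rw [sub_zero] at h2
    exact le_of_tendsto_of_tendsto h1 h2
      ((eventually_ge_atTop t).mono fun s hs => key t s ht hs)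
  refine ⟨P + L • scale (ρ, 0), add_mem hP (smul_mem _ _
    (subset_span ⟨(ρ, 0), hρ, rfl⟩)), |K| * C, fun t ht => ?_⟩
  have ht0 : 0 < t := by linarith
  have h1 : g t - (P + L • scale (ρ, 0)) t = -(scale (ρ, 0) t * (L - u t)) := by
    have : scale (ρ, 0) t * scale (-ρ, 0) t = 1 := by
      simp only [scale, pow_zero, mul_one]
      rw [← ofReal_mul, ← rpow_add ht0, add_neg_cancel, Real.rpow_zero,
        ofReal_one]
    simp only [hu, Pi.add_apply, Pi.smul_apply, smul_eq_mul]
    linear_combination (-(g t - P t)) * this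
  rw [h1, norm_neg, norm_mul]
  have h2 : ‖scale (ρ, 0) t‖ = t ^ ρ := by
    rw [scale, pow_zero, mul_one, norm_real, norm_of_nonneg (by positivity)]
  rw [h2]
  calc t ^ ρ * ‖L - u t‖ ≤ t ^ ρ * (|K| * (C * (t ^ (-(ρ + l)) * log t ^ k))) := by
        gcongr
        exact (hlim t ht).trans (by gcongr; exact hC t ht)
    _ = |K| * C * (t ^ ρ * t ^ (-(ρ + l)) * log t ^ k) := by ring
    _ = _ := by rw [← rpow_add ht0]; congr 4; ring

end

lemma norm_scale (p : ℝ × ℕ) {t : ℝ} (ht : 1 ≤ t) :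
    ‖scale p t‖ = t ^ p.1 * log t ^ p.2 := by
  have := log_nonneg ht
  rw [scale, norm_real, norm_of_nonneg (by positivity)]

lemma scale_ne_zero (p : ℝ × ℕ) {t : ℝ} (ht : 1 < t) : scale p t ≠ 0 := by
  have := log_pos ht
  rw [scale, Complex.ofReal_ne_zero]
  positivity

lemma tendsto_scale_div {p q : ℝ × ℕ} (h : toLex q < toLex p) :
    Tendsto (fun t => scale q t / scale p t) atTop (𝓝 0) := by
  obtain ⟨α, i⟩ := q
  obtain ⟨β, j⟩ := p
  have hlog := Real.tendsto_log_atTop.eventually_ge_atTop (1 : ℝ)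
  rw [tendsto_zero_iff_norm_tendsto_zero]
  rcases toLex_lt_toLex.1 h with h | ⟨h1, h2⟩
  · have h : α < β := h
    refine squeeze_zero' (.of_forall fun _ => norm_nonneg _) ?_
      (tendsto_scale_zero (sub_pos.2 h) i)
    filter_upwards [eventually_ge_atTop 1, hlog] with t ht hl
    have ht0 : 0 < t := by linarith
    rw [norm_div, norm_scale _ ht, norm_scale _ ht, neg_sub, Real.rpow_sub ht0]
    have : 1 ≤ log t ^ j := one_le_pow₀ hl
    have h3 : 0 < t ^ β := by positivity
    rw [div_mul_eq_mul_div, div_le_div_iff₀ (by positivity) h3]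
    have : 0 ≤ t ^ α * log t ^ i * t ^ β := by positivity
    nlinarith
  · have h1 : α = β := h1
    have h2 : i < j := h2
    subst h1
    have h3 : Tendsto (fun t : ℝ => (log t ^ (j - i))⁻¹) atTop (𝓝 0) :=
      tendsto_inv_atTop_zero.comp ((tendsto_pow_atTop (by omega)).comp Real.tendsto_log_atTop)
    refine h3.congr' ?_
    filter_upwards [eventually_ge_atTop 1, hlog] with t ht hl
    have ht0 : 0 < t := by linarith
    rw [norm_div, norm_scale _ ht, norm_scale _ ht]
    have h4 : (log t) ^ j = log t ^ i * log t ^ (j - i) := by rw [← pow_add]; congr 1; omega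
    have h5 : 0 < t ^ α := by positivity
    have h6 : 0 < log t := by linarith
    change _ = t ^ α * log t ^ i / (t ^ α * log t ^ j)
    rw [h4]
    field_simp

lemma tendsto_scale_div_self (c : ℝ × ℕ → ℂ) (p : ℝ × ℕ) :
    Tendsto (fun t => c p * (scale p t / scale p t)) atTop (𝓝 (c p)) := by
  refine tendsto_const_nhds.congr' ?_
  filter_upwards [eventually_gt_atTop 1] with t ht
  rw [div_self (scale_ne_zero p ht), mul_one]

/-- Coefficients above an upper bound vanish. -/
lemma coeff_eq_zero_of_bound {T : Finset (ℝ × ℕ)} {c : ℝ × ℕ → ℂ} {q : ℝ × ℕ} {K : ℝ}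
    (h : ∀ᶠ t in atTop, ‖∑ p ∈ T, c p * scale p t‖ ≤ K * ‖scale q t‖) {p : ℝ × ℕ} (hp : p ∈ T)
    (hqp : toLex q < toLex p) : c p = 0 := by
  classical
  by_contra hc
  set T' := T.filter fun p => c p ≠ 0 ∧ toLex q < toLex p with hT'
  obtain ⟨p₀, hp₀, hmax⟩ := T'.exists_max_image toLex ⟨p, by simp [hT', hp, hc, hqp]⟩
  obtain ⟨hp₀T, hc₀, hq₀⟩ : p₀ ∈ T ∧ c p₀ ≠ 0 ∧ toLex q < toLex p₀ := by simpa [hT'] using hp₀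
  have h1 : Tendsto (fun t => ∑ p ∈ T, c p * (scale p t / scale p₀ t)) atTop
      (𝓝 (∑ p ∈ T, if p = p₀ then c p₀ else 0)) := by
    refine tendsto_finsetSum _ fun p hp => ?_
    by_cases hpp : p = p₀
    · subst hpp
      simpa using tendsto_scale_div_self c p
    rw [if_neg hpp]
    by_cases hcp : c p = 0
    · simp [hcp]
    have : toLex p < toLex p₀ := by
      by_cases hqp' : toLex q < toLex p
      · exact lt_of_le_of_ne (hmax p (by simp [hT', hp, hcp, hqp'])) fun h => hpp (toLex.injective h)
      · exact (not_lt.1 hqp').trans_lt hq₀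
    simpa using (tendsto_scale_div this).const_mul (c p)
  rw [Finset.sum_ite_eq' T p₀, if_pos hp₀T] at h1
  have h2 : Tendsto (fun t => K * ‖scale q t / scale p₀ t‖) atTop (𝓝 (K * ‖(0 : ℂ)‖)) :=
    (tendsto_scale_div hq₀).norm.const_mul K
  rw [norm_zero, mul_zero] at h2
  have h3 : ‖c p₀‖ ≤ 0 := by
    refine le_of_tendsto_of_tendsto h1.norm h2 ?_
    filter_upwards [h, eventually_gt_atTop 1] with t ht ht1
    have h0 : 0 < ‖scale p₀ t‖ := norm_pos_iff.2 (scale_ne_zero p₀ ht1)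
    have : ∑ p ∈ T, c p * (scale p t / scale p₀ t) = (∑ p ∈ T, c p * scale p t) / scale p₀ t := by
      rw [sum_div]
      exact sum_congr rfl fun _ _ => by ring
    change ‖∑ p ∈ T, c p * (scale p t / scale p₀ t)‖ ≤ _
    rw [this, norm_div, norm_div, ← mul_div_assoc]
    gcongr
  exact hc₀ (norm_le_zero_iff.1 h3)

lemma tendsto_div_of_bound {T : Finset (ℝ × ℕ)} {c : ℝ × ℕ → ℂ} {q : ℝ × ℕ} {K : ℝ}
    (h : ∀ᶠ t in atTop, ‖∑ p ∈ T, c p * scale p t‖ ≤ K * ‖scale q t‖) :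
    Tendsto (fun t => (∑ p ∈ T, c p * scale p t) / scale q t) atTop
      (𝓝 (if q ∈ T then c q else 0)) := by
  classical
  have h1 : Tendsto (fun t => ∑ p ∈ T, c p * (scale p t / scale q t)) atTop
      (𝓝 (∑ p ∈ T, if p = q then c q else 0)) := by
    refine tendsto_finsetSum _ fun p hp => ?_
    rcases lt_trichotomy (toLex p) (toLex q) with hlt | heq | hgt
    · rw [if_neg fun h => hlt.ne (congr_arg toLex h)]
      simpa using (tendsto_scale_div hlt).const_mul (c p)
    · have := toLex.injective heq
      subst this
      simpa using tendsto_scale_div_self c p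
    · rw [if_neg fun h => hgt.ne' (congr_arg toLex h), coeff_eq_zero_of_bound h hp hgt]
      simp
  rw [Finset.sum_ite_eq'] at h1
  refine h1.congr fun t => ?_
  rw [sum_div]
  exact sum_congr rfl fun _ _ => by ring

lemma eventually_scale_le {p q : ℝ × ℕ} (h : toLex q ≤ toLex p) :
    ∀ᶠ t in atTop, ‖scale q t‖ ≤ ‖scale p t‖ := by
  rcases h.eq_or_lt with h | h
  · rw [toLex.injective h]
    exact .of_forall fun _ => le_rfl
  have h1 := (tendsto_scale_div h).norm.eventually (Iio_mem_nhds (show ‖(0 : ℂ)‖ < 1 by simp))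
  filter_upwards [h1, eventually_gt_atTop 1] with t ht ht1
  have ht : ‖scale q t / scale p t‖ < 1 := ht
  rw [norm_div, div_lt_one (norm_pos_iff.2 (scale_ne_zero p ht1))] at ht
  exact ht.le

lemma partialSum_eq {n : ℕ} {E : Set ℝ} {C : ℝ → ℕ → ℂ} {M : ℝ}
    (hfin : {β ∈ E | -M ≤ β}.Finite) (t : ℝ) :
    partialSum n E C M t = ∑ p ∈ hfin.toFinset ×ˢ Finset.range n, C p.1 (p.2 + 1) * scale p t := by
  rw [partialSum, finsum_mem_eq_finite_toFinset_sum _ hfin, Finset.sum_product]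
  refine sum_congr rfl fun α _ => ?_
  refine Finset.sum_nbij' (fun j => j - 1) (fun j => j + 1) ?_ ?_ ?_ ?_ ?_
  · intro j hj; simp only [Finset.mem_Icc, Finset.mem_range] at *; omega
  · intro j hj; simp only [Finset.mem_Icc, Finset.mem_range] at *; omega
  · intro j hj; simp only [Finset.mem_Icc] at *; omega
  · intro j hj; simp
  · intro j hj
    rw [Finset.mem_Icc] at hj
    rw [Nat.sub_add_cancel hj.1, scale]
    push_cast
    ring

section
variable {n : ℕ} {g : ℝ → ℂ} {E : Set ℝ} {C : ℝ → ℕ → ℂ} {β : ℝ} {j : ℕ} {K : ℝ}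

lemma HasAsympExpansion.eventually_partialSum_le (h : HasAsympExpansion n g E C) {q : ℝ × ℕ}
    (hg : ∀ᶠ t in atTop, ‖g t‖ ≤ K * ‖scale q t‖) {M : ℝ} (hM : -M < q.1) :
    ∃ K', ∀ᶠ t in atTop, ‖partialSum n E C M t‖ ≤ K' * ‖scale q t‖ := by
  obtain ⟨L, hL⟩ := h.2 M
  refine ⟨K + |L|, ?_⟩
  have hlex : toLex (-M, 0) ≤ toLex q := (toLex_lt_toLex.2 (Or.inl hM)).le
  filter_upwards [hg, eventually_ge_atTop 2, eventually_scale_le hlex] with t h1 h2 h3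
  have h4 := hL t h2
  have h5 : t ^ (-M) = ‖scale (-M, 0) t‖ := by rw [norm_scale _ (by linarith), pow_zero, mul_one]
  have h6 : L * t ^ (-M) ≤ |L| * ‖scale q t‖ := by
    rw [h5]
    exact mul_le_mul (le_abs_self L) h3 (norm_nonneg _) (abs_nonneg L)
  have h7 := norm_sub_norm_le (partialSum n E C M t) (g t)
  rw [norm_sub_rev] at h7
  linarith

/-- An upper bound controls all exponents of an asymptotic expansion. -/
lemma HasAsympExpansion.le_of_bound (h : HasAsympExpansion n g E C) (hE : LocallyFiniteBelow E)
    (hg : ∀ᶠ t in atTop, ‖g t‖ ≤ K * ‖scale (-β, j) t‖) {α : ℝ} {i : ℕ} (hC : C α i ≠ 0) :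
    α < -β ∨ (α = -β ∧ i ≤ j + 1) := by
  obtain ⟨hα, hi1, hin⟩ := h.1 α i hC
  obtain ⟨K', hK'⟩ := h.eventually_partialSum_le hg (M := |α| + |β| + 1)
    (by simp only; linarith [abs_nonneg α, le_abs_self β])
  simp only [partialSum_eq (hE.2 _)] at hK'
  by_contra hcon
  push Not at hcon
  refine hC ?_
  have := coeff_eq_zero_of_bound hK' (p := (α, i - 1)) ?_ ?_
  · simpa [Nat.sub_add_cancel hi1] using this
  · simp only [mem_product, Finite.mem_toFinset, Finset.mem_range]
    exact ⟨⟨hα, by linarith [neg_abs_le α, abs_nonneg β]⟩, by omega⟩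
  · rw [toLex_lt_toLex]
    rcases hcon.1.eq_or_lt with h1 | h1
    · have := hcon.2 h1.symm
      exact Or.inr ⟨h1, by simp only; omega⟩
    · exact Or.inl h1

/-- The leading coefficient of an asymptotic expansion. -/
lemma HasAsympExpansion.coeff_eq (h : HasAsympExpansion n g E C) (hE : LocallyFiniteBelow E)
    {c : ℂ} (hg : Tendsto (fun t => g t / scale (-β, j) t) atTop (𝓝 c)) : C (-β) (j + 1) = c := by
  have hb : ∀ᶠ t in atTop, ‖g t‖ ≤ (‖c‖ + 1) * ‖scale (-β, j) t‖ := by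
    filter_upwards [hg.norm.eventually (Iio_mem_nhds (lt_add_one ‖c‖)), eventually_gt_atTop 1]
      with t ht ht1
    have ht : ‖g t / scale (-β, j) t‖ < ‖c‖ + 1 := ht
    rw [norm_div, div_lt_iff₀ (norm_pos_iff.2 (scale_ne_zero _ ht1))] at ht
    exact ht.le
  obtain ⟨K', hK'⟩ := h.eventually_partialSum_le hb (M := |β| + 1)
    (by simp only; linarith [le_abs_self β])
  simp only [partialSum_eq (hE.2 _)] at hK'
  have h1 := tendsto_div_of_bound hK'
  obtain ⟨L, hL⟩ := h.2 (|β| + 1)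
  have h2 : Tendsto (fun t => (g t - partialSum n E C (|β| + 1) t) / scale (-β, j) t) atTop
      (𝓝 0) := by
    have hlt : toLex ((-(|β| + 1), 0) : ℝ × ℕ) < toLex (-β, j) :=
      toLex_lt_toLex.2 (Or.inl (by simp only; linarith [le_abs_self β]))
    have h3 := (tendsto_scale_div hlt).norm.const_mul |L|
    rw [norm_zero, mul_zero] at h3
    refine squeeze_zero_norm' ?_ h3
    filter_upwards [eventually_ge_atTop 2] with t ht
    rw [norm_div, norm_div, ← mul_div_assoc]
    gcongr
    rw [norm_scale _ (by linarith), pow_zero, mul_one]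
    exact (hL t ht).trans (by gcongr; exact le_abs_self L)
  have h4 := hg.sub h2
  simp only [← sub_div, sub_sub_cancel, sub_zero, partialSum_eq (hE.2 _)] at h4
  rw [tendsto_nhds_unique h4 h1]
  split_ifs with hmem
  · rfl
  · by_contra hne
    obtain ⟨h5, -, h6⟩ := h.1 _ _ hne
    refine hmem ?_
    simp only [mem_product, Finite.mem_toFinset, Finset.mem_range]
    exact ⟨⟨h5, by linarith [le_abs_self β]⟩, by omega⟩

end

lemma exists_scale_le {p : ℝ × ℕ} {M : ℝ} (h : p.1 < M) :
    ∃ K, ∀ t : ℝ, 2 ≤ t → ‖scale p t‖ ≤ K * t ^ M := by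
  obtain ⟨α, i⟩ := p
  have h : α < M := h
  set ε := (M - α) / (i + 1) with hε
  have hε0 : 0 < ε := div_pos (sub_pos.2 h) (by positivity)
  refine ⟨(1 / ε) ^ i, fun t ht => ?_⟩
  have ht1 : 1 ≤ t := by linarith
  have ht0 : 0 < t := by linarith
  rw [norm_scale _ ht1]
  have h1 : log t ^ i ≤ (t ^ ε / ε) ^ i :=
    pow_le_pow_left₀ (log_nonneg ht1) (Real.log_le_rpow_div ht0.le hε0) i
  have h2 : (t ^ ε / ε) ^ i = (1 / ε) ^ i * t ^ (ε * i) := by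
    rw [Real.rpow_mul ht0.le, rpow_natCast, ← mul_pow]
    ring
  have h3 : α + ε * i ≤ M := by
    have : ε * (i + 1) = M - α := by rw [hε]; field_simp
    linarith
  calc t ^ α * log t ^ i ≤ t ^ α * ((1 / ε) ^ i * t ^ (ε * i)) := by rw [← h2]; gcongr
    _ = (1 / ε) ^ i * t ^ (α + ε * i) := by rw [rpow_add ht0]; ring
    _ ≤ (1 / ε) ^ i * t ^ M := by gcongr

lemma exists_finsupp_of_mem_polyhom {A : Set (ℝ × ℕ)} {h : ℝ → ℂ} (hh : h ∈ polyhom A) :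
    ∃ s : (ℝ × ℕ) →₀ ℂ, (∀ p, p ∉ A → s p = 0) ∧ ∀ T : Finset (ℝ × ℕ), s.support ⊆ T →
      ∀ t, h t = ∑ p ∈ T, s p * scale p t := by
  obtain ⟨s, hs, rfl⟩ := (Finsupp.mem_span_image_iff_linearCombination ℂ).1 hh
  refine ⟨s, fun p hp => ?_, fun T hT t => ?_⟩
  · by_contra h
    exact hp ((Finsupp.mem_supported ℂ s).1 hs (by simpa using h))
  · rw [Finsupp.linearCombination_apply, Finsupp.sum_of_support_subset _ hT _ (by simp)]
    simp [Finset.sum_apply]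

/-- Finite expansions of every order assemble to a full asymptotic expansion. -/
lemma exists_hasAsympExpansion {n : ℕ} (hn : 1 ≤ n) {g : ℝ → ℂ}
    (h : ∀ l : ℝ, 0 < l → HasExp (n - 1) l g) {q : ℝ × ℕ} {K : ℝ} (hq : q.1 < 0)
    (hg : ∀ᶠ t in atTop, ‖g t‖ ≤ K * ‖scale q t‖) :
    ∃ E C, LocallyFiniteBelow E ∧ HasAsympExpansion n g E C := by
  classical
  have h1 : ∀ l : ℝ, 0 < l → ∃ s : (ℝ × ℕ) →₀ ℂ, (∀ p : ℝ × ℕ, p.1 ≤ -l → s p = 0) ∧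
      ∃ K : ℝ, ∀ T : Finset (ℝ × ℕ), s.support ⊆ T → ∀ t, 2 ≤ t →
        ‖g t - ∑ p ∈ T, s p * scale p t‖ ≤ K * ‖scale (-l, n - 1) t‖ := by
    intro l hl
    obtain ⟨u, hu, K, hK⟩ := h l hl
    obtain ⟨s, hs, hsT⟩ := exists_finsupp_of_mem_polyhom hu
    refine ⟨s, fun p hp => hs p (not_lt.2 hp), K, fun T hT t ht => ?_⟩
    rw [norm_scale _ (by linarith), ← hsT T hT]
    exact hK t ht
  choose! s hs0 hs using h1
  have hcons : ∀ l l' p, 0 < l → l ≤ l' → toLex (-l, n - 1) < toLex p → s l p = s l' p := by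
    intro l l' p hl hll hp
    by_cases hmem : p ∈ (s l).support ∪ (s l').support
    swap
    · simp only [Finset.mem_union, Finsupp.mem_support_iff] at hmem
      push Not at hmem
      rw [hmem.1, hmem.2]
    obtain ⟨K₁, h1⟩ := hs l hl
    obtain ⟨K₂, h2⟩ := hs l' (hl.trans_le hll)
    refine sub_eq_zero.1 (coeff_eq_zero_of_bound (c := fun p => s l p - s l' p) (K := K₁ + |K₂|)
      (q := (-l, n - 1)) ?_ hmem hp)
    have hlex : toLex ((-l', n - 1) : ℝ × ℕ) ≤ toLex (-l, n - 1) := by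
      rcases hll.eq_or_lt with h | h
      · rw [h]
      · exact (toLex_lt_toLex.2 (Or.inl (neg_lt_neg h))).le
    filter_upwards [eventually_ge_atTop 2, eventually_scale_le hlex] with t ht hle
    have h3 := h1 _ (Finset.subset_union_left (s₂ := (s l').support)) t ht
    have h4 := h2 _ (Finset.subset_union_right (s₁ := (s l).support)) t ht
    have h5 : K₂ * ‖scale (-l', n - 1) t‖ ≤ |K₂| * ‖scale (-l, n - 1) t‖ :=
      mul_le_mul (le_abs_self _) hle (norm_nonneg _) (abs_nonneg _)
    have h6 : ∑ p ∈ (s l).support ∪ (s l').support, (s l p - s l' p) * scale p t =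
        (g t - ∑ p ∈ (s l).support ∪ (s l').support, s l' p * scale p t) -
        (g t - ∑ p ∈ (s l).support ∪ (s l').support, s l p * scale p t) := by
      rw [sub_sub_sub_cancel_left, ← sum_sub_distrib]
      exact sum_congr rfl fun _ _ => by ring
    rw [h6]
    linarith [norm_sub_le (g t - ∑ p ∈ (s l).support ∪ (s l').support, s l' p * scale p t)
      (g t - ∑ p ∈ (s l).support ∪ (s l').support, s l p * scale p t)]
  have hC : ∀ l α j, 0 < l → -l < α → s l (α, j) = s (1 + |α|) (α, j) := by
    intro l α j hl hα
    have hα' : -(1 + |α|) < α := by linarith [neg_abs_le α]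
    rcases le_total l (1 + |α|) with hle | hle
    · exact hcons _ _ _ hl hle (toLex_lt_toLex.2 (Or.inl hα))
    · exact (hcons _ _ _ (by positivity) hle (toLex_lt_toLex.2 (Or.inl hα'))).symm
  have hpow : ∀ l α j, 0 < l → n ≤ j → α < 0 → s l (α, j) = 0 := by
    intro l α j hl hj hα
    by_cases hlα : -l < α
    · rw [← hcons (-α) l (α, j) (by linarith) (by linarith), hs0 _ (by linarith)]
      · simp
      · rw [neg_neg]
        exact toLex_lt_toLex.2 (Or.inr ⟨rfl, by simp only; omega⟩)
    · exact hs0 l hl _ (not_lt.1 hlα)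
  have hneg : ∀ l α j, 0 < l → 0 ≤ α → s l (α, j) = 0 := by
    intro l α j hl hα
    rw [hC l α j hl (by linarith), ← hC (1 + |q.1|) α j (by positivity)
      (by linarith [abs_nonneg q.1])]
    by_cases hmem : (α, j) ∈ (s (1 + |q.1|)).support
    swap
    · simpa using hmem
    obtain ⟨K₁, h1⟩ := hs (1 + |q.1|) (by positivity)
    have hlex : toLex ((-(1 + |q.1|), n - 1) : ℝ × ℕ) ≤ toLex q :=
      (toLex_lt_toLex.2 (Or.inl (by simp only; linarith [neg_abs_le q.1]))).le
    refine coeff_eq_zero_of_bound (q := q) (K := K + |K₁|) ?_ hmem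
      (toLex_lt_toLex.2 (Or.inl (hq.trans_le hα)))
    filter_upwards [eventually_ge_atTop 2, eventually_scale_le hlex, hg] with t ht hle hgt
    have h3 := h1 _ subset_rfl t ht
    have h5 : K₁ * ‖scale (-(1 + |q.1|), n - 1) t‖ ≤ |K₁| * ‖scale q t‖ :=
      mul_le_mul (le_abs_self _) hle (norm_nonneg _) (abs_nonneg _)
    have h6 := norm_sub_norm_le
      (∑ p ∈ (s (1 + |q.1|)).support, s (1 + |q.1|) p * scale p t) (g t)
    rw [norm_sub_rev] at h6
    linarith
  set C : ℝ → ℕ → ℂ := fun α i => if 1 ≤ i then s (1 + |α|) (α, i - 1) else 0 with hCdef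
  have hCs : ∀ l α j, 0 < l → -l < α → C α (j + 1) = s l (α, j) := by
    intro l α j hl hα
    rw [hC l α j hl hα]
    simp [hCdef]
  have hCne : ∀ α i, C α i ≠ 0 → 1 ≤ i ∧ α < 0 ∧ s (1 + |α|) (α, i - 1) ≠ 0 := by
    intro α i hi
    by_cases h1 : 1 ≤ i
    · simp only [hCdef, if_pos h1] at hi
      refine ⟨h1, ?_, hi⟩
      by_contra hα
      exact hi (hneg _ _ _ (by positivity) (not_lt.1 hα))
    · simp [hCdef, h1] at hi
  set E : Set ℝ := {α | ∃ i, C α i ≠ 0} with hE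
  have hsub : ∀ M : ℝ, {β ∈ E | -M ≤ β} ⊆ Prod.fst '' ((s (|M| + 1)).support : Set (ℝ × ℕ)) := by
    rintro M β ⟨⟨i, hi⟩, hβ⟩
    obtain ⟨h1, -, h3⟩ := hCne β i hi
    refine ⟨(β, i - 1), ?_, rfl⟩
    rw [Finset.mem_coe, Finsupp.mem_support_iff, hC _ _ _ (by positivity)
      (by linarith [le_abs_self M])]
    exact h3
  have hfin : ∀ M : ℝ, {β ∈ E | -M ≤ β}.Finite := fun M =>
    ((Finset.finite_toSet _).image _).subset (hsub M)
  refine ⟨E, C, ⟨?_, hfin⟩, ?_, fun M => ?_⟩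
  · rintro α ⟨i, hi⟩
    exact (hCne α i hi).2.1
  · intro α i hi
    obtain ⟨h1, h2, h3⟩ := hCne α i hi
    refine ⟨⟨i, hi⟩, h1, ?_⟩
    by_contra hin
    exact h3 (hpow _ _ _ (by positivity) (by omega) h2)
  · set L := |M| + 1 with hL
    have hL0 : 0 < L := by positivity
    obtain ⟨K₁, h1⟩ := hs L hL0
    obtain ⟨K₂, h2⟩ := exists_scale_le (p := (-L, n - 1)) (M := -M)
      (by simp only; linarith [le_abs_self M])
    have hK : ∀ p : ℝ × ℕ, ∃ K, p.1 < -M → ∀ t : ℝ, 2 ≤ t → ‖scale p t‖ ≤ K * t ^ (-M) := by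
      intro p
      by_cases hp : p.1 < -M
      · obtain ⟨K, hK⟩ := exists_scale_le hp
        exact ⟨K, fun _ => hK⟩
      · exact ⟨0, fun h => absurd h hp⟩
    choose Kp hKp using hK
    refine ⟨|K₁| * K₂ + ∑ p ∈ (s L).support.filter fun p => ¬ -M ≤ p.1, ‖s L p‖ * Kp p,
      fun t ht => ?_⟩
    have h3 : partialSum n E C M t =
        ∑ p ∈ (s L).support.filter (fun p => -M ≤ p.1), s L p * scale p t := by
      rw [partialSum_eq (hfin M)]
      have h4 : ∀ p : ℝ × ℕ, -M ≤ p.1 → C p.1 (p.2 + 1) = s L p := fun p hp =>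
        hCs L p.1 p.2 hL0 (by linarith [le_abs_self M])
      symm
      refine Finset.sum_subset_zero_on_sdiff ?_ ?_ ?_
      · intro p hp
        obtain ⟨hp1, hp2⟩ := mem_filter.1 hp
        have hp3 : s L p ≠ 0 := by simpa using hp1
        have hp4 : C p.1 (p.2 + 1) ≠ 0 := by rwa [h4 p hp2]
        rw [mem_product, Finite.mem_toFinset, Finset.mem_range]
        refine ⟨⟨⟨_, hp4⟩, hp2⟩, ?_⟩
        by_contra hn'
        exact hp3 (hpow L p.1 p.2 hL0 (not_lt.1 hn') (hCne _ _ hp4).2.1)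
      · intro p hp
        obtain ⟨hp1, hp2⟩ := Finset.mem_sdiff.1 hp
        have hp3 : -M ≤ p.1 := by
          rw [mem_product, Finite.mem_toFinset] at hp1
          exact hp1.1.2
        have : s L p = 0 := by
          by_contra h
          exact hp2 (mem_filter.2 ⟨by simpa using h, hp3⟩)
        rw [h4 p hp3, this, zero_mul]
      · intro p hp
        rw [h4 p (mem_filter.1 hp).2]
    have h4 : g t - partialSum n E C M t = (g t - ∑ p ∈ (s L).support, s L p * scale p t) +
        ∑ p ∈ (s L).support.filter (fun p => ¬ -M ≤ p.1), s L p * scale p t := by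
      rw [h3, ← Finset.sum_filter_add_sum_filter_not (s L).support (fun p => -M ≤ p.1)]
      ring
    rw [h4, add_mul, sum_mul]
    refine (norm_add_le _ _).trans (add_le_add ?_ ((norm_sum_le _ _).trans
      (sum_le_sum fun p hp => ?_)))
    · refine (h1 _ subset_rfl t ht).trans ?_
      rw [mul_assoc]
      exact mul_le_mul (le_abs_self _) (h2 t ht) (norm_nonneg _) (abs_nonneg _)
    · rw [norm_mul, mul_assoc]
      exact mul_le_mul_of_nonneg_left (hKp p (not_le.1 (mem_filter.1 hp).2) t ht)
        (norm_nonneg _)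

/-- A function with an expansion and an upper bound on a scale has a leading coefficient. -/
lemma HasExp.exists_tendsto {l : ℝ} {g : ℝ → ℂ} (h : HasExp k l g) {q : ℝ × ℕ} {K : ℝ}
    (hl : -l < q.1) (hg : ∀ᶠ t in atTop, ‖g t‖ ≤ K * ‖scale q t‖) :
    ∃ c, Tendsto (fun t => g t / scale q t) atTop (𝓝 c) := by
  obtain ⟨u, hu, K₁, hK⟩ := h
  obtain ⟨s, -, hs⟩ := exists_finsupp_of_mem_polyhom hu
  have hs := hs _ subset_rfl
  have hlt : toLex ((-l, k) : ℝ × ℕ) < toLex q := toLex_lt_toLex.2 (Or.inl hl)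
  have h1 : ∀ᶠ t in atTop, ‖g t - u t‖ ≤ K₁ * ‖scale (-l, k) t‖ := by
    filter_upwards [eventually_ge_atTop 2] with t ht
    rw [norm_scale _ (by linarith)]
    exact hK t ht
  have h2 : ∀ᶠ t in atTop, ‖∑ p ∈ s.support, s p * scale p t‖ ≤ (K + |K₁|) * ‖scale q t‖ := by
    filter_upwards [h1, eventually_scale_le hlt.le, hg] with t h3 h4 h5
    have h6 : K₁ * ‖scale (-l, k) t‖ ≤ |K₁| * ‖scale q t‖ :=
      mul_le_mul (le_abs_self _) h4 (norm_nonneg _) (abs_nonneg _)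
    have h7 := norm_sub_norm_le (u t) (g t)
    rw [norm_sub_rev] at h7
    rw [← hs]
    linarith
  have h3 : Tendsto (fun t => (g t - u t) / scale q t) atTop (𝓝 0) := by
    have h4 := (tendsto_scale_div hlt).norm.const_mul K₁
    rw [norm_zero, mul_zero] at h4
    refine squeeze_zero_norm' ?_ h4
    filter_upwards [h1] with t ht
    rw [norm_div, norm_div, ← mul_div_assoc]
    gcongr
  refine ⟨_, ((tendsto_div_of_bound h2).add h3).congr fun t => ?_⟩
  rw [← hs]
  ring

/-- The exponent `q + 1` coming from the monomial `x^q` and the Jacobian. -/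
def shift (q : ℕ^[n]) : ℝ^[n] := fun i => q i + 1

lemma one_le_shift (q : ℕ^[n]) (i : Fin n) : 1 ≤ shift q i := by simp [shift]

section

lemma IsAmp.mul_left (hφ : IsAmp R φ) {g : ℝ^[n] → ℝ} (hg : ContDiff ℝ ∞ g) :
    IsAmp R fun x => (g x : ℂ) * φ x where
  smooth := (contDiff_ofReal hg).mul hφ.smooth
  eq_zero x i hx := by rw [hφ.eq_zero x i hx, mul_zero]

lemma IsAmp.cderiv (hφ : IsAmp R φ) (i : Fin n) : IsAmp R (cderiv i φ) where
  smooth := contDiff_cderiv i hφ.smooth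
  eq_zero x j hx := by
    refine cderiv_eq_zero_of_notMem (Ω := {x : ℝ^[n] | |x j| ≤ exp (-R)})
      (isClosed_le (continuous_apply j).abs continuous_const) (fun y hy => ?_) i ?_
    · exact hφ.eq_zero y j (not_le.1 hy)
    · exact not_le.2 hx

lemma contDiff_amp (hφ : ContDiff ℝ ∞ φ) (ρ : ℝ^[n]) : ContDiff ℝ ∞ (amp σ ρ φ) :=
  (contDiff_ofReal (contDiff_exp_dot ρ)).mul (hφ.comp (contDiff_expc σ))

lemma IsAmp.integrable_amp (hφ : IsAmp R φ) (hR : 0 ≤ R) (hσ : ∀ i, |σ i| = 1) {ρ : ℝ^[n]}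
    (hρ : ∀ i, 0 < ρ i) : Integrable (amp σ ρ φ) := by
  obtain ⟨C, hC⟩ := ((hφ.symb hR hσ ρ (ι := Unit)).est 0).zero
  exact integrable_of_bound (isClosed_oct R) (contDiff_amp hφ.smooth ρ).continuous
    (fun z hz => hφ.amp_eq_zero hσ ρ hz) (hC ()) (integrableOn_exp_neg_dot hρ R)

lemma integrable_osc_mul {F : ℝ^[n] → ℝ} (hF : ContDiff ℝ ∞ F) (t : ℝ)
    (hu : Integrable u) : Integrable fun z => osc F t z * u z :=
  hu.mono ((contDiff_osc hF t).continuous.aestronglyMeasurable.mul hu.aestronglyMeasurable)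
    (.of_forall fun z => by rw [norm_mul, norm_osc, one_mul])

lemma amp_xpow_mul (σ : ℝ^[n]) (q p : ℕ^[n]) (θ : ℝ^[n] → ℂ) (z : ℝ^[n]) :
    (xpow p (expc σ z) : ℂ) * amp σ (shift q) θ z = xpow p σ * amp σ (shift (q + p)) θ z := by
  have : shift (q + p) = shift q + natPt p := by
    funext i
    simp only [shift, natPt, Pi.add_apply]
    push_cast
    ring
  rw [amp, amp, xpow_expc, this, dot_comm (shift q + natPt p), dot_add_right,
    dot_comm z (shift q), dot_comm z (natPt p), neg_add, exp_add]
  push_cast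
  ring

lemma amp_coord_mul (σ : ℝ^[n]) (q : ℕ^[n]) (i : Fin n) (θ : ℝ^[n] → ℂ)
    (z : ℝ^[n]) :
    (expc σ z i : ℂ) * amp σ (shift q) θ z = σ i * amp σ (shift (q + single i 1)) θ z := by
  have h1 := amp_xpow_mul σ q (single i 1) θ z
  have h2 : ∀ x : ℝ^[n], xpow (single i 1) x = x i := fun x => by
    rw [xpow, Finset.prod_eq_single i]
    · simp
    · intro j _ hj; simp [hj]
    · simp
  rwa [h2, h2] at h1

lemma cderiv_amp (hφ : ContDiff ℝ ∞ φ) (q : ℕ^[n]) (i : Fin n) (z : ℝ^[n]) :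
    cderiv i (amp σ (shift q) φ) z = -(shift q i * amp σ (shift q) φ z +
      σ i * amp σ (shift (q + single i 1)) (cderiv i φ) z) := by
  rw [← amp_coord_mul]
  have h4 : ContDiff ℝ ∞ fun z => φ (expc σ z) := hφ.comp (contDiff_expc σ)
  have h3 : cderiv i (amp σ (shift q) φ) = cderiv i fun z =>
    ((exp (-dot (shift q) z) : ℝ) : ℂ) * φ (expc σ z) := rfl
  rw [h3, cderiv_mul i (contDiff_ofReal (contDiff_exp_dot _)) h4,
    cderiv_ofReal i (contDiff_exp_dot _)]
  beta_reduce
  have h5 : cderiv i (fun z => φ (expc σ z)) z = _ := cderiv_comp_expc hφ σ i z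
  rw [pderiv1_exp_dot, h5, amp, amp]
  push_cast
  ring

end

namespace LocalModel
variable {φ : ℝ^[n] → ℂ}

/-- The oscillatory integral on an orthant, with an additional monomial `x^q`. -/
noncomputable def oscAmp (σ : ℝ^[n]) (q : ℕ^[n]) (φ : ℝ^[n] → ℂ) (t : ℝ) : ℂ :=
  ∫ z, osc (M.phase σ) t z * amp σ (shift q) φ z

lemma wsum_mul_amp (θ : ℕ^[n] → ℝ^[n] → ℝ) (q : ℕ^[n]) (z : ℝ^[n]) :
    (M.wsum θ (expc σ z) : ℂ) * amp σ (shift q) φ z = ∑ p ∈ M.F,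
      xpow p σ * amp σ (shift (q + p)) (fun x => (θ p x : ℂ) * φ x) z := by
  rw [wsum, Complex.ofReal_sum, sum_mul]
  refine sum_congr rfl fun p _ => ?_
  rw [← amp_xpow_mul, amp, amp]
  push_cast
  ring

lemma integrable_osc_amp (hσ : ∀ i, |σ i| = 1) (hR : 0 ≤ R) (hφ : IsAmp R φ) (q : ℕ^[n])
    (t : ℝ) : Integrable fun z => osc (M.phase σ) t z * amp σ (shift q) φ z :=
  integrable_osc_mul (M.contDiff_phase σ) t
    (hφ.integrable_amp hR hσ fun i => zero_lt_one.trans_le (one_le_shift q i))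

lemma integrable_wsum_mul_amp (hσ : ∀ i, |σ i| = 1) (hR : 0 ≤ R) (hφ : IsAmp R φ)
    (hθ : ∀ p, ContDiff ℝ ∞ (θ p)) (q : ℕ^[n]) :
    Integrable fun z => (M.wsum θ (expc σ z) : ℂ) * amp σ (shift q) φ z := by
  simp only [wsum_mul_amp]
  exact integrable_finsetSum _ fun p _ => ((hφ.mul_left (hθ p)).integrable_amp hR hσ
    fun i => zero_lt_one.trans_le (one_le_shift _ i)).const_mul _

lemma integral_osc_wsum (hσ : ∀ i, |σ i| = 1) (hR : 0 ≤ R) (hφ : IsAmp R φ)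
    {θ : ℕ^[n] → ℝ^[n] → ℝ} (hθ : ∀ p, ContDiff ℝ ∞ (θ p)) (q : ℕ^[n])
    (t : ℝ) : ∫ z, osc (M.phase σ) t z * ((M.wsum θ (expc σ z) : ℂ) * amp σ (shift q) φ z) =
      ∑ p ∈ M.F, xpow p σ * M.oscAmp σ (q + p) (fun x => (θ p x : ℂ) * φ x) t := by
  simp only [wsum_mul_amp, mul_sum]
  rw [integral_finsetSum]
  · refine sum_congr rfl fun p _ => ?_
    rw [oscAmp, ← integral_const_mul]
    exact integral_congr_ae (.of_forall fun z => by ring)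
  · intro p _
    refine ((M.integrable_osc_amp hσ hR (hφ.mul_left (hθ p)) (q + p) t).const_mul
      (xpow p σ : ℂ)).congr (.of_forall fun z => by ring)

lemma hasDerivAt_oscAmp (hσ : ∀ i, |σ i| = 1) (hR : 0 ≤ R) (hφ : IsAmp R φ) (q : ℕ^[n])
    (t : ℝ) : HasDerivAt (M.oscAmp σ q φ) (I *
      ∑ p ∈ M.F, xpow p σ * M.oscAmp σ (q + p) (fun x => (M.ψ p x : ℂ) * φ x) t) t := by
  have hI := M.integrable_wsum_mul_amp hσ hR hφ M.smooth q
  have hcont := (contDiff_amp (σ := σ) hφ.smooth (shift q)).continuous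
  have h := (hasDerivAt_integral_of_dominated_loc_of_deriv_le (μ := volume) (𝕜 := ℝ) (s := univ)
    (x₀ := t) (F := fun t z => osc (M.phase σ) t z * amp σ (shift q) φ z)
    (F' := fun t z => I * (osc (M.phase σ) t z *
      ((M.wsum M.ψ (expc σ z) : ℂ) * amp σ (shift q) φ z))) univ_mem
    (.of_forall fun s => (M.integrable_osc_amp hσ hR hφ q s).aestronglyMeasurable)
    (M.integrable_osc_amp hσ hR hφ q t)
    ((integrable_osc_mul (M.contDiff_phase σ) t hI).const_mul _).aestronglyMeasurable
    (.of_forall fun z s _ => ?_) hI.norm (.of_forall fun z s _ => ?_)).2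
  · rwa [integral_const_mul, M.integral_osc_wsum hσ hR hφ M.smooth] at h
  · rw [norm_mul, norm_mul, Complex.norm_I, norm_osc, one_mul, one_mul]
  · have h1 : HasDerivAt (fun s : ℝ => I * s * M.phase σ z)
        (I * 1 * M.phase σ z) s :=
      ((Complex.ofRealCLM.hasDerivAt (x := s)).const_mul I).mul_const _
    refine (h1.cexp.mul_const _).congr_deriv ?_
    rw [phase, osc, phase]
    ring

lemma oscAmp_ibp (hσ : ∀ i, |σ i| = 1) (hR : 0 ≤ R) (hφ : IsAmp R φ) (q : ℕ^[n]) (i : Fin n)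
    (t : ℝ) : shift q i * M.oscAmp σ q φ t =
      -(σ i * M.oscAmp σ (q + single i 1) (cderiv i φ) t) - I * t *
        ∑ p ∈ M.F, (p i * (xpow p σ * M.oscAmp σ (q + p) (fun x => (M.ψ p x : ℂ) * φ x) t) +
          σ i * (xpow p σ * M.oscAmp σ (q + p + single i 1)
            (fun x => (pderiv1 i (M.ψ p) x : ℂ) * φ x) t)) := by
  have hnt : ∀ {θ : ℝ^[n] → ℂ}, IsAmp R θ → ∀ q t,
      Integrable fun z => osc (M.phase σ) t z * amp σ (shift q) θ z :=
    fun h => M.integrable_osc_amp hσ hR h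
  have hF := M.contDiff_phase σ
  have hL := contDiff_logDer i M.smooth
  have hca : cderiv i (amp σ (shift q) φ) = _ := funext (cderiv_amp hφ.smooth q i)
  have hco : ∀ z, cderiv i (osc (M.phase σ) t) z * amp σ (shift q) φ z = -(I * t *
      (osc (M.phase σ) t z * ((M.wsum (logDer i M.ψ) (expc σ z) : ℂ) * amp σ (shift q) φ z))) := by
    intro z
    rw [cderiv_osc hF, pderiv1_phase]
    push_cast
    ring
  have h1 := (hnt hφ q t).const_mul (shift q i : ℂ)
  have h2 := (hnt (hφ.cderiv i) (q + single i 1) t).const_mul (σ i : ℂ)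
  have h3 := integrable_osc_mul hF t (M.integrable_wsum_mul_amp hσ hR hφ hL q)
  have key : ∫ z, osc (M.phase σ) t z * cderiv i (amp σ (shift q) φ) z =
      -∫ z, cderiv i (osc (M.phase σ) t) z * amp σ (shift q) φ z := by
    refine integral_mul_fderiv_eq_neg_fderiv_mul_of_integrable ?_ ?_ (hnt hφ q t) ?_ ?_
    · exact (h3.const_mul (I * t)).neg.congr (.of_forall fun z => (hco z).symm)
    · refine (h1.add h2).neg.congr (.of_forall fun z => ?_)
      change -(_ + _) = _ * cderiv i (amp σ (shift q) φ) z
      rw [hca]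
      ring
    · exact fun x _ => (contDiff_osc hF t).differentiable (by simp) x
    · exact fun x _ => (contDiff_amp hφ.smooth _).differentiable (by simp) x
  have e1 : ∫ z, osc (M.phase σ) t z * cderiv i (amp σ (shift q) φ) z =
      -(shift q i * M.oscAmp σ q φ t +
        σ i * M.oscAmp σ (q + single i 1) (cderiv i φ) t) := by
    rw [oscAmp, oscAmp, ← integral_const_mul, ← integral_const_mul, ← integral_add h1 h2,
      ← integral_neg, hca]
    exact integral_congr_ae (.of_forall fun z => by ring)
  have e2 : ∫ z, cderiv i (osc (M.phase σ) t) z * amp σ (shift q) φ z = -(I * t *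
      ∑ p ∈ M.F, xpow p σ * M.oscAmp σ (q + p) (fun x => (logDer i M.ψ p x : ℂ) * φ x) t) := by
    rw [← M.integral_osc_wsum hσ hR hφ hL, ← integral_const_mul, ← integral_neg]
    exact integral_congr_ae (.of_forall hco)
  have e3 : ∀ p, M.oscAmp σ (q + p) (fun x => (logDer i M.ψ p x : ℂ) * φ x) t =
      p i * M.oscAmp σ (q + p) (fun x => (M.ψ p x : ℂ) * φ x) t +
      σ i * M.oscAmp σ (q + p + single i 1)
            (fun x => (pderiv1 i (M.ψ p) x : ℂ) * φ x) t := by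
    intro p
    rw [oscAmp, oscAmp, oscAmp, ← integral_const_mul, ← integral_const_mul, ← integral_add
      ((hnt (hφ.mul_left (M.smooth p)) _ t).const_mul _)
      ((hnt (hφ.mul_left (contDiff_pderiv1 (M.smooth p))) _ t).const_mul _)]
    refine integral_congr_ae (.of_forall fun z => ?_)
    have := amp_coord_mul σ (q + p) i (fun x => (pderiv1 i (M.ψ p) x : ℂ) * φ x) z
    change osc (M.phase σ) t z * amp σ (shift (q + p)) (fun x => (logDer i M.ψ p x : ℂ) * φ x) z =
      _ + σ i * (osc (M.phase σ) t z * amp σ (shift (q + p + single i 1)) _ z)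
    rw [mul_left_comm (σ i : ℂ), ← this]
    simp only [amp, logDer]
    push_cast
    ring
  rw [e1, e2, neg_neg] at key
  have e4 : ∑ p ∈ M.F, xpow p σ *
      M.oscAmp σ (q + p) (fun x => (logDer i M.ψ p x : ℂ) * φ x) t = ∑ p ∈ M.F,
      (p i * (xpow p σ * M.oscAmp σ (q + p) (fun x => (M.ψ p x : ℂ) * φ x) t) +
          σ i * (xpow p σ * M.oscAmp σ (q + p + single i 1)
            (fun x => (pderiv1 i (M.ψ p) x : ℂ) * φ x) t)) :=
    sum_congr rfl fun p _ => by rw [e3]; ring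
  rw [← e4]
  linear_combination -key

end LocalModel

lemma ndot_add (a p q : ℕ^[n]) : ndot a (p + q) = ndot a p + ndot a q := by
  simp only [ndot, Pi.add_apply, mul_add, sum_add_distrib]

lemma ndot_single (a : ℕ^[n]) (i : Fin n) : ndot a (single i 1) = a i := by
  rw [ndot, Finset.sum_eq_single i]
  · simp
  · intro j _ hj; simp [hj]
  · simp

namespace PolyData

/-- The minimum of `⟨a, ·⟩` over the Newton polyhedron. -/
def minDot (a : ℕ^[n]) : ℕ := D.S.inf' D.nonempty (ndot a)

lemma minDot_le (a : ℕ^[n]) {p : ℕ^[n]}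
    (hp : natPt p ∈ Γ₊ f) : D.minDot a ≤ ndot a p := by
  obtain ⟨s, hs, h⟩ := D.exists_dot_le hp (z := natPt a) fun i => Nat.cast_nonneg _
  rw [dot_natPt, dot_natPt] at h
  exact (Finset.inf'_le _ hs).trans (by exact_mod_cast h)

lemma exists_minDot_eq (a : ℕ^[n]) : ∃ s ∈ D.S, ndot a s = D.minDot a := by
  obtain ⟨s, hs, h⟩ := D.S.exists_mem_eq_inf' D.nonempty (ndot a)
  exact ⟨s, hs, h.symm⟩

/-- The weight of `t^k x^q dx` with respect to the scaling given by `a`. -/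
def weight (D : PolyData f) (a q : ℕ^[n]) (k : ℕ) : ℤ := ndot a (q + 1) - k * D.minDot a

lemma weight_single (a q : ℕ^[n]) (k : ℕ) (i : Fin n) :
    D.weight a (q + single i 1) k = D.weight a q k + a i := by
  rw [weight, weight, add_right_comm, ndot_add, ndot_single]
  push_cast
  ring

lemma weight_succ (a q p : ℕ^[n]) (k : ℕ) :
    D.weight a (q + p) (k + 1) = D.weight a q k + (ndot a p - D.minDot a) := by
  rw [weight, weight, add_right_comm, ndot_add]
  push_cast
  ring

/-- The total amount by which the weights of `t^k x^q dx` fall short of the order `b`. -/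
noncomputable def deficit (D : PolyData f) (b : ℝ) (q : ℕ^[n]) (k : ℕ) : ℕ :=
  ∑ a ∈ D.A, (⌈b * D.minDot a⌉ - D.weight a q k).toNat

lemma deficit_lt {b : ℝ} {q q' : ℕ^[n]} {k k' : ℕ}
    (h : ∀ a, D.weight a q k ≤ D.weight a q' k') {a : ℕ^[n]} (ha : a ∈ D.A)
    (hlt : D.weight a q k < D.weight a q' k') (hb : (D.weight a q k : ℝ) < b * D.minDot a) :
    D.deficit b q' k' < D.deficit b q k := by
  refine Finset.sum_lt_sum (fun a _ => ?_) ⟨a, ha, ?_⟩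
  · have := h a
    omega
  · have := Int.lt_ceil.2 hb
    omega

end PolyData

namespace LocalModel
variable {φ : ℝ^[n] → ℂ}

lemma hasExp_of_weight_ge (hσ : ∀ i, |σ i| = 1) (hR : 0 ≤ R)
    (H : PhaseBound (oct n R) M.N (M.phase σ)) (hn : 0 < n) {b : ℝ} (hb : 0 < b)
    (hφ : IsAmp R φ) {q : ℕ^[n]} {k : ℕ}
    (h : ∀ a ∈ M.A, b * M.minDot a ≤ (M.weight a q k : ℝ)) :
    HasExp (n - 1) b fun t => (t : ℂ) ^ k * M.oscAmp σ q φ t := by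
  have hμ : 0 < k + b := by positivity
  obtain ⟨C, -, hC⟩ := M.exists_decay_of_mem hσ hR H hφ hn (one_le_shift q) hμ
    (M.mem_of_forall _ fun a ha => by
      obtain ⟨s, hs, e⟩ := M.exists_minDot_eq a
      refine ⟨s, hs, ?_⟩
      have h1 := h a ha
      have h2 : (ndot a (q + 1) : ℝ) = dot (natPt a) (shift q) := by
        rw [← dot_natPt]; congr 1; funext i; simp [natPt, shift]
      rw [PolyData.weight] at h1
      push_cast at h1
      rw [dot_smul_right, dot_natPt, e, inv_mul_eq_div, le_div_iff₀ hμ, ← h2]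
      linarith)
  refine .of_bound (K := C) fun t ht => ?_
  have ht0 : 0 < t := by linarith
  rw [norm_mul, norm_pow, norm_real, norm_of_nonneg ht0.le]
  calc t ^ k * _ ≤ t ^ k * (C * (t ^ (-(k + b)) * log t ^ (n - 1))) :=
        mul_le_mul_of_nonneg_left (hC t ht) (by positivity)
    _ = C * (t ^ (-b) * log t ^ (n - 1)) := by
        rw [neg_add, rpow_add ht0, rpow_neg ht0.le, rpow_natCast]
        field_simp

lemma hasDerivAt_pow_mul_oscAmp (hσ : ∀ i, |σ i| = 1) (hR : 0 ≤ R) (hφ : IsAmp R φ)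
    (q a : ℕ^[n]) (k : ℕ) (ha : M.minDot a ≠ 0) {t : ℝ} (ht : t ≠ 0) :
    HasDerivAt (fun t : ℝ => (t : ℂ) ^ k * M.oscAmp σ q φ t)
      ((((-(M.weight a q k / M.minDot a) : ℝ) : ℂ) * ((t : ℂ) ^ k * M.oscAmp σ q φ t) +
        (M.minDot a : ℂ)⁻¹ * (∑ i, -(a i * σ i) *
            ((t : ℂ) ^ k * M.oscAmp σ (q + single i 1) (cderiv i φ) t) +
          ∑ p ∈ M.F, (-(I * xpow p σ * (ndot a p - M.minDot a)) *
            ((t : ℂ) ^ (k + 1) * M.oscAmp σ (q + p) (fun x => (M.ψ p x : ℂ) * φ x) t) +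
          ∑ i, -(I * xpow p σ * a i * σ i) * ((t : ℂ) ^ (k + 1) *
            M.oscAmp σ (q + p + single i 1)
              (fun x => (pderiv1 i (M.ψ p) x : ℂ) * φ x) t)))) / t) t := by
  have h1 : HasDerivAt (fun t : ℝ => (t : ℂ) ^ k) (k * (t : ℂ) ^ (k - 1)) t := by
    have := (Complex.ofRealCLM.hasDerivAt (x := t)).pow k
    simp only [Complex.ofRealCLM_apply, ofReal_one, mul_one] at this
    exact this
  refine (h1.mul (M.hasDerivAt_oscAmp hσ hR hφ q t)).congr_deriv ?_
  have ibp : ∑ i, (a i : ℂ) * _ = ∑ i, (a i : ℂ) * _ := sum_congr rfl fun i _ =>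
    congrArg ((a i : ℂ) * ·) (M.oscAmp_ibp hσ hR hφ q i t)
  have htc : (t : ℂ) ≠ 0 := by exact_mod_cast ht
  have hl : (M.minDot a : ℂ) ≠ 0 := by exact_mod_cast ha
  have hk : (t : ℂ) * (k * (t : ℂ) ^ (k - 1)) = k * (t : ℂ) ^ k := by
    cases k with
    | zero => simp
    | succ k => simp [pow_succ]; ring
  have hw : ((-(M.weight a q k / M.minDot a) : ℝ) : ℂ) =
      (M.minDot a : ℂ)⁻¹ * (k * M.minDot a - ∑ i, (a i : ℂ) * shift q i) := by
    rw [PolyData.weight, ndot]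
    push_cast [shift, Pi.add_apply, Pi.one_apply]
    field_simp
    ring
  have hnd : ∀ p, (ndot a p : ℂ) = ∑ i, (a i : ℂ) * p i := fun p => by rw [ndot]; push_cast; rfl
  rw [eq_div_iff htc, hw]
  set O := M.oscAmp σ q φ t
  set A := fun p => M.oscAmp σ (q + p) (fun x => (M.ψ p x : ℂ) * φ x) t
  set B := fun i => M.oscAmp σ (q + single i 1) (cderiv i φ) t
  set C := fun p i => M.oscAmp σ (q + p + single i 1)
              (fun x => (pderiv1 i (M.ψ p) x : ℂ) * φ x) t
  have ibp' : (∑ i, (a i : ℂ) * shift q i) * O = -∑ i, (a i * σ i) * B i - I * t *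
      ∑ p ∈ M.F, (ndot a p * (xpow p σ * A p) + ∑ i, xpow p σ * a i * σ i * C p i) := by
    rw [sum_mul]
    simp only [mul_assoc] at ibp ⊢
    rw [ibp]
    simp only [mul_sub, mul_add, sum_sub_distrib, sum_add_distrib, mul_sum,
      mul_neg, sum_neg_distrib, hnd, sum_mul]
    congr 1
    rw [sum_comm, sum_comm (s := (Finset.univ : Finset (Fin n)))]
    congr 1 <;> refine sum_congr rfl fun p _ => sum_congr rfl fun i _ => ?_ <;> ring
  have e1 : ∑ i, -((a i : ℂ) * σ i) * ((t : ℂ) ^ k * B i) =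
      -((t : ℂ) ^ k * ∑ i, (a i * σ i) * B i) := by
    rw [mul_sum, ← sum_neg_distrib]
    exact sum_congr rfl fun i _ => by ring
  have e2 : ∑ p ∈ M.F, (-(I * xpow p σ * (ndot a p - M.minDot a)) *
            ((t : ℂ) ^ (k + 1) * A p) +
          ∑ i, -(I * xpow p σ * a i * σ i) * ((t : ℂ) ^ (k + 1) * C p i)) =
      (t : ℂ) ^ (k + 1) * I * (M.minDot a * ∑ p ∈ M.F, xpow p σ * A p -
      ∑ p ∈ M.F, (ndot a p * (xpow p σ * A p) + ∑ i, xpow p σ * a i * σ i * C p i)) := by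
    rw [mul_sum, ← sum_sub_distrib, mul_sum]
    refine sum_congr rfl fun p _ => ?_
    have : ∑ i, -(I * xpow p σ * a i * σ i) * ((t : ℂ) ^ (k + 1) * C p i) =
        -((t : ℂ) ^ (k + 1) * I * ∑ i, xpow p σ * a i * σ i * C p i) := by
      rw [mul_sum, ← sum_neg_distrib]
      exact sum_congr rfl fun i _ => by ring
    rw [this]
    ring
  rw [e1, e2]
  generalize ∑ p ∈ M.F, ((ndot a p : ℂ) * (xpow p σ * A p) +
    ∑ i, (xpow p σ : ℂ) * a i * σ i * C p i) = X at ibp' ⊢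
  field_simp
  linear_combination (M.minDot a * O) * hk + (t : ℂ) ^ k * ibp'

/-- Orthant integrals have expansions to any order. -/
lemma hasExp_oscAmp (hσ : ∀ i, |σ i| = 1) (hR : 0 ≤ R)
    (H : PhaseBound (oct n R) M.N (M.phase σ)) (hn : 0 < n) {b : ℝ} (hb : 0 < b)
    (hφ : IsAmp R φ) (q : ℕ^[n]) (k : ℕ) :
    HasExp (n - 1) b fun t => (t : ℂ) ^ k * M.oscAmp σ q φ t := by
  induction hN : M.deficit b q k using Nat.strong_induction_on generalizing φ q k with
  | _ N ih =>
  by_cases hall : ∀ a ∈ M.A, b * M.minDot a ≤ (M.weight a q k : ℝ)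
  · exact M.hasExp_of_weight_ge hσ hR H hn hb hφ hall
  push Not at hall
  obtain ⟨a, ha, hlt⟩ := hall
  subst hN
  have hpos : M.minDot a ≠ 0 := fun h => by
    rw [PolyData.weight, h] at hlt
    push_cast at hlt
    have : (0 : ℝ) ≤ ndot a (q + 1) := Nat.cast_nonneg _
    linarith
  have hposr : (0 : ℝ) < M.minDot a := by exact_mod_cast Nat.pos_of_ne_zero hpos
  have step : ∀ {c : ℂ} {θ : ℝ^[n] → ℂ} {q' : ℕ^[n]} {k' : ℕ}, IsAmp R θ →
      (∀ a, M.weight a q k ≤ M.weight a q' k') →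
      (c ≠ 0 → M.weight a q k < M.weight a q' k') →
      HasExp (n - 1) b fun t => c * ((t : ℂ) ^ k' * M.oscAmp σ q' θ t) := by
    intro c θ q' k' hθ h1 h2
    by_cases hc : c = 0
    · simpa [hc] using HasExp.zero
    · exact (ih _ (M.deficit_lt h1 ha (h2 hc) hlt) hθ q' k' rfl).const_mul c
  refine HasExp.of_ode (ρ := -(M.weight a q k / M.minDot a)) ?_ ?_ fun t ht =>
    M.hasDerivAt_pow_mul_oscAmp hσ hR hφ q a k hpos (by linarith)
  · rw [neg_lt_neg_iff, div_lt_iff₀ hposr]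
    exact hlt
  refine HasExp.const_mul (.add (.sum _ fun i _ => ?_) (.sum _ fun p hp => .add ?_
    (.sum _ fun i _ => ?_))) _
  · refine step (hφ.cderiv i) (fun a => ?_) fun hc => ?_ <;> rw [PolyData.weight_single]
    · omega
    · have : a i ≠ 0 := fun h => hc (by simp [h])
      omega
  · have hm := fun a => M.minDot_le a (M.mem_poly p hp)
    refine step (hφ.mul_left (M.smooth p)) (fun a => ?_) fun hc => ?_ <;> rw [PolyData.weight_succ]
    · have := hm a
      omega
    · have h1 : ndot a p ≠ M.minDot a := fun h => hc (by simp [h])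
      have := hm a
      omega
  · have hm := fun a => M.minDot_le a (M.mem_poly p hp)
    refine step (hφ.mul_left (contDiff_pderiv1 (M.smooth p))) (fun a => ?_) fun hc => ?_ <;>
      rw [PolyData.weight_single, PolyData.weight_succ]
    · have := hm a
      omega
    · have : a i ≠ 0 := fun h => hc (by simp [h])
      have := hm a
      omega

end LocalModel

/-- The sign vector of an orthant. -/
def sg (s : Fin n → ℤˣ) : ℝ^[n] := fun i => ((s i : ℤ) : ℝ)

lemma sg_eq (s : Fin n → ℤˣ) (i : Fin n) : sg s i = 1 ∨ sg s i = -1 := by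
  rcases Int.units_eq_one_or (s i) with h | h <;> simp [sg, h]

lemma abs_sg (s : Fin n → ℤˣ) (i : Fin n) : |sg s i| = 1 := by
  rcases sg_eq s i with h | h <;> simp [h]

/-- The open orthant with a given sign vector. -/
def orthant (s : Fin n → ℤˣ) : Set ℝ^[n] := {x | ∀ i, 0 < sg s i * x i}

lemma measurableSet_orthant (s : Fin n → ℤˣ) : MeasurableSet (orthant s) := by
  rw [orthant, ofPred_forall]
  exact MeasurableSet.iInter fun i => (isOpen_lt continuous_const
    (continuous_const.mul (continuous_apply i))).measurableSet

lemma pairwise_disjoint_orthant :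
    Pairwise (Function.onFun Disjoint (orthant : (Fin n → ℤˣ) → Set ℝ^[n])) := by
  intro s s' hne
  rw [Function.onFun, Set.disjoint_left]
  intro x hx hx'
  refine hne (funext fun i => ?_)
  have h1 := hx i
  have h2 := hx' i
  rcases Int.units_eq_one_or (s i) with h | h <;> rcases Int.units_eq_one_or (s' i) with h' | h' <;>
    simp only [sg, h, h', Units.val_one, Units.val_neg, Int.cast_one, Int.cast_neg] at h1 h2 ⊢ <;>
    linarith

lemma iUnion_orthant : (⋃ s, orthant s : Set ℝ^[n]) =ᵐ[volume] univ := by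
  have h : ∀ᵐ x : ℝ^[n], ∀ i, x i ≠ 0 :=
    ae_all_iff.2 fun i => compl_mem_ae_iff.2 (Measure.pi_hyperplane (fun _ : Fin n => volume) i 0)
  rw [eventuallyEq_univ]
  filter_upwards [h] with x hx
  refine mem_iUnion.2 ⟨fun i => if 0 < x i then 1 else -1, fun i => ?_⟩
  by_cases h0 : 0 < x i
  · simp [sg, h0]
  · simpa [sg, h0] using lt_of_le_of_ne (not_lt.1 h0) (hx i)

lemma hasFDerivAt_expc (σ z : ℝ^[n]) : HasFDerivAt (expc σ) (ContinuousLinearMap.pi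
    fun i => ((-(expc σ z i)) • ContinuousLinearMap.id ℝ ℝ).comp (.proj i)) z := by
  rw [hasFDerivAt_pi]
  intro i
  have h1 : HasDerivAt (fun u : ℝ => σ i * exp (-u)) (σ i * (exp (-z i) * -1)) (z i) :=
    ((hasDerivAt_neg (z i)).exp).const_mul _
  have h2 : HasFDerivAt (fun z : ℝ^[n] => z i) (ContinuousLinearMap.proj i) z :=
    (ContinuousLinearMap.proj (R := ℝ) (φ := fun _ : Fin n => ℝ) i).hasFDerivAt
  refine (h1.hasFDerivAt.comp z h2).congr_fderiv ?_
  ext v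
  simp [expc]
  ring

lemma image_expc (s : Fin n → ℤˣ) : expc (sg s) '' univ = orthant s := by
  rw [image_univ]
  refine Subset.antisymm ?_ fun x hx => ⟨fun i => -log (sg s i * x i), funext fun i => ?_⟩
  · rintro _ ⟨z, rfl⟩ i
    have : sg s i * sg s i = 1 := by rcases sg_eq s i with h | h <;> simp [h]
    rw [expc, ← mul_assoc, this, one_mul]
    exact exp_pos _
  · have : sg s i * sg s i = 1 := by rcases sg_eq s i with h | h <;> simp [h]
    rw [expc, neg_neg, exp_log (hx i), ← mul_assoc, this, one_mul]

lemma injective_expc (hσ : ∀ i, |σ i| = 1) : Function.Injective (expc σ) := by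
  intro z w h
  funext i
  have h1 := congrFun h i
  have h0 : σ i ≠ 0 := fun h0 => by have := hσ i; rw [h0] at this; simp at this
  simpa using Real.exp_injective (mul_left_cancel₀ h0 h1)

lemma setIntegral_orthant (s : Fin n → ℤˣ) (g : ℝ^[n] → ℂ) :
    ∫ x in orthant s, g x = ∫ z, (exp (-dot (fun _ => 1) z) : ℂ) * g (expc (sg s) z) := by
  rw [← image_expc, integral_image_eq_integral_abs_det_fderiv_smul volume MeasurableSet.univ
    (fun z _ => (hasFDerivAt_expc (sg s) z).hasFDerivWithinAt) (injective_expc (abs_sg s)).injOn,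
    setIntegral_univ]
  refine integral_congr_ae (.of_forall fun z => ?_)
  have hd : ∀ c : ℝ, (c • ContinuousLinearMap.id ℝ ℝ).det = c := fun c => by
    rw [ContinuousLinearMap.det]
    simp
  beta_reduce
  rw [ContinuousLinearMap.det_pi, Finset.abs_prod]
  simp only [hd, abs_neg, expc, abs_mul, abs_sg, one_mul, Real.abs_exp]
  rw [← exp_sum, sum_neg_distrib, dot_one_left, Complex.real_smul]

lemma integral_eq_sum_orthant {g : ℝ^[n] → ℂ} (hg : Integrable g) :
    ∫ x, g x = ∑ s : Fin n → ℤˣ,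
      ∫ z, (exp (-dot (fun _ => 1) z) : ℂ) * g (expc (sg s) z) := by
  rw [← setIntegral_univ, ← setIntegral_congr_set iUnion_orthant,
    integral_iUnion_fintype measurableSet_orthant pairwise_disjoint_orthant
      fun _ => hg.integrableOn]
  exact sum_congr rfl fun s _ => setIntegral_orthant s g

lemma shift_zero : shift (0 : ℕ^[n]) = fun _ => 1 := by funext i; simp [shift]

/-- The oscillatory integral is the sum of its orthant contributions. -/
lemma LocalModel.oscInt_eq
    (hφ : IsAmp R φ) (hsupp : HasCompactSupport φ)
    (hf : ∀ x, φ x ≠ 0 → f x = M.wsum M.ψ x) (t : ℝ) :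
    oscInt f φ t = ∑ s : Fin n → ℤˣ, M.oscAmp (sg s) 0 φ t := by
  have h1 : oscInt f φ t = ∫ x, Complex.exp (I * t * M.wsum M.ψ x) * φ x := by
    refine integral_congr_ae (.of_forall fun x => ?_)
    by_cases h : φ x = 0
    · simp [h]
    · beta_reduce
      rw [hf x h]
  have hc : Continuous fun x => Complex.exp (I * t * M.wsum M.ψ x) * φ x := by
    have h1 := (M.contDiff_wsum M.smooth).continuous
    have h2 := hφ.smooth.continuous
    fun_prop
  rw [h1, integral_eq_sum_orthant (hc.integrable_of_hasCompactSupport hsupp.mul_left)]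
  refine sum_congr rfl fun s _ => integral_congr_ae (.of_forall fun z => ?_)
  beta_reduce
  rw [amp, shift_zero, osc, phase]
  ring

lemma integrableOn_rpow_mul_exp_neg {s ε : ℝ} (hs : -1 < s) (hε : 0 < ε) :
    IntegrableOn (fun x : ℝ => x ^ s * exp (-(ε * x))) (Ioi 0) := by
  have := integrableOn_rpow_mul_exp_neg_mul_rpow hs (zero_lt_one (α := ℝ)) hε
  simpa [neg_mul] using this

lemma integrableOn_rpow_mul_one_add_pow_mul_exp_neg {s ε : ℝ} (hs : -1 < s) (hε : 0 < ε)
    (j : ℕ) : IntegrableOn (fun x : ℝ => x ^ s * (1 + x) ^ j * exp (-(ε * x))) (Ioi 0) := by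
  set δ := ε / (2 * j + ε) with hδ
  have hd : 0 < 2 * (j : ℝ) + ε := by positivity
  have hδ0 : 0 < δ := by positivity
  have hδ1 : δ ≤ 1 := by rw [hδ, div_le_one hd]; linarith [(Nat.cast_nonneg j : (0 : ℝ) ≤ j)]
  have hjδ : j * δ ≤ ε / 2 := by
    rw [hδ, mul_div_assoc', div_le_iff₀ hd]
    nlinarith
  refine Integrable.mono' ((integrableOn_rpow_mul_exp_neg hs (half_pos hε)).const_mul (δ⁻¹ ^ j))
    (by fun_prop) ?_
  filter_upwards [self_mem_ae_restrict measurableSet_Ioi] with x (hx : 0 < x)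
  rw [norm_of_nonneg (by positivity)]
  have h1 : 1 + x ≤ δ⁻¹ * exp (δ * x) := by
    rw [← mul_le_mul_iff_right₀ hδ0, mul_inv_cancel_left₀ hδ0.ne']
    nlinarith [Real.add_one_le_exp (δ * x)]
  have h2 : (1 + x) ^ j ≤ δ⁻¹ ^ j * exp (ε / 2 * x) := by
    refine (pow_le_pow_left₀ (by positivity) h1 j).trans ?_
    rw [mul_pow, ← Real.exp_nat_mul]
    refine mul_le_mul_of_nonneg_left (exp_le_exp.2 ?_) (by positivity)
    nlinarith
  have h3 : exp (-(ε * x)) = exp (-(ε / 2 * x)) * exp (-(ε / 2 * x)) := by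
    rw [← exp_add]; congr 1; ring
  have h4 : exp (ε / 2 * x) * exp (-(ε / 2 * x)) = 1 := by rw [← exp_add]; simp
  calc x ^ s * (1 + x) ^ j * exp (-(ε * x))
      ≤ x ^ s * (δ⁻¹ ^ j * exp (ε / 2 * x)) * exp (-(ε * x)) := by gcongr
    _ = δ⁻¹ ^ j * (x ^ s * exp (-(ε / 2 * x))) := by
        rw [h3]; linear_combination (x ^ s * δ⁻¹ ^ j * exp (-(ε / 2 * x))) * h4

lemma norm_div_scale_le {g : ℝ → ℂ} {β B K : ℝ} {j : ℕ} (hβ : 0 ≤ β) (hB : ∀ t, ‖g t‖ ≤ B)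
    (hK : ∀ t, 2 ≤ t → ‖g t‖ ≤ K * (t ^ (-β) * log t ^ j)) {t u : ℝ} (ht : 2 ≤ t)
    (hu : 0 < u) :
    ‖g (u * t) / scale (-β, j) t‖ ≤
      (B * 2 ^ β + |K|) / log 2 ^ j * (u ^ (-β) * (1 + u) ^ j) := by
  have ht0 : 0 < t := by linarith
  have hB0 : 0 ≤ B := (norm_nonneg _).trans (hB 0)
  have hl2 : 0 < log 2 := log_pos one_lt_two
  have hlt : log 2 ≤ log t := log_le_log two_pos ht
  have hl0 : 0 < log t := hl2.trans_le hlt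
  rw [norm_div, norm_scale _ (by linarith)]
  dsimp only
  have hpos : 0 < t ^ (-β) * log t ^ j := by positivity
  have hub : (1 : ℝ) ≤ (1 + u) ^ j := one_le_pow₀ (by linarith)
  rw [add_div, add_mul]
  rcases lt_or_ge (u * t) 2 with h | h
  · refine le_add_of_le_of_nonneg ?_ (by positivity)
    rw [div_le_iff₀ hpos]
    refine (hB _).trans ?_
    have h1 : 1 ≤ 2 ^ β * (u ^ (-β) * t ^ (-β)) := by
      rw [← Real.mul_rpow hu.le ht0.le, rpow_neg (by positivity), ← div_eq_mul_inv,
        one_le_div (by positivity)]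
      exact Real.rpow_le_rpow (by positivity) h.le hβ
    have h2 : 1 ≤ log t ^ j / log 2 ^ j := by
      rw [one_le_div (by positivity)]
      exact pow_le_pow_left₀ hl2.le hlt j
    calc B = B * (1 * 1 * 1) := by ring
      _ ≤ B * ((2 ^ β * (u ^ (-β) * t ^ (-β))) * (log t ^ j / log 2 ^ j) *
          (1 + u) ^ j) := by gcongr
      _ = _ := by ring
  · refine le_add_of_nonneg_of_le (by positivity) ?_
    rw [div_le_iff₀ hpos]
    refine (hK _ h).trans ((mul_le_mul_of_nonneg_right (le_abs_self K) (by
      have : 0 ≤ log (u * t) := log_nonneg (by linarith)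
      positivity)).trans ?_)
    have h1 : log (u * t) ≤ (1 + u) * log t / log 2 := by
      rw [log_mul hu.ne' ht0.ne', le_div_iff₀ hl2]
      have h3 : log 2 ≤ 1 := by linarith [Real.log_two_lt_d9]
      have h4 : log u ≤ u := (Real.log_le_sub_one_of_pos hu).trans (by linarith)
      have h5 : log u * log 2 ≤ u * log t := by
        refine (mul_le_mul_of_nonneg_right h4 hl2.le).trans ?_
        gcongr
      nlinarith
    calc |K| * ((u * t) ^ (-β) * log (u * t) ^ j)
        ≤ |K| * ((u * t) ^ (-β) * ((1 + u) * log t / log 2) ^ j) := by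
          have : 0 ≤ log (u * t) := log_nonneg (by linarith)
          gcongr
      _ = _ := by
          rw [Real.mul_rpow hu.le ht0.le, div_pow, mul_pow]
          ring

lemma tendsto_scale_mul_div {β : ℝ} {j : ℕ} {u : ℝ} (hu : 0 < u) :
    Tendsto (fun t => scale (-β, j) (u * t) / scale (-β, j) t) atTop
      (𝓝 ((u ^ (-β) : ℝ) : ℂ)) := by
  have h1 : Tendsto (fun t => 1 + log u / log t) atTop (𝓝 (1 + 0)) :=
    tendsto_const_nhds.add (tendsto_const_nhds.div_atTop Real.tendsto_log_atTop)
  have h2 := ((h1.pow j).const_mul (u ^ (-β)))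
  rw [add_zero, one_pow, mul_one] at h2
  refine ((Complex.continuous_ofReal.tendsto _).comp h2).congr' ?_
  filter_upwards [eventually_gt_atTop 1] with t ht
  have ht0 : 0 < t := by linarith
  have hl := log_pos ht
  simp only [Function.comp_apply, scale]
  rw [← Complex.ofReal_div]
  congr 1
  rw [Real.mul_rpow hu.le ht0.le, log_mul hu.ne' ht0.ne']
  have : t ^ (-β) ≠ 0 := (rpow_pos_of_pos ht0 _).ne'
  rw [one_add_div hl.ne', div_pow, add_comm (log t)]
  field_simp

/-- Averaging a function with known leading behaviour over dilations. -/
lemma tendsto_average {g h : ℝ → ℂ} {β B K ε : ℝ} {j ν : ℕ} {C : ℂ} (hg : Continuous g)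
    (hh : Continuous h) (hβ : 0 ≤ β) (hB : ∀ t, ‖g t‖ ≤ B)
    (hK : ∀ t, 2 ≤ t → ‖g t‖ ≤ K * (t ^ (-β) * log t ^ j))
    (hlim : Tendsto (fun t => g t / scale (-β, j) t) atTop (𝓝 C)) (hε : 0 < ε) (hν : β < ν + 1)
    (hbd : ∀ u : ℝ, 0 < u → ‖h u‖ ≤ u ^ ν * exp (-(ε * u))) :
    Tendsto (fun t => (∫ u in Ioi (0 : ℝ), h u * g (u * t)) / scale (-β, j) t) atTop
      (𝓝 (C * ∫ u in Ioi (0 : ℝ), h u * ((u ^ (-β) : ℝ) : ℂ))) := by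
  set D := (B * 2 ^ β + |K|) / log 2 ^ j
  have hB0 : 0 ≤ B := (norm_nonneg _).trans (hB 0)
  have hl2 : 0 < log 2 := log_pos one_lt_two
  have hJ := (integrableOn_rpow_mul_one_add_pow_mul_exp_neg (s := ν - β) (by linarith) hε
    j).const_mul D
  have key : Tendsto (fun t => ∫ u in Ioi (0 : ℝ), h u * (g (u * t) / scale (-β, j) t)) atTop
      (𝓝 (∫ u in Ioi (0 : ℝ), h u * (C * ((u ^ (-β) : ℝ) : ℂ)))) := by
    refine tendsto_integral_filter_of_dominated_convergence _ (.of_forall fun t => ?_)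
      ?_ hJ ?_
    · exact (hh.mul ((hg.comp (continuous_mul_const t)).div_const _)).aestronglyMeasurable
    · filter_upwards [eventually_ge_atTop 2] with t ht
      filter_upwards [self_mem_ae_restrict measurableSet_Ioi] with u (hu : 0 < u)
      rw [norm_mul]
      refine (mul_le_mul (hbd u hu) (norm_div_scale_le hβ hB hK ht hu) (norm_nonneg _)
        (by positivity)).trans_eq ?_
      rw [sub_eq_add_neg, rpow_add hu, rpow_natCast]
      ring
    · filter_upwards [self_mem_ae_restrict measurableSet_Ioi] with u (hu : 0 < u)
      refine (((hlim.comp (tendsto_id.const_mul_atTop hu)).mul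
        (tendsto_scale_mul_div (j := j) hu)).const_mul (h u)).congr' ?_
      filter_upwards [eventually_gt_atTop (max 1 u⁻¹)] with t ht
      have h1 : 1 < u * t := by
        have := (le_max_right 1 u⁻¹).trans_lt ht
        rwa [inv_lt_iff_one_lt_mul₀ hu, mul_comm] at this
      have h2 := scale_ne_zero (-β, j) h1
      simp only [Function.comp_apply, id]
      field_simp
  have e1 : ∀ t, ∫ u in Ioi (0 : ℝ), h u * (g (u * t) / scale (-β, j) t) =
      (∫ u in Ioi (0 : ℝ), h u * g (u * t)) / scale (-β, j) t := fun t => by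
    simp only [← mul_div_assoc]
    exact integral_div _ _
  have e2 : ∫ u in Ioi (0 : ℝ), h u * (C * ((u ^ (-β) : ℝ) : ℂ)) =
      C * ∫ u in Ioi (0 : ℝ), h u * ((u ^ (-β) : ℝ) : ℂ) := by
    rw [← integral_const_mul]
    exact integral_congr_ae (.of_forall fun u => by ring)
  simpa only [e1, e2] using key

section

/-- The Gamma integral with a complex rate. -/
lemma integral_rpow_mul_cexp_neg_mul {κ : ℝ} (hκ : 0 < κ) {r : ℂ} (hr : 0 < r.re) :
    ∫ u in Ioi (0 : ℝ), ((u ^ (κ - 1) : ℝ) : ℂ) * Complex.exp (-(r * u)) =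
      (1 / r) ^ (κ : ℂ) * Gamma κ := by
  set H : Set ℂ := {r | 0 < r.re} with hH
  have hHo : IsOpen H := isOpen_lt continuous_const Complex.continuous_re
  have hHc : Convex ℝ H := convex_halfSpace_re_gt 0
  set G : ℂ → ℂ := fun r => ∫ u in Ioi (0 : ℝ), ((u ^ (κ - 1) : ℝ) : ℂ) * Complex.exp (-(r * u))
  have hmeas : ∀ r : ℂ, AEStronglyMeasurable
      (fun u : ℝ => ((u ^ (κ - 1) : ℝ) : ℂ) * Complex.exp (-(r * u)))
      (volume.restrict (Ioi 0)) := fun r =>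
    (by fun_prop : Measurable _).aestronglyMeasurable
  have hnorm : ∀ (r : ℂ) (u : ℝ), 0 < u →
      ‖((u ^ (κ - 1) : ℝ) : ℂ) * Complex.exp (-(r * u))‖ =
        u ^ (κ - 1) * exp (-(r.re * u)) := fun r u hu => by
    rw [norm_mul, norm_real, norm_of_nonneg (Real.rpow_nonneg hu.le _),
      Complex.norm_exp]
    simp
  have hG : DifferentiableOn ℂ G H := by
    intro r₀ hr₀
    have hr₀' : 0 < r₀.re / 2 := half_pos hr₀
    refine DifferentiableAt.differentiableWithinAt ?_
    refine (hasDerivAt_integral_of_dominated_loc_of_deriv_le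
      (F' := fun r u => ((u ^ (κ - 1) : ℝ) : ℂ) * (Complex.exp (-(r * u)) * -u))
      (bound := fun u => u ^ κ * exp (-(r₀.re / 2 * u)))
      (s := {r | r₀.re / 2 < r.re})
      ((isOpen_lt continuous_const Complex.continuous_re).mem_nhds (show r₀.re / 2 < r₀.re from half_lt_self hr₀))
      (.of_forall hmeas) ?_ ?_ ?_ ?_ ?_).2.differentiableAt
    · refine Integrable.mono' (integrableOn_rpow_mul_exp_neg (s := κ - 1) (by linarith) hr₀)
        (hmeas r₀) ?_
      filter_upwards [self_mem_ae_restrict measurableSet_Ioi] with u (hu : 0 < u)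
      exact (hnorm r₀ u hu).le
    · exact (by fun_prop : Measurable _).aestronglyMeasurable
    · filter_upwards [self_mem_ae_restrict measurableSet_Ioi] with u (hu : 0 < u) r hr
      rw [← mul_assoc, norm_mul, hnorm r u hu, norm_neg, norm_real,
        norm_of_nonneg hu.le, mul_right_comm, ← Real.rpow_add_one hu.ne', sub_add_cancel]
      have : r₀.re / 2 < r.re := hr
      gcongr
    · exact integrableOn_rpow_mul_exp_neg (by linarith) hr₀'
    · refine .of_forall fun u r _ => ?_
      refine ((((hasDerivAt_id r).mul_const (u : ℂ)).neg.cexp).const_mul _).congr_deriv ?_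
      simp
  have hR : DifferentiableOn ℂ (fun r : ℂ => (1 / r) ^ (κ : ℂ) * Gamma κ) H := by
    intro r hr
    have h0 : r ≠ 0 := fun h => by
      rw [h] at hr
      exact lt_irrefl _ (show (0 : ℝ) < (0 : ℂ).re from hr)
    refine DifferentiableAt.differentiableWithinAt ?_
    refine DifferentiableAt.mul_const (DifferentiableAt.cpow_const ?_ ?_) _
    · exact (differentiableAt_const _).div differentiableAt_id h0
    · refine Or.inl ?_
      rw [one_div, Complex.inv_re]
      exact div_pos hr (Complex.normSq_pos.2 h0)
  have hreal : ∀ x : ℝ, 0 < x → G x = (1 / (x : ℂ)) ^ (κ : ℂ) * Gamma κ := fun x hx => by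
    rw [← Complex.Gamma_ofReal, ← Complex.integral_cpow_mul_exp_neg_mul_Ioi
      (by rwa [ofReal_re]) hx]
    refine setIntegral_congr_fun measurableSet_Ioi fun u (hu : 0 < u) => ?_
    rw [Complex.ofReal_cpow hu.le]
    push_cast
    rfl
  have hfreq : ∃ᶠ z in 𝓝[≠] (1 : ℂ), G z = (1 / z) ^ (κ : ℂ) * Gamma κ := by
    have ht : Tendsto (fun x : ℝ => (x : ℂ)) (𝓝[>] 1) (𝓝[≠] 1) := by
      refine tendsto_nhdsWithin_iff.2 ⟨?_, ?_⟩
      · exact (Complex.continuous_ofReal.tendsto' 1 1 ofReal_one).mono_left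
          nhdsWithin_le_nhds
      · filter_upwards [self_mem_nhdsWithin] with x (hx : 1 < x)
        exact fun h => hx.ne' (by exact_mod_cast mem_singleton_iff.1 h)
    refine ht.frequently (Eventually.frequently ?_)
    filter_upwards [self_mem_nhdsWithin] with x (hx : 1 < x)
    exact hreal x (by linarith)
  exact (hG.analyticOnNhd hHo).eqOn_of_preconnected_of_frequently_eq (hR.analyticOnNhd hHo)
    hHc.isPreconnected (show (1 : ℂ) ∈ H by simp [hH]) hfreq hr

lemma integral_pow_mul_exp_neg_mul_rpow {β : ℝ} {ν : ℕ} (hν : β < ν + 1) {r : ℂ}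
    (hr : 0 < r.re) :
    ∫ u in Ioi (0 : ℝ), ((u : ℂ) ^ ν * Complex.exp (-(r * u))) * ((u ^ (-β) : ℝ) : ℂ) =
      (1 / r) ^ ((ν + 1 - β : ℝ) : ℂ) * Gamma (ν + 1 - β) := by
  rw [← integral_rpow_mul_cexp_neg_mul (sub_pos.2 hν) hr]
  refine setIntegral_congr_fun measurableSet_Ioi fun u (hu : 0 < u) => ?_
  rw [show (ν + 1 - β - 1 : ℝ) = ν + -β by ring, rpow_add hu, rpow_natCast]
  push_cast
  ring

lemma integral_pow_mul_exp_neg_mul (ν : ℕ) {r : ℂ} (hr : 0 < r.re) :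
    ∫ u in Ioi (0 : ℝ), (u : ℂ) ^ ν * Complex.exp (-(r * u)) = (1 / r) ^ (ν + 1) * ν.factorial := by
  have h := integral_pow_mul_exp_neg_mul_rpow (β := 0) (ν := ν) (by positivity) hr
  simp only [neg_zero, Real.rpow_zero, ofReal_one, mul_one, sub_zero] at h
  rw [h, Real.Gamma_nat_eq_factorial, Complex.ofReal_natCast,
    show (((ν + 1 : ℝ)) : ℂ) = ((ν + 1 : ℕ) : ℂ) by push_cast; rfl, Complex.cpow_natCast]

lemma norm_kernel (ν : ℕ) (r : ℂ) {u : ℝ} (hu : 0 < u) :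
    ‖(u : ℂ) ^ ν * Complex.exp (-(r * u))‖ = u ^ ν * exp (-(r.re * u)) := by
  rw [norm_mul, norm_pow, norm_real, norm_of_nonneg hu.le, Complex.norm_exp]
  simp

lemma integrableOn_kernel (ν : ℕ) {r : ℂ} (hr : 0 < r.re) :
    IntegrableOn (fun u : ℝ => (u : ℂ) ^ ν * Complex.exp (-(r * u))) (Ioi 0) := by
  refine Integrable.mono' (integrableOn_rpow_mul_exp_neg (s := ν)
    (by linarith [(Nat.cast_nonneg ν : (0 : ℝ) ≤ ν)]) hr)
    (by fun_prop) ?_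
  filter_upwards [self_mem_ae_restrict measurableSet_Ioi] with u (hu : 0 < u)
  rw [norm_kernel ν r hu, rpow_natCast]

variable {F : ℝ^[n] → ℝ} {w : ℝ^[n] → ℂ}

lemma continuous_integral_osc (hF : Continuous F) (hw : Integrable w) :
    Continuous fun t => ∫ z, osc F t z * w z := by
  refine continuous_of_dominated (bound := fun z => ‖w z‖) (fun t => ?_) (fun t => ?_) hw.norm ?_
  · refine AEStronglyMeasurable.mul ?_ hw.aestronglyMeasurable
    unfold osc
    exact (by fun_prop : Continuous fun z => Complex.exp
      (I * t * F z)).aestronglyMeasurable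
  · exact .of_forall fun z => by rw [norm_mul, norm_osc, one_mul]
  · refine .of_forall fun z => ?_
    unfold osc
    fun_prop

lemma integral_kernel_mul_integral_osc (hF : Continuous F) (hw : Integrable w) (ν : ℕ) {r : ℂ}
    (hr : 0 < r.re) (t : ℝ) :
    ∫ u in Ioi (0 : ℝ), ((u : ℂ) ^ ν * Complex.exp (-(r * u))) * ∫ z, osc F (u * t) z * w z =
      ν.factorial * ∫ z, (1 / (r - I * t * F z)) ^ (ν + 1) * w z := by
  have hk := (integrableOn_kernel ν hr).mul_prod hw
  have hp : Integrable (Function.uncurry fun (u : ℝ) (z : ℝ^[n]) =>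
      ((u : ℂ) ^ ν * Complex.exp (-(r * u))) * (osc F (u * t) z * w z))
      ((volume.restrict (Ioi 0)).prod volume) := by
    have hc : Continuous fun p : ℝ × ℝ^[n] => osc F (p.1 * t) p.2 := by
      unfold osc
      fun_prop
    refine hk.mono ?_ (.of_forall fun p => ?_)
    · refine (hc.aestronglyMeasurable.mul hk.aestronglyMeasurable).congr
        (.of_forall fun p => ?_)
      simp only [Pi.mul_apply, Function.uncurry]
      ring
    · rw [Function.uncurry, norm_mul, norm_mul _ (w p.2), norm_osc, one_mul, norm_mul _ (w p.2)]
  simp only [← integral_const_mul]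
  rw [integral_integral_swap hp]
  refine integral_congr_ae (.of_forall fun z => ?_)
  beta_reduce
  have hr' : 0 < (r - I * t * F z).re := by simpa using hr
  rw [← mul_assoc, mul_comm (ν.factorial : ℂ), ← integral_pow_mul_exp_neg_mul ν hr',
    ← integral_mul_const]
  refine integral_congr_ae (.of_forall fun u => ?_)
  simp only [osc]
  rw [← mul_assoc, mul_assoc (_ ^ ν), ← Complex.exp_add]
  congr 3
  push_cast
  ring

/-- Leading behaviour of averaged oscillatory integrals. -/
lemma tendsto_resolvent (hF : Continuous F) (hw : Integrable w) {β K : ℝ} {j ν : ℕ} {C : ℂ}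
    (hβ : 0 ≤ β)
    (hK : ∀ t, 2 ≤ t → ‖∫ z, osc F t z * w z‖ ≤ K * (t ^ (-β) * log t ^ j))
    (hlim : Tendsto (fun t => (∫ z, osc F t z * w z) / scale (-β, j) t) atTop (𝓝 C))
    (hν : β < ν + 1) {r : ℂ} (hr : 0 < r.re) :
    Tendsto (fun t : ℝ => (ν.factorial * ∫ z, (1 / (r - I * t * F z)) ^ (ν + 1) * w z) /
      scale (-β, j) t) atTop
      (𝓝 (C * ((1 / r) ^ ((ν + 1 - β : ℝ) : ℂ) * Gamma (ν + 1 - β)))) := by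
  have hB : ∀ t, ‖∫ z, osc F t z * w z‖ ≤ ∫ z, ‖w z‖ := fun t => by
    refine (norm_integral_le_integral_norm _).trans_eq ?_
    simp only [norm_mul, norm_osc, one_mul]
  have := tendsto_average (continuous_integral_osc hF hw)
    (h := fun u : ℝ => (u : ℂ) ^ ν * Complex.exp (-(r * u))) (by fun_prop) hβ hB hK hlim hr hν
    fun u hu => (norm_kernel ν r hu).le
  rw [integral_pow_mul_exp_neg_mul_rpow hν hr] at this
  simpa only [integral_kernel_mul_integral_osc hF hw ν hr] using this

end

lemma norm_inv_one_add_pow_le {x : ℝ} (hx : 0 ≤ x) (N : ℕ) : ‖((1 + x)⁻¹) ^ N‖ ≤ 1 := by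
  rw [norm_of_nonneg (by positivity)]
  exact pow_le_one₀ (by positivity) (inv_le_one_of_one_le₀ (by linarith))

lemma integrable_mul_inv_one_add_pow {F w : ℝ^[n] → ℝ} (hw : Integrable w)
    (hF : Measurable F) (N : ℕ) {t : ℝ} (ht : 0 ≤ t) :
    Integrable fun z => w z * ((1 + t * |F z|)⁻¹) ^ N := by
  exact hw.mul_bdd (c := 1)
    (by fun_prop : Measurable fun z => ((1 + t * |F z|)⁻¹) ^ N).aestronglyMeasurable
    (.of_forall fun z => norm_inv_one_add_pow_le (by positivity) N)

/-- The data that determine the argument of the leading coefficient `C` of the oscillatory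
integral with phase `F` and nonnegative weight `w`. -/
structure LeadingTerm (F w : ℝ^[n] → ℝ) (β : ℝ) (j : ℕ) (C : ℂ) : Prop where
  cont : Continuous F
  int : Integrable w
  nonneg : ∀ z, 0 ≤ w z
  exp_nonneg : 0 ≤ β
  bound : ∃ K : ℝ, ∀ t : ℝ, 2 ≤ t →
    ‖∫ z, osc F t z * (w z : ℂ)‖ ≤ K * (t ^ (-β) * log t ^ j)
  lim : Tendsto (fun t => (∫ z, osc F t z * (w z : ℂ)) / scale (-β, j) t) atTop (𝓝 C)
  low : ∀ N : ℕ, ∃ c : ℝ, 0 < c ∧ ∀ᶠ t : ℝ in atTop,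
    c * (t ^ (-β) * log t ^ j) ≤ ∫ z, w z * ((1 + t * |F z|)⁻¹) ^ N

namespace LeadingTerm

variable {F w : ℝ^[n] → ℝ} {β : ℝ} {j : ℕ} {C : ℂ}

lemma neg (h : LeadingTerm F w β j C) :
    LeadingTerm (fun z => -F z) w β j ((starRingEnd ℂ) C) := by
  have hconj : ∀ t : ℝ, ∫ z, osc (fun z => -F z) t z * (w z : ℂ) =
      (starRingEnd ℂ) (∫ z, osc F t z * (w z : ℂ)) := fun t => by
    rw [← integral_conj]
    refine integral_congr_ae (.of_forall fun z => ?_)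
    simp only [osc, map_mul, ← Complex.exp_conj, Complex.conj_I, conj_ofReal]
    congr 2
    push_cast
    ring
  refine ⟨h.cont.neg, h.int, h.nonneg, h.exp_nonneg, ?_, ?_, fun N => ?_⟩
  · obtain ⟨K, hK⟩ := h.bound
    refine ⟨K, fun t ht => ?_⟩
    rw [hconj, RCLike.norm_conj]
    exact hK t ht
  · have := (Complex.continuous_conj.tendsto C).comp h.lim
    refine this.congr fun t => ?_
    simp only [Function.comp_apply, map_div₀, hconj, scale, conj_ofReal]
  · simpa only [abs_neg] using h.low N

lemma tendsto_resolvent (h : LeadingTerm F w β j C) {ν : ℕ} (hν : β < ν + 1) {r : ℂ}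
    (hr : 0 < r.re) :
    Tendsto (fun t : ℝ => (ν.factorial * ∫ z, (1 / (r - I * t * F z)) ^ (ν + 1) *
      (w z : ℂ)) / scale (-β, j) t) atTop
      (𝓝 (C * ((1 / r) ^ ((ν + 1 - β : ℝ) : ℂ) * Gamma (ν + 1 - β)))) := by
  obtain ⟨K, hK⟩ := h.bound
  exact KN.tendsto_resolvent h.cont h.int.ofReal h.exp_nonneg hK h.lim hν hr

lemma integrable_mul (h : LeadingTerm F w β j C) {g : ℝ^[n] → ℂ} (hg : Measurable g)
    {B : ℝ} (hB : ∀ z, ‖g z‖ ≤ B) : Integrable fun z => g z * (w z : ℂ) :=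
  h.int.ofReal.bdd_mul hg.aestronglyMeasurable (.of_forall hB)

lemma integrable_mul_inv_pow (h : LeadingTerm F w β j C) (N : ℕ) {t : ℝ} (ht : 0 ≤ t) :
    Integrable fun z => w z * ((1 + t * |F z|)⁻¹) ^ N :=
  integrable_mul_inv_one_add_pow h.int h.cont.measurable N ht

lemma scale_pos {β : ℝ} {j : ℕ} {t : ℝ} (ht : 1 < t) : 0 < t ^ (-β) * log t ^ j :=
  mul_pos (rpow_pos_of_pos (by linarith) _) (pow_pos (log_pos ht) _)

/-- For slow decay the real part of the leading coefficient is positive. -/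
lemma re_pos (h : LeadingTerm F w β j C) (hβ : β < 1) : 0 < C.re := by
  have hF := h.cont.measurable
  obtain ⟨c, hc, hlow⟩ := h.low 2
  have hlim := (Complex.continuous_re.tendsto _).comp
    (h.tendsto_resolvent (ν := 0) (by simpa using hβ) (r := 1) (by simp))
  have hge : c ≤ (C * ((1 / 1) ^ (((0 : ℕ) + 1 - β : ℝ) : ℂ) * Gamma ((0 : ℕ) + 1 - β))).re := by
    refine ge_of_tendsto hlim ?_
    filter_upwards [hlow, eventually_gt_atTop 1] with t ht ht1
    have hs := scale_pos (β := β) (j := j) ht1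
    simp only [Function.comp_apply, scale, Complex.div_ofReal_re, Nat.factorial_zero, Nat.cast_one,
      one_mul, zero_add, pow_one]
    rw [le_div_iff₀ hs]
    refine ht.trans ?_
    have hre : ∀ z, (1 / (1 - I * t * F z)).re = 1 / (1 + (t * F z) ^ 2) := fun z => by
      rw [one_div, Complex.inv_re]
      simp [Complex.normSq_apply]
      ring
    have hnorm : ∀ z, ‖1 / (1 - I * t * F z)‖ ≤ 1 := fun z => by
      rw [norm_div, norm_one]
      refine div_le_one_of_le₀ ?_ (norm_nonneg _)
      refine le_trans ?_ (Complex.abs_re_le_norm _)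
      simp
    have hi := h.integrable_mul (g := fun z => 1 / (1 - I * t * F z)) (by fun_prop) hnorm
    have := integral_re hi
    simp only [RCLike.re_to_complex] at this
    rw [← this]
    refine integral_mono (h.integrable_mul_inv_pow 2 (by linarith)) hi.re fun z => ?_
    simp only [Complex.re_mul_ofReal, hre]
    rw [mul_comm]
    refine mul_le_mul_of_nonneg_right ?_ (h.nonneg z)
    rw [inv_pow, ← one_div]
    refine one_div_le_one_div_of_le (by positivity) ?_
    have : 0 ≤ t * |F z| := by positivity
    have h2 : (t * F z) ^ 2 = (t * |F z|) ^ 2 := by rw [mul_pow, mul_pow, sq_abs]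
    rw [h2]
    nlinarith
  rw [one_div_one, Complex.one_cpow, one_mul, Complex.re_mul_ofReal] at hge
  exact pos_of_mul_pos_left (hc.trans_le hge)
    (Real.Gamma_pos_of_pos (by simpa using hβ)).le

lemma exists_perturbation (N : ℕ) {η : ℝ} (hη : 0 < η) :
    ∃ ε₀ > 0, ∀ ε : ℝ, 0 < ε → ε ≤ ε₀ → ∀ y : ℝ, 1 ≤ y →
      ‖(1 / ((y : ℂ) + I * ε)) ^ N - ((y⁻¹ ^ N : ℝ) : ℂ)‖ ≤ η * y⁻¹ ^ N := by
  have hc : ContinuousAt (fun δ : ℝ => (1 / (1 + I * δ)) ^ N) 0 := by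
    refine ContinuousAt.pow (ContinuousAt.div continuousAt_const (by fun_prop) ?_) _
    simp
  obtain ⟨ε₀, h0, h1⟩ := Metric.continuousAt_iff.1 hc η hη
  refine ⟨ε₀ / 2, half_pos h0, fun ε he hle y hy => ?_⟩
  have hy0 : 0 < y := by linarith
  have h2 : |ε / y| < ε₀ := by
    rw [abs_of_pos (by positivity)]
    have := div_le_self he.le hy
    linarith
  have h3 := h1 (x := ε / y) (by rwa [dist_zero_right, Real.norm_eq_abs])
  rw [dist_eq_norm] at h3
  have hyc : (y : ℂ) ≠ 0 := by exact_mod_cast hy0.ne'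
  have h4 : 1 / ((y : ℂ) + I * ε) = (y⁻¹ : ℝ) * (1 / (1 + I * (ε / y : ℝ))) := by
    have h5 : (y : ℂ) + I * ε = y * (1 + I * (ε / y : ℝ)) := by
      push_cast
      field_simp
    rw [h5, one_div, mul_inv, one_div]
    push_cast
    rfl
  rw [h4, mul_pow, Complex.ofReal_pow, ← mul_sub_one, norm_mul, norm_pow, norm_real,
    norm_of_nonneg (by positivity), mul_comm]
  refine mul_le_mul_of_nonneg_right ?_ (by positivity)
  simpa using h3.le

/-- For a nonnegative phase the leading coefficient has argument `πβ/2`. -/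
lemma of_nonneg (h : LeadingTerm F w β j C) (hF0 : ∀ z, w z ≠ 0 → 0 ≤ F z) :
    ∃ A : ℝ, 0 < A ∧ C = A * I ^ (β : ℂ) := by
  have hF := h.cont.measurable
  obtain ⟨ν, hν⟩ := exists_nat_gt β
  have hν' : β < ν + 1 := hν.trans (lt_add_one _)
  set κ : ℝ := ν + 1 - β with hκ
  have hκ0 : 0 < κ := sub_pos.2 hν'
  have hΓ := Real.Gamma_pos_of_pos hκ0
  obtain ⟨c, hc, hlow⟩ := h.low (ν + 1)
  set L : ℂ → ℂ := fun r => C * ((1 / r) ^ (κ : ℂ) * Gamma κ) /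
    (ν.factorial * I ^ (ν + 1)) with hL
  have hI : (ν.factorial * I ^ (ν + 1) : ℂ) ≠ 0 :=
    mul_ne_zero (by exact_mod_cast ν.factorial_ne_zero) (pow_ne_zero _ I_ne_zero)
  have hlimL : ∀ ε : ℝ, 0 < ε → Tendsto (fun t : ℝ =>
      (∫ z, (1 / (((1 + t * F z : ℝ) : ℂ) + I * ε)) ^ (ν + 1) * (w z : ℂ)) /
        scale (-β, j) t) atTop (𝓝 (L (ε - I))) := fun ε he => by
    refine ((h.tendsto_resolvent hν' (r := ε - I) (by simpa using he)).div_const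
      (ν.factorial * I ^ (ν + 1))).congr fun t => ?_
    have h1 : ∀ z, (1 / ((ε : ℂ) - I - I * t * F z)) ^ (ν + 1) * (w z : ℂ) =
        I ^ (ν + 1) *
          ((1 / (((1 + t * F z : ℝ) : ℂ) + I * ε)) ^ (ν + 1) * (w z : ℂ)) := fun z => by
      rw [← mul_assoc, ← mul_pow]
      congr 2
      have : (ε : ℂ) - I - I * t * F z =
          I⁻¹ * (((1 + t * F z : ℝ) : ℂ) + I * ε) := by
        rw [mul_add, inv_mul_cancel_left₀ I_ne_zero, Complex.inv_I]
        push_cast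
        ring
      rw [this, one_div, mul_inv, inv_inv, one_div]
    simp only [h1, integral_const_mul]
    rw [← mul_assoc, div_right_comm, mul_div_cancel_left₀ _ hI]
  have hcone : ∀ η : ℝ, 0 < η → η ≤ 1 / 2 →
      c / 2 ≤ (L (-I)).re ∧ |(L (-I)).im| ≤ 2 * η * (L (-I)).re := by
    intro η hη hη2
    obtain ⟨ε₀, hε₀, hpert⟩ := exists_perturbation (ν + 1) hη
    set S : Set ℂ := {z | c / 2 ≤ z.re ∧ |z.im| ≤ 2 * η * z.re} with hS
    have hScl : IsClosed S :=
      (isClosed_le continuous_const Complex.continuous_re).inter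
        (isClosed_le (Complex.continuous_im.abs) (continuous_const.mul Complex.continuous_re))
    have hmem : ∀ ε : ℝ, 0 < ε → ε ≤ ε₀ → L (ε - I) ∈ S := fun ε he hle => by
      refine hScl.mem_of_tendsto (hlimL ε he) ?_
      filter_upwards [hlow, eventually_gt_atTop 1] with t ht ht1
      have hs := scale_pos (β := β) (j := j) ht1
      have hJ := h.integrable_mul_inv_pow (ν + 1) (t := t) (by linarith)
      set P : ℝ := ∫ z, w z * ((1 + t * |F z|)⁻¹) ^ (ν + 1) with hP
      have herr : ‖(∫ z, (1 / (((1 + t * F z : ℝ) : ℂ) + I * ε)) ^ (ν + 1) * (w z : ℂ)) -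
          (P : ℂ)‖ ≤ η * P := by
        have hPc : (P : ℂ) = ∫ z, ((w z * ((1 + t * |F z|)⁻¹) ^ (ν + 1) : ℝ) : ℂ) :=
          integral_ofReal.symm
        have hi : Integrable fun z =>
            (1 / (((1 + t * F z : ℝ) : ℂ) + I * ε)) ^ (ν + 1) * (w z : ℂ) := by
          refine h.integrable_mul (B := (1 / ε) ^ (ν + 1)) (by fun_prop) fun z => ?_
          rw [norm_pow, norm_div, norm_one]
          refine pow_le_pow_left₀ (by positivity) (one_div_le_one_div_of_le he ?_) _
          refine le_trans ?_ (Complex.abs_im_le_norm _)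
          simp [abs_of_pos he]
        have hJ' : Integrable fun z => ((w z * ((1 + t * |F z|)⁻¹) ^ (ν + 1) : ℝ) : ℂ) := hJ.ofReal
        rw [hPc, ← integral_sub hi hJ', hP, ← integral_const_mul]
        refine norm_integral_le_of_norm_le (hJ.const_mul η) (.of_forall fun z => ?_)
        by_cases hz : w z = 0
        · simp [hz]
        have hFz := hF0 z hz
        rw [abs_of_nonneg hFz]
        have := hpert ε he hle (1 + t * F z) (le_add_of_nonneg_right (by positivity))
        rw [ofReal_mul, mul_comm ((w z : ℝ) : ℂ), ← sub_mul, norm_mul, norm_real,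
          norm_of_nonneg (h.nonneg z), mul_comm (w z), ← mul_assoc]
        exact mul_le_mul_of_nonneg_right this (h.nonneg z)
      set X : ℂ := ∫ z, (1 / (((1 + t * F z : ℝ) : ℂ) + I * ε)) ^ (ν + 1) * (w z : ℂ)
      have hre := (Complex.abs_re_le_norm _).trans herr
      have him := (Complex.abs_im_le_norm _).trans herr
      rw [Complex.sub_re, ofReal_re, abs_le] at hre
      rw [Complex.sub_im, Complex.ofReal_im, sub_zero] at him
      have hP0 : 0 < P := (mul_pos hc hs).trans_le ht
      have hXre : P / 2 ≤ X.re := by nlinarith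
      change c / 2 ≤ (X / ((_ : ℝ) : ℂ)).re ∧ |(X / ((_ : ℝ) : ℂ)).im| ≤ 2 * η * (X / ((_ : ℝ) : ℂ)).re
      rw [Complex.div_ofReal_re, Complex.div_ofReal_im, abs_div, abs_of_pos hs, le_div_iff₀ hs,
        ← mul_div_assoc, div_le_div_iff_of_pos_right hs]
      constructor
      · change _ * (t ^ (-β) * log t ^ j) ≤ _
        linarith
      · nlinarith
    have hcont : Tendsto (fun ε : ℝ => L (ε - I)) (𝓝[>] 0) (𝓝 (L (-I))) := by
      have h1 : ContinuousAt L (-I) := by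
        refine ContinuousAt.div_const (continuousAt_const.mul (ContinuousAt.mul ?_
          continuousAt_const)) _
        refine ContinuousAt.cpow (ContinuousAt.div continuousAt_const continuousAt_id
          (by simp)) continuousAt_const ?_
        simp [Complex.mem_slitPlane_iff]
      have h2 : Tendsto (fun ε : ℝ => (ε : ℂ) - I) (𝓝[>] 0) (𝓝 (-I)) := by
        refine (Continuous.tendsto' (by fun_prop) _ _ ?_).mono_left nhdsWithin_le_nhds
        simp
      exact h1.tendsto.comp h2
    refine hScl.mem_of_tendsto hcont ?_
    filter_upwards [Ioc_mem_nhdsGT hε₀] with ε he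
    exact hmem ε he.1 he.2
  set l : ℂ := L (-I) with hl
  have hre : 0 < l.re := (half_pos hc).trans_le (hcone (1 / 2) (by norm_num) le_rfl).1
  have him : l.im = 0 := by
    by_contra hne
    have hpos : 0 < |l.im| := abs_pos.2 hne
    have h1 := (hcone (min (1 / 2) (|l.im| / (4 * l.re))) (by positivity) (min_le_left _ _)).2
    have h2 : min (1 / 2) (|l.im| / (4 * l.re)) ≤ |l.im| / (4 * l.re) := min_le_right _ _
    have h3 : 2 * min (1 / 2) (|l.im| / (4 * l.re)) * l.re ≤ 2 * (|l.im| / (4 * l.re)) * l.re := by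
      gcongr
    have h4 : 2 * (|l.im| / (4 * l.re)) * l.re = |l.im| / 2 := by
      field_simp
      ring
    linarith
  have hlr : l = (l.re : ℂ) := Complex.ext rfl (by simpa using him)
  refine ⟨l.re * ν.factorial / Gamma κ, by positivity, ?_⟩
  have hGc : (Gamma κ : ℂ) ≠ 0 := by exact_mod_cast hΓ.ne'
  have hIκ : I ^ (κ : ℂ) ≠ 0 := by
    rw [Ne, Complex.cpow_eq_zero_iff]
    exact fun h => I_ne_zero h.1
  have h1 : l * (ν.factorial * I ^ (ν + 1)) = C * (I ^ (κ : ℂ) * Gamma κ) := by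
    rw [hl, hL]
    simp only
    rw [div_mul_cancel₀ _ hI]
    congr 3
    simp
  have h2 : I ^ (ν + 1) = I ^ (κ : ℂ) * I ^ (β : ℂ) := by
    rw [← Complex.cpow_add _ _ I_ne_zero, ← Complex.cpow_natCast]
    congr 1
    rw [hκ]
    push_cast
    ring
  rw [h2] at h1
  have h3 : C = l * ν.factorial * I ^ (β : ℂ) / Gamma κ := by
    rw [eq_div_iff hGc]
    refine mul_right_cancel₀ hIκ ?_
    linear_combination -h1
  rw [h3]
  nth_rewrite 1 [hlr]
  push_cast
  ring

lemma of_nonpos (h : LeadingTerm F w β j C) (hF0 : ∀ z, w z ≠ 0 → F z ≤ 0) :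
    ∃ A : ℝ, 0 < A ∧ C = A * (starRingEnd ℂ) (I ^ (β : ℂ)) := by
  obtain ⟨A, hA, h1⟩ := h.neg.of_nonneg fun z hz => neg_nonneg.2 (hF0 z hz)
  refine ⟨A, hA, ?_⟩
  rw [← Complex.conj_conj C, h1, map_mul, conj_ofReal]

end LeadingTerm

lemma I_cpow_re (β : ℝ) : (I ^ (β : ℂ)).re = Real.cos (Real.pi * β / 2) := by
  rw [Complex.cpow_def_of_ne_zero I_ne_zero, Complex.log_I,
    show (Real.pi / 2 * I * β : ℂ) = ((Real.pi * β / 2 : ℝ) : ℂ) * I by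
      push_cast; ring, Complex.exp_ofReal_mul_I_re]

lemma cos_ne_zero_of_not_odd {β : ℝ} (hβ : 0 ≤ β) (h : ¬ ∃ k : ℕ, Odd k ∧ β = k) :
    Real.cos (Real.pi * β / 2) ≠ 0 := by
  intro h0
  obtain ⟨k, hk⟩ := Real.cos_eq_zero_iff.1 h0
  have h1 : β = 2 * k + 1 := by
    have := Real.pi_pos
    have h2 : Real.pi * β = Real.pi * (2 * k + 1) := by linarith
    exact mul_left_cancel₀ this.ne' h2
  have hk0 : 0 ≤ k := by
    by_contra hneg
    have : k ≤ -1 := by omega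
    have : (k : ℝ) ≤ -1 := by exact_mod_cast this
    linarith
  lift k to ℕ using hk0
  exact h ⟨2 * k + 1, ⟨k, rfl⟩, by rw [h1]; push_cast; rfl⟩

lemma continuous_TI (I : Set (Fin n)) : Continuous (TI I) := by
  unfold TI
  refine continuous_pi fun i => ?_
  split_ifs
  · exact continuous_const
  · exact continuous_apply i

lemma TI_zero (I : Set (Fin n)) : TI I 0 = 0 := by
  funext i
  simp [TI]

/-- A nonempty face of a Newton polyhedron has a normal vector with nonnegative entries whose
zero entries are exactly the coordinate directions contained in the face. -/
lemma mem_Vset_iff {a : Fin n → ℤ} {l : ℤ}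
    (hval : ValidPair (Γ₊ f) a l)
    (hne : (Γ₊ f ∩ Hplane (intPt a) l).Nonempty) (i : Fin n) :
    0 ≤ a i ∧ (i ∈ Vset (Γ₊ f ∩ Hplane (intPt a) l) ↔ a i = 0) := by
  obtain ⟨q, hq⟩ := hne
  have hup : ∀ x ∈ Γ₊ f, ∀ r : ℝ, 0 ≤ r →
      x + r • (single i (1 : ℝ) : ℝ^[n]) ∈ Γ₊ f := fun x hx r hr => by
    refine NewtonPolyhedron_upward hx fun j => ?_
    rw [Pi.add_apply, Pi.smul_apply, smul_eq_mul]
    have : (0 : ℝ) ≤ (single i (1 : ℝ) : ℝ^[n]) j := by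
      by_cases h : j = i
      · subst h; simp
      · simp [h]
    exact le_add_of_nonneg_right (mul_nonneg hr this)
  have hdot : ∀ (x : ℝ^[n]) (r : ℝ), dot (intPt a) (x + r • (single i (1 : ℝ) : ℝ^[n])) =
      dot (intPt a) x + r * a i := fun x r => by
    rw [dot_add_right, dot_smul_right, dot_comm (intPt a) (single i 1), dot_single_left]
    rfl
  have h0 : (0 : ℝ) ≤ a i := by
    have h1 : (l : ℝ) ≤ dot (intPt a) (q + (1 : ℝ) • (single i (1 : ℝ) : ℝ^[n])) :=
      hval (hup q hq.1 1 zero_le_one)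
    have h2 : dot (intPt a) q = l := hq.2
    rw [hdot, h2] at h1
    linarith
  refine ⟨by exact_mod_cast h0, fun h => ?_, fun h x hx r hr => ⟨hup x hx.1 r hr, ?_⟩⟩
  · have h1 : dot (intPt a) (q + (1 : ℝ) • (single i (1 : ℝ) : ℝ^[n])) = l :=
      (h q hq 1 zero_le_one).2
    have h2 : dot (intPt a) q = l := hq.2
    rw [hdot, h2] at h1
    have : (a i : ℝ) = 0 := by linarith
    exact_mod_cast this
  · have h2 : dot (intPt a) x = l := hx.2
    change dot (intPt a) _ = l
    rw [hdot, h2, h, Int.cast_zero, mul_zero, add_zero]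

namespace LocalModel

open Classical in
/-- The `τ`-part of a local model. -/
noncomputable def facePart (τ : Set ℝ^[n]) (x : ℝ^[n]) : ℝ :=
  ∑ p ∈ M.F with natPt p ∈ τ, xpow p x * M.ψ p (TI (Wset τ) x)

open Classical in
lemma gammaFn_eq (hτ : IsFaceOf (Γ₊ f) τ)
    (hne : τ.Nonempty) : ∀ᶠ x in 𝓝 (0 : ℝ^[n]), gammaFn f τ x = M.facePart τ x := by
  obtain ⟨a, l, hval, hτe⟩ := hτ
  have hV := fun i => mem_Vset_iff hval (hτe ▸ hne) i
  rw [← hτe] at hV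
  have hev : ∀ᶠ x in 𝓝 (0 : ℝ^[n]), f =ᶠ[𝓝 (TI (Wset τ) x)]
      fun x => ∑ p ∈ M.F, xpow p x * M.ψ p x := by
    have : Tendsto (TI (Wset τ)) (𝓝 0) (𝓝 0) := (continuous_TI _).tendsto' _ _ (TI_zero _)
    exact this.eventually M.germ.eventuallyEq_nhds
  filter_upwards [hev] with x hx
  set y := TI (Wset τ) x with hy
  have hyW : ∀ i, i ∉ Vset τ → y i = 0 := fun i hi => by
    rw [hy, TI, if_pos (show i ∈ Wset τ from hi)]
  have hyV : ∀ i, i ∈ Vset τ → y i = x i := fun i hi => by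
    rw [hy, TI, if_neg (show ¬ i ∈ Wset τ from fun h => h hi)]
  let tr : ℕ^[n] → ℕ^[n] := fun p i => if i ∈ Vset τ then 0 else p i
  have htr : ∀ p : ℕ^[n], natPt (tr p) = TI (Vset τ) (natPt p) := fun p => by
    funext i
    simp only [natPt, TI, tr]
    split_ifs <;> simp
  have hterm : ∀ α : {α : ℕ^[n] // natPt α ∈ TI (Vset τ) '' τ},
      mderiv α.1 f y * (∏ i, x i ^ (α.1 i)) / ((∏ i, Nat.factorial (α.1 i) : ℕ) : ℝ) =
        ∑ p ∈ M.F with natPt p ∈ τ, if tr p = α.1 then xpow p x * M.ψ p y else 0 := by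
    rintro ⟨α, q, hq, hqα⟩
    have hαV : ∀ i, i ∈ Vset τ → α i = 0 := fun i hi => by
      have := congrFun hqα i
      rw [TI, if_pos hi] at this
      exact Nat.cast_eq_zero.1 this.symm
    have hαW : ∀ i, i ∉ Vset τ → (α i : ℝ) = q i := fun i hi => by
      have := congrFun hqα i
      rw [TI, if_neg hi] at this
      exact this.symm
    have hq' := hq
    rw [hτe] at hq'
    have hql : dot (intPt a) q = l := hq'.2
    have hdotα : ∑ i, (a i : ℝ) * α i = l := by
      rw [← hql]
      refine sum_congr rfl fun i _ => ?_
      by_cases hi : i ∈ Vset τ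
      · rw [intPt, ((hV i).2.1 hi)]; simp
      · rw [hαW i hi]; rfl
    have hp : ∀ p ∈ M.F, mderiv α (fun x => xpow p x * M.ψ p x) y * (∏ i, x i ^ α i) /
        ((∏ i, Nat.factorial (α i) : ℕ) : ℝ) =
        if natPt p ∈ τ then if tr p = α then xpow p x * M.ψ p y else 0 else 0 := by
      intro p hpF
      by_cases hj : ∃ j, j ∉ Vset τ ∧ α j < p j
      · obtain ⟨j, hjV, hjp⟩ := hj
        rw [mderiv_xpow_mul_eq_zero α p j hjp (M.smooth p) (hyW j hjV), zero_mul, zero_div]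
        have : tr p ≠ α := fun h => by
          have := congrFun h j
          simp only [tr, if_neg hjV] at this
          omega
        simp [this]
      push Not at hj
      have hle : ∀ i ∈ Finset.univ, (a i : ℝ) * p i ≤ a i * α i := fun i _ => by
        by_cases hi : i ∈ Vset τ
        · rw [(hV i).2.1 hi]; simp
        · refine mul_le_mul_of_nonneg_left (by exact_mod_cast hj i hi) ?_
          exact_mod_cast (hV i).1
      have hge : (l : ℝ) ≤ ∑ i, (a i : ℝ) * p i := hval (M.mem_poly p hpF)
      have heq : ∑ i, (a i : ℝ) * p i = ∑ i, (a i : ℝ) * α i :=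
        le_antisymm (sum_le_sum hle) (by rw [hdotα]; exact hge)
      have hpτ : natPt p ∈ τ := by
        rw [hτe]
        exact ⟨M.mem_poly p hpF, heq.trans hdotα⟩
      have htrα : tr p = α := by
        funext i
        simp only [tr]
        split_ifs with hi
        · exact (hαV i hi).symm
        · have h1 := (Finset.sum_eq_sum_iff_of_le hle).1 heq i (Finset.mem_univ i)
          have h2 : (a i : ℝ) ≠ 0 := fun h => hi ((hV i).2.2 (by exact_mod_cast h))
          exact_mod_cast mul_left_cancel₀ h2 h1
      rw [if_pos hpτ, if_pos htrα]
      have hsplit : ∀ x, xpow p x = xpow α x * ∏ i, x i ^ (p i - α i) := fun x => by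
        rw [xpow, xpow, ← Finset.prod_mul_distrib]
        refine prod_congr rfl fun i _ => ?_
        rw [← pow_add]
        congr 1
        have : α i ≤ p i := by
          rw [← htrα]
          simp only [tr]
          split_ifs <;> omega
        omega
      have hfun : (fun x => xpow p x * M.ψ p x) =
          fun x => xpow α x * ((∏ i, x i ^ (p i - α i)) * M.ψ p x) := by
        funext x
        rw [hsplit, mul_assoc]
      have hprod : ∏ i, y i ^ (p i - α i) = ∏ i, x i ^ (p i - α i) := by
        refine prod_congr rfl fun i _ => ?_
        by_cases hi : i ∈ Vset τ
        · rw [hyV i hi]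
        · have : p i - α i = 0 := by
            rw [← htrα]
            simp [tr, hi]
          rw [this, pow_zero, pow_zero]
      have hfac : ((∏ i, Nat.factorial (α i) : ℕ) : ℝ) ≠ 0 := by
        exact_mod_cast Finset.prod_ne_zero_iff.2 fun i _ => Nat.factorial_ne_zero _
      rw [hfun, mderiv_xpow_mul α (fun i hi => hyW i fun h => hi (hαV i h))
        ((contDiff_prod fun i _ => (contDiff_coord i).pow _).mul (M.smooth p)), hprod, hsplit,
        div_eq_iff hfac, xpow]
      ring
    simp only
    rw [mderiv_sum_xpow M.smooth hx, sum_mul, sum_div, sum_congr rfl hp,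
      Finset.sum_filter]
  rw [gammaFn, facePart, tsum_congr hterm]
  have hfin : ∀ p, natPt p ∈ τ → HasSum (fun α : {α : ℕ^[n] // natPt α ∈ TI (Vset τ) '' τ} =>
      if tr p = α.1 then xpow p x * M.ψ p y else 0) (xpow p x * M.ψ p y) := fun p hp => by
    have := hasSum_single (f := fun α : {α : ℕ^[n] // natPt α ∈ TI (Vset τ) '' τ} =>
      if tr p = α.1 then xpow p x * M.ψ p y else 0) ⟨tr p, natPt p, hp, (htr p).symm⟩
      fun α hα => if_neg fun h => hα (Subtype.ext h.symm)
    simpa using this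
  exact (hasSum_sum fun p hp => hfin p (mem_filter.1 hp).2).tsum_eq

end LocalModel

lemma exists_oct_expc_mem (hU : U ∈ 𝓝 (0 : ℝ^[n])) :
    ∃ R : ℝ, 0 ≤ R ∧ ∀ x : ℝ^[n], (∀ i, |x i| ≤ exp (-R)) → x ∈ U := by
  obtain ⟨r, hr, hrU⟩ := Metric.mem_nhds_iff.1 hU
  refine ⟨max 0 (-log (r / 2)), le_max_left _ _, fun x hx => hrU ?_⟩
  have h1 : exp (-max 0 (-log (r / 2))) ≤ r / 2 := by
    rw [← Real.le_log_iff_exp_le (half_pos hr)]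
    linarith [le_max_right 0 (-log (r / 2))]
  rw [mem_ball_zero_iff]
  refine lt_of_le_of_lt ((pi_norm_le_iff_of_nonneg (half_pos hr).le).2 fun i => ?_) (half_lt_self hr)
  exact (hx i).trans h1

lemma abs_expc_le_of_mem_oct (hσ : ∀ i, |σ i| = 1)
    (hz : ∀ i, R ≤ z i) (i : Fin n) : |expc σ z i| ≤ exp (-R) := by
  rw [abs_expc_le hσ, exp_le_exp]
  exact neg_le_neg (hz i)

lemma convex_oct (n : ℕ) (R : ℝ) : Convex ℝ (oct n R) := fun x hx y hy a b ha hb hab i => by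
  have h1 := mul_le_mul_of_nonneg_left (hx i) ha
  have h2 := mul_le_mul_of_nonneg_left (hy i) hb
  have h3 : R = a * R + b * R := by rw [← add_mul, hab, one_mul]
  simp only [Pi.add_apply, Pi.smul_apply, smul_eq_mul]
  linarith

/-- A face of a Newton polyhedron that contains the exponents of `S` on another face with
positive normal vector contains that face. -/
lemma PolyData.mem_face_of_forall
    (hτ : IsFaceOf (Γ₊ f) τ) {l : ℕ} (hb : ∀ i, 0 < b i)
    (hP : Γ₊ f ⊆ Hhalf (natPt b) l)
    (h : ∀ s ∈ D.S, ndot b s = l → natPt s ∈ τ) (hv : v ∈ Γ₊ f)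
    (hvl : dot (natPt b) v = l) : v ∈ τ := by
  obtain ⟨a, lτ, hval, rfl⟩ := hτ
  obtain ⟨K₁, hK₁⟩ : ∃ K : ℝ, ∀ i, (a i : ℝ) ≤ K := by
    obtain ⟨K, hK⟩ := (Set.finite_range fun i => (a i : ℝ)).bddAbove
    exact ⟨K, fun i => hK ⟨i, rfl⟩⟩
  obtain ⟨K₂, hK₂⟩ : ∃ K : ℝ, ∀ s ∈ D.S, dot (intPt a) (natPt s) - lτ ≤ K := by
    obtain ⟨K, hK⟩ := (D.S.finite_toSet.image fun s => dot (intPt a) (natPt s) - lτ).bddAbove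
    exact ⟨K, fun s hs => hK ⟨s, hs, rfl⟩⟩
  have hK₂' : ∀ s ∈ D.S, (l : ℝ) ≤ ndot b s := fun s hs => by rw [← dot_natPt]; exact hP (D.mem hs)
  set K := max 0 (max K₁ (K₂ + 1)) with hK
  have hz : ∀ i, 0 ≤ (K • natPt b - intPt a) i := fun i => by
    have h1 : (1 : ℝ) ≤ b i := by exact_mod_cast hb i
    have h2 : (0 : ℝ) ≤ K := le_max_left _ _
    have h3 : (a i : ℝ) ≤ K := (hK₁ i).trans ((le_max_left _ _).trans (le_max_right _ _))
    simp only [Pi.sub_apply, Pi.smul_apply, smul_eq_mul, natPt, intPt]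
    nlinarith
  obtain ⟨s, hs, hle⟩ := D.exists_dot_le hv hz
  have hexp : ∀ x, dot (K • natPt b - intPt a) x = K * dot (natPt b) x - dot (intPt a) x :=
    fun x => by rw [dot_sub_left, dot_comm, dot_smul_right, dot_comm x]
  rw [hexp, hexp, hvl, dot_natPt] at hle
  have hvτ : (lτ : ℝ) ≤ dot (intPt a) v := hval hv
  refine ⟨hv, ?_⟩
  by_cases hsl : ndot b s = l
  · have h1 : dot (intPt a) (natPt s) = lτ := (h s hs hsl).2
    rw [hsl, h1] at hle
    exact le_antisymm (by linarith) hvτ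
  · exfalso
    have h1 : (l : ℝ) + 1 ≤ ndot b s := by
      have h2 : l ≤ ndot b s := by exact_mod_cast hK₂' s hs
      exact_mod_cast Nat.lt_of_le_of_ne h2 (Ne.symm hsl)
    have h2 : K₂ + 1 ≤ K := (le_max_right _ _).trans (le_max_right _ _)
    have h3 : (0 : ℝ) ≤ K := le_max_left _ _
    have h4 := hK₂ s hs
    nlinarith

namespace LocalModel

lemma continuous_facePart (τ : Set ℝ^[n]) : Continuous (M.facePart τ) :=
  continuous_finsetSum _ fun p _ => (contDiff_xpow p).continuous.mul
    ((M.smooth p).continuous.comp (continuous_TI _))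

/-- A nonvanishing `τ`-part has a constant sign on the orthants. -/
lemma exists_sign (hU : U ∈ 𝓝 (0 : ℝ^[n]))
    (hτ : IsFaceOf (Γ₊ f) τ) (hne : τ.Nonempty)
    (h : ∀ x ∈ U, (∀ i, x i ≠ 0) → gammaFn f τ x ≠ 0) (hσ : ∀ i, |σ i| = 1) :
    ∃ ε : ℝ, (ε = 1 ∨ ε = -1) ∧ ∃ R : ℝ, ∀ z, (∀ i, R ≤ z i) →
      0 < ε * M.facePart τ (expc σ z) := by
  obtain ⟨R, -, hR⟩ := exists_oct_expc_mem (inter_mem hU (M.gammaFn_eq hτ hne))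
  set g : ℝ^[n] → ℝ := fun z => M.facePart τ (expc σ z) with hg
  have hgc : Continuous g := (M.continuous_facePart τ).comp (contDiff_expc σ).continuous
  have hg0 : ∀ z ∈ oct n R, g z ≠ 0 := fun z hz => by
    obtain ⟨h1, h2⟩ := hR _ (abs_expc_le_of_mem_oct hσ hz)
    have h2' : gammaFn f τ (expc σ z) = M.facePart τ (expc σ z) := h2
    rw [hg]
    simp only
    rw [← h2']
    exact h _ h1 (expc_ne_zero hσ z)
  have hpre := (convex_oct n R).isPreconnected
  have hz0 : (fun _ => R : ℝ^[n]) ∈ oct n R := fun _ => le_rfl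
  rcases lt_or_gt_of_ne (hg0 _ hz0) with h0 | h0
  · refine ⟨-1, Or.inr rfl, R, fun z hz => ?_⟩
    by_contra hcon
    have hcon' : 0 ≤ g z := by
      change ¬ 0 < -1 * g z at hcon
      linarith
    obtain ⟨y, hy, hy0⟩ := hpre.intermediate_value hz0 hz hgc.continuousOn ⟨h0.le, hcon'⟩
    exact hg0 y hy hy0
  · refine ⟨1, Or.inl rfl, R, fun z hz => ?_⟩
    by_contra hcon
    have hcon' : g z ≤ 0 := by
      change ¬ 0 < 1 * g z at hcon
      linarith
    obtain ⟨y, hy, hy0⟩ := hpre.intermediate_value hz hz0 hgc.continuousOn ⟨hcon', h0.le⟩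
    exact hg0 y hy hy0

open Classical in
lemma facePolynomial_nonneg {ε R : ℝ}
    (hε : ∀ z, (∀ i, R ≤ z i) → 0 < ε * M.facePart τ (expc σ z)) {l : ℕ}
    (hb : ∀ i, 0 < b i) (hP : Γ₊ f ⊆ Hhalf (natPt b) l)
    (h : ∀ p ∈ M.F, ndot b p = l → natPt p ∈ τ) (w : ℝ^[n]) :
    0 ≤ ε * ∑ p ∈ M.F with ndot b p = l, xpow p (expc σ w) * M.ψ p 0 := by
  have hz := tendsto_add_smul_natPt hb w
  have hlim : Tendsto (fun k : ℕ => ε * (exp (k * l) *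
      M.facePart τ (expc σ (w + (k : ℝ) • natPt b)))) atTop
      (𝓝 (ε * ∑ p ∈ M.F with ndot b p = l, xpow p (expc σ w) * M.ψ p 0)) := by
    refine Tendsto.const_mul ε ?_
    have hset : (M.F.filter fun p => ndot b p = l) =
        (M.F.filter fun p => natPt p ∈ τ).filter fun p => ndot b p = l := by
      ext p
      simp only [mem_filter]
      constructor
      · rintro ⟨h1, h2⟩; exact ⟨⟨h1, h p h1 h2⟩, h2⟩
      · rintro ⟨⟨h1, -⟩, h2⟩; exact ⟨h1, h2⟩
    rw [hset, Finset.sum_filter]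
    simp only [facePart, mul_sum]
    refine tendsto_finsetSum _ fun p hp => ?_
    have hψ : Tendsto (fun k : ℕ => M.ψ p (TI (Wset τ) (expc σ (w + (k : ℝ) • natPt b)))) atTop
        (𝓝 (M.ψ p 0)) := by
      have h1 : Tendsto (fun x => M.ψ p (TI (Wset τ) x)) (𝓝 0) (𝓝 (M.ψ p 0)) := by
        refine ((M.smooth p).continuous.comp (continuous_TI (Wset τ))).tendsto' _ _ ?_
        simp [TI_zero]
      exact h1.comp (tendsto_expc hz)
    have hpl : (l : ℝ) ≤ ndot b p := by
      rw [← dot_natPt]; exact hP (M.mem_poly p (mem_filter.1 hp).1)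
    have hexp : ∀ k : ℕ, exp (k * l) * xpow p (expc σ (w + (k : ℝ) • natPt b)) =
        exp (-((k : ℝ) * (ndot b p - l))) * xpow p (expc σ w) := fun k => by
      rw [xpow_expc_add, ← mul_assoc, ← exp_add]
      congr 2
      ring
    simp only [← mul_assoc, hexp]
    split_ifs with hl
    · have := (hψ.const_mul (xpow p (expc σ w)))
      simpa [hl] using this
    · have hlt : 0 < (ndot b p : ℝ) - l := sub_pos.2 (lt_of_le_of_ne hpl
        fun h => hl (by exact_mod_cast h.symm))
      have h1 : Tendsto (fun k : ℕ => exp (-((k : ℝ) * (ndot b p - l)))) atTop (𝓝 0) :=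
        Real.tendsto_exp_neg_atTop_nhds_zero.comp
          (tendsto_natCast_atTop_atTop.atTop_mul_const hlt)
      simpa using (h1.mul_const (xpow p (expc σ w))).mul hψ
  refine ge_of_tendsto hlim ?_
  have hbig : ∀ᶠ k : ℕ in atTop, ∀ i, R ≤ (w + (k : ℝ) • natPt b) i :=
    eventually_all.2 fun i => (hz i).eventually_ge_atTop R
  filter_upwards [hbig] with k hk
  have := hε _ hk
  calc 0 ≤ exp (k * l) * (ε * M.facePart τ (expc σ (w + (k : ℝ) • natPt b))) := by positivity
    _ = _ := by ring

/-- Away from the exponents outside `τ` the phase has the sign of the `τ`-part. -/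
lemma exists_phase_lower_bound (hU : U ∈ 𝓝 (0 : ℝ^[n]))
    (hnd : Nondegenerate f U) (hτ : IsFaceOf (Γ₊ f) τ) (hσ : ∀ i, |σ i| = 1)
    {ε R₀ : ℝ} (hε1 : ε ≠ 0)
    (hε : ∀ z, (∀ i, R₀ ≤ z i) → 0 < ε * M.facePart τ (expc σ z)) :
    ∃ R c δ : ℝ, 0 ≤ R ∧ 0 < c ∧ 0 < δ ∧ ∀ z : ℝ^[n], (∀ i, R ≤ z i) →
      (∀ p ∈ M.S, natPt p ∉ τ → exp (-dot (natPt p) z) ≤ δ * M.N z) →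
      c * M.N z ≤ ε * M.phase σ z := by
  classical
  by_contra! hcon
  choose z hz hsmall hlt using fun k : ℕ => hcon k (1 / ((k : ℝ) + 1)) (1 / ((k : ℝ) + 1))
    (Nat.cast_nonneg _) (by positivity) (by positivity)
  obtain ⟨φ, b, l, w, C, hφ, hz', hb, hC, hP, ⟨s, hs, hsl⟩, hlim⟩ :=
    exists_face_limit M.toPolyData z hz
  have htend0 : Tendsto (fun k => 1 / ((φ k : ℝ) + 1)) atTop (𝓝 0) :=
    tendsto_one_div_add_atTop_nhds_zero_nat.comp hφ.tendsto_atTop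
  have hSτ : ∀ p ∈ M.S, ndot b p = l → natPt p ∈ τ := by
    intro p hp hpl
    by_contra hpτ
    have h1 := (hlim _ (M.mem hp)).1 (by rw [dot_natPt, hpl])
    have h2 := le_of_tendsto_of_tendsto' h1 htend0 fun k =>
      (div_le_iff₀ (M.N_pos _)).2 (hsmall (φ k) p hp hpτ)
    exact absurd h2 (not_le.2 (mul_pos hC (exp_pos _)))
  have hFτ : ∀ p ∈ M.F, ndot b p = l → natPt p ∈ τ := fun p hp hpl =>
    M.mem_face_of_forall hτ hb hP hSτ (M.mem_poly p hp) (by rw [dot_natPt, hpl])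
  have hnn := M.facePolynomial_nonneg hε hb hP hFτ
  set g : ℝ^[n] → ℝ := fun x => ∑ p ∈ M.F with ndot b p = l, xpow p x * M.ψ p 0 with hg
  have hgs : ContDiff ℝ ∞ g := ContDiff.sum fun p _ => (contDiff_xpow p).mul contDiff_const
  have hT := M.tendsto_wsum_div σ hz' hP hlim fun p => (M.smooth p).continuous
  have hw0 : g (expc σ w) = 0 := by
    have h1 := le_of_tendsto_of_tendsto' (hT.const_mul ε) htend0 fun k => by
      rw [← mul_div_assoc, div_le_iff₀ (M.N_pos _)]
      exact (hlt (φ k)).le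
    have h2 : ε * (C * g (expc σ w)) ≤ 0 := h1
    have h3 : 0 ≤ ε * g (expc σ w) := hnn w
    have h4 : ε * g (expc σ w) = 0 := by nlinarith
    exact (mul_eq_zero.1 h4).resolve_left hε1
  obtain ⟨i, hi⟩ := M.exists_face_sum_ne_zero hU hnd hσ hb hP hs hsl w
  refine hi ?_
  have hmin : IsLocalMin (fun z => ε * g (expc σ z)) w := .of_forall fun z => by
    simp only [hw0, mul_zero]
    exact hnn z
  have h1 : pderiv1 i (fun z => ε * g (expc σ z)) w = 0 := by rw [pderiv1, hmin.fderiv_eq_zero]; rfl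
  have h2 := fderiv_comp_expc (contDiff_const.mul hgs : ContDiff ℝ ∞ fun x => ε * g x) σ i w
  rw [h1, pderiv1_const_mul i ε hgs] at h2
  rw [← M.pderiv1_face_sum]
  exact mul_left_cancel₀ hε1 (by linear_combination h2)

end LocalModel

section

lemma eventually_mul_scale_le (C : ℝ) {η μ β : ℝ} {k j : ℕ} (hη : 0 < η)
    (h : toLex (-μ, k) < toLex (-β, j)) :
    ∀ᶠ t : ℝ in atTop, C * (t ^ (-μ) * log t ^ k) ≤ η * (t ^ (-β) * log t ^ j) := by
  have h1 := ((tendsto_scale_div h).norm.const_mul |C|)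
  rw [norm_zero, mul_zero] at h1
  filter_upwards [h1.eventually_le_const hη, eventually_gt_atTop 1] with t ht h1t
  have hlog := log_pos h1t
  have hp : 0 < t ^ (-β) * log t ^ j := by positivity
  rw [norm_div, norm_scale _ h1t.le, norm_scale _ h1t.le, mul_div_assoc', div_le_iff₀ hp] at ht
  refine le_trans (mul_le_mul_of_nonneg_right (le_abs_self C) ?_) ht
  positivity

lemma PolyData.exists_bad_volume (hf0 : f 0 = 0) (hτ : IsPrincipalFace f τ) {p : ℕ^[n]}
    (hp : p ∈ D.S) (hpτ : natPt p ∉ τ) {δ : ℝ} (hδ : 0 < δ) :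
    ∃ K₀ : ℕ, ∀ K, K₀ ≤ K → ∀ η : ℝ, 0 < η → ∀ᶠ t : ℝ in atTop,
      ∫ z in {z | (∀ i, 0 ≤ z i) ∧ δ * expSum D.S z ≤ exp (-dot (natPt p) z)},
        exp (-dot (fun _ => 1) z) * ((1 + t * expSum D.S z)⁻¹) ^ K ≤
      η * (t ^ (-(1 / newtonDist f)) * log t ^ (n - finrank ℝ D.lineal - 1)) := by
  classical
  set Ω := {z : ℝ^[n] | (∀ i, 0 ≤ z i) ∧ δ * expSum D.S z ≤ exp (-dot (natPt p) z)}
    with hΩ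
  have hΩm : MeasurableSet Ω := by
    have h1 : Continuous fun z => exp (-dot (natPt p) z) := (continuous_dot _).neg.rexp
    refine ((isClosed_oct 0).inter (isClosed_le (f := fun z => δ * expSum D.S z) ?_
      h1)).measurableSet
    exact continuous_const.mul (continuous_finsetSum _ fun s _ => (continuous_dot _).neg.rexp)
  obtain ⟨T, hTl, hli, hs, hcard⟩ := D.exists_lineal_basis
  have hd := D.newtonDist_pos hf0
  set d := newtonDist f with hdd
  set q : ℝ^[n] := fun _ => d with hq
  have hdv : ∀ z, dot (natPt p - q) z = dot (natPt p) z - d * ∑ i, z i := fun z => by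
    rw [dot_sub_left, dot_comm q, dot_const_right]
  obtain ⟨ε, hε, hle⟩ := D.exists_lineal_le hf0 hTl
  have hone : (fun _ => (1 : ℝ)) ∉ T := fun h => D.one_notMem_lineal hf0 (hTl _ h)
  have hli1 := D.linearIndepOn_insert_one hf0 hli hs
  set L := |log δ|
  have hup : ∀ z ∈ Ω, dot (natPt p - q) z ≤ L - (log (expSum D.S z) + d * ∑ i, z i) := by
    intro z hz
    have hN := expSum_pos D.nonempty z
    have h1 := log_le_log (mul_pos hδ hN) hz.2
    rw [log_exp, log_mul hδ.ne' hN.ne'] at h1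
    have := neg_abs_le (log δ)
    rw [hdv]
    linarith
  by_cases hv : natPt p - q ∈ span ℝ (insert (fun _ => (1 : ℝ)) (T : Set ℝ^[n]))
  · obtain ⟨c, u, hu, hcu⟩ := Submodule.mem_span_insert.1 hv
    rw [hs] at hu
    have hpq : natPt p = q + (c • (fun _ => (1 : ℝ)) + u) := by rw [← hcu]; abel
    have hc : 0 < c := by
      obtain ⟨a, ha, hpos⟩ := D.exists_diagActive hf0
      have h1 := D.active_le ha (D.mem hp)
      rw [hpq, dot_add_right, dot_add_right, dot_smul_right, dot_const_right _ 1, hu a ha] at h1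
      have hc0 : 0 ≤ c := by
        by_contra hneg
        push Not at hneg
        simp only [one_mul, add_zero] at h1
        have := mul_neg_of_neg_of_pos hneg hpos
        linarith
      refine lt_of_le_of_ne hc0 fun h => hpτ ?_
      rw [← h, zero_smul, zero_add] at hpq
      rw [hpq]
      exact D.mem_face_of_lineal hf0 hτ hu (hpq ▸ D.mem hp)
    obtain ⟨ε₂, hε₂, hle₂⟩ := D.exists_lineal_le (T := {u}) hf0 (by simpa using hu)
    simp only [Finset.sum_singleton] at hle₂
    set e := min (ε₂ * c) (d / 2)
    have he : 0 < e := lt_min (mul_pos hε₂ hc) (by linarith)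
    have he1 : e ≤ ε₂ * c := min_le_left _ _
    have he2 : e ≤ d / 2 := min_le_right _ _
    have hd' : 0 < d - e := by linarith
    refine ⟨⌈2 * (1 / (d - e))⌉₊, fun K hK η hη => ?_⟩
    have hexp : ∀ z ∈ Ω, exp (-dot (fun _ => 1) z / (1 / (d - e)) +
        ε₂ * ∑ u ∈ (∅ : Finset ℝ^[n]), |dot u z|) ≤ exp (ε₂ * L) * expSum D.S z := by
      intro z hz
      have hN := expSum_pos D.nonempty z
      have h1 := hup z hz
      have h2 := hle₂ z hz.1
      have hsum : 0 ≤ ∑ i, z i := sum_nonneg fun i _ => hz.1 i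
      rw [hcu, dot_comm, dot_add_right, dot_smul_right, dot_comm z u, dot_const_right _ 1,
        one_mul] at h1
      have h3 := neg_abs_le (dot u z)
      have h0 : 0 ≤ log (expSum D.S z) + d * ∑ i, z i := (mul_nonneg hε₂.le (abs_nonneg _)).trans h2
      have h4 : ε₂ * (c * ∑ i, z i) ≤ ε₂ * (L + |dot u z|) :=
        mul_le_mul_of_nonneg_left (by linarith) hε₂.le
      have h5 : e * ∑ i, z i ≤ ε₂ * c * ∑ i, z i := mul_le_mul_of_nonneg_right he1 hsum
      rw [← exp_log hN, ← exp_add, Finset.sum_empty, mul_zero, add_zero, dot_one_left,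
        one_div, div_inv_eq_mul, exp_le_exp]
      linarith
    obtain ⟨C, hC, h⟩ := exists_volume_le (ρ := fun _ => (1 : ℝ)) (T := ∅) (fun _ => le_rfl)
      (Finset.notMem_empty _) (hli1.mono (by simp)) (one_div_pos.2 hd') hε₂
      (exp_pos (ε₂ * L)) hΩm (fun z hz => hz.1) (Nf := expSum D.S) hexp
      (Nat.ceil_le.1 hK)
    filter_upwards [eventually_ge_atTop 2, eventually_mul_scale_le C
      (k := n - 1 - (∅ : Finset ℝ^[n]).card)
      (j := n - finrank ℝ D.lineal - 1) hη
      (toLex_lt_toLex.2 (Or.inl (neg_lt_neg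
        (one_div_lt_one_div_of_lt hd' (by linarith : d - e < d)))))] with t ht h2
    exact (h t ht).trans h2
  · have hvT : natPt p - q ∉ T := fun h => hv (subset_span (by simp [h]))
    have hv1 : (fun _ => (1 : ℝ)) ≠ natPt p - q := fun h => hv (subset_span (by simp [h]))
    have hli2 := hli1.id_insert hv
    rw [insert_comm, ← Finset.coe_insert] at hli2
    have hcard2 : finrank ℝ D.lineal + 2 ≤ n := by
      have h1 := hli2
      rw [← Finset.coe_insert] at h1
      have h2 := h1.linearIndependent.fintype_card_le_finrank
      erw [Fintype.card_coe, Finset.card_insert_of_notMem, Finset.card_insert_of_notMem hvT, hcard,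
        Module.finrank_fin_fun] at h2
      · exact h2
      · simp [hv1, hone]
    set e := min ε 1 / 2
    have he : 0 < e := half_pos (lt_min hε one_pos)
    have he1 : 2 * e ≤ ε := by have := min_le_left ε 1; simp only [e]; linarith
    have he2 : 2 * e ≤ 1 := by have := min_le_right ε 1; simp only [e]; linarith
    refine ⟨⌈2 * (1 / d)⌉₊, fun K hK η hη => ?_⟩
    have hexp : ∀ z ∈ Ω, exp (-dot (fun _ => 1) z / (1 / d) +
        e * ∑ u ∈ insert (natPt p - q) T, |dot u z|) ≤ exp L * expSum D.S z := by
      intro z hz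
      have hN := expSum_pos D.nonempty z
      have h1 := hup z hz
      have h2 := hle z hz.1
      set A := ∑ u ∈ T, |dot u z|
      have hA : 0 ≤ A := sum_nonneg fun _ _ => abs_nonneg _
      have h6 : -dot (natPt p) z ≤ log (expSum D.S z) :=
        (Real.le_log_iff_exp_le hN).2 (exp_le_expSum hp z)
      have h0 : 0 ≤ log (expSum D.S z) + d * ∑ i, z i := (mul_nonneg hε.le hA).trans h2
      have hL : 0 ≤ L := abs_nonneg _
      have h7 : |dot (natPt p - q) z| ≤ log (expSum D.S z) + d * ∑ i, z i + L := by
        refine abs_le.2 ⟨?_, by linarith⟩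
        rw [hdv]
        linarith
      have h8 : 2 * e * A ≤ ε * A := mul_le_mul_of_nonneg_right he1 hA
      have h9 : 2 * e * |dot (natPt p - q) z| ≤ 1 * |dot (natPt p - q) z| :=
        mul_le_mul_of_nonneg_right he2 (abs_nonneg _)
      rw [← exp_log hN, ← exp_add, sum_insert hvT, dot_one_left,
        one_div, div_inv_eq_mul, exp_le_exp]
      linarith
    obtain ⟨C, hC, h⟩ := exists_volume_le (ρ := fun _ => (1 : ℝ)) (fun _ => le_rfl)
      (by simp [hv1, hone]) hli2 (one_div_pos.2 hd) he
      (exp_pos L) hΩm (fun z hz => hz.1) (Nf := expSum D.S) hexp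
      (Nat.ceil_le.1 hK)
    filter_upwards [eventually_ge_atTop 2, eventually_mul_scale_le C
      (k := n - 1 - (insert (natPt p - q) T).card)
      (j := n - finrank ℝ D.lineal - 1) hη
      (toLex_lt_toLex.2
        (Or.inr ⟨rfl, by simp only; rw [Finset.card_insert_of_notMem hvT]; omega⟩))] with t ht h2
    exact (h t ht).trans h2

end

lemma Symb.comp_real {ι : Type*} {g : ℝ^[n] → ℝ}
    (hgs : ContDiff ℝ ∞ g) (hg : Symb Ω (fun (_ : ι) _ => 1) fun _ z => (g z : ℂ))
    {θ : ℝ → ℝ} (hθ : ContDiff ℝ ∞ θ) :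
    Symb Ω (fun (_ : ι) _ => 1) fun _ z => (θ (g z) : ℂ) := by
  have base : ∀ θ : ℝ → ℝ, ContDiff ℝ ∞ θ →
      ∃ C : ℝ, ∀ _ : ι, ∀ z ∈ Ω, ‖(θ (g z) : ℂ)‖ ≤ C * 1 := by
    intro θ hθ
    obtain ⟨B, hB⟩ := (hg.est 0).zero
    obtain ⟨C, hC⟩ := (isCompact_Icc (a := -B) (b := B)).exists_bound_of_continuousOn
      hθ.continuous.continuousOn
    refine ⟨C, fun i z hz => ?_⟩
    have h1 := hB i z hz
    rw [norm_real, Real.norm_eq_abs, mul_one] at h1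
    rw [norm_real, mul_one]
    exact hC _ (abs_le.1 h1)
  refine ⟨fun _ => contDiff_ofReal (hθ.comp hgs), fun k => ?_⟩
  induction k generalizing θ with
  | zero => exact base θ hθ
  | succ k ih =>
    refine ⟨base θ hθ, fun i => ?_⟩
    have hθ' : ContDiff ℝ ∞ (deriv θ) := (contDiff_infty_iff_deriv.1 hθ).2
    have e : (fun (_ : ι) => KN.cderiv i fun z => (θ (g z) : ℂ)) = fun _ z =>
        ((deriv θ (g z) : ℝ) : ℂ) * KN.cderiv i (fun z => (g z : ℂ)) z := by
      funext _ z
      have hc : ContDiff ℝ ∞ fun z => θ (g z) := hθ.comp hgs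
      rw [cderiv_ofReal i hc, cderiv_ofReal i hgs, ← ofReal_mul]
      have h1 := (hθ.differentiable (by simp) (g z)).hasDerivAt.comp_hasFDerivAt z
        (hgs.differentiable (by simp) z).hasFDerivAt
      have h2 : fderiv ℝ (fun z => θ (g z)) z = _ := h1.fderiv
      change ((fderiv ℝ (fun z => θ (g z)) z (single i 1) : ℝ) : ℂ) = _
      rw [h2]
      rfl
    rw [e]
    have hc' : ContDiff ℝ ∞ fun z => deriv θ (g z) := hθ'.comp hgs
    have h := (ih hθ').mul (fun _ => contDiff_ofReal hc')
      (fun _ => contDiff_cderiv i (contDiff_ofReal hgs)) ((hg.est (k + 1)).2 i)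
    simpa only [one_mul] using h

lemma PolyData.exists_low (hf0 : f 0 = 0) {R B : ℝ}
    (hR : 0 ≤ R) (hB : 0 ≤ B) {w G : ℝ^[n] → ℝ} (hw : Integrable w) (hw0 : ∀ z, 0 ≤ w z)
    (hwR : ∀ z ∈ oct n R, w z = exp (-dot (fun _ => 1) z)) (hG : Measurable G)
    (hGN : ∀ z ∈ oct n R, |G z| ≤ B * expSum D.S z) (K : ℕ) :
    ∃ c : ℝ, 0 < c ∧ ∀ᶠ t : ℝ in atTop,
      c * (t ^ (-(1 / newtonDist f)) * log t ^ (n - finrank ℝ D.lineal - 1)) ≤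
        ∫ z, w z * ((1 + t * |G z|)⁻¹) ^ K := by
  obtain ⟨c, t₀, hc, ht₀, h⟩ := D.exists_volume_ge hf0 hR
  refine ⟨((1 + B)⁻¹) ^ K * c, by positivity, ?_⟩
  filter_upwards [eventually_ge_atTop t₀] with t ht
  obtain ⟨A, hA, hAR, hAN, hvol⟩ := h t ht
  have ht0 : 0 < t := by linarith
  have hJ := integrable_mul_inv_one_add_pow hw hG K ht0.le
  have hexp : IntegrableOn (fun z : ℝ^[n] => exp (-dot (fun _ => 1) z)) A :=
    ((contDiff_exp_dot _).continuous.continuousOn.integrableOn_compact hA)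
  calc ((1 + B)⁻¹) ^ K * c *
        (t ^ (-(1 / newtonDist f)) * log t ^ (n - finrank ℝ D.lineal - 1))
      ≤ ((1 + B)⁻¹) ^ K * ∫ z in A, exp (-dot (fun _ => 1) z) := by
        rw [mul_assoc]
        exact mul_le_mul_of_nonneg_left hvol (by positivity)
    _ = ∫ z in A, ((1 + B)⁻¹) ^ K * exp (-dot (fun _ => 1) z) := (integral_const_mul _ _).symm
    _ ≤ ∫ z in A, w z * ((1 + t * |G z|)⁻¹) ^ K := by
        refine setIntegral_mono_on (hexp.const_mul _) hJ.integrableOn hA.measurableSet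
          fun z hz => ?_
        rw [hwR z (hAR hz), mul_comm]
        refine mul_le_mul_of_nonneg_left (pow_le_pow_left₀ (by positivity) ?_ K)
          (exp_pos _).le
        refine inv_anti₀ (by positivity) ?_
        have h1 : t * |G z| ≤ t * (B * (1 / t)) := mul_le_mul_of_nonneg_left
          ((hGN z (hAR hz)).trans (mul_le_mul_of_nonneg_left (hAN z hz) hB)) ht0.le
        rw [mul_left_comm, mul_one_div_cancel ht0.ne', mul_one] at h1
        linarith
    _ ≤ _ := setIntegral_le_integral hJ (.of_forall fun z => by
        have := hw0 z
        positivity)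

namespace LocalModel

lemma exists_bad_volume (hf0 : f 0 = 0) (hτ : IsPrincipalFace f τ) {δ : ℝ} (hδ : 0 < δ)
   
    (hΩ : ∀ z ∈ Ω, (∀ i, 0 ≤ z i) ∧
      ∃ p ∈ M.S, natPt p ∉ τ ∧ δ * M.N z ≤ exp (-dot (natPt p) z)) :
    ∃ K₀ : ℕ, ∀ K, K₀ ≤ K → ∀ η : ℝ, 0 < η → ∀ᶠ t : ℝ in atTop,
      ∫ z in Ω, exp (-dot (fun _ => 1) z) * ((1 + t * M.N z)⁻¹) ^ K ≤
      η * (t ^ (-(1 / newtonDist f)) * log t ^ (n - finrank ℝ M.lineal - 1)) := by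
  classical
  set S := M.S.filter fun p => natPt p ∉ τ with hS
  have hp : ∀ p : ℕ^[n], ∃ K₀ : ℕ, p ∈ S → ∀ K, K₀ ≤ K → ∀ η : ℝ, 0 < η → ∀ᶠ t : ℝ in atTop,
      ∫ z in {z | (∀ i, 0 ≤ z i) ∧ δ * expSum M.S z ≤ exp (-dot (natPt p) z)},
        exp (-dot (fun _ => 1) z) * ((1 + t * expSum M.S z)⁻¹) ^ K ≤
      η * (t ^ (-(1 / newtonDist f)) * log t ^ (n - finrank ℝ M.lineal - 1)) := by
    intro p
    by_cases h : p ∈ S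
    · obtain ⟨K₀, hK₀⟩ := M.toPolyData.exists_bad_volume hf0 hτ (mem_filter.1 h).1
        (mem_filter.1 h).2 hδ
      exact ⟨K₀, fun _ => hK₀⟩
    · exact ⟨0, fun h' => absurd h' h⟩
  choose K₀ hK₀ using hp
  refine ⟨S.sup K₀, fun K hK η hη => ?_⟩
  have hη' : 0 < η / (S.card + 1) := by positivity
  filter_upwards [(Finset.eventually_all S).2 fun p hp =>
    hK₀ p hp K ((Finset.le_sup hp).trans hK) _ hη', eventually_gt_atTop 1] with t ht ht1
  set A : ℕ^[n] → Set ℝ^[n] := fun p =>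
    {z | (∀ i, 0 ≤ z i) ∧ δ * expSum M.S z ≤ exp (-dot (natPt p) z)} with hA
  set g : ℝ^[n] → ℝ := fun z => exp (-dot (fun _ => 1) z) * ((1 + t * M.N z)⁻¹) ^ K with hg
  have hNc := M.contDiff_N.continuous
  have hg0 : ∀ z, 0 ≤ g z := fun z => by
    have := M.N_pos z
    positivity
  have hAm : ∀ p, MeasurableSet (A p) := fun p =>
    ((isClosed_oct 0).inter (isClosed_le (continuous_const.mul hNc)
      (contDiff_exp_dot (natPt p)).continuous)).measurableSet
  have hgi : IntegrableOn g (oct n 0) := by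
    exact (integrableOn_exp_neg_dot (ρ := fun _ => (1 : ℝ)) (fun _ => one_pos) 0).mul_bdd (c := 1)
      (Measurable.aestronglyMeasurable (by have := hNc.measurable; fun_prop))
      (.of_forall fun z => norm_inv_one_add_pow_le (mul_nonneg (by linarith) (M.N_pos z).le) _)
  have hgA : ∀ p, IntegrableOn g (A p) := fun p => hgi.mono_set fun z hz => hz.1
  calc ∫ z in Ω, g z ≤ ∫ z in ⋃ p ∈ S, A p, g z := by
        refine setIntegral_mono_set (hgi.mono_set ?_) (.of_forall hg0)
          (LE.le.eventuallyLE ?_)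
        · exact iUnion₂_subset fun p _ z hz => hz.1
        · intro z hz
          obtain ⟨h1, p, hp, hpτ, h2⟩ := hΩ z hz
          exact mem_iUnion₂.2 ⟨p, mem_filter.2 ⟨hp, hpτ⟩, h1, h2⟩
    _ ≤ ∑ p ∈ S, ∫ z in A p, g z := by
        rw [← integral_indicator (S.measurableSet_biUnion fun p _ => hAm p)]
        simp_rw [← integral_indicator (hAm _)]
        rw [← integral_finsetSum _ fun p _ => (hgA p).integrable_indicator (hAm p)]
        refine integral_mono_of_nonneg (.of_forall fun z =>
          indicator_nonneg (fun z _ => hg0 z) z) (integrable_finsetSum _ fun p _ =>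
          (hgA p).integrable_indicator (hAm p)) (.of_forall fun z => ?_)
        have hs : ∀ p ∈ S, 0 ≤ (A p).indicator g z := fun p _ =>
          indicator_nonneg (fun z _ => hg0 z) z
        by_cases hz : z ∈ ⋃ p ∈ S, A p
        · obtain ⟨p, hp, hzp⟩ := mem_iUnion₂.1 hz
          rw [indicator_of_mem hz, ← indicator_of_mem hzp g]
          exact single_le_sum hs hp
        · rw [indicator_of_notMem hz]
          exact sum_nonneg hs
    _ ≤ ∑ p ∈ S, η / (S.card + 1) *
        (t ^ (-(1 / newtonDist f)) * log t ^ (n - finrank ℝ M.lineal - 1)) :=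
        sum_le_sum ht
    _ ≤ _ := by
        have := LeadingTerm.scale_pos (β := 1 / newtonDist f)
          (j := n - finrank ℝ M.lineal - 1) ht1
        rw [Finset.sum_const, nsmul_eq_mul, ← mul_assoc]
        refine mul_le_mul_of_nonneg_right ?_ this.le
        rw [mul_div_assoc', div_le_iff₀ (by positivity)]
        nlinarith

end LocalModel

/-- Nonnegative cutoff functions that equal one on the box `|x_i| ≤ e^{-R'}`. -/
structure IsCutoff (R R' : ℝ) (φ : ℝ^[n] → ℝ) : Prop where
  isAmp : IsAmp R fun x => (φ x : ℂ)
  nonneg : ∀ x, 0 ≤ φ x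
  eq_one : ∀ x : ℝ^[n], (∀ i, |x i| ≤ exp (-R')) → φ x = 1

/-- The real amplitude in exponential coordinates. -/
noncomputable def weight (σ : ℝ^[n]) (φ : ℝ^[n] → ℝ) (z : ℝ^[n]) : ℝ :=
  exp (-dot (fun _ => 1) z) * φ (expc σ z)

section weight
variable {R R' : ℝ} {φ : ℝ^[n] → ℝ}

lemma ofReal_weight (z : ℝ^[n]) :
    (weight σ φ z : ℂ) = amp σ (fun _ => 1) (fun x => (φ x : ℂ)) z := by
  rw [weight, amp, ofReal_mul]

lemma IsCutoff.weight_nonneg (hφ : IsCutoff R R' φ) (z : ℝ^[n]) : 0 ≤ weight σ φ z :=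
  mul_nonneg (exp_pos _).le (hφ.nonneg _)

lemma IsCutoff.weight_eq (hφ : IsCutoff R R' φ) (hσ : ∀ i, |σ i| = 1)
    (hz : z ∈ oct n R') : weight σ φ z = exp (-dot (fun _ => 1) z) := by
  rw [weight, hφ.eq_one _ (abs_expc_le_of_mem_oct hσ hz), mul_one]

lemma IsCutoff.integrable_weight (hφ : IsCutoff R R' φ) (hR : 0 ≤ R) (hσ : ∀ i, |σ i| = 1) :
    Integrable (weight σ φ) := by
  have h := (hφ.isAmp.integrable_amp hR hσ (ρ := fun _ => (1 : ℝ)) fun _ => one_pos).re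
  refine h.congr (.of_forall fun z => ?_)
  simp only [← ofReal_weight, RCLike.re_to_complex, ofReal_re]

end weight

namespace LocalModel
variable {R R' : ℝ} {φ : ℝ^[n] → ℝ}

lemma abs_phase_le (hσ : ∀ i, |σ i| = 1) (hR : 0 ≤ R) :
    ∃ B, 1 ≤ B ∧ ∀ z ∈ oct n R, |M.phase σ z| ≤ B * M.N z := by
  obtain ⟨B, hB⟩ := ((M.symb_wsum (ι := Unit) hσ hR M.smooth).est 0).zero
  refine ⟨max B 1, le_max_right _ _, fun z hz => ?_⟩
  have := hB () z hz
  rw [norm_real] at this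
  exact this.trans (mul_le_mul_of_nonneg_right (le_max_left _ _) (M.N_pos z).le)

lemma exists_leadingTerm (hσ : ∀ i, |σ i| = 1) (hR : 0 ≤ R)
    (H : PhaseBound (oct n R) M.N (M.phase σ)) (hf0 : f 0 = 0) (hφ : IsCutoff R R' φ) :
    ∃ C, LeadingTerm (M.phase σ) (weight σ φ) (1 / newtonDist f)
        (n - finrank ℝ M.lineal - 1) C ∧
      Tendsto (fun t => M.oscAmp σ 0 (fun x => (φ x : ℂ)) t /
        scale (-(1 / newtonDist f), n - finrank ℝ M.lineal - 1) t) atTop (𝓝 C) := by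
  have hd := M.newtonDist_pos hf0
  have hn := M.dim_pos hf0
  have hosc : ∀ t, M.oscAmp σ 0 (fun x => (φ x : ℂ)) t =
      ∫ z, osc (M.phase σ) t z * (weight σ φ z : ℂ) := fun t => by
    simp only [oscAmp, shift_zero, ofReal_weight]
  obtain ⟨K, hK0, hK⟩ := M.exists_decay_diag hR H hf0
    (u := fun z => (weight σ φ z : ℂ)) (by
      simp only [ofReal_weight]
      exact hφ.isAmp.symb hR hσ _) (fun z hz => by
      rw [ofReal_weight]
      exact hφ.isAmp.amp_eq_zero hσ _ hz)
  have hexp := M.hasExp_oscAmp hσ hR H hn (b := 1 / newtonDist f + 1) (by positivity) hφ.isAmp 0 0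
  simp only [pow_zero, one_mul] at hexp
  obtain ⟨C, hC⟩ := hexp.exists_tendsto
    (q := (-(1 / newtonDist f), n - finrank ℝ M.lineal - 1)) (K := K) (by simp) (by
      filter_upwards [eventually_ge_atTop 2] with t ht
      rw [norm_scale _ (by linarith), hosc]
      exact hK t ht)
  refine ⟨C, ⟨(M.contDiff_phase σ).continuous, hφ.integrable_weight hR hσ, hφ.weight_nonneg,
    by positivity, ⟨K, hK⟩, by simpa only [hosc] using hC, fun N => ?_⟩, hC⟩
  obtain ⟨B, hB1, hB⟩ := M.abs_phase_le hσ hR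
  exact M.exists_low hf0 (le_max_of_le_left hR : 0 ≤ max R R') (by linarith)
    (hφ.integrable_weight hR hσ) hφ.weight_nonneg
    (fun z hz => hφ.weight_eq hσ fun i => (le_max_right _ _).trans (hz i))
    (M.contDiff_phase σ).continuous.measurable
    (fun z hz => hB z fun i => (le_max_left _ _).trans (hz i)) N

lemma symb_N (ι : Type*) (R : ℝ) :
    Symb (oct n R) (fun (_ : ι) z => M.N z) fun _ z => (M.N z : ℂ) := by
  have h : ∀ s ∈ M.S, Symb (oct n R) (fun (_ : ι) z => M.N z) fun _ z =>
      ((exp (-dot (natPt s) z) : ℝ) : ℂ) := fun s hs =>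
    (symb_exp_dot _ _).mono (c := 1) (fun _ z _ => (exp_pos _).le) fun _ z _ => by
      rw [one_mul]
      exact exp_le_expSum hs z
  have := Symb.sum M.S h
  simpa only [N, expSum, Complex.ofReal_sum] using this

/-- A smooth cutoff to the region where the phase is comparable with its majorant. -/
noncomputable def cutoff (σ : ℝ^[n]) (ε c : ℝ) (z : ℝ^[n]) : ℝ :=
  Real.smoothTransition (4 / c * (ε * (M.phase σ z * (M.N z)⁻¹)) - 1)

lemma cutoff_eq_one {ε c : ℝ} (hc : 0 < c)
    (h : c / 2 * M.N z ≤ ε * M.phase σ z) : M.cutoff σ ε c z = 1 := by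
  refine Real.smoothTransition.one_of_one_le ?_
  have h1 : c / 2 ≤ ε * (M.phase σ z * (M.N z)⁻¹) := by
    rw [← mul_assoc, ← div_eq_mul_inv, le_div_iff₀ (M.N_pos z)]
    exact h
  have h2 : 4 / c * (c / 2) ≤ 4 / c * (ε * (M.phase σ z * (M.N z)⁻¹)) := by gcongr
  have h3 : 4 / c * (c / 2) = 2 := by field_simp; norm_num
  linarith

lemma phase_nonneg_of_cutoff {ε c : ℝ} (hc : 0 < c)
    (h : M.cutoff σ ε c z ≠ 0) : 0 ≤ ε * M.phase σ z := by
  by_contra hneg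
  refine h (Real.smoothTransition.zero_of_nonpos ?_)
  have h1 : ε * (M.phase σ z * (M.N z)⁻¹) ≤ 0 := by
    rw [← mul_assoc]
    exact mul_nonpos_of_nonpos_of_nonneg (not_le.1 hneg).le (inv_nonneg.2 (M.N_pos z).le)
  have h2 : 4 / c * (ε * (M.phase σ z * (M.N z)⁻¹)) ≤ 0 :=
    mul_nonpos_of_nonneg_of_nonpos (by positivity) h1
  linarith

lemma symb_cutoff (ι : Type*) (hσ : ∀ i, |σ i| = 1) (hR : 0 ≤ R) (ε c : ℝ) :
    Symb (oct n R) (fun (_ : ι) _ => 1) fun _ z => (M.cutoff σ ε c z : ℂ) := by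
  have hN := (M.symb_N ι R).inv (c := 1) (fun _ z _ => M.N_pos z)
    (fun _ z => by exact_mod_cast (M.N_pos z).ne') one_pos fun _ z _ => by
      rw [one_mul, norm_real]
      exact le_abs_self _
  have hg : Symb (oct n R) (fun (_ : ι) _ => 1) fun _ z => ((M.phase σ z * (M.N z)⁻¹ : ℝ) : ℂ) := by
    have h := ((M.symb_wsum (ι := ι) hσ hR M.smooth).mul hN).congr (m' := fun _ _ => 1)
      (fun _ z _ => by rw [mul_inv_cancel₀ (M.N_pos z).ne']; exact zero_le_one)
      fun _ z _ => mul_inv_cancel₀ (M.N_pos z).ne'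
    simpa only [phase, ofReal_mul, Complex.ofReal_inv] using h
  have hgs : ContDiff ℝ ∞ fun z => M.phase σ z * (M.N z)⁻¹ :=
    (M.contDiff_phase σ).mul (M.contDiff_N.inv fun z => (M.N_pos z).ne')
  exact Symb.comp_real hgs hg
    (θ := fun x => Real.smoothTransition (4 / c * (ε * x) - 1))
    (Real.smoothTransition.contDiff.comp (by fun_prop))

lemma exists_leadingTerm_sign (hσ : ∀ i, |σ i| = 1) (hR : 0 ≤ R)
    (H : PhaseBound (oct n R) M.N (M.phase σ)) (hf0 : f 0 = 0) (hφ : IsCutoff R R' φ)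
    (hτ : IsPrincipalFace f τ) {ε c δ : ℝ} (hc : 0 < c) (hδ : 0 < δ)
    (hlow : ∀ z : ℝ^[n], (∀ i, R ≤ z i) →
      (∀ p ∈ M.S, natPt p ∉ τ → exp (-dot (natPt p) z) ≤ δ * M.N z) →
      c * M.N z ≤ ε * M.phase σ z) :
    ∃ C w, LeadingTerm (M.phase σ) w (1 / newtonDist f)
        (n - finrank ℝ M.lineal - 1) C ∧
      (∀ z, w z ≠ 0 → 0 ≤ ε * M.phase σ z) ∧
      Tendsto (fun t => M.oscAmp σ 0 (fun x => (φ x : ℂ)) t /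
        scale (-(1 / newtonDist f), n - finrank ℝ M.lineal - 1) t) atTop (𝓝 C) := by
  obtain ⟨C, hL, hC⟩ := M.exists_leadingTerm hσ hR H hf0 hφ
  set β := 1 / newtonDist f with hβ
  set j := n - finrank ℝ M.lineal - 1 with hj
  set κ := M.cutoff σ ε c with hκ
  set w₀ := weight σ φ with hw₀
  have hFc := M.contDiff_phase σ
  have hNc := M.contDiff_N (f := f)
  have hκ01 : ∀ z, 0 ≤ κ z ∧ κ z ≤ 1 := fun z =>
    ⟨Real.smoothTransition.nonneg _, Real.smoothTransition.le_one _⟩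
  have hκs := M.symb_cutoff Unit hσ hR ε c
  have hκc : Continuous κ := Complex.isometry_ofReal.comp_continuous_iff.1
    (hκs.smooth ()).continuous
  have hw₀z : ∀ z ∉ oct n R, w₀ z = 0 := fun z hz => by
    rw [← Complex.ofReal_eq_zero, hw₀, ofReal_weight]
    exact hφ.isAmp.amp_eq_zero hσ _ hz
  have hw₀s : Symb (oct n R) (fun (_ : Unit) z => exp (-dot (fun _ => 1) z))
      fun _ z => (w₀ z : ℂ) := by
    simp only [hw₀, ofReal_weight]
    exact hφ.isAmp.symb hR hσ _
  set Ω : Set ℝ^[n] := oct n R ∩ {z | ε * M.phase σ z ≤ c / 2 * M.N z} with hΩ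
  have hΩc : IsClosed Ω := (isClosed_oct R).inter
    (isClosed_le (continuous_const.mul hFc.continuous) (continuous_const.mul hNc.continuous))
  have hκΩ : ∀ z ∉ Ω, (1 - κ z) * w₀ z = 0 := fun z hz => by
    by_cases h : z ∈ oct n R
    · have h1 : ¬ ε * M.phase σ z ≤ c / 2 * M.N z := fun h' => hz ⟨h, h'⟩
      rw [hκ, M.cutoff_eq_one hc (not_le.1 h1).le, sub_self, zero_mul]
    · rw [hw₀z z h, mul_zero]
  obtain ⟨K₀, hK₀⟩ := M.exists_bad_volume hf0 hτ hδ (Ω := Ω) fun z hz => by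
    refine ⟨fun i => hR.trans (hz.1 i), ?_⟩
    by_contra! hcon
    have h1 := hlow z hz.1 fun p hp hpτ => (hcon p hp hpτ).le
    have h2 := M.N_pos z
    have h3 := hz.2.out
    nlinarith
  have hexpΩ : IntegrableOn (fun z : ℝ^[n] => exp (-dot (fun _ => 1) z)) Ω :=
    (integrableOn_exp_neg_dot (fun _ => one_pos) R).mono_set inter_subset_left
  have hw₀i : Integrable w₀ := hφ.integrable_weight hR hσ
  have hwi : Integrable fun z => κ z * w₀ z :=
    hw₀i.bdd_mul (c := 1) hκc.aestronglyMeasurable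
      (.of_forall fun z => by rw [norm_of_nonneg (hκ01 z).1]; exact (hκ01 z).2)
  have hui : Integrable fun z => (1 - κ z) * w₀ z :=
    (hw₀i.sub hwi).congr (.of_forall fun z => by simp [sub_mul])
  have hus : Symb Ω (fun (_ : Ici (2 : ℝ)) z => exp (-dot (fun _ => 1) z))
      fun _ z => (((1 - κ z) * w₀ z : ℝ) : ℂ) := by
    have h1 : Symb (oct n R) (fun (_ : Unit) z => exp (-dot (fun _ => 1) z))
        fun _ z => (w₀ z : ℂ) + (-1) * ((κ z : ℂ) * (w₀ z : ℂ)) :=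
      hw₀s.add (((hκs.mul hw₀s).congr (fun _ z _ => by positivity)
        fun _ z _ => one_mul _).const_mul (-1))
    convert (h1.mono_set (inter_subset_left : Ω ⊆ _)).comp fun _ : Ici (2 : ℝ) => () using 3
    push_cast
    ring
  obtain ⟨C₁, hC₁, hdecay⟩ := (H.mono hΩc inter_subset_left).norm_integral_le
    (s := fun t : Ici (2 : ℝ) => (t : ℝ)) (fun t => zero_le_two.trans t.2) K₀
    (fun _ _ _ => (exp_pos _).le) (fun _ => hexpΩ) hus fun _ z hz => by rw [hκΩ z hz, ofReal_zero]
  have hlimu : Tendsto (fun t : ℝ => (∫ z, osc (M.phase σ) t z * (((1 - κ z) * w₀ z : ℝ) : ℂ)) /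
      scale (-β, j) t) atTop (𝓝 0) := by
    rw [NormedAddGroup.tendsto_nhds_zero]
    intro η hη
    filter_upwards [hK₀ K₀ le_rfl (η / (2 * (C₁ + 1))) (by positivity), eventually_ge_atTop 2]
      with t ht ht2
    have hs := LeadingTerm.scale_pos (β := β) (j := j) (by linarith : 1 < t)
    rw [norm_div, norm_scale _ (by linarith), div_lt_iff₀ hs]
    refine (hdecay ⟨t, ht2⟩).trans_lt ((mul_le_mul_of_nonneg_left ht hC₁).trans_lt ?_)
    have h1 : C₁ * (η / (2 * (C₁ + 1))) < η := by
      rw [mul_div_assoc', div_lt_iff₀ (by positivity)]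
      nlinarith
    rw [← mul_assoc]
    exact mul_lt_mul_of_pos_right h1 hs
  have hsplit : ∀ t, ∫ z, osc (M.phase σ) t z * ((κ z * w₀ z : ℝ) : ℂ) =
      (∫ z, osc (M.phase σ) t z * (w₀ z : ℂ)) -
        ∫ z, osc (M.phase σ) t z * (((1 - κ z) * w₀ z : ℝ) : ℂ) := fun t => by
    have h1 : Integrable fun z => osc (M.phase σ) t z * (w₀ z : ℂ) :=
      integrable_osc_mul hFc t hw₀i.ofReal
    have h2 : Integrable fun z => osc (M.phase σ) t z * (((1 - κ z) * w₀ z : ℝ) : ℂ) :=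
      integrable_osc_mul hFc t hui.ofReal
    rw [← integral_sub h1 h2]
    refine integral_congr_ae (.of_forall fun z => ?_)
    simp only
    push_cast
    ring
  refine ⟨C, fun z => κ z * w₀ z, ⟨hFc.continuous, hwi,
    fun z => mul_nonneg (hκ01 z).1 (hL.nonneg z), hL.exp_nonneg, ?_, ?_, fun N => ?_⟩,
    fun z hz => M.phase_nonneg_of_cutoff hc (left_ne_zero_of_mul hz), hC⟩
  · obtain ⟨K, -, hK⟩ := M.exists_decay_diag hR H hf0 (u := fun z => ((κ z * w₀ z : ℝ) : ℂ)) (by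
      simpa only [one_mul, ofReal_mul] using hκs.mul hw₀s) fun z hz => by
        rw [hw₀z z hz, mul_zero, ofReal_zero]
    exact ⟨K, hK⟩
  · have := hL.lim.sub hlimu
    rw [sub_zero] at this
    exact this.congr fun t => by rw [hsplit, sub_div]
  · obtain ⟨B, hB1, hB⟩ := M.abs_phase_le hσ hR
    set K := max N K₀ with hK
    obtain ⟨c₁, hc₁, h₁⟩ := M.exists_low hf0 (le_max_of_le_left hR : 0 ≤ max R R')
      (by linarith : 0 ≤ B) hw₀i hL.nonneg
      (fun z hz => hφ.weight_eq hσ fun i => (le_max_right _ _).trans (hz i))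
      (G := fun z => B * M.N z) (continuous_const.mul hNc.continuous).measurable
      (fun z hz => (abs_of_nonneg (mul_nonneg (by linarith) (M.N_pos z).le)).le) K
    obtain ⟨C₂, hC₂⟩ := (hw₀s.est 0).zero
    have hC₂' : ∀ z ∈ Ω, w₀ z ≤ |C₂| * exp (-dot (fun _ => 1) z) := fun z hz => by
      have h := hC₂ () z hz.1
      rw [norm_real] at h
      exact (le_abs_self _).trans (h.trans
        (mul_le_mul_of_nonneg_right (le_abs_self _) (exp_pos _).le))
    refine ⟨c₁ / 2, half_pos hc₁, ?_⟩
    filter_upwards [h₁, hK₀ K (le_max_right _ _) (c₁ / (2 * (|C₂| + 1))) (by positivity),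
      eventually_gt_atTop 1] with t ht1 ht2 ht
    have ht0 : 0 ≤ t := by linarith
    have hs := LeadingTerm.scale_pos (β := β) (j := j) ht
    set q : ℝ^[n] → ℝ := fun z => ((1 + t * |B * M.N z|)⁻¹) ^ K with hq
    have hqm : Measurable fun z => B * M.N z := (continuous_const.mul hNc.continuous).measurable
    have hiκ := integrable_mul_inv_one_add_pow hwi hqm K ht0
    have hiu := integrable_mul_inv_one_add_pow hui hqm K ht0
    have hsum : ∫ z, w₀ z * q z = (∫ z, κ z * w₀ z * q z) + ∫ z, (1 - κ z) * w₀ z * q z := by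
      rw [← integral_add hiκ hiu]
      exact integral_congr_ae (.of_forall fun z => by ring)
    have hBN : ∀ z, |B * M.N z| = B * M.N z := fun z =>
      abs_of_nonneg (mul_nonneg (by linarith) (M.N_pos z).le)
    have hN1 : ∀ z, M.N z ≤ B * M.N z := fun z => le_mul_of_one_le_left (M.N_pos z).le hB1
    have hu : ∫ z, (1 - κ z) * w₀ z * q z ≤
        |C₂| * ∫ z in Ω, exp (-dot (fun _ => 1) z) * ((1 + t * M.N z)⁻¹) ^ K := by
      have hgi : IntegrableOn
          (fun z => exp (-dot (fun _ => 1) z) * ((1 + t * M.N z)⁻¹) ^ K) Ω := by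
        exact hexpΩ.mul_bdd (c := 1) (Measurable.aestronglyMeasurable
          (by have := hNc.continuous.measurable; fun_prop)) (.of_forall fun z =>
            norm_inv_one_add_pow_le (mul_nonneg ht0 (M.N_pos z).le) _)
      rw [← integral_const_mul, ← setIntegral_eq_integral_of_forall_compl_eq_zero (s := Ω)
        fun z hz => by rw [hκΩ z hz, zero_mul]]
      refine setIntegral_mono_on hiu.integrableOn (hgi.const_mul _) hΩc.measurableSet
        fun z hz => ?_
      have hNz := M.N_pos z
      have h1 : (1 - κ z) * w₀ z ≤ |C₂| * exp (-dot (fun _ => 1) z) :=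
        (mul_le_of_le_one_left (hL.nonneg z) (by linarith [(hκ01 z).1])).trans (hC₂' z hz)
      have h2 : q z ≤ ((1 + t * M.N z)⁻¹) ^ K := by
        rw [hq]
        simp only [hBN]
        refine pow_le_pow_left₀ (by have := (hNz.le.trans (hN1 z)); positivity) ?_ K
        exact inv_anti₀ (by positivity) (by gcongr; exact hN1 z)
      rw [← mul_assoc]
      exact mul_le_mul h1 h2 (by positivity) (by positivity)
    have hlast : ∫ z, κ z * w₀ z * q z ≤
        ∫ z, κ z * w₀ z * ((1 + t * |M.phase σ z|)⁻¹) ^ N := by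
      refine integral_mono hiκ
        (integrable_mul_inv_one_add_pow hwi hFc.continuous.measurable N ht0) fun z => ?_
      by_cases hz : z ∈ oct n R
      · refine mul_le_mul_of_nonneg_left ?_ (mul_nonneg (hκ01 z).1 (hL.nonneg z))
        have h1 : 1 ≤ 1 + t * |B * M.N z| := le_add_of_nonneg_right (by positivity)
        calc q z ≤ ((1 + t * |B * M.N z|)⁻¹) ^ N :=
              pow_le_pow_of_le_one (by positivity) (inv_le_one_of_one_le₀ h1) (le_max_left _ _)
          _ ≤ _ := by
              refine pow_le_pow_left₀ (by positivity) ?_ N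
              refine inv_anti₀ (by positivity) ?_
              rw [hBN]
              gcongr
              exact hB z hz
      · simp only [hw₀z z hz, mul_zero, zero_mul, le_refl]
    have h3 : |C₂| * (c₁ / (2 * (|C₂| + 1))) ≤ c₁ / 2 := by
      rw [mul_div_assoc', div_le_div_iff₀ (by positivity) two_pos]
      nlinarith [abs_nonneg C₂]
    have h4 := mul_le_mul_of_nonneg_left ht2 (abs_nonneg C₂)
    have h5 := mul_le_mul_of_nonneg_right h3 hs.le
    change c₁ * (t ^ (-β) * log t ^ j) ≤ ∫ z, w₀ z * q z at ht1
    rw [← mul_assoc] at h4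
    linarith

end LocalModel

lemma eventually_box (hU : U ∈ 𝓝 (0 : ℝ^[n])) :
    ∀ᶠ R : ℝ in atTop, ∀ x : ℝ^[n], (∀ i, |x i| ≤ exp (-R)) → x ∈ U := by
  obtain ⟨R₀, -, h⟩ := exists_oct_expc_mem hU
  filter_upwards [eventually_ge_atTop R₀] with R hR x hx
  exact h x fun i => (hx i).trans (exp_le_exp.2 (by linarith))

lemma exists_isCutoff (n : ℕ) (R : ℝ) : ∃ φ : ℝ^[n] → ℝ, IsCutoff R (R + 2) φ ∧
    HasCompactSupport φ ∧ tsupport φ ⊆ {x | ∀ i, |x i| ≤ exp (-R)} := by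
  have hρ := exp_pos (-R)
  let χ : ContDiffBump (0 : ℝ^[n]) := ⟨exp (-R) / 3, exp (-R) / 2, by positivity, by linarith⟩
  have hsub : tsupport χ ⊆ {x | ∀ i, |x i| ≤ exp (-R)} := fun x hx i => by
    rw [χ.tsupport_eq, mem_closedBall_zero_iff] at hx
    have h1 : |x i| ≤ ‖x‖ := norm_le_pi_norm x i
    have h2 : ‖x‖ ≤ exp (-R) / 2 := hx
    linarith
  refine ⟨χ, ⟨⟨contDiff_ofReal χ.contDiff, fun x i hx => ?_⟩, fun x => χ.nonneg,
    fun x hx => χ.one_of_mem_closedBall ?_⟩, χ.hasCompactSupport, hsub⟩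
  · by_contra h
    exact absurd (hsub (subset_tsupport _ (Complex.ofReal_ne_zero.1 h)) i) hx.not_ge
  · rw [mem_closedBall_zero_iff]
    change ‖x‖ ≤ exp (-R) / 3
    refine (pi_norm_le_iff_of_nonneg (by positivity)).2 fun i => (hx i).trans ?_
    have h1 : exp (-(R + 2)) * exp 2 = exp (-R) := by
      rw [← exp_add]
      congr 1
      ring
    have h2 := Real.add_one_le_exp 2
    nlinarith [exp_pos (-(R + 2))]

namespace LocalModel

lemma eventually_phaseBound (hU : U ∈ 𝓝 (0 : ℝ^[n])) (hnd : Nondegenerate f U) :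
    ∀ᶠ R : ℝ in atTop, ∀ s, PhaseBound (oct n R) M.N (M.phase (sg s)) := by
  refine eventually_all.2 fun s => ?_
  obtain ⟨R₀, c, hR₀, hc, h⟩ := M.exists_gradient_bound hU hnd (abs_sg s)
  filter_upwards [eventually_ge_atTop R₀] with R hR
  exact M.phaseBound (abs_sg s) (hR₀.trans hR) hc fun z hz => h z fun i => hR.trans (hz i)

lemma exists_leading_coeff (hU : U ∈ 𝓝 (0 : ℝ^[n])) (hnd : Nondegenerate f U)
    (hf0 : f 0 = 0) (hτ : IsPrincipalFace f τ)
    (hcase : 1 < newtonDist f ∨ ((∀ x ∈ U, 0 ≤ f x) ∨ (∀ x ∈ U, f x ≤ 0)) ∨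
      ((¬ ∃ k : ℕ, Odd k ∧ 1 / newtonDist f = (k : ℝ)) ∧
        ∀ x ∈ U, (∀ i, x i ≠ 0) → gammaFn f τ x ≠ 0)) :
    ∃ v : ℂ, ∀ᶠ R : ℝ in atTop, ∀ R' φ, IsCutoff R R' φ → ∀ s, ∃ C,
      Tendsto (fun t => M.oscAmp (sg s) 0 (fun x => (φ x : ℂ)) t /
        scale (-(1 / newtonDist f), n - finrank ℝ M.lineal - 1) t) atTop (𝓝 C) ∧
      0 < (C * v).re := by
  have hd := M.newtonDist_pos hf0
  have hI : I ^ ((1 / newtonDist f : ℝ) : ℂ) ≠ 0 := by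
    rw [Ne, Complex.cpow_eq_zero_iff]
    exact fun h => I_ne_zero h.1
  have hev := (eventually_ge_atTop (0 : ℝ)).and ((M.eventually_phaseBound hU hnd).and
    (eventually_box (inter_mem hU M.germ)))
  have hphase : ∀ {R R' φ s}, (∀ x : ℝ^[n], (∀ i, |x i| ≤ exp (-R)) →
      x ∈ U ∩ {x | f x = M.wsum M.ψ x}) → IsCutoff R R' φ → ∀ z, weight (sg s) φ z ≠ 0 →
      ∃ x ∈ U, f x = M.phase (sg s) z := by
    intro R R' φ s hbox hφ z hz
    have h := hbox (expc (sg s) z) fun i => by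
      by_contra hlt
      refine right_ne_zero_of_mul hz (Complex.ofReal_eq_zero.1 ?_)
      exact hφ.isAmp.eq_zero _ i (not_le.1 hlt)
    exact ⟨_, h.1, h.2⟩
  rcases hcase with h | (h | h) | ⟨hodd, h⟩
  · refine ⟨1, ?_⟩
    filter_upwards [hev] with R ⟨hR, H, _⟩ R' φ hφ s
    obtain ⟨C, hC, hlim⟩ := M.exists_leadingTerm (abs_sg s) hR (H s) hf0 hφ
    refine ⟨C, hlim, ?_⟩
    rw [mul_one]
    exact hC.re_pos ((div_lt_one hd).2 h)
  · refine ⟨(I ^ ((1 / newtonDist f : ℝ) : ℂ))⁻¹, ?_⟩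
    filter_upwards [hev] with R ⟨hR, H, hbox⟩ R' φ hφ s
    obtain ⟨C, hC, hlim⟩ := M.exists_leadingTerm (abs_sg s) hR (H s) hf0 hφ
    obtain ⟨A, hA, hCA⟩ := hC.of_nonneg fun z hz => by
      obtain ⟨x, hx, hfx⟩ := hphase hbox hφ z hz
      rw [← hfx]
      exact h x hx
    refine ⟨C, hlim, ?_⟩
    rwa [hCA, mul_assoc, mul_inv_cancel₀ hI, mul_one, ofReal_re]
  · refine ⟨((starRingEnd ℂ) (I ^ ((1 / newtonDist f : ℝ) : ℂ)))⁻¹, ?_⟩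
    filter_upwards [hev] with R ⟨hR, H, hbox⟩ R' φ hφ s
    obtain ⟨C, hC, hlim⟩ := M.exists_leadingTerm (abs_sg s) hR (H s) hf0 hφ
    obtain ⟨A, hA, hCA⟩ := hC.of_nonpos fun z hz => by
      obtain ⟨x, hx, hfx⟩ := hphase hbox hφ z hz
      rw [← hfx]
      exact h x hx
    refine ⟨C, hlim, ?_⟩
    rwa [hCA, mul_assoc, mul_inv_cancel₀ ((map_ne_zero _).2 hI), mul_one, ofReal_re]
  · have hcos := cos_ne_zero_of_not_odd (by positivity) hodd
    have hsign : ∀ᶠ R : ℝ in atTop, ∀ s, ∃ ε c δ : ℝ, (ε = 1 ∨ ε = -1) ∧ 0 < c ∧ 0 < δ ∧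
        ∀ z : ℝ^[n], (∀ i, R ≤ z i) →
          (∀ p ∈ M.S, natPt p ∉ τ → exp (-dot (natPt p) z) ≤ δ * M.N z) →
          c * M.N z ≤ ε * M.phase (sg s) z := by
      refine eventually_all.2 fun s => ?_
      obtain ⟨ε, hε, R₀, hR₀⟩ := M.exists_sign hU hτ.1 ⟨_, intrinsicInterior_subset hτ.2⟩ h
        (abs_sg s)
      obtain ⟨R₁, c, δ, -, hc, hδ, h₁⟩ := M.exists_phase_lower_bound hU hnd hτ.1 (abs_sg s)
        (by rcases hε with rfl | rfl <;> norm_num) hR₀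
      filter_upwards [eventually_ge_atTop R₁] with R hR
      exact ⟨ε, c, δ, hε, hc, hδ, fun z hz => h₁ z fun i => hR.trans (hz i)⟩
    refine ⟨((Real.cos (Real.pi * (1 / newtonDist f) / 2))⁻¹ : ℝ), ?_⟩
    filter_upwards [hev, hsign] with R ⟨hR, H, _⟩ hs R' φ hφ s
    obtain ⟨ε, c, δ, hε, hc, hδ, hlow⟩ := hs s
    obtain ⟨C, w, hC, hw, hlim⟩ := M.exists_leadingTerm_sign (abs_sg s) hR (H s) hf0 hφ hτ hc hδ hlow
    refine ⟨C, hlim, ?_⟩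
    have hre : ∃ A : ℝ, 0 < A ∧ C.re = A * Real.cos (Real.pi * (1 / newtonDist f) / 2) := by
      rcases hε with rfl | rfl
      · obtain ⟨A, hA, rfl⟩ := hC.of_nonneg fun z hz => by simpa using hw z hz
        exact ⟨A, hA, by rw [Complex.re_ofReal_mul, I_cpow_re]⟩
      · obtain ⟨A, hA, rfl⟩ := hC.of_nonpos fun z hz => by simpa using hw z hz
        exact ⟨A, hA, by rw [Complex.re_ofReal_mul, Complex.conj_re, I_cpow_re]⟩
    obtain ⟨A, hA, hre⟩ := hre
    rwa [Complex.re_mul_ofReal, hre, mul_inv_cancel_right₀ hcos]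

lemma exists_bound_oscInt (hR : 0 ≤ R)
    (H : ∀ s, PhaseBound (oct n R) M.N (M.phase (sg s))) (hf0 : f 0 = 0)
    (hφ : IsAmp R φ) (hsupp : HasCompactSupport φ) (hf : ∀ x, φ x ≠ 0 → f x = M.wsum M.ψ x) :
    ∃ K : ℝ, ∀ᶠ t in atTop, ‖oscInt f φ t‖ ≤
      K * ‖scale (-(1 / newtonDist f), n - finrank ℝ M.lineal - 1) t‖ := by
  have h : ∀ s, ∃ C, ∀ t : ℝ, 2 ≤ t → ‖M.oscAmp (sg s) 0 φ t‖ ≤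
      C * (t ^ (-(1 / newtonDist f)) * log t ^ (n - finrank ℝ M.lineal - 1)) := by
    intro s
    obtain ⟨C, -, hC⟩ := M.exists_decay_diag hR (H s) hf0 (hφ.symb hR (abs_sg s) _)
      fun z hz => hφ.amp_eq_zero (abs_sg s) _ hz
    refine ⟨C, fun t ht => ?_⟩
    rw [oscAmp, shift_zero]
    exact hC t ht
  choose C hC using h
  refine ⟨∑ s, C s, ?_⟩
  filter_upwards [eventually_ge_atTop 2] with t ht
  rw [M.oscInt_eq hφ hsupp hf, norm_scale _ (by linarith), sum_mul]
  exact norm_sum_le_of_le _ fun s _ => hC s t ht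

lemma le_of_mem_oscSet (hU : U ∈ 𝓝 (0 : ℝ^[n])) (hnd : Nondegenerate f U) (hf0 : f 0 = 0)
    {p : ℝ × ℕ} (hp : p ∈ OscSet U f) : p.1 < -(1 / newtonDist f) ∨
      (p.1 = -(1 / newtonDist f) ∧ p.2 ≤ n - finrank ℝ M.lineal - 1 + 1) := by
  obtain ⟨R, hR, H, hbox⟩ := ((eventually_ge_atTop (0 : ℝ)).and
    ((M.eventually_phaseBound hU hnd).and (eventually_box M.germ))).exists
  have hV : {x : ℝ^[n] | ∀ i, |x i| ≤ exp (-R)} ∈ 𝓝 (0 : ℝ^[n]) := by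
    simp only [ofPred_forall]
    refine (Filter.iInter_mem).2 fun i => ?_
    exact (continuous_apply i).abs.continuousAt.preimage_mem_nhds
      (Iic_mem_nhds (by simpa using exp_pos (-R)))
  obtain ⟨φ, ⟨hs, hsupp, hφV⟩, E, C, hE, hexp, hC⟩ := hp _ hV
  have hφ : ∀ x, φ x ≠ 0 → ∀ i, |x i| ≤ exp (-R) := fun x hx => (hφV (subset_tsupport _ hx)).2
  obtain ⟨K, hK⟩ := M.exists_bound_oscInt hR H hf0
    ⟨hs, fun x i hx => by_contra fun h => (hφ x h i).not_gt hx⟩ hsupp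
    fun x hx => hbox x (hφ x hx)
  exact hexp.le_of_bound hE hK hC

lemma mem_oscSet (hU : U ∈ 𝓝 (0 : ℝ^[n])) (hnd : Nondegenerate f U)
    (hf0 : f 0 = 0) (hτ : IsPrincipalFace f τ)
    (hcase : 1 < newtonDist f ∨ ((∀ x ∈ U, 0 ≤ f x) ∨ (∀ x ∈ U, f x ≤ 0)) ∨
      ((¬ ∃ k : ℕ, Odd k ∧ 1 / newtonDist f = (k : ℝ)) ∧
        ∀ x ∈ U, (∀ i, x i ≠ 0) → gammaFn f τ x ≠ 0)) :
    (-(1 / newtonDist f), n - finrank ℝ M.lineal - 1 + 1) ∈ OscSet U f := by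
  intro V hV
  have hd := M.newtonDist_pos hf0
  have hn := M.dim_pos hf0
  obtain ⟨v, hv⟩ := M.exists_leading_coeff hU hnd hf0 hτ hcase
  obtain ⟨R, hR, H, hbox, hv⟩ := ((eventually_ge_atTop (0 : ℝ)).and
    ((M.eventually_phaseBound hU hnd).and
      ((eventually_box (inter_mem (inter_mem hU hV) M.germ)).and hv))).exists
  obtain ⟨φ, hφ, hsupp, hsub⟩ := exists_isCutoff n R
  have hsupp' : HasCompactSupport fun x => (φ x : ℂ) := hsupp.comp_left ofReal_zero
  have htsupp : tsupport (fun x => (φ x : ℂ)) ⊆ {x | ∀ i, |x i| ≤ exp (-R)} :=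
    (closure_mono (Function.support_comp_subset ofReal_zero φ)).trans hsub
  have hfw : ∀ x, (φ x : ℂ) ≠ 0 → f x = M.wsum M.ψ x := fun x hx =>
    (hbox x (htsupp (subset_tsupport _ hx))).2
  have hosc : oscInt f (fun x => (φ x : ℂ)) =
      fun t => ∑ s, M.oscAmp (sg s) 0 (fun x => (φ x : ℂ)) t :=
    funext (M.oscInt_eq hφ.isAmp hsupp' hfw)
  obtain ⟨K, hK⟩ := M.exists_bound_oscInt hR H hf0 hφ.isAmp hsupp' hfw
  obtain ⟨E, C, hE, hexp⟩ := exists_hasAsympExpansion hn (fun l hl => by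
    rw [hosc]
    refine HasExp.sum _ fun s _ => ?_
    simpa using M.hasExp_oscAmp (abs_sg s) hR (H s) hn hl hφ.isAmp 0 0) (by simpa using hd) hK
  refine ⟨_, ⟨hφ.isAmp.smooth, hsupp', fun x hx => (hbox x (htsupp hx)).1⟩, E, C, hE, hexp, ?_⟩
  choose c hc hpos using hv _ φ hφ
  have hlim : Tendsto (fun t => oscInt f (fun x => (φ x : ℂ)) t /
      scale (-(1 / newtonDist f), n - finrank ℝ M.lineal - 1) t) atTop (𝓝 (∑ s, c s)) := by
    simp only [hosc, sum_div]
    exact tendsto_finsetSum _ fun s _ => hc s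
  rw [hexp.coeff_eq hE hlim]
  intro h0
  have h1 : 0 < ((∑ s, c s) * v).re := by
    rw [sum_mul, Complex.re_sum]
    exact Finset.sum_pos (fun s _ => hpos s) Finset.univ_nonempty
  rw [h0, zero_mul, Complex.zero_re] at h1
  exact h1.false

end LocalModel

lemma exists_localModel (hUopen : IsOpen U)
    (hU0 : (0 : ℝ^[n]) ∈ U) (hf : ContDiffOn ℝ ∞ f U)
    (hΓ : (Γ₊ f).Nonempty) (hE : MemEhat U f) : Nonempty (LocalModel f) := by
  obtain ⟨D⟩ := exists_polyData hΓ
  obtain ⟨r, hr, -, -, F, ψ, hψ, hF, h⟩ := exists_local_rep hUopen hU0 hf hΓ hE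
  refine ⟨⟨D, F, ψ, hψ, hF, ?_⟩⟩
  filter_upwards [Metric.ball_mem_nhds (0 : ℝ^[n]) hr] with x hx
  exact h x fun i => (norm_le_pi_norm x i).trans_lt (mem_ball_zero_iff.1 hx)

end

/-- Theorem 3.7: if `f` satisfies condition (C) and (a) `d(f) > 1`, or
(b) `f` is nonnegative or nonpositive on `U`, or (c) `1/d(f)` is not an odd integer and the
`τ_*`-part does not vanish on `U ∩ (ℝ∖{0})ⁿ`, then the oscillation index and its
multiplicity satisfy `β(f) = -1/d(f)` and `η(f) = m(f)`, i.e. `(-1/d(f), m(f))` is the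
maximum of `S(f)` in the lexicographic order. -/
theorem statement2 {n : ℕ} (U : Set (Fin n → ℝ)) (hUopen : IsOpen U)
    (hU0 : (0 : Fin n → ℝ) ∈ U)
    (f : (Fin n → ℝ) → ℝ) (hf : ContDiffOn ℝ (⊤ : ℕ∞) f U)
    (hf0 : f 0 = 0) (hdf0 : fderiv ℝ f 0 = 0)
    (hΓ : (NewtonPolyhedron f).Nonempty)
    (hC : ConditionC U f)
    (τ : Set (Fin n → ℝ)) (hτ : IsPrincipalFace f τ)
    (hcase : 1 < newtonDist f ∨ ((∀ x ∈ U, 0 ≤ f x) ∨ (∀ x ∈ U, f x ≤ 0)) ∨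
      ((¬ ∃ k : ℕ, Odd k ∧ 1 / newtonDist f = (k : ℝ)) ∧
        ∀ x ∈ U, (∀ i, x i ≠ 0) → gammaFn f τ x ≠ 0)) :
    (-(1 / newtonDist f), n - setDim τ) ∈ OscSet U f ∧
    ∀ p ∈ OscSet U f,
      p.1 < -(1 / newtonDist f) ∨ (p.1 = -(1 / newtonDist f) ∧ p.2 ≤ n - setDim τ) := by
  obtain ⟨M⟩ := exists_localModel hUopen hU0 hf hΓ hC.1
  have hU : U ∈ 𝓝 (0 : Fin n → ℝ) := hUopen.mem_nhds hU0
  have hlt : Module.finrank ℝ M.lineal < n := by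
    have h := Submodule.finrank_lt (s := M.lineal) fun h =>
      M.one_notMem_lineal hf0 (h ▸ Submodule.mem_top)
    simpa using h
  have hm : n - setDim τ = n - Module.finrank ℝ M.lineal - 1 + 1 := by
    rw [M.setDim_principal hf0 hτ]
    omega
  rw [hm]
  exact ⟨M.mem_oscSet hU hC.2 hf0 hτ hcase, fun p hp => M.le_of_mem_oscSet hU hC.2 hf0 hp⟩

end KN
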